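/- Every finite simple graph G with n ≥ 3 vertices that admits an IC-planar straight-line drawing in the plane also admits an IC-planar straight-line grid drawing in which all vertex images lie in the integer grid {0, 1, …, 2n−2} × {0, 1, …, 2n−3}; in particular, every such graph has an IC-planar straight-line grid drawing of area O(n) × O(n). -/

import Mathlib

/-- The open straight-line segment representing an edge (an unordered pair of
vertices) in a straight-line drawing `ρ`. -/
def edgeSeg {V : Type*} (ρ : V → ℝ × ℝ) : Sym2 V → Set (ℝ × ℝ) :=
  Sym2.lift ⟨fun u v => openSegment ℝ (ρ u) (ρ v),
    fun u v => openSegment_symm ℝ (ρ u) (ρ v)⟩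

/-- Two edges *cross* in the drawing `ρ`: they share no endpoint and
their open segments meet. -/
def Crosses {V : Type*} (ρ : V → ℝ × ℝ) (e f : Sym2 V) : Prop :=
  (∀ v : V, v ∈ e → v ∉ f) ∧ (edgeSeg ρ e ∩ edgeSeg ρ f).Nonempty

/-- `ρ` is a straight-line drawing of the simple graph `G`. -/
structure IsStraightLineDrawing {V : Type*} (G : SimpleGraph V) (ρ : V → ℝ × ℝ) : Prop where
  inj : Function.Injective ρ
  no_vertex_on_edge : ∀ e ∈ G.edgeSet, ∀ v : V, v ∉ e → ρ v ∉ edgeSeg ρ e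
  meet_at_most_once : ∀ e ∈ G.edgeSet, ∀ f ∈ G.edgeSet, (∀ v : V, v ∈ e → v ∉ f) →
    (edgeSeg ρ e ∩ edgeSeg ρ f).Subsingleton

/-- `ρ` is an IC-planar straight-line drawing of `G`: it is a straight-line drawing,
each edge crosses at most one other edge, and the crossed edges form a matching. -/
def IsICPlanarDrawing {V : Type*} (G : SimpleGraph V) (ρ : V → ℝ × ℝ) : Prop :=
  IsStraightLineDrawing G ρ ∧
  (∀ e ∈ G.edgeSet, ∀ f ∈ G.edgeSet, ∀ g ∈ G.edgeSet,
    Crosses ρ e f → Crosses ρ e g → f = g) ∧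
  (∀ e ∈ G.edgeSet, ∀ f ∈ G.edgeSet,
    (∃ e' ∈ G.edgeSet, Crosses ρ e e') → (∃ f' ∈ G.edgeSet, Crosses ρ f f') →
    e ≠ f → ∀ v : V, v ∈ e → v ∉ f)

/-- All vertices are placed at integer coordinates. -/
def IsGridDrawing {V : Type*} (ρ : V → ℝ × ℝ) : Prop :=
  ∀ v : V, ∃ a b : ℤ, ρ v = ((a : ℝ), (b : ℝ))

/-- `ρ` is a RAC drawing of `G`: any two crossing edges are perpendicular. -/
def IsRACDrawing {V : Type*} (G : SimpleGraph V) (ρ : V → ℝ × ℝ) : Prop :=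
  ∀ e ∈ G.edgeSet, ∀ f ∈ G.edgeSet, Crosses ρ e f →
    ∀ a b c d : V, e = s(a, b) → f = s(c, d) →
      ((ρ b).1 - (ρ a).1) * ((ρ d).1 - (ρ c).1)
        + ((ρ b).2 - (ρ a).2) * ((ρ d).2 - (ρ c).2) = 0

set_option autoImplicit false
set_option linter.all false

/-- combinatorial triangulated sphere, given by its oriented triangles -/
structure Tri (W : Type) [Fintype W] where
  F : W → W → W → Prop
  cyc : ∀ {a b c : W}, F a b c → F b c a
  ne : ∀ {a b c : W}, F a b c → a ≠ b
  uniq : ∀ {a b c d : W}, F a b c → F a b d → c = d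
  rev : ∀ {a b c : W}, F a b c → ∃ d, F b a d
  link : ∀ (u : W) (A : Set W) (v : W), v ∈ A → (∃ c, F u v c) →
    (∀ a b, a ∈ A → F u a b → b ∈ A) → ∀ w, (∃ c, F u w c) → w ∈ A
  conn : ∀ A : Set W, A.Nonempty → (∀ a b c, a ∈ A → F a b c → b ∈ A) → ∀ w, w ∈ A
  h1 : ∀ z : W → W → ZMod 2, (∀ a b, z a b = z b a) → (∀ a b, z a b ≠ 0 → ∃ c, F a b c) →
    (∀ a, ∑ b, z a b = 0) → ∃ f : W → W → ZMod 2,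
      (∀ a b c, F a b c → f a b = f b c) ∧ (∀ a b, (∃ c, F a b c) → f a b + f b a = z a b)

theorem z2cases (x : ZMod 2) : x = 0 ∨ x = 1 := by revert x; decide

theorem z2self (x : ZMod 2) : x + x = 0 := by revert x; decide

open Classical in
/-- indicator of an undirected edge -/
noncomputable def ed {W : Type} (x y : W) : W → W → ZMod 2 :=
  fun p q => if (p = x ∧ q = y) ∨ (p = y ∧ q = x) then 1 else 0

theorem ed_symm {W : Type} (x y p q : W) : ed x y p q = ed x y q p := by
  unfold ed; congr 1; simp only [eq_iff_iff]; grind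

open Classical in
theorem ed_deg {W : Type} [Fintype W] {x y : W} (h : x ≠ y) (p : W) :
    ∑ q, ed x y p q = (if p = x then 1 else 0) + (if p = y then 1 else 0) := by
  unfold ed
  by_cases hx : p = x
  · subst hx
    simp [h]
  · by_cases hy : p = y
    · subst hy; simp [hx]
    · simp [hx, hy]

namespace Tri
variable {W : Type} [Fintype W] (T : Tri W)

def E (a b : W) : Prop := ∃ c, T.F a b c

variable {T}

theorem F.cyc {a b c : W} (h : T.F a b c) : T.F b c a := T.cyc h
theorem F.cyc2 {a b c : W} (h : T.F a b c) : T.F c a b := T.cyc (T.cyc h)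
theorem F.n12 {a b c : W} (h : T.F a b c) : a ≠ b := T.ne h
theorem F.n23 {a b c : W} (h : T.F a b c) : b ≠ c := T.ne h.cyc
theorem F.n31 {a b c : W} (h : T.F a b c) : c ≠ a := T.ne h.cyc2
theorem F.e12 {a b c : W} (h : T.F a b c) : T.E a b := ⟨_, h⟩
theorem F.e23 {a b c : W} (h : T.F a b c) : T.E b c := ⟨_, h.cyc⟩
theorem F.e31 {a b c : W} (h : T.F a b c) : T.E c a := ⟨_, h.cyc2⟩
theorem E.symm {a b : W} (h : T.E a b) : T.E b a := by
  obtain ⟨c, hc⟩ := h; exact T.rev hc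
theorem E.ne {a b : W} (h : T.E a b) : a ≠ b := by
  obtain ⟨c, hc⟩ := h; exact hc.n12
theorem E.comm {a b : W} : T.E a b ↔ T.E b a := ⟨E.symm, E.symm⟩
theorem u3 {a b c d : W} (h : T.F a b c) (h' : T.F a b d) : c = d := T.uniq h h'
theorem u2 {a b c d : W} (h : T.F a b c) (h' : T.F a d c) : b = d := T.uniq h.cyc2 h'.cyc2

/-- sides of the darts at a vertex not on the cycle agree -/
theorem side_const {z f : W → W → ZMod 2}
    (hf : ∀ a b c, T.F a b c → f a b = f b c)
    (hz : ∀ a b, T.E a b → f a b + f b a = z a b)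
    {t : W} (ht : ∀ b, z t b = 0) {v w : W} (hv : T.E t v) (hw : T.E t w) :
    f t v = f t w := by
  have := T.link t {w | f t w = f t v} v rfl hv (by
    intro a b ha hab
    have h1 := hf _ _ _ hab
    have h2 := hf _ _ _ hab.cyc
    have h3 := hz t b hab.e31.symm
    rw [ht b, ← h2, ← h1] at h3
    have : f t b = f t a := by
      rcases z2cases (f t b) with h | h <;> rcases z2cases (f t a) with h' | h' <;>
        simp_all
    simp only [Set.mem_ofPred_eq] at *
    rw [this, ha]) w hw
  exact this.symm

theorem sep_of_cycle {z : W → W → ZMod 2} (hs : ∀ a b, z a b = z b a)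
    (hE : ∀ a b, z a b ≠ 0 → T.E a b) (hd : ∀ a, ∑ b, z a b = 0) :
    ∃ f : W → W → ZMod 2, (∀ a b c, T.F a b c → f a b = f b c) ∧
      (∀ a b, T.E a b → f a b + f b a = z a b) := T.h1 z hs hE hd

open Classical in
theorem sep3 {x y z p q : W} (hxy : T.E x y) (hyz : T.E y z) (hzx : T.E z x)
    (hp : T.F x y p) (hq : T.F y x q) (hpz : p ≠ z) (hqz : q ≠ z) :
    ∃ s : W → ZMod 2, (∀ t t', t ≠ x → t ≠ y → t ≠ z → t' ≠ x → t' ≠ y → t' ≠ z →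
      T.E t t' → s t = s t') ∧ s p ≠ s q := by
  have nxy := hxy.ne
  have nyz := hyz.ne
  have nzx := hzx.ne
  obtain ⟨f, hf, hz⟩ := T.sep_of_cycle (z := fun a b => ed x y a b + ed y z a b + ed z x a b)
    (by intro a b; simp only [ed_symm x y a b, ed_symm y z a b, ed_symm z x a b])
    (by
      intro a b h
      by_contra hne
      apply h
      have k1 : ¬ ((a = x ∧ b = y) ∨ (a = y ∧ b = x)) := by
        rintro (⟨rfl, rfl⟩ | ⟨rfl, rfl⟩); exacts [hne hxy, hne hxy.symm]
      have k2 : ¬ ((a = y ∧ b = z) ∨ (a = z ∧ b = y)) := by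
        rintro (⟨rfl, rfl⟩ | ⟨rfl, rfl⟩); exacts [hne hyz, hne hyz.symm]
      have k3 : ¬ ((a = z ∧ b = x) ∨ (a = x ∧ b = z)) := by
        rintro (⟨rfl, rfl⟩ | ⟨rfl, rfl⟩); exacts [hne hzx, hne hzx.symm]
      simp [ed, k1, k2, k3])
    (by
      intro a
      simp only [Finset.sum_add_distrib, ed_deg nxy, ed_deg nyz, ed_deg nzx]
      generalize (if a = x then (1 : ZMod 2) else 0) = u
      generalize (if a = y then (1 : ZMod 2) else 0) = v
      generalize (if a = z then (1 : ZMod 2) else 0) = w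
      revert u v w; decide)
  have h0 : ∀ t, t ≠ x → t ≠ y → t ≠ z → ∀ b, ed x y t b + ed y z t b + ed z x t b = 0 := by
    intro t h1 h2 h3 b
    simp [ed, h1, h2, h3]
  let s : W → ZMod 2 := fun t => if h : ∃ v, T.E t v then f t h.choose else 0
  have hs : ∀ t v, t ≠ x → t ≠ y → t ≠ z → T.E t v → s t = f t v := by
    intro t v h1 h2 h3 h
    have hh : ∃ v, T.E t v := ⟨v, h⟩
    simp only [s, dif_pos hh]
    exact side_const hf hz (h0 t h1 h2 h3) hh.choose_spec h
  refine ⟨s, ?_, ?_⟩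
  · intro t t' h1 h2 h3 h1' h2' h3' h
    rw [hs t t' h1 h2 h3 h, hs t' t h1' h2' h3' h.symm]
    have := hz t t' h
    rw [h0 t h1 h2 h3] at this
    rcases z2cases (f t t') with h | h <;> rcases z2cases (f t' t) with h' | h' <;> simp_all
  · rw [hs p x hp.n31 hp.n23.symm hpz hp.e31, hs q y hq.n23.symm hq.n31 hqz hq.e31]
    rw [← hf _ _ _ hp.cyc, ← hf _ _ _ hp, ← hf _ _ _ hq.cyc, ← hf _ _ _ hq]
    have := hz x y hxy
    have e : ed x y x y + ed y z x y + ed z x x y = (1 : ZMod 2) := by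
      simp [ed, nxy, nyz, nyz.symm, nzx, nzx.symm]
    rw [e] at this
    intro h
    rw [h, z2self] at this
    exact zero_ne_one this

theorem sep3_nadj {x y z p q : W} (hxy : T.E x y) (hyz : T.E y z) (hzx : T.E z x)
    (hp : T.F x y p) (hq : T.F y x q) (hpz : p ≠ z) (hqz : q ≠ z) :
    p ≠ q ∧ ¬ T.E p q ∧ ∀ t, t ≠ x → t ≠ y → t ≠ z → T.E p t → T.E q t → False := by
  obtain ⟨s, hs, hne⟩ := sep3 hxy hyz hzx hp hq hpz hqz
  refine ⟨fun h => hne (by rw [h]), fun h => hne (hs _ _ hp.n31 hp.n23.symm hpz hq.n23.symm hq.n31 hqz h), ?_⟩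
  intro t h1 h2 h3 ht ht'
  apply hne
  rw [hs p t hp.n31 hp.n23.symm hpz h1 h2 h3 ht, hs q t hq.n23.symm hq.n31 hqz h1 h2 h3 ht']

/-- rotations of a triple -/
def rot (p q r x y z : W) : Prop :=
  (x = p ∧ y = q ∧ z = r) ∨ (x = q ∧ y = r ∧ z = p) ∨ (x = r ∧ y = p ∧ z = q)

/-- triangles after flipping `ab` to `cd` -/
def flipF (T : Tri W) (a b c d x y z : W) : Prop :=
  (T.F x y z ∧ ¬ rot a b c x y z ∧ ¬ rot b a d x y z) ∨ rot c a d x y z ∨ rot d b c x y z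

theorem flipF_swap (T : Tri W) (a b c d x y z : W) :
    flipF T a b c d x y z ↔ flipF T b a d c x y z := by
  unfold flipF
  constructor
  · rintro (⟨h, h1, h2⟩ | h | h)
    · exact Or.inl ⟨h, h2, h1⟩
    · right; right; unfold rot at *; grind
    · right; left; unfold rot at *; grind
  · rintro (⟨h, h1, h2⟩ | h | h)
    · exact Or.inl ⟨h, h2, h1⟩
    · right; right; unfold rot at *; grind
    · right; left; unfold rot at *; grind

theorem flipF_cyc {a b c d x y z : W} (h : flipF T a b c d x y z) :
    flipF T a b c d y z x := by
  unfold flipF rot at *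
  rcases h with ⟨h, h1, h2⟩ | h | h
  · exact Or.inl ⟨h.cyc, by grind, by grind⟩
  · right; left; grind
  · right; right; grind

theorem flipF_old {a b c d x y z : W} (h : T.F x y z) (hh : ¬ (x = a ∧ y = b))
    (h2 : ¬ (y = a ∧ z = b)) (h3 : ¬ (z = a ∧ x = b)) (h4 : ¬ (x = b ∧ y = a))
    (h5 : ¬ (y = b ∧ z = a)) (h6 : ¬ (z = b ∧ x = a)) : flipF T a b c d x y z := by
  left; refine ⟨h, ?_, ?_⟩ <;> (unfold rot; grind)

theorem flipE_iff {a b c d : W} (h1 : T.F a b c) (h2 : T.F b a d) (u v : W) :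
    (∃ w, flipF T a b c d u v w) ↔ ((T.E u v ∧ ¬ (u = a ∧ v = b) ∧ ¬ (u = b ∧ v = a)) ∨
      (u = c ∧ v = d) ∨ (u = d ∧ v = c)) := by
  have n1 := h1.n12; have n2 := h1.n23; have n3 := h1.n31
  have m1 := h2.n23; have m2 := h2.n31
  constructor
  · rintro ⟨w, ⟨h, h3, h4⟩ | h | h⟩
    · left
      refine ⟨⟨w, h⟩, ?_, ?_⟩
      · rintro ⟨rfl, rfl⟩
        exact h3 (Or.inl ⟨rfl, rfl, u3 h h1⟩)
      · rintro ⟨rfl, rfl⟩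
        exact h4 (Or.inl ⟨rfl, rfl, u3 h h2⟩)
    · rcases h with ⟨rfl, rfl, rfl⟩ | ⟨rfl, rfl, rfl⟩ | ⟨rfl, rfl, rfl⟩
      · exact Or.inl ⟨h1.e31, by grind, by grind⟩
      · exact Or.inl ⟨h2.e23, by grind, by grind⟩
      · grind
    · rcases h with ⟨rfl, rfl, rfl⟩ | ⟨rfl, rfl, rfl⟩ | ⟨rfl, rfl, rfl⟩
      · exact Or.inl ⟨h2.e31, by grind, by grind⟩
      · exact Or.inl ⟨h1.e23, by grind, by grind⟩
      · grind
  · rintro (⟨⟨w, h⟩, h3, h4⟩ | ⟨rfl, rfl⟩ | ⟨rfl, rfl⟩)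
    · by_cases r1 : rot a b c u v w
      · rcases r1 with ⟨rfl, rfl, rfl⟩ | ⟨rfl, rfl, rfl⟩ | ⟨rfl, rfl, rfl⟩
        · grind
        · exact ⟨d, Or.inr (Or.inr (by unfold rot; grind))⟩
        · exact ⟨d, Or.inr (Or.inl (by unfold rot; grind))⟩
      · by_cases r2 : rot b a d u v w
        · rcases r2 with ⟨rfl, rfl, rfl⟩ | ⟨rfl, rfl, rfl⟩ | ⟨rfl, rfl, rfl⟩
          · grind
          · exact ⟨c, Or.inr (Or.inl (by unfold rot; grind))⟩
          · exact ⟨c, Or.inr (Or.inr (by unfold rot; grind))⟩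
        · exact ⟨w, Or.inl ⟨h, r1, r2⟩⟩
    · exact ⟨b, Or.inr (Or.inr (by unfold rot; grind))⟩
    · exact ⟨a, Or.inr (Or.inl (by unfold rot; grind))⟩

theorem flip_uniq {a b c d : W} (h1 : T.F a b c) (h2 : T.F b a d) (hcd : ¬ T.E c d) (hn : c ≠ d)
    {x y z w : W} (hz : flipF T a b c d x y z) (hw : flipF T a b c d x y w) : z = w := by
  have n1 := h1.n12; have n2 := h1.n23; have n3 := h1.n31
  have m1 := h2.n23; have m2 := h2.n31
  have hdc : ¬ T.E d c := fun h => hcd h.symm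
  have key : ∀ {x y z w : W}, (T.F x y z ∧ ¬ rot a b c x y z ∧ ¬ rot b a d x y z) →
      (rot c a d x y w ∨ rot d b c x y w) → False := by
    rintro x y z w ⟨h, r1, r2⟩ ((⟨rfl, rfl, rfl⟩ | ⟨rfl, rfl, rfl⟩ | ⟨rfl, rfl, rfl⟩) | (⟨rfl, rfl, rfl⟩ | ⟨rfl, rfl, rfl⟩ | ⟨rfl, rfl, rfl⟩))
    · exact r1 (by have := u3 h h1.cyc2; unfold rot; grind)
    · exact r2 (by have := u3 h h2.cyc; unfold rot; grind)
    · exact hdc ⟨_, h⟩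
    · exact r2 (by have := u3 h h2.cyc2; unfold rot; grind)
    · exact r1 (by have := u3 h h1.cyc; unfold rot; grind)
    · exact hcd ⟨_, h⟩
  rcases hz with hz | hz
  · rcases hw with hw | hw
    · exact u3 hz.1 hw.1
    · exact (key hz hw).elim
  · rcases hw with hw | hw
    · exact (key hw hz).elim
    · clear key h1 h2 hcd hdc
      unfold rot at hz hw
      grind

theorem flip_link_a {a b c d : W} (h1 : T.F a b c) (h2 : T.F b a d)
    (A : Set W) (v : W) (hv : v ∈ A) (hav : ∃ w, flipF T a b c d a v w)
    (hc : ∀ x y, x ∈ A → flipF T a b c d a x y → y ∈ A) :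
    ∀ w, (∃ z, flipF T a b c d a w z) → w ∈ A := by
  have n1 := h1.n12; have n2 := h1.n23; have n3 := h1.n31
  have m1 := h2.n23; have m2 := h2.n31
  have hE := flipE_iff h1 h2
  intro w hw
  have hvb : v ≠ b ∧ T.E a v := by
    have := (hE a v).1 hav; grind
  have hwb : w ≠ b ∧ T.E a w := by
    have := (hE a w).1 hw; grind
  have key := T.link a {x | (x ≠ b ∧ x ∈ A) ∨ (x = b ∧ d ∈ A)} v (Or.inl ⟨hvb.1, hv⟩) hvb.2 (by
    intro x y hx hxy
    rcases hx with ⟨hxb, hx⟩ | ⟨rfl, hd⟩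
    · by_cases hxd : x = d
      · subst hxd
        have := u3 hxy h2.cyc
        right; exact ⟨this, hx⟩
      · have hyb : y ≠ b := by
          rintro rfl
          exact hxd (u2 hxy h2.cyc)
        refine Or.inl ⟨hyb, hc x y hx (flipF_old hxy ?_ ?_ ?_ ?_ ?_ ?_)⟩
        all_goals grind
    · have := u3 hxy h1
      subst this
      exact Or.inl ⟨n2.symm, hc d y hd (Or.inr (Or.inl (by unfold rot; grind)))⟩) w hwb.2
  rcases key with h | h
  · exact h.2
  · exact (hwb.1 h.1).elim

theorem flip_link_c {a b c d : W} (h1 : T.F a b c) (h2 : T.F b a d) (hn : c ≠ d)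
    (A : Set W) (v : W) (hv : v ∈ A) (hav : ∃ w, flipF T a b c d c v w)
    (hc : ∀ x y, x ∈ A → flipF T a b c d c x y → y ∈ A) :
    ∀ w, (∃ z, flipF T a b c d c w z) → w ∈ A := by
  have n1 := h1.n12; have n2 := h1.n23; have n3 := h1.n31
  have m1 := h2.n23; have m2 := h2.n31
  have hE := flipE_iff h1 h2
  have had : a ∈ A → d ∈ A := fun h => hc a d h (Or.inr (Or.inl (by unfold rot; grind)))
  have hdb : d ∈ A → b ∈ A := fun h => hc d b h (Or.inr (Or.inr (by unfold rot; grind)))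
  have hv' : ∃ v', v' ∈ A ∧ T.E c v' := by
    rcases (hE c v).1 hav with h | h | h
    · exact ⟨v, hv, h.1⟩
    · obtain ⟨_, rfl⟩ := h
      exact ⟨b, hdb hv, h1.e23.symm⟩
    · exact (hn h.1).elim
  obtain ⟨v', hv', hcv'⟩ := hv'
  have key := T.link c A v' hv' hcv' (by
    intro x y hx hxy
    by_cases hxa : x = a
    · subst hxa
      rw [u3 hxy h1.cyc2]
      exact hdb (had hx)
    · refine hc x y hx (flipF_old hxy ?_ ?_ ?_ ?_ ?_ ?_)
      · grind
      · grind
      · grind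
      · grind
      · rintro ⟨rfl, rfl⟩
        exact hn (u3 hxy.cyc h2)
      · grind)
  intro w hw
  rcases (hE c w).1 hw with h | h | h
  · exact key w h.1
  · rw [h.2]; exact had (key a h1.e31)
  · exact (hn h.1).elim

open Classical in
theorem flip_h1 {a b c d : W} (h1 : T.F a b c) (h2 : T.F b a d) (hcd : ¬ T.E c d) (hn : c ≠ d)
    (z : W → W → ZMod 2) (hs : ∀ a b, z a b = z b a)
    (hsup : ∀ x y, z x y ≠ 0 → ∃ w, flipF T a b c d x y w)
    (hdeg : ∀ a, ∑ b, z a b = 0) : ∃ f : W → W → ZMod 2,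
      (∀ x y w, flipF T a b c d x y w → f x y = f y w) ∧
      (∀ x y, (∃ w, flipF T a b c d x y w) → f x y + f y x = z x y) := by
  have n1 := h1.n12; have n2 := h1.n23; have n3 := h1.n31
  have m1 := h2.n23; have m2 := h2.n31
  have hE := flipE_iff h1 h2
  have hdc : ¬ T.E d c := fun h => hcd h.symm
  obtain ⟨k, hk⟩ : ∃ k, k = z c d := ⟨_, rfl⟩
  let t : W → W → ZMod 2 := fun x y => ed c a x y + ed a d x y + ed d c x y
  obtain ⟨f, hf, hz⟩ := T.sep_of_cycle (z := fun x y => z x y + k * t x y)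
    (by intro x y; simp only [t, ed_symm c a x y, ed_symm a d x y, ed_symm d c x y, hs x y])
    (by
      intro x y h
      by_contra hne
      apply h
      have k1 : ¬ ((x = c ∧ y = a) ∨ (x = a ∧ y = c)) := by
        rintro (⟨rfl, rfl⟩ | ⟨rfl, rfl⟩); exacts [hne h1.e31, hne h1.e31.symm]
      have k2 : ¬ ((x = a ∧ y = d) ∨ (x = d ∧ y = a)) := by
        rintro (⟨rfl, rfl⟩ | ⟨rfl, rfl⟩); exacts [hne h2.e23, hne h2.e23.symm]
      by_cases k3 : ((x = d ∧ y = c) ∨ (x = c ∧ y = d))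
      · have : z x y = k := by
          rcases k3 with ⟨rfl, rfl⟩ | ⟨rfl, rfl⟩
          · rw [hk, hs]
          · rw [hk]
        simp [t, ed, k1, k2, k3, this, z2self]
      · have : z x y = 0 := by
          by_contra hz
          have := (hE x y).1 (hsup x y hz)
          grind
        simp [t, ed, k1, k2, k3, this])
    (by
      intro x
      simp only [t, Finset.sum_add_distrib, ← Finset.mul_sum, hdeg, ed_deg n3, ed_deg m1, ed_deg hn.symm]
      generalize (if x = c then (1 : ZMod 2) else 0) = u
      generalize (if x = a then (1 : ZMod 2) else 0) = v
      generalize (if x = d then (1 : ZMod 2) else 0) = w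
      clear hk; revert k u v w; decide)
  have zab : z a b = 0 := by
    by_contra hz
    have := (hE a b).1 (hsup a b hz)
    grind
  obtain ⟨s, hsdef⟩ : ∃ s, s = f a b := ⟨_, rfl⟩
  have e1 : f b c = s := by rw [hsdef, hf _ _ _ h1]
  have e2 : f c a = s := by rw [← hf _ _ _ h1.cyc, e1]
  have e3 : f b a = s := by
    have := hz a b h1.e12
    have t0 : t a b = 0 := by simp only [t, ed]; grind
    rw [zab, t0, ← hsdef] at this
    have z : ∀ s u k : ZMod 2, s + u = 0 + k * 0 → u = s := by decide
    exact z _ _ _ this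
  have e4 : f a d = s := by rw [← hf _ _ _ h2, e3]
  have e5 : f d b = s := by rw [← hf _ _ _ h2.cyc, e4]
  have z2aux : ∀ s u w k : ZMod 2, s + u = w + k * 1 → s + k + u = w := by decide
  have z2aux' : ∀ s u w k : ZMod 2, u + s = w + k * 1 → u + (s + k) = w := by decide
  let g : W → W → ZMod 2 := fun x y =>
    if (x = c ∧ y = a) ∨ (x = a ∧ y = d) ∨ (x = d ∧ y = c) then s + k else
      if x = c ∧ y = d then s else f x y
  have hg : ∀ x y, ¬ (x = c ∧ y = a) → ¬ (x = a ∧ y = d) → ¬ (x = d ∧ y = c) → ¬ (x = c ∧ y = d) →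
    g x y = f x y := by
    intro x y q1 q2 q3 q4
    simp [g, q1, q2, q3, q4]
  have g1 : g c a = s + k := by simp [g]
  have g2 : g a d = s + k := by simp [g]
  have g3 : g d c = s + k := by simp [g]
  have g4 : g c d = s := by simp [g, n3, n3.symm, m1, m1.symm, hn, hn.symm]
  have g5 : g d b = s := by rw [hg _ _ (by grind) (by grind) (by grind) (by grind), e5]
  have g6 : g b c = s := by rw [hg _ _ (by grind) (by grind) (by grind) (by grind), e1]
  refine ⟨g, ?_, ?_⟩
  · rintro x y w (⟨h, r1, r2⟩ | h | h)
    · have key : ∀ {x y w : W}, T.F x y w → ¬ rot a b c x y w → ¬ rot b a d x y w → g x y = f x y := by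
        intro x y w h r1 r2
        apply hg
        · rintro ⟨rfl, rfl⟩
          exact r1 (by have := u3 h h1.cyc2; unfold rot; grind)
        · rintro ⟨rfl, rfl⟩
          exact r2 (by have := u3 h h2.cyc; unfold rot; grind)
        · rintro ⟨rfl, rfl⟩; exact hdc ⟨_, h⟩
        · rintro ⟨rfl, rfl⟩; exact hcd ⟨_, h⟩
      rw [key h r1 r2, key h.cyc (by unfold rot at *; grind) (by unfold rot at *; grind), hf _ _ _ h]
    · rcases h with ⟨rfl, rfl, rfl⟩ | ⟨rfl, rfl, rfl⟩ | ⟨rfl, rfl, rfl⟩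
      · rw [g1, g2]
      · rw [g2, g3]
      · rw [g3, g1]
    · rcases h with ⟨rfl, rfl, rfl⟩ | ⟨rfl, rfl, rfl⟩ | ⟨rfl, rfl, rfl⟩
      · rw [g5, g6]
      · rw [g6, g4]
      · rw [g4, g5]
  · have main : ∀ x y, ((T.E x y ∧ ¬ (x = a ∧ y = b) ∧ ¬ (x = b ∧ y = a)) ∨ (x = c ∧ y = d)) →
        g x y + g y x = z x y := by
      rintro x y (⟨h, q1, q2⟩ | ⟨rfl, rfl⟩)
      · have hz' := hz x y h
        have k4 : ¬ (x = c ∧ y = d) := by rintro ⟨rfl, rfl⟩; exact hcd h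
        have k5 : ¬ (x = d ∧ y = c) := by rintro ⟨rfl, rfl⟩; exact hdc h
        by_cases k1 : x = c ∧ y = a
        · obtain ⟨rfl, rfl⟩ := k1
          rw [g1, hg y x (by grind) (by grind) (by grind) (by grind)]
          have t0 : t x y = 1 := by simp only [t, ed]; grind
          rw [t0, e2] at hz'
          generalize f y x = u at *; generalize z x y = w at *; exact z2aux _ _ _ _ hz'
        by_cases k1' : x = a ∧ y = c
        · obtain ⟨rfl, rfl⟩ := k1'
          rw [g1, hg x y (by grind) (by grind) (by grind) (by grind)]
          have t0 : t x y = 1 := by simp only [t, ed]; grind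
          rw [t0, e2] at hz'
          generalize f x y = u at *; generalize z x y = w at *; exact z2aux' _ _ _ _ hz'
        by_cases k2 : x = a ∧ y = d
        · obtain ⟨rfl, rfl⟩ := k2
          rw [g2, hg y x (by grind) (by grind) (by grind) (by grind)]
          have t0 : t x y = 1 := by simp only [t, ed]; grind
          rw [t0, e4] at hz'
          generalize f y x = u at *; generalize z x y = w at *; exact z2aux _ _ _ _ hz'
        by_cases k2' : x = d ∧ y = a
        · obtain ⟨rfl, rfl⟩ := k2'
          rw [g2, hg x y (by grind) (by grind) (by grind) (by grind)]
          have t0 : t x y = 1 := by simp only [t, ed]; grind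
          rw [t0, e4] at hz'
          generalize f x y = u at *; generalize z x y = w at *; exact z2aux' _ _ _ _ hz'
        have t0 : t x y = 0 := by
          simp only [t, ed]
          rw [if_neg (by grind), if_neg (by grind), if_neg (by grind)]; simp
        rw [hg x y (by grind) (by grind) (by grind) (by grind),
          hg y x (by grind) (by grind) (by grind) (by grind), hz', t0]
        simp
      · rw [g4, g3, ← add_assoc, z2self, zero_add, hk]
    intro x y h
    rcases (hE x y).1 h with h | h | h
    · exact main x y (Or.inl h)
    · exact main x y (Or.inr h)
    · rw [add_comm, hs x y]; exact main y x (Or.inr h.symm)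

open Classical in
/-- The flip of the edge `ab`. -/
def flip {a b c d : W} (h1 : T.F a b c) (h2 : T.F b a d) (hcd : ¬ T.E c d) (hn : c ≠ d) :
    Tri W where
  F := flipF T a b c d
  cyc := flipF_cyc
  ne := by
    rintro x y z (h | h | h)
    · exact h.1.n12
    · have := h1.n31; have := h2.n23
      rcases h with ⟨rfl, rfl, rfl⟩ | ⟨rfl, rfl, rfl⟩ | ⟨rfl, rfl, rfl⟩ <;> grind
    · have := h1.n23; have := h2.n31
      rcases h with ⟨rfl, rfl, rfl⟩ | ⟨rfl, rfl, rfl⟩ | ⟨rfl, rfl, rfl⟩ <;> grind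
  uniq := flip_uniq h1 h2 hcd hn
  rev := by
    intro x y z h
    have hE := flipE_iff h1 h2
    rw [hE y x]
    have := (hE x y).1 ⟨z, h⟩
    rw [E.comm] at this
    grind
  link := by
    intro u A v hv hE hc
    have sw := flipF_swap T a b c d
    by_cases ha : u = a
    · subst ha; exact flip_link_a h1 h2 A v hv hE hc
    by_cases hb : u = b
    · subst hb
      simp only [sw] at hE hc ⊢
      exact flip_link_a h2 h1 A v hv hE hc
    by_cases hcc : u = c
    · subst hcc; exact flip_link_c h1 h2 hn A v hv hE hc
    by_cases hd : u = d
    · subst hd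
      simp only [sw] at hE hc ⊢
      exact flip_link_c h2 h1 hn.symm A v hv hE hc
    have e : ∀ w, (∃ c_1, flipF T a b c d u w c_1) ↔ T.E u w := by
      intro w; rw [flipE_iff h1 h2]; grind
    simp only [e] at hE ⊢
    refine T.link u A v hv hE ?_
    intro x y hx hxy
    refine hc x y hx (Or.inl ⟨hxy, ?_, ?_⟩)
    · unfold rot; grind
    · unfold rot; grind
  conn := by
    intro A hne hA
    refine T.conn A hne ?_
    intro x y z hx hxy
    have hE := flipE_iff h1 h2
    have m1 := h2.n23; have m2 := h2.n31
    have step : ∀ x y, x ∈ A → (∃ w, flipF T a b c d x y w) → y ∈ A := by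
      rintro x y hx ⟨w, hw⟩; exact hA x y w hx hw
    have had : a ∈ A → d ∈ A := fun h => step a d h ((hE _ _).2 (Or.inl ⟨h2.e23, by grind, by grind⟩))
    have hda : d ∈ A → a ∈ A := fun h => step d a h ((hE _ _).2 (Or.inl ⟨h2.e23.symm, by grind, by grind⟩))
    have hbd : b ∈ A → d ∈ A := fun h => step b d h ((hE _ _).2 (Or.inl ⟨h2.e31.symm, by grind, by grind⟩))
    have hdb : d ∈ A → b ∈ A := fun h => step d b h ((hE _ _).2 (Or.inl ⟨h2.e31, by grind, by grind⟩))
    by_cases q1 : x = a ∧ y = b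
    · obtain ⟨rfl, rfl⟩ := q1; exact hdb (had hx)
    by_cases q2 : x = b ∧ y = a
    · obtain ⟨rfl, rfl⟩ := q2; exact hda (hbd hx)
    exact step x y hx ((hE _ _).2 (Or.inl ⟨⟨z, hxy⟩, q1, q2⟩))
  h1 := flip_h1 h1 h2 hcd hn

end Tri

namespace Tri
variable {W : Type} [Fintype W] {T : Tri W}

theorem flip_E {a b c d : W} (h1 : T.F a b c) (h2 : T.F b a d) (hcd : ¬ T.E c d) (hn : c ≠ d)
    (u v : W) : (T.flip h1 h2 hcd hn).E u v ↔
      ((T.E u v ∧ ¬ (u = a ∧ v = b) ∧ ¬ (u = b ∧ v = a)) ∨ (u = c ∧ v = d) ∨ (u = d ∧ v = c)) :=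
  flipE_iff h1 h2 u v

/-- triangles without the flipped edge survive -/
theorem flip_keep {a b c d x y z : W} (h : T.F x y z)
    (hab : ∀ p q, (p = x ∨ p = y ∨ p = z) → (q = x ∨ q = y ∨ q = z) → p = a → q = b → False) :
    flipF T a b c d x y z := by
  apply flipF_old h <;> (rintro ⟨rfl, rfl⟩; exact hab _ _ (by simp) (by simp) rfl rfl)

theorem link3 {u p q r w : W} (h1 : T.F u p q) (h2 : T.F u q r) (h3 : T.F u r p)
    (hw : T.E u w) : w = p ∨ w = q ∨ w = r := by
  have := T.link u {x | x = p ∨ x = q ∨ x = r} p (Or.inl rfl) h1.e12 (by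
    rintro a b (rfl | rfl | rfl) h
    · exact Or.inr (Or.inl (u3 h h1))
    · exact Or.inr (Or.inr (u3 h h2))
    · exact (Or.inl (u3 h h3))) w hw
  exact this

theorem link4 {u p q r s w : W} (h1 : T.F u p q) (h2 : T.F u q r) (h3 : T.F u r s) (h4 : T.F u s p)
    (hw : T.E u w) : w = p ∨ w = q ∨ w = r ∨ w = s := by
  have := T.link u {x | x = p ∨ x = q ∨ x = r ∨ x = s} p (Or.inl rfl) h1.e12 (by
    rintro a b (rfl | rfl | rfl | rfl) h
    · exact Or.inr (Or.inl (u3 h h1))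
    · exact Or.inr (Or.inr (Or.inl (u3 h h2)))
    · exact Or.inr (Or.inr (Or.inr (u3 h h3)))
    · exact (Or.inl (u3 h h4))) w hw
  exact this

/-- path in the link of `x` from `u` to `v`, with intermediate vertices outside `B` -/
inductive Arc (T : Tri W) (x : W) (B : W → Prop) (v : W) : W → Prop
  | one (u : W) : T.F x u v → Arc T x B v u
  | step (u p : W) : T.F x u p → ¬ B p → Arc T x B v p → Arc T x B v u

theorem Arc.e {x u v : W} {B : W → Prop} (h : Arc T x B v u) : T.E x u := by
  cases h with
  | one _ h => exact h.e12
  | step _ p h => exact h.e12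

theorem Arc.mono_F {T' : Tri W} {x u v : W} {B : W → Prop} (h : Arc T x B v u)
    (hF : ∀ p q, T.F x p q → T'.F x p q) : Arc T' x B v u := by
  induction h with
  | one u h => exact Arc.one u (hF _ _ h)
  | step u p h hB _ ih => exact Arc.step u p (hF _ _ h) hB ih

theorem Arc.flip_a {a b c d u v : W} {B : W → Prop}
    (h1 : T.F a b c) (h2 : T.F b a d) (hcd : ¬ T.E c d) (hn : c ≠ d)
    (h : Arc T a B v u) (hb : ¬ B b) (hv : B v) (hu : u ≠ b) :
    Arc (T.flip h1 h2 hcd hn) a B v u := by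
  have n1 := h1.n12; have n2 := h1.n23; have n3 := h1.n31
  have m1 := h2.n23; have m2 := h2.n31
  have old : ∀ x y, T.F a x y → x ≠ b → y ≠ b → (T.flip h1 h2 hcd hn).F a x y := by
    intro x y h hx hy
    apply flip_keep h
    rintro p q - hq rfl rfl
    rcases hq with h | h | h <;> simp_all
  have hnew : (T.flip h1 h2 hcd hn).F a d c := Or.inr (Or.inl (Or.inr (Or.inl ⟨rfl, rfl, rfl⟩)))
  have key : (u ≠ b → Arc (T.flip h1 h2 hcd hn) a B v u) ∧
      (u = b → (c = v ∨ (¬ B c ∧ Arc (T.flip h1 h2 hcd hn) a B v c))) := by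
    clear hu
    induction h with
    | one u h =>
      refine ⟨fun hu => Arc.one u (old _ _ h hu (by rintro rfl; exact hb hv)), ?_⟩
      rintro rfl
      exact Or.inl (u3 h1 h)
    | step u q h hB _ ih =>
      constructor
      · intro hu
        by_cases hq : q = b
        · subst hq
          have hud : u = d := u2 h h2.cyc
          rcases ih.2 rfl with k | k
          · rw [hud]; exact Arc.one _ (k ▸ hnew)
          · rw [hud]; exact Arc.step _ _ hnew k.1 k.2
        · exact Arc.step u q (old _ _ h hu hq) hB (ih.1 hq)
      · rintro rfl
        have := u3 h1 h
        subst this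
        exact Or.inr ⟨hB, ih.1 n2.symm⟩
  exact key.1 hu

theorem Arc.flip_c {a b c d u v : W} {B : W → Prop}
    (h1 : T.F a b c) (h2 : T.F b a d) (hcd : ¬ T.E c d) (hn : c ≠ d)
    (h : Arc T c B v u) (hd : ¬ B d) :
    Arc (T.flip h1 h2 hcd hn) c B v u := by
  have n1 := h1.n12; have n2 := h1.n23; have n3 := h1.n31
  have old : ∀ x y, T.F c x y → x ≠ a → (T.flip h1 h2 hcd hn).F c x y := by
    intro x y h hx
    apply flip_keep h
    rintro p q hp hq rfl rfl
    have : p = y := by rcases hp with h | h | h <;> simp_all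
    subst this
    have : q = x := by rcases hq with h | h | h <;> simp_all
    subst this
    exact hn (u3 h.cyc h2)
  have hnew : (T.flip h1 h2 hcd hn).F c a d := Or.inr (Or.inl (Or.inl ⟨rfl, rfl, rfl⟩))
  have hnew' : (T.flip h1 h2 hcd hn).F c d b := Or.inr (Or.inr (Or.inr (Or.inr ⟨rfl, rfl, rfl⟩)))
  induction h with
  | one u h =>
    by_cases hu : u = a
    · subst hu
      have := u3 h h1.cyc2
      subst this
      exact Arc.step _ _ hnew hd (Arc.one _ hnew')
    · exact Arc.one _ (old _ _ h hu)
  | step u q h hB _ ih =>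
    by_cases hu : u = a
    · subst hu
      have := u3 h h1.cyc2
      subst this
      exact Arc.step _ _ hnew hd (Arc.step _ _ hnew' hB ih)
    · exact Arc.step _ _ (old _ _ h hu) hB ih

theorem flip_swap {a b c d : W}
    (h1 : T.F a b c) (h2 : T.F b a d) (hcd : ¬ T.E c d) (hn : c ≠ d) (x y z : W) :
    (T.flip h2 h1 (fun h => hcd h.symm) hn.symm).F x y z → (T.flip h1 h2 hcd hn).F x y z :=
  (flipF_swap T b a d c x y z).1

theorem Arc.flip_any {a b c d x u v : W} {B : W → Prop}
    (h1 : T.F a b c) (h2 : T.F b a d) (hcd : ¬ T.E c d) (hn : c ≠ d)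
    (h : Arc T x B v u) (hu : B u) (hv : B v) (hB : ∀ w, B w → T.E x w)
    (ha : x = a → ¬ B b) (hb : x = b → ¬ B a) : Arc (T.flip h1 h2 hcd hn) x B v u := by
  by_cases q1 : x = a
  · subst q1
    exact h.flip_a h1 h2 hcd hn (ha rfl) hv (by rintro rfl; exact ha rfl hu)
  by_cases q2 : x = b
  · subst q2
    have := h.flip_a h2 h1 (fun h => hcd h.symm) hn.symm (hb rfl) hv (by rintro rfl; exact hb rfl hu)
    exact this.mono_F (fun p q => flip_swap h1 h2 hcd hn _ _ _)
  by_cases q3 : x = c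
  · subst q3
    exact h.flip_c h1 h2 hcd hn (fun h => hcd (hB _ h))
  by_cases q4 : x = d
  · subst q4
    have := h.flip_c h2 h1 (fun h => hcd h.symm) hn.symm (fun h => hcd (hB _ h).symm)
    exact this.mono_F (fun p q => flip_swap h1 h2 hcd hn _ _ _)
  refine h.mono_F ?_
  intro p q hpq
  left
  refine ⟨hpq, ?_, ?_⟩ <;> (unfold rot; grind)

end Tri

/-- kites: crossing vertices `X`, corners `κ`, and the three outer vertices -/
structure Kites (W ι : Type) where
  X : ι → W
  κ : ι → Fin 4 → W
  D1 : W
  D2 : W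
  D3 : W
  Xinj : ∀ i j, X i = X j → i = j
  κinj : ∀ i j m m', κ i m = κ j m' → i = j ∧ m = m'
  Xκ : ∀ i j m, X i ≠ κ j m
  XD1 : ∀ i, X i ≠ D1
  XD2 : ∀ i, X i ≠ D2
  XD3 : ∀ i, X i ≠ D3
  κD1 : ∀ i m, κ i m ≠ D1
  κD2 : ∀ i m, κ i m ≠ D2
  κD3 : ∀ i m, κ i m ≠ D3

namespace Kites
variable {W ι : Type} [Fintype W] (K : Kites W ι)

def Cor (i : ι) (w : W) : Prop := ∃ m, w = K.κ i m

structure Inv (P : W → W → Prop) (T : Tri W) (Dn : Set ι) : Prop where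
  arc : ∀ i m, T.Arc (K.X i) (K.Cor i) (K.κ i (m + 1)) (K.κ i m)
  need : ∀ u v, P u v → T.E u v
  done : ∀ i ∈ Dn, ∀ m, T.F (K.X i) (K.κ i m) (K.κ i (m + 1))
  outer : T.F K.D2 K.D1 K.D3

variable {K}

theorem nbr_done {T : Tri W} {i : ι} (h : ∀ m, T.F (K.X i) (K.κ i m) (K.κ i (m + 1))) {w : W}
    (hw : T.E (K.X i) w) : K.Cor i w := by
  rcases Tri.link4 (h 0) (h 1) (h 2) (h 3) hw with h | h | h | h
  · exact ⟨0, h⟩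
  · exact ⟨1, h⟩
  · exact ⟨2, h⟩
  · exact ⟨3, h⟩

theorem Inv.corE {P : W → W → Prop} {T : Tri W} {Dn : Set ι} (h : K.Inv P T Dn) {i : ι} {w : W}
    (hw : K.Cor i w) : T.E (K.X i) w := by
  obtain ⟨m, rfl⟩ := hw
  exact (h.arc i m).e

theorem Inv.flip {P : W → W → Prop} {T : Tri W} {Dn : Set ι} (h : K.Inv P T Dn) {P' : W → W → Prop}
    {a b c d : W} (h1 : T.F a b c) (h2 : T.F b a d) (hcd : ¬ T.E c d) (hn : c ≠ d)
    (ha : ∀ i, K.X i = a → ¬ K.Cor i b) (hb : ∀ i, K.X i = b → ¬ K.Cor i a)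
    (hd : ∀ i ∈ Dn, K.X i ≠ c ∧ K.X i ≠ d)
    (hP : ∀ u v, P' u v → (T.flip h1 h2 hcd hn).E u v)
    (hD : a ≠ K.D1 ∧ a ≠ K.D2 ∧ a ≠ K.D3) : K.Inv P' (T.flip h1 h2 hcd hn) Dn where
  arc := fun i m => (h.arc i m).flip_any h1 h2 hcd hn ⟨m, rfl⟩ ⟨_, rfl⟩ (fun w hw => h.corE hw)
    (ha i) (hb i)
  need := hP
  done := by
    intro i hi m
    have hF := h.done i hi m
    have q1 : K.X i ≠ a := fun e => ha i e (nbr_done (h.done i hi) (e ▸ h1.e12))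
    have q2 : K.X i ≠ b := fun e => hb i e (nbr_done (h.done i hi) (e ▸ h2.e12))
    have q3 := hd i hi
    left
    refine ⟨hF, ?_, ?_⟩ <;> (unfold Tri.rot; grind)
  outer := by
    left
    refine ⟨h.outer, ?_, ?_⟩ <;> (unfold Tri.rot; grind)

/-- degree -/
noncomputable def dg (T : Tri W) (x : W) : ℕ := Set.ncard {v | T.E x v}

theorem dg_lt {T T' : Tri W} {x p : W} (h : T.E x p) (h' : ∀ v, T'.E x v → T.E x v ∧ v ≠ p) :
    dg T' x < dg T x := by
  apply Set.ncard_lt_ncard _ (Set.toFinite _)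
  rw [Set.ssubset_iff_of_subset (show {v | T'.E x v} ⊆ {v | T.E x v} from fun v hv => (h' v hv).1)]
  exact ⟨p, h, fun hp => (h' p hp).2 rfl⟩

theorem fin4_ne (m : Fin 4) : m ≠ m + 1 ∧ m ≠ m + 2 ∧ m ≠ m + 3 ∧ m + 1 ≠ m + 2 ∧ m + 1 ≠ m + 3 ∧ m + 2 ≠ m + 3 := by
  revert m; decide

/-- flipping away a non-corner neighbour of `X i` -/
theorem Inv.flipX {P : W → W → Prop} {T : Tri W} {Dn : Set ι} (h : K.Inv P T Dn)
    (hPX : ∀ u v i, P u v → u ≠ K.X i ∧ v ≠ K.X i)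
    {i : ι} (hi : i ∉ Dn) {p q s : W}
    (h1 : T.F (K.X i) p q) (h2 : T.F p (K.X i) s) (hp : ¬ K.Cor i p)
    (hcd : ¬ T.E q s) (hn : q ≠ s) :
    K.Inv P (T.flip h1 h2 hcd hn) Dn ∧ dg (T.flip h1 h2 hcd hn) (K.X i) < dg T (K.X i) := by
  constructor
  · refine h.flip h1 h2 hcd hn ?_ ?_ ?_ ?_ ⟨K.XD1 i, K.XD2 i, K.XD3 i⟩
    · intro j hj; rw [K.Xinj _ _ hj]; exact hp
    · rintro j hj ⟨m, hm⟩; exact K.Xκ _ _ _ hm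
    · intro j hj
      have : ∀ w, T.E (K.X i) w → K.X j ≠ w := by
        rintro w hw rfl
        obtain ⟨m, hm⟩ := nbr_done (h.done j hj) hw.symm
        exact K.Xκ _ _ _ hm
      exact ⟨this _ h1.e31.symm, this _ h2.e23⟩
    · intro u v huv
      have := hPX u v i huv
      rw [Tri.flip_E]
      exact Or.inl ⟨h.need u v huv, fun e => this.1 e.1, fun e => this.2 e.2⟩
  · apply dg_lt h1.e12
    intro v hv
    rw [Tri.flip_E] at hv
    have := h1.n31; have := h2.n23
    grind

theorem Inv.step1 {P : W → W → Prop} {T : Tri W} {Dn : Set ι} (h : K.Inv P T Dn)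
    (hPX : ∀ u v i, P u v → u ≠ K.X i ∧ v ≠ K.X i)
    {i : ι} (hi : i ∉ Dn) {m : Fin 4} (hm : ¬ T.F (K.X i) (K.κ i m) (K.κ i (m + 1))) :
    ∃ T', K.Inv P T' Dn ∧ dg T' (K.X i) < dg T (K.X i) := by
  have harc := h.arc i m
  have fm := fin4_ne m
  have hcor : ∀ m, K.Cor i (K.κ i m) := fun m => ⟨m, rfl⟩
  generalize hs : K.κ i m = s at *
  generalize ht : K.κ i (m + 1) = t at *
  have cs : K.Cor i s := hs ▸ hcor m
  have ct : K.Cor i t := ht ▸ hcor _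
  have hst : s ≠ t := by
    rintro rfl
    exact fm.1 (K.κinj _ _ _ _ (hs.trans ht.symm)).2
  have hneC : ∀ {p c}, K.Cor i c → ¬ K.Cor i p → p ≠ c := by rintro p c hc hp rfl; exact hp hc
  cases harc with
  | one _ hF => exact (hm hF).elim
  | step _ p1 hs1 hp1 harc =>
  cases harc with
  | step _ p2 h12 hp2 harc =>
    by_cases hE : T.E p2 s
    · have : ∃ p3, T.F (K.X i) p2 p3 ∧ p3 ≠ s := by
        cases harc with
        | one _ h3 => exact ⟨t, h3, hst.symm⟩
        | step _ p3 h3 hB => exact ⟨p3, h3, hneC cs hB⟩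
      obtain ⟨p3, h23, h3s⟩ := this
      have sp := Tri.sep3_nadj h23.e12 hE hs1.e12.symm h23 h12.cyc2 h3s (hneC cs hp1)
      exact ⟨_, h.flipX hPX hi h23 h12.cyc2 hp2 sp.2.1 sp.1⟩
    · exact ⟨_, h.flipX hPX hi h12 hs1.cyc2 hp1 hE (hneC cs hp2)⟩
  | one _ h1t =>
    by_cases hE : T.E t s
    · obtain ⟨x, hx⟩ := hE.symm
      obtain ⟨y, hy⟩ := hE
      have hxX : x ≠ K.X i := by
        rintro rfl
        exact hneC ct hp1 (Tri.u3 hs1 hx.cyc2)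
      have hyX : y ≠ K.X i := by
        rintro rfl
        have e := Tri.link3 hs1 h1t hy.cyc2 (h.arc i (m + 2)).e
        rcases e with e | e | e
        · exact fm.2.1 (K.κinj _ _ _ _ (e.trans hs.symm)).2.symm
        · exact hneC (hcor _) hp1 e.symm
        · exact fm.2.2.2.1 (K.κinj _ _ _ _ (e.trans ht.symm)).2.symm
      have sp := Tri.sep3_nadj hx.e12 h1t.e31 hs1.e12 hx hy hxX hyX
      have notX : ∀ j c, K.Cor i c → K.X j ≠ c := by rintro j c ⟨m, rfl⟩; exact K.Xκ _ _ _
      have I1 : K.Inv (fun u v => P u v ∧ ¬ (u = s ∧ v = t) ∧ ¬ (u = t ∧ v = s)) (T.flip hx hy sp.2.1 sp.1) Dn := by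
        refine h.flip hx hy sp.2.1 sp.1 ?_ ?_ ?_ ?_ ?_
        · intro j hj; exact (notX _ _ cs hj).elim
        · intro j hj; exact (notX _ _ ct hj).elim
        · intro j hj
          have : ∀ w, T.E s w → K.X j ≠ w := by
            rintro w hw rfl
            obtain ⟨m', hm'⟩ := nbr_done (h.done j hj) hw.symm
            have := (K.κinj _ _ _ _ (hs.trans hm')).1
            exact hi (this ▸ hj)
          exact ⟨this _ hx.e31.symm, this _ hy.e23⟩
        · intro u v huv
          rw [Tri.flip_E]
          exact Or.inl ⟨h.need u v huv.1, huv.2⟩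
        · rw [← hs]; exact ⟨K.κD1 _ _, K.κD2 _ _, K.κD3 _ _⟩
      have hXs := notX i s cs
      have hXt := notX i t ct
      have keep : ∀ p q, T.F (K.X i) p q → (p ≠ s ∨ q ≠ t) → (p ≠ t ∨ q ≠ s) → (T.flip hx hy sp.2.1 sp.1).F (K.X i) p q := by
        intro p q hpq k1 k2
        left
        refine ⟨hpq, ?_, ?_⟩ <;> (unfold Tri.rot; grind)
      have hp1s := hneC cs hp1
      have hp1t := hneC ct hp1
      have hs1' := keep _ _ hs1 (Or.inr hp1t) (Or.inr hp1s)
      have h1t' := keep _ _ h1t (Or.inl hp1s) (Or.inl hp1t)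
      have hxs := hx.n31
      have hys := hy.n23
      have hE' : ¬ (T.flip hx hy sp.2.1 sp.1).E t s := by
        rw [Tri.flip_E]; grind
      obtain ⟨I2, hdg⟩ := I1.flipX (fun u v j huv => hPX u v j huv.1) hi h1t' hs1'.cyc2 hp1 hE' hst.symm
      refine ⟨_, ⟨I2.arc, ?_, I2.done, I2.outer⟩, ?_⟩
      · intro u v huv
        by_cases e1 : u = s ∧ v = t
        · rw [Tri.flip_E]; exact Or.inr (Or.inr e1)
        by_cases e2 : u = t ∧ v = s
        · rw [Tri.flip_E]; exact Or.inr (Or.inl e2)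
        exact I2.need u v ⟨huv, e1, e2⟩
      · refine lt_of_lt_of_le hdg (Set.ncard_le_ncard ?_ (Set.toFinite _))
        intro v hv
        simp only [Set.mem_ofPred_eq, Tri.flip_E] at hv ⊢
        grind
    · exact ⟨_, h.flipX hPX hi h1t hs1.cyc2 hp1 hE hst.symm⟩

theorem Inv.stage1 [Finite ι] {P : W → W → Prop}
    (hPX : ∀ u v i, P u v → u ≠ K.X i ∧ v ≠ K.X i) {T : Tri W} (h : K.Inv P T ∅) :
    ∃ T', K.Inv P T' Set.univ := by
  have one : ∀ (n : ℕ) (T : Tri W) (Dn : Set ι) (i : ι), i ∉ Dn → K.Inv P T Dn → dg T (K.X i) = n →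
      ∃ T', K.Inv P T' (insert i Dn) := by
    intro n
    induction n using Nat.strong_induction_on with
    | _ n ih =>
      intro T Dn i hi hT hn
      by_cases hall : ∀ m, T.F (K.X i) (K.κ i m) (K.κ i (m + 1))
      · refine ⟨T, hT.arc, hT.need, ?_, hT.outer⟩
        rintro j (rfl | hj)
        · exact hall
        · exact hT.done j hj
      · push Not at hall
        obtain ⟨m, hm⟩ := hall
        obtain ⟨T', hT', hlt⟩ := hT.step1 hPX hi hm
        exact ih _ (hn ▸ hlt) T' Dn i hi hT' rfl
  have : ∀ S : Set ι, ∃ T', K.Inv P T' S := by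
    intro S
    induction S, S.toFinite using Set.Finite.induction_on with
    | empty => exact ⟨T, h⟩
    | insert hi _ ih =>
      obtain ⟨T', hT'⟩ := ih
      exact one _ T' _ _ hi hT' rfl
  exact this _

/-- the number of diagonals present -/
noncomputable def nd (K : Kites W ι) (T : Tri W) : ℕ :=
  Set.ncard {q : ι × Fin 4 | T.E (K.κ q.1 q.2) (K.κ q.1 (q.2 + 2))}

theorem fin4_add (m : Fin 4) : m + 1 + 1 = m + 2 ∧ m + 2 + 1 = m + 3 ∧ m + 3 + 1 = m ∧ m + 2 + 2 = m
    ∧ m + 1 + 2 = m + 3 := by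
  revert m; decide

theorem fin4_cases (m m' : Fin 4) : m' = m ∨ m' = m + 1 ∨ m' = m + 2 ∨ m' = m + 3 := by
  revert m m'; decide

theorem Inv.step2 [Finite ι] {P : W → W → Prop} {T : Tri W} (h : K.Inv P T Set.univ)
    (hPd : ∀ i m, ¬ P (K.κ i m) (K.κ i (m + 2)))
    {i : ι} {m : Fin 4} (hm : T.E (K.κ i m) (K.κ i (m + 2))) :
    ∃ T', K.Inv P T' Set.univ ∧ nd K T' < nd K T := by
  obtain ⟨fa1, fa2, fa3, fa4, fa5⟩ := fin4_add m
  have fm := fin4_ne m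
  have hF := fun m => h.done i (Set.mem_univ _) m
  have hPd' := hPd i (m + 2)
  rw [fa4] at hPd'
  have hPd1 := hPd i m
  have ha : ∀ k, K.κ i m ≠ K.κ i k ∨ m = k := by
    intro k; by_cases hk : m = k
    · exact Or.inr hk
    · exact Or.inl fun e => hk (K.κinj _ _ _ _ e).2
  have t1 := hF m
  have t2 := hF (m + 1)
  have t3 := hF (m + 2)
  have t4 := hF (m + 3)
  rw [fa1] at t2; rw [fa2] at t3; rw [fa3] at t4
  have nac : K.κ i m ≠ K.κ i (m + 2) := fun e => fm.2.1 (K.κinj _ _ _ _ e).2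
  obtain ⟨x, hx⟩ := hm
  obtain ⟨y, hy⟩ := T.rev hx
  have hxX : x ≠ K.X i := by
    rintro rfl
    exact fm.2.2.2.1 (K.κinj _ _ _ _ (Tri.u3 t1 hx.cyc2)).2
  have hyX : y ≠ K.X i := by
    rintro rfl
    exact fm.2.2.1 (K.κinj _ _ _ _ (Tri.u3 t3 hy.cyc2)).2.symm
  have sp := Tri.sep3_nadj hx.e12 t2.e31 t1.e12 hx hy hxX hyX
  have hdone : ∀ j w, T.E (K.κ i m) w → w ≠ K.X i → K.X j ≠ w := by
    rintro j w hw hn rfl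
    obtain ⟨m', hm'⟩ := nbr_done (h.done j (Set.mem_univ _)) hw.symm
    have := (K.κinj _ _ _ _ hm').1
    exact hn (by rw [this])
  have key : ∀ j k, ¬ ((K.κ j k = x ∧ K.κ j (k + 2) = y) ∨ (K.κ j k = y ∧ K.κ j (k + 2) = x)) := by
    intro j k hjk
    by_cases hji : j = i
    · subst hji
      -- the other diagonal
      have hxc : x = K.κ j (m + 1) := by
        have hc : K.Cor j x := by
          rcases hjk with ⟨e, _⟩ | ⟨_, e⟩
          · exact ⟨_, e.symm⟩
          · exact ⟨_, e.symm⟩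
        obtain ⟨m', rfl⟩ := hc
        rcases fin4_cases m m' with e | e | e | e
        · exact (hx.n31 (by rw [e])).elim
        · rw [e]
        · exact (hx.n23 (by rw [e])).elim
        · exfalso
          have hyc : y = K.κ j (m + 1) := by
            have ff : ∀ m k m' : Fin 4, m' = m + 3 → (k = m' → k + 2 = m + 1) ∧ (k + 2 = m' → k = m + 1) := by decide
            rcases hjk with ⟨e1, e2⟩ | ⟨e1, e2⟩
            · rw [← e2]; rw [(ff m k m' e).1 (K.κinj _ _ _ _ e1).2]
            · rw [← e1]; rw [(ff m k m' e).2 (K.κinj _ _ _ _ e2).2]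
          subst hyc
          have := Tri.u3 hy.cyc t1.cyc
          exact K.Xκ _ _ _ this.symm
      have hyd : y = K.κ j (m + 3) := by
        have ff : ∀ m k : Fin 4, (k = m + 1 → k + 2 = m + 3) ∧ (k + 2 = m + 1 → k = m + 3) := by decide
        rcases hjk with ⟨e1, e2⟩ | ⟨e1, e2⟩
        · rw [← e2]; rw [(ff m k).1 (K.κinj _ _ _ _ (e1.trans hxc)).2]
        · rw [← e1]; rw [(ff m k).2 (K.κinj _ _ _ _ (e2.trans hxc)).2]
      subst hxc hyd
      have hcl := T.conn {w | w = K.X j ∨ K.Cor j w} ⟨_, Or.inl rfl⟩ (by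
        have cm : ∀ k, K.Cor j (K.κ j k) := fun k => ⟨k, rfl⟩
        rintro u v w hu huv
        have huv := huv.e12
        rcases hu with rfl | ⟨k, rfl⟩
        · exact Or.inr (nbr_done hF huv)
        · rcases fin4_cases m k with rfl | rfl | rfl | rfl
          · rcases Tri.link4 t1.cyc t4.cyc2 hy.cyc hx huv with rfl | rfl | rfl | rfl
            exacts [Or.inr (cm _), Or.inl rfl, Or.inr (cm _), Or.inr (cm _)]
          · rcases Tri.link3 t1.cyc2 hx.cyc2 t2.cyc huv with rfl | rfl | rfl
            exacts [Or.inl rfl, Or.inr (cm _), Or.inr (cm _)]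
          · rcases Tri.link4 t2.cyc2 hx.cyc hy t3.cyc huv with rfl | rfl | rfl | rfl
            exacts [Or.inl rfl, Or.inr (cm _), Or.inr (cm _), Or.inr (cm _)]
          · rcases Tri.link3 t4.cyc t3.cyc2 hy.cyc2 huv with rfl | rfl | rfl
            exacts [Or.inr (cm _), Or.inl rfl, Or.inr (cm _)]) K.D1
      rcases hcl with e | ⟨_, e⟩
      · exact K.XD1 _ e.symm
      · exact K.κD1 _ _ e.symm
    · have n1 : K.X j ≠ K.κ i m := K.Xκ _ _ _
      have n2 : K.X j ≠ K.κ i (m + 2) := K.Xκ _ _ _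
      have n3 : K.X j ≠ K.X i := fun e => hji (K.Xinj _ _ e)
      have e1 : T.E (K.X j) (K.κ j k) := (h.arc j k).e
      have e2 : T.E (K.X j) (K.κ j (k + 2)) := (h.arc j _).e
      rcases hjk with ⟨rfl, rfl⟩ | ⟨rfl, rfl⟩
      · exact sp.2.2 _ n1 n2 n3 e1.symm e2.symm
      · exact sp.2.2 _ n1 n2 n3 e2.symm e1.symm
  refine ⟨T.flip hx hy sp.2.1 sp.1, h.flip hx hy sp.2.1 sp.1 ?_ ?_ ?_ ?_ ⟨K.κD1 _ _, K.κD2 _ _, K.κD3 _ _⟩, ?_⟩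
  · intro j hj; exact (K.Xκ _ _ _ hj).elim
  · intro j hj; exact (K.Xκ _ _ _ hj).elim
  · intro j _
    exact ⟨hdone j x hx.e31.symm hxX, hdone j y hy.e23 hyX⟩
  · intro u v huv
    rw [Tri.flip_E]
    refine Or.inl ⟨h.need u v huv, ?_, ?_⟩
    · rintro ⟨rfl, rfl⟩; exact hPd1 huv
    · rintro ⟨rfl, rfl⟩; exact hPd' huv
  · apply Set.ncard_lt_ncard _ (Set.toFinite _)
    rw [Set.ssubset_iff_of_subset]
    · refine ⟨(i, m), ⟨x, hx⟩, ?_⟩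
      simp only [Set.mem_ofPred_eq]
      rw [Tri.flip_E]
      rintro (h | h | h)
      · exact h.2.1 ⟨rfl, rfl⟩
      · exact hx.n31 h.1.symm
      · exact hy.n23 h.1
    · rintro ⟨j, k⟩ hjk
      simp only [Set.mem_ofPred_eq, Tri.flip_E] at hjk ⊢
      rcases hjk with h | h | h
      · exact h.1
      · exact (key j k (Or.inl h)).elim
      · exact (key j k (Or.inr h)).elim

theorem normalize [Finite ι] {P : W → W → Prop}
    (hPX : ∀ u v i, P u v → u ≠ K.X i ∧ v ≠ K.X i)
    (hPd : ∀ i m, ¬ P (K.κ i m) (K.κ i (m + 2))) {T : Tri W} (h : K.Inv P T ∅) :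
    ∃ T' : Tri W, (∀ i m, T'.F (K.X i) (K.κ i m) (K.κ i (m + 1))) ∧
      (∀ i m, ¬ T'.E (K.κ i m) (K.κ i (m + 2))) ∧ (∀ u v, P u v → T'.E u v) ∧
      T'.F K.D2 K.D1 K.D3 := by
  obtain ⟨T1, h1⟩ := h.stage1 hPX
  have : ∀ (n : ℕ) (T : Tri W), K.Inv P T Set.univ → nd K T = n → ∃ T', K.Inv P T' Set.univ ∧
      (∀ i m, ¬ T'.E (K.κ i m) (K.κ i (m + 2))) := by
    intro n
    induction n using Nat.strong_induction_on with
    | _ n ih =>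
      intro T hT hn
      by_cases hall : ∀ i m, ¬ T.E (K.κ i m) (K.κ i (m + 2))
      · exact ⟨T, hT, hall⟩
      · push Not at hall
        obtain ⟨i, m, hm⟩ := hall
        obtain ⟨T', hT', hlt⟩ := hT.step2 hPd hm
        exact ih _ (hn ▸ hlt) T' hT' rfl
  obtain ⟨T', hT', hd⟩ := this _ T1 h1 rfl
  exact ⟨T', fun i m => hT'.done i (Set.mem_univ _) m, hd, hT'.need, hT'.outer⟩

end Kites

/-- consecutive elements of a list -/
def Nx {W : Type} : List W → W → W → Prop
  | [], _, _ => False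
  | [_], _, _ => False
  | x :: y :: l, c, d => (c = x ∧ d = y) ∨ Nx (y :: l) c d

theorem Nx.mem {W : Type} : ∀ {l : List W} {c d : W}, Nx l c d → c ∈ l ∧ d ∈ l
  | [], _, _, h => h.elim
  | [_], _, _, h => h.elim
  | x :: y :: l, c, d, h => by
    rcases h with ⟨rfl, rfl⟩ | h
    · simp
    · have := Nx.mem h
      exact ⟨List.mem_cons_of_mem _ this.1, List.mem_cons_of_mem _ this.2⟩

theorem nx_append {W : Type} (x : W) (l2 : List W) (c d : W) : ∀ (l1 : List W),
    (Nx (l1 ++ x :: l2) c d ↔ Nx (l1 ++ [x]) c d ∨ Nx (x :: l2) c d)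
  | [] => by simp [Nx]
  | [y] => by simp [Nx]
  | y :: z :: l => by
    have := nx_append x l2 c d (z :: l)
    simp only [List.cons_append, Nx] at *
    rw [this]; tauto

theorem nx_cons {W : Type} {l : List W} {a c d : W} (h : Nx l c d) : Nx (a :: l) c d := by
  cases l with
  | nil => exact h.elim
  | cons b l => exact Or.inr h

theorem nx_pairwise {W : Type} {R : W → W → Prop} (hR : ∀ a b c, R a b → R b c → R a c) :
    ∀ {l : List W}, (∀ c d, Nx l c d → R c d) → l.Pairwise R
  | [], _ => List.Pairwise.nil
  | [x], _ => by simp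
  | x :: y :: l, h => by
    have ih := nx_pairwise hR (l := y :: l) (fun c d hcd => h c d (Or.inr hcd))
    rw [List.pairwise_cons]
    refine ⟨?_, ih⟩
    intro w hw
    have hxy := h x y (Or.inl ⟨rfl, rfl⟩)
    rcases List.mem_cons.1 hw with rfl | hw
    · exact hxy
    · exact hR _ _ _ hxy ((List.pairwise_cons.1 ih).1 w hw)

/-- orientation determinant -/
def ori (p q r : ℝ × ℝ) : ℝ := (q.1 - p.1) * (r.2 - p.2) - (q.2 - p.2) * (r.1 - p.1)

/-- open segment -/
def Sg (p q x : ℝ × ℝ) : Prop :=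
  ∃ t : ℝ, 0 < t ∧ t < 1 ∧ x.1 = p.1 + t * (q.1 - p.1) ∧ x.2 = p.2 + t * (q.2 - p.2)

theorem Sg.symm {p q x : ℝ × ℝ} (h : Sg p q x) : Sg q p x := by
  obtain ⟨t, h0, h1, hx, hy⟩ := h
  exact ⟨1 - t, by linarith, by linarith, by rw [hx]; ring, by rw [hy]; ring⟩

/-- open triangle -/
def It (l o r x : ℝ × ℝ) : Prop :=
  ∃ α β γ : ℝ, 0 < α ∧ 0 < β ∧ 0 < γ ∧ α + β + γ = 1 ∧
    x.1 = α * l.1 + β * o.1 + γ * r.1 ∧ x.2 = α * l.2 + β * o.2 + γ * r.2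

theorem lc_le {α β γ x y z M : ℝ} (hα : 0 < α) (hβ : 0 < β) (hγ : 0 < γ) (hs : α + β + γ = 1)
    (hx : x ≤ M) (hy : y ≤ M) (hz : z ≤ M) : α * x + β * y + γ * z ≤ M := by
  have e : M = α * M + β * M + γ * M := by rw [← add_mul, ← add_mul, hs, one_mul]
  rw [e]; gcongr

theorem le_lc {α β γ x y z M : ℝ} (hα : 0 < α) (hβ : 0 < β) (hγ : 0 < γ) (hs : α + β + γ = 1)
    (hx : M ≤ x) (hy : M ≤ y) (hz : M ≤ z) : M ≤ α * x + β * y + γ * z := by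
  have e : M = α * M + β * M + γ * M := by rw [← add_mul, ← add_mul, hs, one_mul]
  rw [e]; gcongr

theorem lt_lc {α β γ x y z M : ℝ} (hα : 0 < α) (hβ : 0 < β) (hγ : 0 < γ) (hs : α + β + γ = 1)
    (hx : M ≤ x) (hy : M ≤ y) (hz : M ≤ z) (h : M < x ∨ M < y ∨ M < z) :
    M < α * x + β * y + γ * z := by
  have e : M = α * M + β * M + γ * M := by rw [← add_mul, ← add_mul, hs, one_mul]
  have h1 := mul_le_mul_of_nonneg_left hx hα.le
  have h2 := mul_le_mul_of_nonneg_left hy hβ.le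
  have h3 := mul_le_mul_of_nonneg_left hz hγ.le
  rcases h with h | h | h
  · have := mul_lt_mul_of_pos_left h hα; linarith
  · have := mul_lt_mul_of_pos_left h hβ; linarith
  · have := mul_lt_mul_of_pos_left h hγ; linarith

theorem lc_lt {α β γ x y z M : ℝ} (hα : 0 < α) (hβ : 0 < β) (hγ : 0 < γ) (hs : α + β + γ = 1)
    (hx : x ≤ M) (hy : y ≤ M) (hz : z ≤ M) (h : x < M ∨ y < M ∨ z < M) :
    α * x + β * y + γ * z < M := by
  have := lt_lc hα hβ hγ hs (neg_le_neg hx) (neg_le_neg hy) (neg_le_neg hz) (by simpa using h)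
  linarith

section geo
variable {W : Type}

/-- the region above the contour -/
def Up (ρ : W → ℝ × ℝ) (C : List W) (p : ℝ × ℝ) : Prop :=
  ∃ a b, Nx C a b ∧ (ρ a).1 ≤ p.1 ∧ p.1 ≤ (ρ b).1 ∧ 0 < ori (ρ a) (ρ b) p

def SameE (u v u' v' : W) : Prop := (u = u' ∧ v = v') ∨ (u = v' ∧ v = u')

structure Good (ρ : W → ℝ × ℝ) (S : Set W) (C : List W) (A : W → W → Prop)
    (CR : W → W → W → W → Prop) : Prop where
  inj : ∀ u ∈ S, ∀ v ∈ S, ρ u = ρ v → u = v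
  sub : ∀ u v, A u v → u ∈ S ∧ v ∈ S ∧ u ≠ v
  CS : ∀ c ∈ C, c ∈ S
  xs : ∀ c d, Nx C c d → (ρ c).1 < (ρ d).1
  ss : ∀ c d, Nx C c d → (ρ c).2 ≤ (ρ d).2
  vU : ∀ u ∈ S, ¬ Up ρ C (ρ u)
  eU : ∀ u v, A u v → ∀ p, Sg (ρ u) (ρ v) p → ¬ Up ρ C p
  ev : ∀ u v, A u v → ∀ w ∈ S, ¬ Sg (ρ u) (ρ v) (ρ w)
  ee : ∀ u v u' v', A u v → A u' v' → ∀ p, Sg (ρ u) (ρ v) p → Sg (ρ u') (ρ v') p →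
    SameE u v u' v' ∨ CR u v u' v'

/-- the open triangle avoids everything -/
def Free (ρ : W → ℝ × ℝ) (S : Set W) (C : List W) (A : W → W → Prop) (l o r : W) : Prop :=
  ∀ p, It (ρ l) (ρ o) (ρ r) p → ¬ Up ρ C p ∧ (∀ w ∈ S, p ≠ ρ w) ∧ ∀ u v, A u v → ¬ Sg (ρ u) (ρ v) p

theorem Up.congr {ρ ρ' : W → ℝ × ℝ} {S : Set W} {C : List W} (hC : ∀ c ∈ C, c ∈ S)
    (h : ∀ w ∈ S, ρ' w = ρ w) (p : ℝ × ℝ) : Up ρ' C p ↔ Up ρ C p := by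
  constructor
  · rintro ⟨a, b, hn, h1⟩
    rw [h a (hC _ hn.mem.1), h b (hC _ hn.mem.2)] at h1
    exact ⟨a, b, hn, h1⟩
  · rintro ⟨a, b, hn, h1⟩
    rw [← h a (hC _ hn.mem.1), ← h b (hC _ hn.mem.2)] at h1
    exact ⟨a, b, hn, h1⟩

theorem Good.congr {ρ ρ' : W → ℝ × ℝ} {S : Set W} {C : List W} {A : W → W → Prop}
    {CR : W → W → W → W → Prop} (g : Good ρ S C A CR)
    (h : ∀ w ∈ S, ρ' w = ρ w) : Good ρ' S C A CR where
  inj := by intro u hu v hv; rw [h u hu, h v hv]; exact g.inj u hu v hv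
  sub := g.sub
  CS := g.CS
  xs := by
    intro c d hn; rw [h c (g.CS _ hn.mem.1), h d (g.CS _ hn.mem.2)]; exact g.xs c d hn
  ss := by
    intro c d hn; rw [h c (g.CS _ hn.mem.1), h d (g.CS _ hn.mem.2)]; exact g.ss c d hn
  vU := by intro u hu; rw [Up.congr g.CS h, h u hu]; exact g.vU u hu
  eU := by
    intro u v ha; rw [h u (g.sub _ _ ha).1, h v (g.sub _ _ ha).2.1]
    intro p; rw [Up.congr g.CS h]; exact g.eU u v ha p
  ev := by
    intro u v ha w hw; rw [h u (g.sub _ _ ha).1, h v (g.sub _ _ ha).2.1, h w hw]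
    exact g.ev u v ha w hw
  ee := by
    intro u v u' v' ha ha'
    rw [h u (g.sub _ _ ha).1, h v (g.sub _ _ ha).2.1, h u' (g.sub _ _ ha').1, h v' (g.sub _ _ ha').2.1]
    exact g.ee u v u' v' ha ha'

theorem Free.congr {ρ ρ' : W → ℝ × ℝ} {S : Set W} {C : List W} {A : W → W → Prop}
    {CR : W → W → W → W → Prop} (g : Good ρ S C A CR)
    (h : ∀ w ∈ S, ρ' w = ρ w) {l o r : W} (hl : l ∈ S) (ho : o ∈ S) (hr : r ∈ S)
    (hf : Free ρ S C A l o r) : Free ρ' S C A l o r := by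
  intro p hp
  rw [h l hl, h o ho, h r hr] at hp
  obtain ⟨h1, h2, h3⟩ := hf p hp
  rw [Up.congr g.CS h]
  refine ⟨h1, fun w hw => by rw [h w hw]; exact h2 w hw, ?_⟩
  intro u v ha
  rw [h u (g.sub _ _ ha).1, h v (g.sub _ _ ha).2.1]
  exact h3 u v ha

theorem Good.mono {ρ : W → ℝ × ℝ} {S : Set W} {C : List W} {A A' : W → W → Prop}
    {CR : W → W → W → W → Prop} (g : Good ρ S C A CR) (h : ∀ u v, A' u v → A u v) :
    Good ρ S C A' CR where
  inj := g.inj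
  sub := fun u v ha => g.sub u v (h _ _ ha)
  CS := g.CS
  xs := g.xs
  ss := g.ss
  vU := g.vU
  eU := fun u v ha => g.eU u v (h _ _ ha)
  ev := fun u v ha => g.ev u v (h _ _ ha)
  ee := fun u v u' v' ha ha' => g.ee u v u' v' (h _ _ ha) (h _ _ ha')

theorem up_of_gt (ρ : W → ℝ × ℝ) (p : ℝ × ℝ) (v : W) : ∀ (L : List W) (a : W), L ≠ [] →
    (∀ c d, Nx (a :: L) c d → (ρ c).1 < (ρ d).1) → (∀ c d, Nx (a :: L) c d → (ρ c).2 ≤ (ρ d).2) →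
    (ρ a).1 ≤ p.1 → v ∈ a :: L → p.1 ≤ (ρ v).1 → (ρ v).2 < p.2 → Up ρ (a :: L) p
  | [], _, h, _, _, _, _, _, _ => (h rfl).elim
  | d :: L, a, _, hx, hs, ha, hv, hpv, hsv => by
    have hxad := hx a d (Or.inl ⟨rfl, rfl⟩)
    have hsad := hs a d (Or.inl ⟨rfl, rfl⟩)
    by_cases hpd : p.1 ≤ (ρ d).1
    · refine ⟨a, d, Or.inl ⟨rfl, rfl⟩, ha, hpd, ?_⟩
      rcases List.mem_cons.1 hv with rfl | hv'
      · have e : p.1 = (ρ v).1 := le_antisymm hpv ha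
        unfold ori
        rw [e]
        have : 0 < ((ρ d).1 - (ρ v).1) * (p.2 - (ρ v).2) := mul_pos (by linarith) (by linarith)
        linarith
      · have hdv : (ρ d).2 ≤ (ρ v).2 := by
          rcases List.mem_cons.1 hv' with rfl | hv''
          · exact le_rfl
          · have := nx_pairwise (R := fun c d => (ρ c).2 ≤ (ρ d).2) (fun a b c => le_trans) hs
            rw [List.pairwise_cons] at this
            exact (List.pairwise_cons.1 this.2).1 v hv''
        unfold ori
        nlinarith
    · push Not at hpd
      have hva : v ∈ d :: L := by
        rcases List.mem_cons.1 hv with rfl | hv'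
        · linarith
        · exact hv'
      have hL : L ≠ [] := by
        rintro rfl
        simp at hva
        subst hva; linarith
      obtain ⟨c, e, hn, h⟩ := up_of_gt ρ p v L d hL (fun c e h => hx c e (Or.inr h))
        (fun c e h => hs c e (Or.inr h)) hpd.le hva hpv hsv
      exact ⟨c, e, Or.inr hn, h⟩

/-- hypotheses for placing a new vertex `z` above the contour part `a :: mid ++ [b]` -/
structure Birth (ρ : W → ℝ × ℝ) (a b z : W) (mid : List W) : Prop where
  xaz : (ρ a).1 < (ρ z).1
  xzb : (ρ z).1 < (ρ b).1
  szb : (ρ z).2 ≤ (ρ b).2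
  sa : (ρ a).2 ≤ (ρ z).2
  abz : mid = [] → 0 < ori (ρ a) (ρ b) (ρ z)
  xm : ∀ v ∈ mid, (ρ z).1 ≤ (ρ v).1
  sm : ∀ v ∈ mid, (ρ v).2 < (ρ z).2
  xs : ∀ c d, Nx (a :: (mid ++ [b])) c d → (ρ c).1 < (ρ d).1
  ss : ∀ c d, Nx (a :: (mid ++ [b])) c d → (ρ c).2 ≤ (ρ d).2

namespace Birth
variable {ρ : W → ℝ × ℝ} {a b z : W} {mid : List W} (B : Birth ρ a b z mid)
include B

theorem pw_s : (a :: (mid ++ [b])).Pairwise (fun c d => (ρ c).2 ≤ (ρ d).2) :=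
  nx_pairwise (R := fun c d => (ρ c).2 ≤ (ρ d).2) (fun _ _ _ => le_trans) B.ss

theorem pw_x : (a :: (mid ++ [b])).Pairwise (fun c d => (ρ c).1 < (ρ d).1) :=
  nx_pairwise (R := fun c d => (ρ c).1 < (ρ d).1) (fun _ _ _ => lt_trans) B.xs

theorem mem_m {v : W} (hv : v ∈ mid) : (ρ a).2 ≤ (ρ v).2 ∧ (ρ v).2 ≤ (ρ b).2 ∧
    (ρ a).1 < (ρ v).1 ∧ (ρ v).1 < (ρ b).1 := by
  have h1 := B.pw_s
  have h2 := B.pw_x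
  rw [List.pairwise_cons, List.pairwise_append] at h1 h2
  exact ⟨h1.1 v (by simp [hv]), h1.2.2.2 v hv b (by simp), h2.1 v (by simp [hv]), h2.2.2.2 v hv b (by simp)⟩

theorem auz {u : W} (hu : u ∈ mid) : 0 < ori (ρ a) (ρ u) (ρ z) := by
  have h := B.mem_m hu
  have h1 := B.xm u hu
  have h2 := B.sm u hu
  have h3 := B.xaz
  unfold ori
  nlinarith

/-- points weakly above the new contour lie in the old region -/
theorem up_l {p : ℝ × ℝ} (h1 : (ρ a).1 ≤ p.1) (h2 : p.1 ≤ (ρ z).1) (h3 : 0 ≤ ori (ρ a) (ρ z) p)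
    (h4 : (ρ a).1 < p.1 ∨ 0 < ori (ρ a) (ρ z) p) : Up ρ (a :: (mid ++ [b])) p := by
  have key : ∀ c, Nx (a :: (mid ++ [b])) a c → (c ∈ mid ∨ (c = b ∧ mid = [])) → Up ρ (a :: (mid ++ [b])) p := by
    intro c hn hc
    have hxz : (ρ z).1 ≤ (ρ c).1 := by
      rcases hc with hc | ⟨rfl, -⟩
      · exact B.xm c hc
      · exact B.xzb.le
    have ho : 0 < ori (ρ a) (ρ c) (ρ z) := by
      rcases hc with hc | ⟨rfl, hm⟩
      · exact B.auz hc
      · exact B.abz hm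
    refine ⟨a, c, hn, h1, h2.trans hxz, ?_⟩
    have haz := B.xaz
    have id : ((ρ z).1 - (ρ a).1) * ori (ρ a) (ρ c) p =
      ((ρ c).1 - (ρ a).1) * ori (ρ a) (ρ z) p + (p.1 - (ρ a).1) * ori (ρ a) (ρ c) (ρ z) := by
      unfold ori; ring
    have : 0 < ((ρ z).1 - (ρ a).1) * ori (ρ a) (ρ c) p := by
      rw [id]
      rcases h4 with h4 | h4
      · exact add_pos_of_nonneg_of_pos (mul_nonneg (by linarith) h3) (mul_pos (by linarith) ho)
      · exact add_pos_of_pos_of_nonneg (mul_pos (by linarith) h4) (mul_nonneg (by linarith) ho.le)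
    exact pos_of_mul_pos_right this (by linarith)
  cases hm : mid with
  | nil => subst hm; exact key b (Or.inl ⟨rfl, rfl⟩) (Or.inr ⟨rfl, rfl⟩)
  | cons m l =>
    rw [← hm]
    exact key m (by rw [hm]; exact Or.inl ⟨rfl, rfl⟩) (Or.inl (by simp [hm]))

theorem up_r {p : ℝ × ℝ} (h1 : (ρ z).1 ≤ p.1) (h2 : p.1 ≤ (ρ b).1) (h3 : 0 ≤ ori (ρ z) (ρ b) p)
    (h4 : p.1 < (ρ b).1 ∨ 0 < ori (ρ z) (ρ b) p) : Up ρ (a :: (mid ++ [b])) p := by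
  have haz := B.xaz
  have hzb := B.xzb
  have key : ∀ d, Nx (a :: (mid ++ [b])) d b → (ρ d).1 ≤ p.1 → (ρ d).1 < (ρ b).1 →
      0 < ori (ρ d) (ρ b) (ρ z) → Up ρ (a :: (mid ++ [b])) p := by
    intro d hn hd hdb ho
    refine ⟨d, b, hn, hd, h2, ?_⟩
    have id : ((ρ b).1 - (ρ z).1) * ori (ρ d) (ρ b) p =
      ((ρ b).1 - (ρ d).1) * ori (ρ z) (ρ b) p + ((ρ b).1 - p.1) * ori (ρ d) (ρ b) (ρ z) := by
      unfold ori; ring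
    have : 0 < ((ρ b).1 - (ρ z).1) * ori (ρ d) (ρ b) p := by
      rw [id]
      rcases h4 with h4 | h4
      · exact add_pos_of_nonneg_of_pos (mul_nonneg (by linarith) h3) (mul_pos (by linarith) ho)
      · exact add_pos_of_pos_of_nonneg (mul_pos (by linarith) h4) (mul_nonneg (by linarith) ho.le)
    exact pos_of_mul_pos_right this (by linarith)
  rcases List.eq_nil_or_concat mid with hm | ⟨l, d, hm⟩
  · subst hm
    exact key a (Or.inl ⟨rfl, rfl⟩) (by linarith) (by linarith) (B.abz rfl)
  · rw [List.concat_eq_append] at hm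
    have hd : d ∈ mid := by simp [hm]
    have h := B.mem_m hd
    have hx := B.xm d hd
    have hs := B.sm d hd
    by_cases hp : p.1 ≤ (ρ d).1
    · refine up_of_gt ρ p d _ _ (by simp) B.xs B.ss (by linarith) (by simp [hd]) hp ?_
      have hszb := B.szb
      unfold ori at h3
      nlinarith
    · push Not at hp
      refine key d ?_ hp.le h.2.2.2 ?_
      · rw [hm, show a :: (l ++ [d] ++ [b]) = (a :: l) ++ d :: [b] by simp, nx_append]
        right; exact Or.inl ⟨rfl, rfl⟩
      · unfold ori; nlinarith

theorem up_z : Up ρ (a :: (mid ++ [b])) (ρ z) :=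
  B.up_l B.xaz.le le_rfl (by unfold ori; nlinarith) (Or.inl B.xaz)

theorem up_seg {v : W} (hv : v ∈ a :: (mid ++ [b])) {p : ℝ × ℝ} (hp : Sg (ρ z) (ρ v) p) :
    Up ρ (a :: (mid ++ [b])) p := by
  obtain ⟨t, t0, t1, hx, hy⟩ := hp
  have haz := B.xaz
  have hzb := B.xzb
  simp only [List.mem_cons, List.mem_append, List.not_mem_nil, or_false] at hv
  rcases hv with rfl | hv | rfl
  · have : (ρ v).1 < p.1 := by rw [hx]; nlinarith
    refine B.up_l this.le (by rw [hx]; nlinarith) ?_ (Or.inl this)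
    unfold ori; rw [hx, hy]; nlinarith
  · have h1 := B.xm v hv
    have h2 := B.sm v hv
    refine up_of_gt ρ p v _ _ (by simp) B.xs B.ss ?_ (by simp [hv]) ?_ ?_
    · rw [hx]; nlinarith
    · rw [hx]; nlinarith
    · rw [hy]; nlinarith
  · have : p.1 < (ρ v).1 := by rw [hx]; nlinarith
    refine B.up_r (by rw [hx]; nlinarith) this.le ?_ (Or.inl this)
    unfold ori; rw [hx, hy]; nlinarith

theorem nx_cases {u u' : W} (hn : Nx (a :: (mid ++ [b])) u u') :
    (u = a ∨ u ∈ mid) ∧ (u' ∈ mid ∨ u' = b) := by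
  have hx := B.xs u u' hn
  have hm := hn.mem
  simp only [List.mem_cons, List.mem_append, List.not_mem_nil, or_false] at hm
  have hab := B.xaz.trans B.xzb
  constructor
  · rcases hm.1 with h | h | rfl
    · exact Or.inl h
    · exact Or.inr h
    · exfalso
      rcases hm.2 with rfl | h | rfl
      · linarith
      · have := B.mem_m h; linarith
      · linarith
  · rcases hm.2 with rfl | h | h
    · exfalso
      rcases hm.1 with rfl | h | rfl
      · linarith
      · have := B.mem_m h; linarith
      · linarith
    · exact Or.inl h
    · exact Or.inr h

theorem nx_ab (hn : Nx (a :: (mid ++ [b])) a b) : mid = [] := by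
  cases hm : mid with
  | nil => rfl
  | cons m l =>
    exfalso
    have hM := B.mem_m (v := m) (by simp [hm])
    have pw := B.pw_x
    rw [hm] at hn pw
    rcases hn with ⟨-, h⟩ | h
    · rw [h] at hM; linarith
    · rw [List.pairwise_cons] at pw
      exact lt_irrefl _ (pw.1 a h.mem.1)

theorem ori_pair {u u' : W} (hn : Nx (a :: (mid ++ [b])) u u') : 0 < ori (ρ u) (ρ u') (ρ z) := by
  have hx := B.xs u u' hn
  have hs := B.ss u u' hn
  obtain ⟨h1, h2⟩ := B.nx_cases hn
  rcases h1 with rfl | h1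
  · rcases h2 with h2 | rfl
    · exact B.auz h2
    · exact B.abz (B.nx_ab hn)
  · have e1 := B.xm u h1
    have e2 := B.sm u h1
    unfold ori; nlinarith

theorem up_tri {u u' : W} (hn : Nx (a :: (mid ++ [b])) u u') {p : ℝ × ℝ}
    (hp : It (ρ z) (ρ u) (ρ u') p) : Up ρ (a :: (mid ++ [b])) p := by
  obtain ⟨α, β, γ, hα, hβ, hγ, hs, hx, hy⟩ := hp
  have hxu := B.xs u u' hn
  have hsu := B.ss u u' hn
  have ho := B.ori_pair hn
  obtain ⟨h1, h2⟩ := B.nx_cases hn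
  have haz := B.xaz
  have hzu' : (ρ z).1 ≤ (ρ u').1 := by
    rcases h2 with h2 | rfl
    · exact B.xm u' h2
    · exact B.xzb.le
  have hα' : α = 1 - β - γ := by linarith
  have hop : ori (ρ u) (ρ u') p = α * ori (ρ u) (ρ u') (ρ z) := by
    unfold ori; rw [hx, hy, hα']; ring
  have hop' : 0 < ori (ρ u) (ρ u') p := by rw [hop]; exact mul_pos hα ho
  have hpu' : p.1 ≤ (ρ u').1 := by
    rw [hx]; exact lc_le hα hβ hγ hs hzu' hxu.le le_rfl
  rcases h1 with rfl | h1
  · exact ⟨u, u', hn, by rw [hx]; exact le_lc hα hβ hγ hs haz.le le_rfl hxu.le, hpu', hop'⟩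
  · have e1 := B.xm u h1
    have e2 := B.sm u h1
    by_cases hp : p.1 ≤ (ρ u).1
    · refine up_of_gt ρ p u _ _ (by simp) B.xs B.ss ?_ (by simp [h1]) hp ?_
      · have := B.mem_m h1
        rw [hx]; exact le_lc hα hβ hγ hs haz.le this.2.2.1.le (by linarith)
      · rw [hy]; exact lt_lc hα hβ hγ hs e2.le le_rfl hsu (Or.inl e2)
    · push Not at hp
      exact ⟨u, u', hn, hp.le, hpu', hop'⟩

theorem below_m {v : W} (hv : v ∈ mid) :
    ori (ρ a) (ρ z) (ρ v) ≤ 0 ∧ ori (ρ z) (ρ b) (ρ v) ≤ 0 := by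
  obtain ⟨xaz, xzb, szb, sa, -, xm, sm, -, -⟩ := B
  have h1 := xm v hv
  have h2 := sm v hv
  constructor
  · unfold ori; nlinarith
  · unfold ori; nlinarith

end Birth
end geo

theorem It.of_ori {l o r p : ℝ × ℝ} (h1 : 0 < ori l o p) (h2 : 0 < ori o r p) (h3 : 0 < ori r l p) :
    It l o r p := by
  have hD : ori l o p + ori o r p + ori r l p = ori l o r := by unfold ori; ring
  have hpos : 0 < ori l o r := by linarith
  refine ⟨ori o r p / ori l o r, ori r l p / ori l o r, ori l o p / ori l o r, by positivity,
    by positivity, by positivity, by field_simp; linarith, ?_, ?_⟩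
  · field_simp; unfold ori; ring
  · field_simp; unfold ori; ring

theorem It.ori_pos {l o r p : ℝ × ℝ} (h : It l o r p) (hpos : 0 < ori l o r) :
    0 < ori l o p ∧ 0 < ori o r p ∧ 0 < ori r l p := by
  obtain ⟨α, β, γ, hα, hβ, hγ, hs, hx, hy⟩ := h
  have hα' : α = 1 - β - γ := by linarith
  have e1 : ori l o p = γ * ori l o r := by unfold ori; rw [hx, hy, hα']; ring
  have e2 : ori o r p = α * ori l o r := by
    have : β = 1 - α - γ := by linarith
    unfold ori; rw [hx, hy, this]; ring
  have e3 : ori r l p = β * ori l o r := by unfold ori; rw [hx, hy, hα']; ring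
  rw [e1, e2, e3]
  exact ⟨by positivity, by positivity, by positivity⟩

theorem Sg.ori_zero {p q x : ℝ × ℝ} (h : Sg p q x) : ori p q x = 0 := by
  obtain ⟨t, h0, h1, hx, hy⟩ := h
  unfold ori; rw [hx, hy]; ring

theorem Sg.x_between {p q x : ℝ × ℝ} (h : Sg p q x) (hpq : p.1 < q.1) : p.1 < x.1 ∧ x.1 < q.1 := by
  obtain ⟨t, h0, h1, hx, hy⟩ := h
  constructor
  · rw [hx]; nlinarith
  · rw [hx]; nlinarith

theorem sg_ray {z v v' p : ℝ × ℝ} (h : Sg z v p) (h' : Sg z v' p) : v = v' ∨ Sg z v' v ∨ Sg z v v' := by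
  obtain ⟨t, h0, h1, hx, hy⟩ := h
  obtain ⟨s, s0, s1, hx', hy'⟩ := h'
  rcases lt_trichotomy s t with hst | hst | hst
  · right; left
    refine ⟨s / t, by positivity, by rw [div_lt_one h0]; exact hst, ?_, ?_⟩
    · field_simp; linarith
    · field_simp; linarith
  · left; subst hst
    have e1 : s * (v.1 - v'.1) = 0 := by linarith
    have e2 : s * (v.2 - v'.2) = 0 := by linarith
    have e1 := (mul_eq_zero.1 e1).resolve_left s0.ne'
    have e2 := (mul_eq_zero.1 e2).resolve_left s0.ne'
    exact Prod.ext (by linarith) (by linarith)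
  · right; right
    refine ⟨t / s, by positivity, by rw [div_lt_one s0]; exact hst, ?_, ?_⟩
    · field_simp; linarith
    · field_simp; linarith

theorem sg_kite {z l o r p : ℝ × ℝ} (h1 : 0 < ori z l o) (h2 : 0 < ori o r z) (h3 : 0 < ori l o r)
    (h4 : 0 < ori l r z) (hp : Sg z o p) : It z l r p ∨ Sg l r p ∨ It l o r p := by
  obtain ⟨t, t0, t1, hx, hy⟩ := hp
  have s0 : 0 < 1 - t := by linarith
  have a1 : 0 < ori z l p := by
    have : ori z l p = t * ori z l o := by unfold ori; rw [hx, hy]; ring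
    rw [this]; positivity
  have a2 : 0 < ori r z p := by
    have : ori r z p = t * ori o r z := by unfold ori; rw [hx, hy]; ring
    rw [this]; positivity
  have a3 : 0 < ori l o p := by
    have : ori l o p = (1 - t) * ori z l o := by unfold ori; rw [hx, hy]; ring
    rw [this]; positivity
  have a4 : 0 < ori o r p := by
    have : ori o r p = (1 - t) * ori o r z := by unfold ori; rw [hx, hy]; ring
    rw [this]; positivity
  rcases lt_trichotomy 0 (ori l r p) with h | h | h
  · exact Or.inl (It.of_ori a1 h a2)
  · right; left
    have hD : ori z l p + ori l r p + ori r z p = ori l r z := by unfold ori; ring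
    refine ⟨ori z l p / ori l r z, by positivity, by rw [div_lt_one h4]; linarith, ?_, ?_⟩
    · have e : ori l r z * p.1 = ori l r p * z.1 + ori r z p * l.1 + ori z l p * r.1 := by
        unfold ori; ring
      rw [← h] at e hD
      field_simp
      have e2 : ori r z p = ori l r z - ori z l p := by linarith
      rw [e2] at e; linarith
    · have e : ori l r z * p.2 = ori l r p * z.2 + ori r z p * l.2 + ori z l p * r.2 := by
        unfold ori; ring
      rw [← h] at e hD
      field_simp
      have e2 : ori r z p = ori l r z - ori z l p := by linarith
      rw [e2] at e; linarith
  · right; right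
    refine It.of_ori a3 a4 ?_
    have : ori r l p = - ori l r p := by unfold ori; ring
    linarith

section geo2
variable {W : Type} {ρ : W → ℝ × ℝ} {S : Set W} {A : W → W → Prop} {CR : W → W → W → W → Prop}

theorem nx_out : ∀ {C : List W} (hx : ∀ c d, Nx C c d → (ρ c).1 < (ρ d).1)
    {u u' : W} (hn : Nx C u u') {v : W} (hv : v ∈ C), (ρ v).1 ≤ (ρ u).1 ∨ (ρ u').1 ≤ (ρ v).1
  | [], _, _, _, hn, _, _ => hn.elim
  | [_], _, _, _, hn, _, _ => hn.elim
  | x :: y :: l, hx, u, u', hn, v, hv => by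
    have pw := nx_pairwise (R := fun c d => (ρ c).1 < (ρ d).1) (fun _ _ _ => lt_trans) hx
    rw [List.pairwise_cons] at pw
    rcases hn with ⟨rfl, rfl⟩ | hn
    · rcases List.mem_cons.1 hv with rfl | hv
      · exact Or.inl le_rfl
      rcases List.mem_cons.1 hv with rfl | hv
      · exact Or.inr le_rfl
      · exact Or.inr ((List.pairwise_cons.1 pw.2).1 v hv).le
    · rcases List.mem_cons.1 hv with rfl | hv
      · exact Or.inl (pw.1 u hn.mem.1).le
      · exact nx_out (fun c d h => hx c d (Or.inr h)) hn hv

theorem nx_fun {C : List W} (hx : ∀ c d, Nx C c d → (ρ c).1 < (ρ d).1) : ∀ {u u' v : W},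
    Nx C u u' → Nx C u v → u' = v := by
  induction C with
  | nil => intro u u' v h; exact h.elim
  | cons x C ih =>
    cases C with
    | nil => intro u u' v h; exact h.elim
    | cons y l =>
      have pw := nx_pairwise (R := fun c d => (ρ c).1 < (ρ d).1) (fun _ _ _ => lt_trans) hx
      rw [List.pairwise_cons] at pw
      intro u u' v h h'
      rcases h with ⟨rfl, rfl⟩ | h
      · rcases h' with ⟨h1, rfl⟩ | h'
        · rfl
        · exact absurd (pw.1 u h'.mem.1) (lt_irrefl _)
      · rcases h' with ⟨rfl, rfl⟩ | h'
        · exact absurd (pw.1 u h.mem.1) (lt_irrefl _)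
        · exact ih (fun c d h => hx c d (Or.inr h)) h h'

theorem mem_inj {C : List W} (hx : ∀ c d, Nx C c d → (ρ c).1 < (ρ d).1) {u v : W} (hu : u ∈ C)
    (hv : v ∈ C) (h : (ρ u).1 = (ρ v).1) : u = v := by
  induction C with
  | nil => simp at hu
  | cons x C ih =>
    have pw := nx_pairwise (R := fun c d => (ρ c).1 < (ρ d).1) (fun _ _ _ => lt_trans) hx
    rw [List.pairwise_cons] at pw
    rcases List.mem_cons.1 hu with rfl | hu'
    · rcases List.mem_cons.1 hv with rfl | hv'
      · rfl
      · have := pw.1 v hv'; linarith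
    · rcases List.mem_cons.1 hv with rfl | hv'
      · have := pw.1 u hu'; linarith
      · exact ih (fun c d h => hx c d (nx_cons h)) hu' hv'

theorem nx_unique {C : List W} (hx : ∀ c d, Nx C c d → (ρ c).1 < (ρ d).1) {u u' c d : W} {q : ℝ}
    (hn : Nx C u u') (h1 : (ρ u).1 < q) (h2 : q < (ρ u').1) (hn' : Nx C c d)
    (h3 : (ρ c).1 ≤ q) (h4 : q ≤ (ρ d).1) : c = u ∧ d = u' := by
  have a1 := nx_out hx hn hn'.mem.1
  have a2 := nx_out hx hn hn'.mem.2
  have a3 := nx_out hx hn' hn.mem.1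
  have a4 := nx_out hx hn' hn.mem.2
  have e : c = u := mem_inj hx hn'.mem.1 hn.mem.1 (by
    rcases a1 with a1 | a1
    · rcases a3 with a3 | a3
      · linarith
      · linarith
    · linarith)
  subst e
  exact ⟨rfl, nx_fun hx hn' hn⟩

/-- a point in the strip of a consecutive pair, weakly below the segment, is not above the contour -/
theorem not_up_of {C : List W} (hx : ∀ c d, Nx C c d → (ρ c).1 < (ρ d).1) {u u' : W} {q : ℝ × ℝ}
    (hn : Nx C u u') (h1 : (ρ u).1 < q.1) (h2 : q.1 < (ρ u').1) (h3 : ori (ρ u) (ρ u') q ≤ 0) :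
    ¬ Up ρ C q := by
  rintro ⟨c, d, hn', h4, h5, h6⟩
  obtain ⟨rfl, rfl⟩ := nx_unique hx hn h1 h2 hn' h4 h5
  linarith

/-- adding edges -/
def Aplus (A : W → W → Prop) (z : W) (L : List W) (u v : W) : Prop :=
  A u v ∨ (u = z ∧ v ∈ L) ∨ (v = z ∧ u ∈ L)

theorem nx_old {α β mid : List W} {a b c d : W} : Nx (α ++ a :: (mid ++ b :: β)) c d ↔
    Nx (α ++ [a]) c d ∨ Nx (a :: (mid ++ [b])) c d ∨ Nx (b :: β) c d := by
  rw [nx_append, show a :: (mid ++ b :: β) = (a :: mid) ++ b :: β by simp, nx_append b β c d (a :: mid)]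
  simp

theorem nx_new {α β : List W} {a b z c d : W} : Nx (α ++ a :: z :: b :: β) c d ↔
    Nx (α ++ [a]) c d ∨ (c = a ∧ d = z) ∨ (c = z ∧ d = b) ∨ Nx (b :: β) c d := by
  rw [nx_append]; simp only [Nx]

section birth
variable {α β mid : List W} {a b z : W} (g : Good ρ S (α ++ a :: (mid ++ b :: β)) A CR)
  (hz : z ∉ S) (B : Birth ρ a b z mid)
include g B

theorem up_old {p : ℝ × ℝ} (h : Up ρ (a :: (mid ++ [b])) p) : Up ρ (α ++ a :: (mid ++ b :: β)) p := by
  obtain ⟨c, d, hn, h⟩ := h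
  exact ⟨c, d, nx_old.2 (Or.inr (Or.inl hn)), h⟩

theorem up_new {p : ℝ × ℝ} (h : Up ρ (α ++ a :: z :: b :: β) p) : Up ρ (α ++ a :: (mid ++ b :: β)) p := by
  obtain ⟨c, d, hn, h1, h2, h3⟩ := h
  rcases nx_new.1 hn with hn | ⟨rfl, rfl⟩ | ⟨rfl, rfl⟩ | hn
  · exact ⟨c, d, nx_old.2 (Or.inl hn), h1, h2, h3⟩
  · exact up_old g B (B.up_l h1 h2 h3.le (Or.inr h3))
  · exact up_old g B (B.up_r h1 h2 h3.le (Or.inr h3))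
  · exact ⟨c, d, nx_old.2 (Or.inr (Or.inr hn)), h1, h2, h3⟩

theorem new_xs : ∀ c d, Nx (α ++ a :: z :: b :: β) c d → (ρ c).1 < (ρ d).1 := by
  intro c d hn
  rcases nx_new.1 hn with hn | ⟨rfl, rfl⟩ | ⟨rfl, rfl⟩ | hn
  · exact g.xs _ _ (nx_old.2 (Or.inl hn))
  · exact B.xaz
  · exact B.xzb
  · exact g.xs _ _ (nx_old.2 (Or.inr (Or.inr hn)))

theorem avoid {p : ℝ × ℝ} (h1 : (ρ a).1 < p.1) (h2 : p.1 < (ρ b).1)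
    (h3 : p.1 < (ρ z).1 → ori (ρ a) (ρ z) p ≤ 0) (h30 : p.1 = (ρ z).1 → p.2 ≤ (ρ z).2)
    (h4 : (ρ z).1 < p.1 → ori (ρ z) (ρ b) p ≤ 0) : ¬ Up ρ (α ++ a :: z :: b :: β) p := by
  rintro ⟨c, d, hn, h5, h6, h7⟩
  have hx := new_xs g B
  rcases lt_trichotomy p.1 (ρ z).1 with h | h | h
  · obtain ⟨rfl, rfl⟩ := nx_unique hx (nx_new.2 (Or.inr (Or.inl ⟨rfl, rfl⟩))) h1 h hn h5 h6
    linarith [h3 h]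
  · have pz : p.2 ≤ (ρ z).2 := h30 h
    rcases nx_new.1 hn with hn | ⟨rfl, rfl⟩ | ⟨rfl, rfl⟩ | hn
    · have hm : d ∈ α ++ [a] := hn.mem.2
      have hn' : Nx (α ++ a :: z :: b :: β) a z := nx_new.2 (Or.inr (Or.inl ⟨rfl, rfl⟩))
      have pw := nx_pairwise (R := fun c d => (ρ c).1 < (ρ d).1) (fun _ _ _ => lt_trans) hx
      rw [show α ++ a :: z :: b :: β = (α ++ [a]) ++ z :: b :: β by simp, List.pairwise_append] at pw
      have := pw.2.2 d hm z (by simp)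
      linarith
    · have := B.xaz
      unfold ori at h7; rw [h] at h7; nlinarith
    · unfold ori at h7; rw [h] at h7; nlinarith
    · have pw := nx_pairwise (R := fun c d => (ρ c).1 < (ρ d).1) (fun _ _ _ => lt_trans) hx
      rw [show α ++ a :: z :: b :: β = (α ++ [a, z]) ++ b :: β by simp, List.pairwise_append] at pw
      have := pw.2.2 z (by simp) c hn.mem.1
      linarith
  · obtain ⟨rfl, rfl⟩ := nx_unique hx (nx_new.2 (Or.inr (Or.inr (Or.inl ⟨rfl, rfl⟩)))) h h2 hn h5 h6
    linarith [h4 h]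

theorem fan_x {v : W} (hv : v ∈ a :: (mid ++ [b])) : (ρ a).1 ≤ (ρ v).1 ∧ (ρ v).1 ≤ (ρ b).1 := by
  have hab := B.xaz.trans B.xzb
  simp only [List.mem_cons, List.mem_append, List.not_mem_nil, or_false] at hv
  rcases hv with rfl | hv | rfl
  · exact ⟨le_rfl, hab.le⟩
  · have := B.mem_m hv; exact ⟨this.2.2.1.le, this.2.2.2.le⟩
  · exact ⟨hab.le, le_rfl⟩

theorem avoid_seg {v : W} (hv : v ∈ a :: (mid ++ [b])) {p : ℝ × ℝ} (hp : Sg (ρ z) (ρ v) p) :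
    ¬ Up ρ (α ++ a :: z :: b :: β) p := by
  have h1 := B.xaz
  have h2 := B.xzb
  have h := fan_x g B hv
  obtain ⟨t, t0, t1, hx, hy⟩ := hp
  have s0 : 0 < 1 - t := by linarith
  have e1 : ori (ρ a) (ρ z) p = t * ori (ρ a) (ρ z) (ρ v) := by unfold ori; rw [hx, hy]; ring
  have e2 : ori (ρ z) (ρ b) p = t * ori (ρ z) (ρ b) (ρ v) := by unfold ori; rw [hx, hy]; ring
  have hpa : (ρ a).1 < p.1 := by rw [hx]; nlinarith
  have hpb : p.1 < (ρ b).1 := by rw [hx]; nlinarith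
  simp only [List.mem_cons, List.mem_append, List.not_mem_nil, or_false] at hv
  rcases hv with rfl | hv | rfl
  · have : p.1 < (ρ z).1 := by rw [hx]; nlinarith
    refine avoid g B hpa hpb (fun _ => ?_) (fun _ => ?_) (fun _ => ?_)
    · rw [e1]; unfold ori; nlinarith
    · linarith
    · linarith
  · have hb := B.below_m hv
    have hs := B.sm v hv
    refine avoid g B hpa hpb (fun _ => ?_) (fun _ => ?_) (fun _ => ?_)
    · rw [e1]; exact mul_nonpos_of_nonneg_of_nonpos t0.le hb.1
    · rw [hy]; nlinarith
    · rw [e2]; exact mul_nonpos_of_nonneg_of_nonpos t0.le hb.2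
  · have : (ρ z).1 < p.1 := by rw [hx]; nlinarith
    refine avoid g B hpa hpb (fun _ => ?_) (fun _ => ?_) (fun _ => ?_)
    · linarith
    · linarith
    · rw [e2]; unfold ori; nlinarith

theorem avoid_tri {u u' : W} (hn : Nx (a :: (mid ++ [b])) u u') {p : ℝ × ℝ}
    (hp : It (ρ z) (ρ u) (ρ u') p) : ¬ Up ρ (α ++ a :: z :: b :: β) p := by
  have h := fan_x g B hn.mem.1
  have h' := fan_x g B hn.mem.2
  have h1 := B.xaz
  have h2 := B.xzb
  have hxu := B.xs u u' hn
  have hD := B.ori_pair hn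
  obtain ⟨hu, hu'⟩ := B.nx_cases hn
  obtain ⟨r, s, t, r0, s0, t0, hs, hx, hy⟩ := hp
  have hr : r = 1 - s - t := by linarith
  have hpa : (ρ a).1 < p.1 := by rw [hx]; exact lt_lc r0 s0 t0 hs h1.le h.1 h'.1 (Or.inl h1)
  have hpb : p.1 < (ρ b).1 := by rw [hx]; exact lc_lt r0 s0 t0 hs h2.le h.2 h'.2 (Or.inl h2)
  have hzu' : ori (ρ z) (ρ u') p < 0 := by
    have : ori (ρ z) (ρ u') p = - (s * ori (ρ u) (ρ u') (ρ z)) := by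
      unfold ori; rw [hx, hy, hr]; ring
    have := mul_pos s0 hD
    linarith
  have hright : (ρ z).1 < p.1 → ori (ρ z) (ρ b) p ≤ 0 := by
    intro hzp
    rcases hu' with hu' | rfl
    · have hb := B.below_m hu'
      have hzu : (ρ z).1 < (ρ u').1 := by
        by_contra hc
        push Not at hc
        have : p.1 ≤ (ρ z).1 := by rw [hx]; exact lc_le r0 s0 t0 hs le_rfl (hxu.le.trans hc) hc
        linarith
      have id : ((ρ u').1 - (ρ z).1) * ori (ρ z) (ρ b) p = ((ρ b).1 - (ρ z).1) * ori (ρ z) (ρ u') p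
        + (p.1 - (ρ z).1) * ori (ρ z) (ρ b) (ρ u') := by unfold ori; ring
      have : ((ρ u').1 - (ρ z).1) * ori (ρ z) (ρ b) p ≤ 0 := by
        rw [id]
        have a1 := mul_nonpos_of_nonneg_of_nonpos (sub_nonneg.2 h2.le) hzu'.le
        have a2 := mul_nonpos_of_nonneg_of_nonpos (sub_nonneg.2 hzp.le) hb.2
        linarith
      exact nonpos_of_mul_nonpos_right this (by linarith)
    · exact hzu'.le
  rcases hu with rfl | hu
  · have hb : ori (ρ u) (ρ z) (ρ u') ≤ 0 := by
      rcases hu' with hu' | rfl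
      · exact (B.below_m hu').1
      · unfold ori at hD ⊢; linarith
    have e1 : ori (ρ u) (ρ z) p = t * ori (ρ u) (ρ z) (ρ u') := by
      unfold ori; rw [hx, hy, hr]; ring
    have e2 : ori (ρ u) (ρ z) p ≤ 0 := by rw [e1]; exact mul_nonpos_of_nonneg_of_nonpos t0.le hb
    refine avoid g B hpa hpb (fun _ => e2) (fun e => ?_) hright
    unfold ori at e2; rw [e] at e2; nlinarith
  · have := B.xm u hu
    have : (ρ z).1 < p.1 := by
      rw [hx]; exact lt_lc r0 s0 t0 hs le_rfl this (by linarith) (Or.inr (Or.inr (by linarith)))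
    exact avoid g B hpa hpb (fun _ => by linarith) (fun _ => by linarith) hright

theorem fan_S {v : W} (hv : v ∈ a :: (mid ++ [b])) : v ∈ S := by
  refine g.CS v ?_
  simp only [List.mem_cons, List.mem_append, List.not_mem_nil, or_false] at hv ⊢
  tauto

theorem z_ne {v : W} (hv : v ∈ S) : ρ z ≠ ρ v := by
  intro h
  have := up_old g B B.up_z
  rw [h] at this
  exact g.vU v hv this

theorem aplus_new {u v : W} {p : ℝ × ℝ} (h : Aplus A z (a :: (mid ++ [b])) u v)
    (hp : Sg (ρ u) (ρ v) p) : A u v ∨ ∃ w ∈ a :: (mid ++ [b]), Sg (ρ z) (ρ w) p ∧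
      ((u = z ∧ v = w) ∨ (u = w ∧ v = z)) := by
  rcases h with h | ⟨rfl, h⟩ | ⟨rfl, h⟩
  · exact Or.inl h
  · exact Or.inr ⟨v, h, hp, Or.inl ⟨rfl, rfl⟩⟩
  · exact Or.inr ⟨u, h, hp.symm, Or.inr ⟨rfl, rfl⟩⟩

include hz

theorem geo_birth : Good ρ (insert z S) (α ++ a :: z :: b :: β) (Aplus A z (a :: (mid ++ [b]))) CR where
  inj := by
    intro u hu v hv h
    rcases hu with rfl | hu
    · rcases hv with rfl | hv
      · rfl
      · exact absurd h (z_ne g B hv)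
    · rcases hv with rfl | hv
      · exact absurd h.symm (z_ne g B hu)
      · exact g.inj u hu v hv h
  sub := by
    rintro u v (h | ⟨rfl, h⟩ | ⟨rfl, h⟩)
    · have := g.sub u v h
      exact ⟨Or.inr this.1, Or.inr this.2.1, this.2.2⟩
    · refine ⟨Or.inl rfl, Or.inr (fan_S g B h), ?_⟩
      rintro rfl; exact hz (fan_S g B h)
    · refine ⟨Or.inr (fan_S g B h), Or.inl rfl, ?_⟩
      rintro rfl; exact hz (fan_S g B h)
  CS := by
    intro c hc
    have : c = z ∨ c ∈ α ++ a :: (mid ++ b :: β) := by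
      simp only [List.mem_cons, List.mem_append] at hc ⊢
      tauto
    rcases this with rfl | h
    · exact Or.inl rfl
    · exact Or.inr (g.CS c h)
  xs := new_xs g B
  ss := by
    intro c d hn
    rcases nx_new.1 hn with hn | ⟨rfl, rfl⟩ | ⟨rfl, rfl⟩ | hn
    · exact g.ss _ _ (nx_old.2 (Or.inl hn))
    · exact B.sa
    · exact B.szb
    · exact g.ss _ _ (nx_old.2 (Or.inr (Or.inr hn)))
  vU := by
    intro u hu
    rcases hu with rfl | hu
    · exact avoid g B B.xaz B.xzb (fun _ => by unfold ori; linarith) (fun _ => le_rfl)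
        (fun _ => by unfold ori; linarith)
    · exact fun h => g.vU u hu (up_new g B h)
  eU := by
    intro u v h p hp
    rcases aplus_new g B h hp with h | ⟨w, hw, hp, -⟩
    · exact fun h' => g.eU u v h p hp (up_new g B h')
    · exact avoid_seg g B hw hp
  ev := by
    intro u v h0 w hw hp
    rcases aplus_new g B h0 hp with h | ⟨w', hw', hp, -⟩
    · rcases hw with rfl | hw
      · exact g.eU u v h _ hp (up_old g B B.up_z)
      · exact g.ev u v h w hw hp
    · rcases hw with rfl | hw
      · obtain ⟨t, t0, t1, hx, hy⟩ := hp
        refine z_ne g B (fan_S g B hw') (Prod.ext ?_ ?_)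
        · have : t * ((ρ w').1 - (ρ w).1) = 0 := by linarith
          have := (mul_eq_zero.1 this).resolve_left t0.ne'
          linarith
        · have : t * ((ρ w').2 - (ρ w).2) = 0 := by linarith
          have := (mul_eq_zero.1 this).resolve_left t0.ne'
          linarith
      · exact g.vU w hw (up_old g B (B.up_seg hw' hp))
  ee := by
    intro u v u' v' h h' p hp hp'
    rcases aplus_new g B h hp with h | ⟨w, hw, hp, e⟩
    · rcases aplus_new g B h' hp' with h' | ⟨w', hw', hp', e'⟩
      · exact g.ee u v u' v' h h' p hp hp'
      · exact (g.eU u v h p hp (up_old g B (B.up_seg hw' hp'))).elim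
    · rcases aplus_new g B h' hp' with h' | ⟨w', hw', hp', e'⟩
      · exact (g.eU u' v' h' p hp' (up_old g B (B.up_seg hw hp))).elim
      · have : w = w' := by
          rcases sg_ray hp hp' with h1 | h1 | h1
          · exact g.inj _ (fan_S g B hw) _ (fan_S g B hw') h1
          · exact (g.vU w (fan_S g B hw) (up_old g B (B.up_seg hw' h1))).elim
          · exact (g.vU w' (fan_S g B hw') (up_old g B (B.up_seg hw h1))).elim
        subst this
        left; unfold SameE
        grind

theorem free_old {l o r : W} (h : Free ρ S (α ++ a :: (mid ++ b :: β)) A l o r) :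
    Free ρ (insert z S) (α ++ a :: z :: b :: β) (Aplus A z (a :: (mid ++ [b]))) l o r := by
  intro p hp
  obtain ⟨h1, h2, h3⟩ := h p hp
  refine ⟨fun h' => h1 (up_new g B h'), ?_, ?_⟩
  · rintro w (rfl | hw)
    · rintro rfl; exact h1 (up_old g B B.up_z)
    · exact h2 w hw
  · intro u v h hp'
    rcases aplus_new g B h hp' with h | ⟨w, hw, hp', -⟩
    · exact h3 u v h hp'
    · exact h1 (up_old g B (B.up_seg hw hp'))

theorem free_new {u u' : W} (hn : Nx (a :: (mid ++ [b])) u u') :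
    Free ρ (insert z S) (α ++ a :: z :: b :: β) (Aplus A z (a :: (mid ++ [b]))) z u u' := by
  intro p hp
  have hU := up_old g B (B.up_tri hn hp)
  have hD := B.ori_pair hn
  have hN : Nx (α ++ a :: (mid ++ b :: β)) u u' := nx_old.2 (Or.inr (Or.inl hn))
  refine ⟨avoid_tri g B hn hp, ?_, ?_⟩
  · rintro w (rfl | hw) rfl
    · have := hp.ori_pos (by unfold ori at *; linarith)
      have e : ori (ρ w) (ρ u) (ρ w) = 0 := by unfold ori; ring
      linarith [this.1]
    · exact g.vU w hw hU
  · intro c d h hp'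
    rcases aplus_new g B h hp' with h | ⟨v, hv, hp', -⟩
    · exact g.eU c d h p hp' hU
    · obtain ⟨r, s, t, r0, s0, t0, hs, hx, hy⟩ := hp
      obtain ⟨q, q0, q1, hx', hy'⟩ := hp'
      have hr : r = 1 - s - t := by linarith
      have hst : 0 < s + t := by linarith
      have ex : q * ((ρ v).1 - (ρ z).1) = s * ((ρ u).1 - (ρ z).1) + t * ((ρ u').1 - (ρ z).1) := by
        rw [hr] at hx; linarith
      have ey : q * ((ρ v).2 - (ρ z).2) = s * ((ρ u).2 - (ρ z).2) + t * ((ρ u').2 - (ρ z).2) := by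
        rw [hr] at hy; linarith
      have hxu := g.xs _ _ hN
      have hmid : ∀ y : ℝ × ℝ, (s + t) * (y.1 - (ρ z).1) = q * ((ρ v).1 - (ρ z).1) →
          (s + t) * (y.2 - (ρ z).2) = q * ((ρ v).2 - (ρ z).2) → Sg (ρ u) (ρ u') y := by
        intro y y1 y2
        refine ⟨t / (s + t), by positivity, by rw [div_lt_one hst]; linarith, ?_, ?_⟩
        · rw [ex] at y1
          field_simp; linarith
        · rw [ey] at y2
          field_simp; linarith
      rcases lt_trichotomy (s + t) q with h | h | h
      · -- v inside the triangle
        refine g.vU v (fan_S g B hv) (up_old g B (B.up_tri hn ⟨1 - s / q - t / q, s / q, t / q, ?_,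
          by positivity, by positivity, by ring, ?_, ?_⟩))
        · have : s / q + t / q < 1 := by rw [← add_div, div_lt_one q0]; exact h
          linarith
        · field_simp; linarith
        · field_simp; linarith
      · have hm := (hmid (ρ v) (by rw [h]) (by rw [h])).x_between hxu
        have hvC : v ∈ α ++ a :: (mid ++ b :: β) := by
          simp only [List.mem_cons, List.mem_append, List.not_mem_nil, or_false] at hv ⊢
          tauto
        rcases nx_out g.xs hN hvC with h' | h' <;> linarith
      · have hy := hmid ((ρ z).1 + q / (s + t) * ((ρ v).1 - (ρ z).1),
          (ρ z).2 + q / (s + t) * ((ρ v).2 - (ρ z).2)) (by field_simp; ring) (by field_simp; ring)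
        have hb := hy.x_between hxu
        refine not_up_of g.xs hN hb.1 hb.2 hy.ori_zero.le (up_old g B (B.up_seg hv ?_))
        exact ⟨q / (s + t), by positivity, by rw [div_lt_one hst]; exact h, rfl, rfl⟩

end birth

section cover
variable {α β : List W} {l o r : W} (g : Good ρ S (α ++ l :: o :: r :: β) A CR)
  (hD : 0 < ori (ρ l) (ρ o) (ρ r))
include g hD

theorem nx_cov {c d : W} : Nx (α ++ l :: r :: β) c d ↔
    Nx (α ++ [l]) c d ∨ (c = l ∧ d = r) ∨ Nx (r :: β) c d := by
  rw [nx_append]; simp only [Nx]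

theorem cov_x : (ρ l).1 < (ρ o).1 ∧ (ρ o).1 < (ρ r).1 :=
  ⟨g.xs _ _ (nx_new.2 (Or.inr (Or.inl ⟨rfl, rfl⟩))), g.xs _ _ (nx_new.2 (Or.inr (Or.inr (Or.inl ⟨rfl, rfl⟩))))⟩

theorem cov_up {p : ℝ × ℝ} (h1 : (ρ l).1 ≤ p.1) (h2 : p.1 ≤ (ρ r).1)
    (h : (0 < ori (ρ l) (ρ o) p ∧ 0 < ori (ρ o) (ρ r) p) ∨ 0 < ori (ρ l) (ρ r) p ∨
      (0 ≤ ori (ρ l) (ρ r) p ∧ (ρ l).1 < p.1 ∧ p.1 < (ρ r).1)) :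
    Up ρ (α ++ l :: o :: r :: β) p := by
  have hx := cov_x g hD
  by_cases hp : p.1 ≤ (ρ o).1
  · refine ⟨l, o, nx_new.2 (Or.inr (Or.inl ⟨rfl, rfl⟩)), h1, hp, ?_⟩
    have id : ((ρ r).1 - (ρ l).1) * ori (ρ l) (ρ o) p =
      ((ρ o).1 - (ρ l).1) * ori (ρ l) (ρ r) p + (p.1 - (ρ l).1) * ori (ρ l) (ρ o) (ρ r) := by
      unfold ori; ring
    rcases h with h | h | h
    · exact h.1
    · have : 0 < ((ρ r).1 - (ρ l).1) * ori (ρ l) (ρ o) p := by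
        rw [id]
        exact add_pos_of_pos_of_nonneg (mul_pos (by linarith) h) (mul_nonneg (by linarith) hD.le)
      exact pos_of_mul_pos_right this (by linarith)
    · have : 0 < ((ρ r).1 - (ρ l).1) * ori (ρ l) (ρ o) p := by
        rw [id]
        exact add_pos_of_nonneg_of_pos (mul_nonneg (by linarith) h.1) (mul_pos (by linarith) hD)
      exact pos_of_mul_pos_right this (by linarith)
  · push Not at hp
    refine ⟨o, r, nx_new.2 (Or.inr (Or.inr (Or.inl ⟨rfl, rfl⟩))), hp.le, h2, ?_⟩
    have id : ((ρ r).1 - (ρ l).1) * ori (ρ o) (ρ r) p =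
      ((ρ r).1 - (ρ o).1) * ori (ρ l) (ρ r) p + ((ρ r).1 - p.1) * ori (ρ l) (ρ o) (ρ r) := by
      unfold ori; ring
    rcases h with h | h | h
    · exact h.2
    · have : 0 < ((ρ r).1 - (ρ l).1) * ori (ρ o) (ρ r) p := by
        rw [id]
        exact add_pos_of_pos_of_nonneg (mul_pos (by linarith) h) (mul_nonneg (by linarith) hD.le)
      exact pos_of_mul_pos_right this (by linarith)
    · have : 0 < ((ρ r).1 - (ρ l).1) * ori (ρ o) (ρ r) p := by
        rw [id]
        exact add_pos_of_nonneg_of_pos (mul_nonneg (by linarith) h.1) (mul_pos (by linarith) hD)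
      exact pos_of_mul_pos_right this (by linarith)

theorem cov_new {p : ℝ × ℝ} (h : Up ρ (α ++ l :: r :: β) p) : Up ρ (α ++ l :: o :: r :: β) p := by
  obtain ⟨c, d, hn, h1, h2, h3⟩ := h
  rcases (nx_cov g hD).1 hn with hn | ⟨rfl, rfl⟩ | hn
  · exact ⟨c, d, nx_new.2 (Or.inl hn), h1, h2, h3⟩
  · exact cov_up g hD h1 h2 (Or.inr (Or.inl h3))
  · exact ⟨c, d, nx_new.2 (Or.inr (Or.inr (Or.inr hn))), h1, h2, h3⟩

theorem cov_xs : ∀ c d, Nx (α ++ l :: r :: β) c d → (ρ c).1 < (ρ d).1 := by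
  intro c d hn
  have hx := cov_x g hD
  rcases (nx_cov g hD).1 hn with hn | ⟨rfl, rfl⟩ | hn
  · exact g.xs c d (nx_new.2 (Or.inl hn))
  · linarith
  · exact g.xs c d (nx_new.2 (Or.inr (Or.inr (Or.inr hn))))

theorem cov_seg {p : ℝ × ℝ} (hp : Sg (ρ l) (ρ r) p) :
    Up ρ (α ++ l :: o :: r :: β) p ∧ ¬ Up ρ (α ++ l :: r :: β) p := by
  have hx := cov_x g hD
  have hb := hp.x_between (by linarith)
  exact ⟨cov_up g hD hb.1.le hb.2.le (Or.inr (Or.inr ⟨hp.ori_zero.ge, hb⟩)),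
    not_up_of (cov_xs g hD) ((nx_cov g hD).2 (Or.inr (Or.inl ⟨rfl, rfl⟩))) hb.1 hb.2 hp.ori_zero.le⟩

theorem cov_cases {u v : W} {p : ℝ × ℝ} (h : Aplus A l [r] u v) (hp : Sg (ρ u) (ρ v) p) :
    A u v ∨ (Sg (ρ l) (ρ r) p ∧ ((u = l ∧ v = r) ∨ (u = r ∧ v = l))) := by
  rcases h with h | ⟨rfl, h⟩ | ⟨rfl, h⟩
  · exact Or.inl h
  · simp at h; subst h; exact Or.inr ⟨hp, Or.inl ⟨rfl, rfl⟩⟩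
  · simp at h; subst h; exact Or.inr ⟨hp.symm, Or.inr ⟨rfl, rfl⟩⟩

theorem geo_cover : Good ρ S (α ++ l :: r :: β) (Aplus A l [r]) CR where
  inj := g.inj
  sub := by
    have hl : l ∈ S := g.CS l (by simp)
    have hr : r ∈ S := g.CS r (by simp)
    have hx := cov_x g hD
    have hlr : l ≠ r := by rintro rfl; linarith
    rintro u v (h | ⟨rfl, h⟩ | ⟨rfl, h⟩)
    · exact g.sub u v h
    · simp at h; subst h; exact ⟨hl, hr, hlr⟩
    · simp at h; subst h; exact ⟨hr, hl, hlr.symm⟩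
  CS := by
    intro c hc
    refine g.CS c ?_
    simp only [List.mem_cons, List.mem_append] at hc ⊢
    tauto
  xs := cov_xs g hD
  ss := by
    intro c d hn
    rcases (nx_cov g hD).1 hn with hn | ⟨rfl, rfl⟩ | hn
    · exact g.ss c d (nx_new.2 (Or.inl hn))
    · exact (g.ss _ _ (nx_new.2 (Or.inr (Or.inl ⟨rfl, rfl⟩)))).trans
        (g.ss _ _ (nx_new.2 (Or.inr (Or.inr (Or.inl ⟨rfl, rfl⟩)))))
    · exact g.ss c d (nx_new.2 (Or.inr (Or.inr (Or.inr hn))))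
  vU := fun u hu h => g.vU u hu (cov_new g hD h)
  eU := by
    intro u v h p hp h'
    rcases cov_cases g hD h hp with h | ⟨hp, -⟩
    · exact g.eU u v h p hp (cov_new g hD h')
    · exact (cov_seg g hD hp).2 h'
  ev := by
    intro u v h w hw hp
    rcases cov_cases g hD h hp with h | ⟨hp, -⟩
    · exact g.ev u v h w hw hp
    · exact g.vU w hw (cov_seg g hD hp).1
  ee := by
    intro u v u' v' h h' p hp hp'
    rcases cov_cases g hD h hp with h | ⟨hp, e⟩
    · rcases cov_cases g hD h' hp' with h' | ⟨hp', e'⟩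
      · exact g.ee u v u' v' h h' p hp hp'
      · exact (g.eU u v h p hp (cov_seg g hD hp').1).elim
    · rcases cov_cases g hD h' hp' with h' | ⟨hp', e'⟩
      · exact (g.eU u' v' h' p hp' (cov_seg g hD hp).1).elim
      · left; unfold SameE; grind

theorem cov_free_old {l' o' r' : W} (h : Free ρ S (α ++ l :: o :: r :: β) A l' o' r') :
    Free ρ S (α ++ l :: r :: β) (Aplus A l [r]) l' o' r' := by
  intro p hp
  obtain ⟨h1, h2, h3⟩ := h p hp
  refine ⟨fun h' => h1 (cov_new g hD h'), h2, ?_⟩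
  intro u v h hp'
  rcases cov_cases g hD h hp' with h | ⟨hp', -⟩
  · exact h3 u v h hp'
  · exact h1 (cov_seg g hD hp').1

theorem cov_free : Free ρ S (α ++ l :: r :: β) (Aplus A l [r]) l o r := by
  intro p hp
  have hx := cov_x g hD
  have ho := hp.ori_pos hD
  have ho3 : ori (ρ l) (ρ r) p < 0 := by
    have := ho.2.2; unfold ori at *; linarith
  obtain ⟨a, b, c, a0, b0, c0, hs, hpx, hpy⟩ := hp
  have h1 : (ρ l).1 < p.1 := by
    rw [hpx]; exact lt_lc a0 b0 c0 hs le_rfl hx.1.le (hx.1.trans hx.2).le (Or.inr (Or.inl hx.1))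
  have h2 : p.1 < (ρ r).1 := by
    rw [hpx]; exact lc_lt a0 b0 c0 hs (hx.1.trans hx.2).le hx.2.le le_rfl (Or.inr (Or.inl hx.2))
  have hU := cov_up g hD h1.le h2.le (Or.inl ⟨ho.1, ho.2.1⟩)
  refine ⟨not_up_of (cov_xs g hD) ((nx_cov g hD).2 (Or.inr (Or.inl ⟨rfl, rfl⟩))) h1 h2 ho3.le, ?_, ?_⟩
  · rintro w hw rfl; exact g.vU w hw hU
  · intro u v h hp'
    rcases cov_cases g hD h hp' with h | ⟨hp', -⟩
    · exact g.eU u v h p hp' hU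
    · have := hp'.ori_zero; linarith

end cover

section kite
variable {C : List W} {l o r z : W} (g : Good ρ S C A CR)
include g

theorem geo_kite (hz : z ∈ S) (ho : o ∈ S) (hzo : z ≠ o) (hA : A l r)
    (f1 : Free ρ S C A z l r) (f2 : Free ρ S C A l o r)
    (hseg : ∀ p, Sg (ρ z) (ρ o) p → It (ρ z) (ρ l) (ρ r) p ∨ Sg (ρ l) (ρ r) p ∨ It (ρ l) (ρ o) (ρ r) p)
    (hCR : ∀ u v, A u v → ¬ CR u v l r)
    (hc : ∀ u v u' v', SameE u v z o → SameE u' v' l r → CR u v u' v' ∧ CR u' v' u v) :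
    Good ρ S C (Aplus A z [o]) CR := by
  have cases : ∀ {u v : W} {p : ℝ × ℝ} (h : Aplus A z [o] u v) (hp : Sg (ρ u) (ρ v) p),
      A u v ∨ (Sg (ρ z) (ρ o) p ∧ SameE u v z o) := by
    intro u v p h hp
    rcases h with h | ⟨rfl, h⟩ | ⟨rfl, h⟩
    · exact Or.inl h
    · simp at h; subst h; exact Or.inr ⟨hp, Or.inl ⟨rfl, rfl⟩⟩
    · simp at h; subst h; exact Or.inr ⟨hp.symm, Or.inr ⟨rfl, rfl⟩⟩
  exact {
    inj := g.inj
    sub := by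
      rintro u v (h | ⟨rfl, h⟩ | ⟨rfl, h⟩)
      · exact g.sub u v h
      · simp at h; subst h; exact ⟨hz, ho, hzo⟩
      · simp at h; subst h; exact ⟨ho, hz, hzo.symm⟩
    CS := g.CS
    xs := g.xs
    ss := g.ss
    vU := g.vU
    eU := by
      intro u v h p hp
      rcases cases h hp with h | ⟨hp, -⟩
      · exact g.eU u v h p hp
      · rcases hseg p hp with h | h | h
        · exact (f1 p h).1
        · exact g.eU _ _ hA p h
        · exact (f2 p h).1
    ev := by
      intro u v h w hw hp
      rcases cases h hp with h | ⟨hp, -⟩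
      · exact g.ev u v h w hw hp
      · rcases hseg _ hp with h | h | h
        · exact (f1 _ h).2.1 w hw rfl
        · exact g.ev _ _ hA w hw h
        · exact (f2 _ h).2.1 w hw rfl
    ee := by
      intro u v u' v' h h' p hp hp'
      rcases cases h hp with h | ⟨hp, e⟩
      · rcases cases h' hp' with h' | ⟨hp', e'⟩
        · exact g.ee u v u' v' h h' p hp hp'
        · rcases hseg p hp' with h2 | h2 | h2
          · exact ((f1 p h2).2.2 u v h hp).elim
          · rcases g.ee u v l r h hA p hp h2 with h3 | h3
            · exact Or.inr (hc _ _ _ _ e' h3).2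
            · exact (hCR u v h h3).elim
          · exact ((f2 p h2).2.2 u v h hp).elim
      · rcases cases h' hp' with h' | ⟨hp', e'⟩
        · rcases hseg p hp with h2 | h2 | h2
          · exact ((f1 p h2).2.2 u' v' h' hp').elim
          · rcases g.ee u' v' l r h' hA p hp' h2 with h3 | h3
            · exact Or.inr (hc _ _ _ _ e h3).1
            · exact (hCR u' v' h' h3).elim
          · exact ((f2 p h2).2.2 u' v' h' hp').elim
        · left; unfold SameE at *; grind }

theorem kite_free {l' o' r' : W} (hd : ∀ p, Sg (ρ z) (ρ o) p → ¬ It (ρ l') (ρ o') (ρ r') p)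
    (h : Free ρ S C A l' o' r') : Free ρ S C (Aplus A z [o]) l' o' r' := by
  intro p hp
  obtain ⟨h1, h2, h3⟩ := h p hp
  refine ⟨h1, h2, ?_⟩
  rintro u v (h | ⟨rfl, h⟩ | ⟨rfl, h⟩) hp'
  · exact h3 u v h hp'
  · simp at h; subst h; exact hd p hp' hp
  · simp at h; subst h; exact hd p hp'.symm hp

end kite
end geo2

section dr
variable {W : Type}

def Rho (px ps : W → ℤ) (w : W) : ℝ × ℝ := ((px w : ℝ), (ps w : ℝ))

/-- flexible drawings: every stretching of the base contour is realised -/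
def Flx (D1 : W) (C : List W) (bx bY : W → ℤ) (Q : (W → ℤ) → (W → ℤ) → Prop) : Prop :=
  ∀ x' : W → ℤ, x' D1 = 0 → (∀ c d, Nx C c d → bx d - bx c ≤ x' d - x' c) →
    ∃ px ps : W → ℤ, (∀ c ∈ C, px c = x' c ∧ ps c = x' c + bY c) ∧ Q px ps

theorem Flx.mono {D1 : W} {C : List W} {bx bY : W → ℤ} {Q Q' : (W → ℤ) → (W → ℤ) → Prop}
    (h : Flx D1 C bx bY Q) (hQ : ∀ px ps, Q px ps → Q' px ps) : Flx D1 C bx bY Q' := by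
  intro x' h0 hg
  obtain ⟨px, ps, hc, q⟩ := h x' h0 hg
  exact ⟨px, ps, hc, hQ _ _ q⟩

structure PendQ (S : Set W) (C : List W) (A : W → W → Prop) (l o r : W) (px ps : W → ℤ) : Prop where
  lr : A l r
  lS : l ∈ S
  oS : o ∈ S
  rS : r ∈ S
  nx : Nx C l r
  free : Free (Rho px ps) S C A l o r
  ori : 0 < ori (Rho px ps l) (Rho px ps o) (Rho px ps r)
  xlo : px l < px o
  xor : px o ≤ px r
  slo : ps l ≤ ps o

structure Qs (D1 D2 : W) (S : Set W) (C : List W) (A : W → W → Prop) (CR : W → W → W → W → Prop)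
    (Pd : W → W → W → Prop) (px ps : W → ℤ) : Prop where
  good : Good (Rho px ps) S C A CR
  box : ∀ w ∈ S, w = D1 ∨ w = D2 ∨ (1 ≤ px w ∧ px w + 1 ≤ ps w ∧ ps w ≤ px D2)
  pend : ∀ l o r, Pd l o r → PendQ S C A l o r px ps

structure Base (D1 D2 : W) (C : List W) (N : ℤ) (bx bY : W → ℤ) : Prop where
  b1 : bx D1 = 0
  y1 : bY D1 = 0
  y2 : bY D2 = 0
  wd : bx D2 ≤ N
  ypos : ∀ c ∈ C, 0 ≤ bY c

/-- facts about the new vertex -/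
structure BF (bx bY : W → ℤ) (C : List W) (a b z : W) (mid : List W) (k e f : ℤ) (px ps : W → ℤ) : Prop where
  hc : ∀ c ∈ C, ps c = px c + bY c
  ga : px a + k ≤ px z
  gb : px z + (bx b + f - bx a - k) ≤ px b
  gm : ∀ m ∈ mid, px m = px z - (bx a + k) + bx m + e
  hz : ps z = px z + (bx b + bY b + f - bx a - k)

theorem Qs.congr {D1 D2 : W} {S : Set W} {C : List W} {A : W → W → Prop}
    {CR : W → W → W → W → Prop} {Pd : W → W → W → Prop} {px ps px' ps' : W → ℤ}
    (q : Qs D1 D2 S C A CR Pd px ps) (hx : ∀ w ∈ S, px' w = px w) (hs : ∀ w ∈ S, ps' w = ps w)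
    (hD : D2 ∈ S) : Qs D1 D2 S C A CR Pd px' ps' where
  good := q.good.congr (fun w hw => by unfold Rho; rw [hx w hw, hs w hw])
  box := by
    intro w hw
    rw [hx w hw, hs w hw, hx D2 hD]; exact q.box w hw
  pend := by
    intro l o r h
    have hp := q.pend l o r h
    have hR : ∀ w ∈ S, Rho px' ps' w = Rho px ps w := fun w hw => by unfold Rho; rw [hx w hw, hs w hw]
    exact {
      lr := hp.lr, lS := hp.lS, oS := hp.oS, rS := hp.rS, nx := hp.nx
      free := Free.congr q.good hR hp.lS hp.oS hp.rS hp.free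
      ori := by rw [hR l hp.lS, hR o hp.oS, hR r hp.rS]; exact hp.ori
      xlo := by rw [hx l hp.lS, hx o hp.oS]; exact hp.xlo
      xor := by rw [hx o hp.oS, hx r hp.rS]; exact hp.xor
      slo := by rw [hs l hp.lS, hs o hp.oS]; exact hp.slo }

theorem Good.pw_x {px ps : W → ℤ} {S : Set W} {C : List W} {A : W → W → Prop}
    {CR : W → W → W → W → Prop} (g : Good (Rho px ps) S C A CR) : C.Pairwise (fun c d => px c < px d) :=
  nx_pairwise (R := fun c d => px c < px d) (fun _ _ _ => lt_trans) (fun c d h => by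
    have := g.xs c d h; simpa [Rho] using this)

theorem Good.pw_s {px ps : W → ℤ} {S : Set W} {C : List W} {A : W → W → Prop}
    {CR : W → W → W → W → Prop} (g : Good (Rho px ps) S C A CR) : C.Pairwise (fun c d => ps c ≤ ps d) :=
  nx_pairwise (R := fun c d => ps c ≤ ps d) (fun _ _ _ => le_trans) (fun c d h => by
    have := g.ss c d h; simpa [Rho] using this)

variable {D1 D2 : W} {S : Set W} {α β mid : List W} {a b z : W} {A : W → W → Prop}
    {CR : W → W → W → W → Prop} {Pd : W → W → W → Prop} {N : ℤ} {bx bY : W → ℤ}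

theorem base_pw {C : List W} (hB : Base D1 D2 C N bx bY) (hF : Flx D1 C bx bY (Qs D1 D2 S C A CR Pd)) :
    C.Pairwise (fun c d => bx c < bx d) ∧ C.Pairwise (fun c d => bx c + bY c ≤ bx d + bY d) ∧
    ∀ c ∈ C, c ∈ S := by
  obtain ⟨px, ps, hc, q⟩ := hF bx hB.b1 (fun _ _ _ => le_rfl)
  refine ⟨?_, ?_, q.good.CS⟩
  · refine q.good.pw_x.imp_of_mem ?_
    intro c d h1 h2 h
    rw [(hc c h1).1, (hc d h2).1] at h; exact h
  · refine q.good.pw_s.imp_of_mem ?_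
    intro c d h1 h2 h
    rw [(hc c h1).2, (hc d h2).2] at h; exact h

set_option maxHeartbeats 1000000 in
open Classical in
theorem dr_birth (hB : Base D1 D2 (α ++ a :: (mid ++ b :: β)) N bx bY)
    {R : (W → ℤ) → (W → ℤ) → Prop}
    (hF : Flx D1 (α ++ a :: (mid ++ b :: β)) bx bY (fun px ps =>
      Qs D1 D2 S (α ++ a :: (mid ++ b :: β)) A CR Pd px ps ∧ R px ps))
    (hR : ∀ px ps px' ps', Qs D1 D2 S (α ++ a :: (mid ++ b :: β)) A CR Pd px ps →
      (∀ w ∈ S, px' w = px w) → (∀ w ∈ S, ps' w = ps w) → R px ps → R px' ps')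
    (hz : z ∉ S) (hD1 : D1 ∈ α ++ [a]) (hD2 : D2 ∈ b :: β) (k e f : ℤ) (hk : 1 ≤ k) (he : 0 ≤ e)
    (hef : e < f) (hm : ∀ m ∈ mid, bx a + k ≤ bx m + e) (hmid : mid = [] → k ≤ f)
    {Q' : (W → ℤ) → (W → ℤ) → Prop}
    (hQ' : ∀ px ps, Qs D1 D2 S (α ++ a :: (mid ++ b :: β)) A CR Pd px ps → R px ps →
      Good (Rho px ps) (insert z S) (α ++ a :: z :: b :: β) (Aplus A z (a :: (mid ++ [b]))) CR →
      (∀ w ∈ (insert z S : Set W), w = D1 ∨ w = D2 ∨ (1 ≤ px w ∧ px w + 1 ≤ ps w ∧ ps w ≤ px D2)) →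
      Birth (Rho px ps) a b z mid → BF bx bY (α ++ a :: (mid ++ b :: β)) a b z mid k e f px ps → Q' px ps) :
    ∃ bx' bY', Base D1 D2 (α ++ a :: z :: b :: β) (N + f) bx' bY' ∧
      bx' z = bx a + k ∧ bY' z = bx b + bY b + f - bx a - k ∧ (∀ w ∈ α ++ [a], bx' w = bx w) ∧
      (∀ w ∈ b :: β, bx' w = bx w + f) ∧ (∀ w, w ≠ z → bY' w = bY w) ∧
      Flx D1 (α ++ a :: z :: b :: β) bx' bY' Q' := by
  obtain ⟨pwx, pws, hCS⟩ := base_pw hB (hF.mono (fun px ps h => h.1))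
  have hzC : z ∉ α ++ a :: (mid ++ b :: β) := fun h => hz (hCS z h)
  have memL : ∀ w ∈ α ++ [a], w ∈ α ++ a :: (mid ++ b :: β) := by
    intro w hw; simp only [List.mem_append, List.mem_cons, List.not_mem_nil, or_false] at hw ⊢; tauto
  have memR : ∀ w ∈ b :: β, w ∈ α ++ a :: (mid ++ b :: β) := by
    intro w hw; simp only [List.mem_append, List.mem_cons] at hw ⊢; tauto
  have memM : ∀ w ∈ mid, w ∈ α ++ a :: (mid ++ b :: β) := by
    intro w hw; simp only [List.mem_append, List.mem_cons] at hw ⊢; tauto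
  have memF : ∀ w ∈ a :: (mid ++ [b]), w ∈ α ++ a :: (mid ++ b :: β) := by
    intro w hw; simp only [List.mem_append, List.mem_cons, List.not_mem_nil, or_false] at hw ⊢; tauto
  have aL : a ∈ α ++ [a] := by simp
  have bR : b ∈ b :: β := by simp
  have hDS : D2 ∈ S := hCS _ (memR _ hD2)
  have pw1 := pwx
  rw [show α ++ a :: (mid ++ b :: β) = (α ++ [a]) ++ (mid ++ b :: β) by simp, List.pairwise_append] at pw1
  have LM : ∀ w ∈ α ++ [a], ∀ m ∈ mid, bx w < bx m := fun w hw m hm =>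
    pw1.2.2 w hw m (by simp [hm])
  have LR : ∀ w ∈ α ++ [a], ∀ m ∈ b :: β, bx w < bx m := fun w hw m hm =>
    pw1.2.2 w hw m (List.mem_append_right _ hm)
  have MR : ∀ w ∈ mid, ∀ m ∈ b :: β, bx w < bx m := (List.pairwise_append.1 pw1.2.1).2.2
  have pw2 := pws
  rw [show α ++ a :: (mid ++ b :: β) = (α ++ [a]) ++ (mid ++ b :: β) by simp, List.pairwise_append] at pw2
  have sLR := pw2.2.2 a aL b (by simp)
  have sMR : ∀ w ∈ mid, bx w + bY w ≤ bx b + bY b := fun w hw => (List.pairwise_append.1 pw2.2.1).2.2 w hw b bR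
  have hkb : bx a + k < bx b + f := by
    cases hmm : mid with
    | nil => have := hmid hmm; have := LR a aL b bR; linarith
    | cons m l =>
      have hm1 : m ∈ mid := by simp [hmm]
      have := hm m hm1; have := MR m hm1 b bR; linarith
  set bx' : W → ℤ := fun w => if w = z then bx a + k else if w ∈ b :: β then bx w + f else bx w with hbx'
  set bY' : W → ℤ := fun w => if w = z then bx b + bY b + f - bx a - k else bY w with hbY'
  have e1 : bx' z = bx a + k := by simp [hbx']
  have e2 : bY' z = bx b + bY b + f - bx a - k := by simp [hbY']
  have e3 : ∀ w ∈ α ++ [a], bx' w = bx w := by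
    intro w hw
    have h1 : w ≠ z := by rintro rfl; exact hzC (memL _ hw)
    have h2 : w ∉ b :: β := fun h => lt_irrefl _ (LR w hw w h)
    simp only [hbx', if_neg h1, if_neg h2]
  have e4 : ∀ w ∈ b :: β, bx' w = bx w + f := by
    intro w hw
    have h1 : w ≠ z := by rintro rfl; exact hzC (memR _ hw)
    simp only [hbx', if_neg h1, if_pos hw]
  have e5 : ∀ w, w ≠ z → bY' w = bY w := by
    intro w hw; simp only [hbY', if_neg hw]
  have neS : ∀ w ∈ α ++ a :: (mid ++ b :: β), w ≠ z := by rintro w hw rfl; exact hzC hw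
  refine ⟨bx', bY', ⟨?_, ?_, ?_, ?_, ?_⟩, e1, e2, e3, e4, e5, ?_⟩
  · rw [e3 _ hD1]; exact hB.b1
  · rw [e5 _ (neS _ (memL _ hD1))]; exact hB.y1
  · rw [e5 _ (neS _ (memR _ hD2))]; exact hB.y2
  · rw [e4 _ hD2]; have := hB.wd; linarith
  · intro c hc
    by_cases h : c = z
    · subst h; rw [e2]; have := hB.ypos b (memR _ bR); linarith
    · rw [e5 _ h]
      refine hB.ypos c ?_
      simp only [List.mem_append, List.mem_cons] at hc ⊢; tauto
  · intro x'' h0 hgap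
    have ga : bx a + k - bx a ≤ x'' z - x'' a := by
      have := hgap a z (nx_new.2 (Or.inr (Or.inl ⟨rfl, rfl⟩)))
      rw [e1, e3 a aL] at this; exact this
    have gb : bx b + f - (bx a + k) ≤ x'' b - x'' z := by
      have := hgap z b (nx_new.2 (Or.inr (Or.inr (Or.inl ⟨rfl, rfl⟩))))
      rw [e1, e4 b bR] at this; exact this
    set x' : W → ℤ := fun w => if w ∈ mid then x'' z - (bx a + k) + bx w + e else x'' w with hx'
    have xL : ∀ w ∈ α ++ [a], x' w = x'' w := by
      intro w hw
      have : w ∉ mid := fun h => lt_irrefl _ (LM w hw w h)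
      simp only [hx', if_neg this]
    have xR : ∀ w ∈ b :: β, x' w = x'' w := by
      intro w hw
      have : w ∉ mid := fun h => lt_irrefl _ (MR w h w hw)
      simp only [hx', if_neg this]
    have xM : ∀ w ∈ mid, x' w = x'' z - (bx a + k) + bx w + e := by
      intro w hw
      simp only [hx', if_pos hw]
    have hgap' : ∀ c d, Nx (α ++ a :: (mid ++ b :: β)) c d → bx d - bx c ≤ x' d - x' c := by
      intro c d hn
      rcases nx_old.1 hn with h | h | h
      · rw [xL c h.mem.1, xL d h.mem.2]
        have := hgap c d (nx_new.2 (Or.inl h))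
        rwa [e3 _ h.mem.1, e3 _ h.mem.2] at this
      · have hlt : bx c < bx d := by
          have pw3 := pwx
          have : ∀ {l : List W}, l.Pairwise (fun c d => bx c < bx d) → Nx l c d → bx c < bx d := by
            intro l
            induction l with
            | nil => intro _ h; exact h.elim
            | cons x l ih =>
              intro hp h
              cases l with
              | nil => exact h.elim
              | cons y l =>
                rcases h with ⟨rfl, rfl⟩ | h
                · exact (List.pairwise_cons.1 hp).1 _ (by simp)
                · exact ih (List.pairwise_cons.1 hp).2 h
          exact this pwx hn
        have hc := h.mem.1
        have hd := h.mem.2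
        simp only [List.mem_append, List.mem_cons, List.not_mem_nil, or_false] at hc hd
        rcases hc with rfl | hc | rfl
        · rw [xL c aL]
          rcases hd with rfl | hd | rfl
          · exact absurd hlt (lt_irrefl _)
          · rw [xM d hd]; linarith
          · rw [xR d bR]
            have : mid = [] := by
              cases hmm : mid with
              | nil => rfl
              | cons m l =>
                exfalso
                have hm1 : m ∈ mid := by simp [hmm]
                rw [hmm] at h
                rcases h with ⟨-, h⟩ | h
                · rw [← h] at hm1; exact lt_irrefl _ (MR _ hm1 _ bR)
                · have : c ∈ mid ∨ c = d := by
                    have : c ∈ m :: (l ++ [d]) := h.mem.1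
                    rw [hmm]
                    simp only [List.mem_append, List.mem_cons, List.not_mem_nil, or_false] at this ⊢; tauto
                  rcases this with h | h
                  · exact lt_irrefl _ (LM _ aL _ h)
                  · exact lt_irrefl _ (LR _ aL _ (by rw [h]; simp))
            have := hmid this
            linarith
        · rw [xM c hc]
          rcases hd with rfl | hd | rfl
          · exact absurd hlt (lt_asymm (LM _ aL _ hc))
          · rw [xM d hd]; linarith
          · rw [xR d bR]; linarith
        · exfalso
          rcases hd with rfl | hd | rfl
          · exact lt_asymm hlt (LR _ aL _ bR)
          · exact lt_asymm hlt (MR _ hd _ bR)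
          · exact lt_irrefl _ hlt
      · rw [xR c h.mem.1, xR d h.mem.2]
        have := hgap c d (nx_new.2 (Or.inr (Or.inr (Or.inr h))))
        rw [e4 _ h.mem.1, e4 _ h.mem.2] at this; linarith
    obtain ⟨px0, ps0, hc0, q0, r0⟩ := hF x' (by rw [xL _ hD1]; exact h0) hgap'
    set px : W → ℤ := Function.update px0 z (x'' z) with hpx
    set ps : W → ℤ := Function.update ps0 z (x'' z + bY' z) with hps
    have hxS : ∀ w, w ≠ z → px w = px0 w := fun w hw => by rw [hpx, Function.update_of_ne hw]
    have hsS : ∀ w, w ≠ z → ps w = ps0 w := fun w hw => by rw [hps, Function.update_of_ne hw]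
    have pxz : px z = x'' z := by rw [hpx, Function.update_self]
    have psz : ps z = x'' z + bY' z := by rw [hps, Function.update_self]
    have nz : ∀ w ∈ S, w ≠ z := by rintro w hw rfl; exact hz hw
    have q : Qs D1 D2 S (α ++ a :: (mid ++ b :: β)) A CR Pd px ps :=
      q0.congr (fun w hw => hxS w (nz w hw)) (fun w hw => hsS w (nz w hw)) hDS
    have hcx : ∀ c ∈ α ++ a :: (mid ++ b :: β), px c = x' c ∧ ps c = x' c + bY c := by
      intro c hc; rw [hxS c (neS c hc), hsS c (neS c hc)]; exact hc0 c hc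
    have pa : px a = x'' a := by rw [(hcx a (memL _ aL)).1, xL a aL]
    have pb : px b = x'' b := by rw [(hcx b (memR _ bR)).1, xR b bR]
    have sa : ps a = x'' a + bY a := by rw [(hcx a (memL _ aL)).2, xL a aL]
    have sb : ps b = x'' b + bY b := by rw [(hcx b (memR _ bR)).2, xR b bR]
    have bf : BF bx bY (α ++ a :: (mid ++ b :: β)) a b z mid k e f px ps := {
      hc := fun c hc => by rw [(hcx c hc).1, (hcx c hc).2]
      ga := by rw [pa, pxz]; linarith
      gb := by rw [pb, pxz]; linarith
      gm := fun m hm => by rw [(hcx m (memM m hm)).1, pxz, xM m hm]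
      hz := by rw [psz, pxz, e2] }
    have hbz := bf.hz
    have hbga := bf.ga
    have hbgb := bf.gb
    have birth : Birth (Rho px ps) a b z mid := {
      xaz := by simp only [Rho]; exact_mod_cast (by linarith : px a < px z)
      xzb := by simp only [Rho]; exact_mod_cast (by linarith : px z < px b)
      szb := by simp only [Rho]; exact_mod_cast (by linarith : ps z ≤ ps b)
      sa := by simp only [Rho]; exact_mod_cast (by linarith : ps a ≤ ps z)
      abz := by
        intro hm0
        have hkf := hmid hm0
        have h1 : px a < px z := by linarith
        have h2 : px z < px b := by linarith
        have h3 : ps a - px a ≤ ps z - px z := by linarith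
        have h4 : ps b - px b < ps z - px z := by linarith
        have h5 : ps z ≤ ps b := by linarith
        have : 0 < (px b - px a) * (ps z - ps a) - (ps b - ps a) * (px z - px a) := by nlinarith
        simp only [Rho, ori]; exact_mod_cast this
      xm := by
        intro m hm1
        have := bf.gm m hm1; have := hm m hm1
        simp only [Rho]; exact_mod_cast (by linarith : px z ≤ px m)
      sm := by
        intro m hm1
        have h1 := bf.gm m hm1; have h2 := bf.hc m (memM m hm1); have h3 := sMR m hm1
        simp only [Rho]; exact_mod_cast (by linarith : ps m < ps z)
      xs := fun c d hn => q.good.xs c d (nx_old.2 (Or.inr (Or.inl hn)))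
      ss := fun c d hn => q.good.ss c d (nx_old.2 (Or.inr (Or.inl hn))) }
    refine ⟨px, ps, ?_, hQ' px ps q
      (hR px0 ps0 px ps q0 (fun w hw => hxS w (nz w hw)) (fun w hw => hsS w (nz w hw)) r0) (geo_birth q.good hz birth) ?_ birth bf⟩
    · intro c hc
      by_cases h : c = z
      · subst h; exact ⟨pxz, psz⟩
      · rw [e5 c h]
        have : c ∈ α ++ [a] ∨ c ∈ b :: β := by
          simp only [List.mem_append, List.mem_cons, List.not_mem_nil, or_false] at hc ⊢; tauto
        rcases this with h | h
        · rw [← xL c h]; exact hcx c (memL c h)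
        · rw [← xR c h]; exact hcx c (memR c h)
    · rintro w (rfl | hw)
      · right; right
        have hD2' := hcx D2 (memR _ hD2)
        rw [hB.y2, add_zero] at hD2'
        have hsD : ps b ≤ ps D2 := by
          have := q.good.pw_s
          rw [show α ++ a :: (mid ++ b :: β) = (α ++ a :: mid) ++ b :: β by simp, List.pairwise_append] at this
          rcases List.mem_cons.1 hD2 with h | h
          · rw [h]
          · exact (List.pairwise_cons.1 this.2.1).1 _ h
        have ha0 : 0 ≤ px a := by
          have h1 : px D1 = 0 := by rw [(hcx _ (memL _ hD1)).1, xL _ hD1]; exact h0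
          have := q.good.pw_x
          rw [show α ++ a :: (mid ++ b :: β) = (α ++ [a]) ++ (mid ++ b :: β) by simp, List.pairwise_append,
            List.pairwise_append] at this
          rcases List.mem_append.1 hD1 with h | h
          · have := this.1.2.2 _ h a (by simp); linarith
          · simp at h; rw [h] at h1; exact h1.ge
        have hyb := hB.ypos b (memR _ bR)
        refine ⟨by linarith, by linarith, by linarith⟩
      · exact q.box w hw

end dr

theorem It.rot {a b c p : ℝ × ℝ} (h : It a b c p) : It b c a p := by
  obtain ⟨α, β, γ, h1, h2, h3, hs, hx, hy⟩ := h
  exact ⟨β, γ, α, h2, h3, h1, by linarith, by linarith, by linarith⟩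

section ops
variable {W : Type}

theorem Free.rot {ρ : W → ℝ × ℝ} {S : Set W} {C : List W} {A : W → W → Prop} {l o r : W}
    (h : Free ρ S C A l o r) : Free ρ S C A o r l := fun p hp => h p hp.rot.rot

def Dr (D1 D2 : W) (S : Set W) (C : List W) (A : W → W → Prop) (CR : W → W → W → W → Prop)
    (Pd : W → W → W → Prop) (N : ℤ) : Prop :=
  ∃ bx bY, Base D1 D2 C N bx bY ∧ Flx D1 C bx bY (Qs D1 D2 S C A CR Pd)

variable {D1 D2 : W} {S : Set W} {α β mid : List W} {a b z : W} {A : W → W → Prop}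
    {CR : W → W → W → W → Prop} {Pd Pd' : W → W → W → Prop} {N : ℤ}

theorem pend_old {l o r : W} {px ps : W → ℤ}
    (g : Good (Rho px ps) S (α ++ a :: (mid ++ b :: β)) A CR) (hz : z ∉ S)
    (B : Birth (Rho px ps) a b z mid)
    (h : PendQ S (α ++ a :: (mid ++ b :: β)) A l o r px ps) (hn : ¬ Nx (a :: (mid ++ [b])) l r) :
    PendQ (insert z S) (α ++ a :: z :: b :: β) (Aplus A z (a :: (mid ++ [b]))) l o r px ps where
  lr := Or.inl h.lr
  lS := Or.inr h.lS
  oS := Or.inr h.oS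
  rS := Or.inr h.rS
  nx := by
    rcases nx_old.1 h.nx with h | h | h
    · exact nx_new.2 (Or.inl h)
    · exact absurd h hn
    · exact nx_new.2 (Or.inr (Or.inr (Or.inr h)))
  free := free_old g hz B h.free
  ori := h.ori
  xlo := h.xlo
  xor := h.xor
  slo := h.slo

theorem hR0 {C : List W} : ∀ (px ps px' ps' : W → ℤ), Qs D1 D2 S C A CR Pd px ps →
      (∀ w ∈ S, px' w = px w) → (∀ w ∈ S, ps' w = ps w) → True → True := fun _ _ _ _ _ _ _ h => h

theorem pw_fan {R : W → W → Prop} (h : (α ++ a :: (mid ++ b :: β)).Pairwise R) :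
    (∀ m ∈ mid, R a m) ∧ R a b ∧ (∀ m ∈ mid, R m b) ∧ mid.Pairwise R := by
  rw [List.pairwise_append, List.pairwise_cons] at h
  have h2 := List.pairwise_append.1 h.2.1.2
  exact ⟨fun m hm => h.2.1.1 m (by simp [hm]), h.2.1.1 b (by simp), fun m hm => h2.2.2 m hm b (by simp), h2.1⟩

theorem dr_N (hD : Dr D1 D2 S (α ++ a :: (mid ++ b :: β)) A CR Pd N) (hz : z ∉ S)
    (hD1 : D1 ∈ α ++ [a]) (hD2 : D2 ∈ b :: β)
    (hPd : ∀ l o r, Pd l o r → ¬ Nx (a :: (mid ++ [b])) l r) :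
    Dr D1 D2 (insert z S) (α ++ a :: z :: b :: β) (Aplus A z (a :: (mid ++ [b]))) CR Pd (N + 1) := by
  obtain ⟨bx, bY, hB, hF⟩ := hD
  obtain ⟨pwx, pws, hCS⟩ := base_pw hB hF
  obtain ⟨bx', bY', hB', -, -, -, -, -, hF'⟩ := dr_birth hB (R := fun _ _ => True)
    (hF.mono (fun px ps h => ⟨h, trivial⟩)) hR0 hz hD1 hD2 1 0 1 le_rfl le_rfl one_pos
    (fun m hm => by have := (pw_fan pwx).1 m hm; linarith) (fun _ => le_rfl)
    (Q' := Qs D1 D2 (insert z S) (α ++ a :: z :: b :: β) (Aplus A z (a :: (mid ++ [b]))) CR Pd) (by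
      intro px ps q _ g box B bf
      exact ⟨g, box, fun l o r h => pend_old q.good hz B (q.pend l o r h) (hPd l o r h)⟩)
  exact ⟨bx', bY', hB', hF'⟩

theorem dr_R {o : W} (hD : Dr D1 D2 S (α ++ a :: (o :: mid ++ b :: β)) A CR Pd N) (hz : z ∉ S)
    (hD1 : D1 ∈ α ++ [a]) (hD2 : D2 ∈ b :: β)
    (hPd : ∀ l o' r, Pd l o' r → ¬ Nx (a :: (o :: mid ++ [b])) l r)
    (hPd' : ∀ l o' r, Pd' l o' r → Pd l o' r ∨ (l = a ∧ o' = o ∧ r = z)) :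
    Dr D1 D2 (insert z S) (α ++ a :: z :: b :: β) (Aplus A z (a :: (o :: mid ++ [b]))) CR Pd' (N + 1) := by
  obtain ⟨bx, bY, hB, hF⟩ := hD
  obtain ⟨pwx, pws, hCS⟩ := base_pw hB hF
  have pf := pw_fan pwx
  obtain ⟨bx', bY', hB', -, -, -, -, -, hF'⟩ := dr_birth hB (R := fun _ _ => True)
    (hF.mono (fun px ps h => ⟨h, trivial⟩)) hR0 hz hD1 hD2 (bx o - bx a) 0 1
    (by have := pf.1 o (by simp); linarith) le_rfl one_pos
    (fun m hm => by
      rcases List.mem_cons.1 hm with rfl | hm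
      · linarith
      · have := (List.pairwise_cons.1 pf.2.2.2).1 m hm; linarith)
    (fun h => by simp at h)
    (Q' := Qs D1 D2 (insert z S) (α ++ a :: z :: b :: β) (Aplus A z (a :: (o :: mid ++ [b]))) CR Pd') (by
      intro px ps q _ g box B bf
      refine ⟨g, box, fun l o' r h => ?_⟩
      rcases hPd' l o' r h with h | ⟨rfl, rfl, rfl⟩
      · exact pend_old q.good hz B (q.pend l o' r h) (hPd l o' r h)
      · have hm := B.mem_m (v := o') (by simp)
        have hgm := bf.gm o' (by simp)
        simp only [Rho] at hm
        exact {
          lr := Or.inr (Or.inr ⟨rfl, by simp⟩)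
          lS := Or.inr (hCS _ (by simp))
          oS := Or.inr (hCS _ (by simp))
          rS := Or.inl rfl
          nx := nx_new.2 (Or.inr (Or.inl ⟨rfl, rfl⟩))
          free := (free_new q.good hz B (Or.inl ⟨rfl, rfl⟩)).rot
          ori := B.auz (by simp)
          xlo := by exact_mod_cast hm.2.2.1
          xor := by linarith
          slo := by exact_mod_cast hm.1 })
  exact ⟨bx', bY', hB', hF'⟩

open Classical in
theorem dr_cover {l o r : W} {bx bY : W → ℤ} (hB : Base D1 D2 (α ++ l :: o :: r :: β) N bx bY)
    (hF : Flx D1 (α ++ l :: o :: r :: β) bx bY (Qs D1 D2 S (α ++ l :: o :: r :: β) A CR Pd))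
    (hs : bx l + bY l = bx o + bY o)
    (hD1 : D1 ∈ α ++ [l]) (hD2 : D2 ∈ r :: β)
    (hPd : ∀ l' o' r', Pd l' o' r' → ¬ (l' = l ∧ r' = o) ∧ ¬ (l' = o ∧ r' = r))
    (hPd' : ∀ l' o' r', Pd' l' o' r' → Pd l' o' r' ∨ (l' = l ∧ o' = o ∧ r' = r)) :
    Dr D1 D2 S (α ++ l :: r :: β) (Aplus A l [r]) CR Pd' (N + 1) := by
  obtain ⟨pwx, pws, hCS⟩ := base_pw hB hF
  have pw1 := pwx
  rw [show α ++ l :: o :: r :: β = (α ++ [l]) ++ o :: (r :: β) by simp, List.pairwise_append] at pw1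
  have oR : ∀ w ∈ r :: β, bx o < bx w := (List.pairwise_cons.1 pw1.2.1).1
  have Lo : ∀ w ∈ α ++ [l], bx w < bx o := fun w hw => pw1.2.2 w hw o (by simp)
  have lL : l ∈ α ++ [l] := by simp
  have rR : r ∈ r :: β := by simp
  have nxc : ∀ c d, Nx (α ++ l :: r :: β) c d ↔
    Nx (α ++ [l]) c d ∨ (c = l ∧ d = r) ∨ Nx (r :: β) c d := by
    intro c d; rw [nx_append]; simp only [Nx]
  set bx' : W → ℤ := fun w => if w ∈ r :: β then bx w + 1 else bx w with hbx'
  have e1 : ∀ w ∈ α ++ [l], bx' w = bx w := by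
    intro w hw
    have : w ∉ r :: β := fun h => lt_asymm (Lo w hw) (oR w h)
    simp only [hbx', if_neg this]
  have e2 : ∀ w ∈ r :: β, bx' w = bx w + 1 := by
    intro w hw; simp only [hbx', if_pos hw]
  refine ⟨bx', bY, ⟨?_, hB.y1, hB.y2, ?_, ?_⟩, ?_⟩
  · rw [e1 _ hD1]; exact hB.b1
  · rw [e2 _ hD2]; have := hB.wd; linarith
  · intro c hc
    refine hB.ypos c ?_
    simp only [List.mem_cons, List.mem_append] at hc ⊢
    tauto
  · intro x'' h0 hgap
    set x' : W → ℤ := fun w => if w = o then x'' l + (bx o - bx l) else x'' w with hx'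
    have xo : x' o = x'' l + (bx o - bx l) := by simp [hx']
    have xL : ∀ w ∈ α ++ [l], x' w = x'' w := by
      intro w hw
      have : w ≠ o := by rintro rfl; exact lt_irrefl _ (Lo _ hw)
      simp only [hx', if_neg this]
    have xR : ∀ w ∈ r :: β, x' w = x'' w := by
      intro w hw
      have : w ≠ o := by rintro rfl; exact lt_irrefl _ (oR _ hw)
      simp only [hx', if_neg this]
    have glr := hgap l r ((nxc _ _).2 (Or.inr (Or.inl ⟨rfl, rfl⟩)))
    rw [e1 l lL, e2 r rR] at glr
    obtain ⟨px, ps, hc, q⟩ := hF x' (by rw [xL _ hD1]; exact h0) (by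
      intro c d hn
      rcases nx_new.1 hn with h | ⟨rfl, rfl⟩ | ⟨rfl, rfl⟩ | h
      · rw [xL _ h.mem.1, xL _ h.mem.2]
        have := hgap c d ((nxc _ _).2 (Or.inl h))
        rwa [e1 _ h.mem.1, e1 _ h.mem.2] at this
      · rw [xo, xL _ lL]; linarith
      · rw [xo, xR _ rR]; linarith
      · rw [xR _ h.mem.1, xR _ h.mem.2]
        have := hgap c d ((nxc _ _).2 (Or.inr (Or.inr h)))
        rw [e2 _ h.mem.1, e2 _ h.mem.2] at this; linarith)
    have hl := hc l (by simp)
    have ho := hc o (by simp)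
    have hr := hc r (by simp)
    rw [xL _ lL] at hl
    rw [xo] at ho
    rw [xR _ rR] at hr
    have b1 := Lo l lL
    have b2 := oR r rR
    have bs : bx o + bY o ≤ bx r + bY r := by
      rw [show α ++ l :: o :: r :: β = (α ++ [l]) ++ o :: (r :: β) by simp, List.pairwise_append] at pws
      exact (List.pairwise_cons.1 pws.2.1).1 r rR
    have i1 : px l < px o := by linarith
    have i2 : ps l = ps o := by linarith
    have i3 : ps o < ps r := by linarith
    have hO : 0 < ori (Rho px ps l) (Rho px ps o) (Rho px ps r) := by
      have : 0 < (px o - px l) * (ps r - ps l) - (ps o - ps l) * (px r - px l) := by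
        rw [i2, sub_self, zero_mul, sub_zero]
        exact mul_pos (by linarith) (by linarith)
      simp only [Rho, ori]; exact_mod_cast this
    refine ⟨px, ps, ?_, ⟨geo_cover q.good hO, q.box, ?_⟩⟩
    · intro c hc'
      have : c ∈ α ++ [l] ∨ c ∈ r :: β := by
        simp only [List.mem_append, List.mem_cons, List.not_mem_nil, or_false] at hc' ⊢; tauto
      rcases this with h | h
      · rw [← xL c h]; refine hc c ?_
        simp only [List.mem_append, List.mem_cons, List.not_mem_nil, or_false] at h ⊢; tauto
      · rw [← xR c h]; refine hc c ?_
        simp only [List.mem_append, List.mem_cons, List.not_mem_nil, or_false] at h ⊢; tauto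
    · intro l' o' r' h
      rcases hPd' l' o' r' h with h | ⟨rfl, rfl, rfl⟩
      · have hp := q.pend l' o' r' h
        have hh := hPd l' o' r' h
        exact {
          lr := Or.inl hp.lr, lS := hp.lS, oS := hp.oS, rS := hp.rS
          nx := by
            rcases nx_new.1 hp.nx with h | h | h | h
            · exact (nxc _ _).2 (Or.inl h)
            · exact absurd h hh.1
            · exact absurd h hh.2
            · exact (nxc _ _).2 (Or.inr (Or.inr h))
          free := cov_free_old q.good hO hp.free
          ori := hp.ori, xlo := hp.xlo, xor := hp.xor, slo := hp.slo }
      · exact {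
          lr := Or.inr (Or.inl ⟨rfl, by simp⟩)
          lS := hCS _ (by simp)
          oS := hCS _ (by simp)
          rS := hCS _ (by simp)
          nx := (nxc _ _).2 (Or.inr (Or.inl ⟨rfl, rfl⟩))
          free := cov_free q.good hO
          ori := hO
          xlo := i1
          xor := by linarith
          slo := i2.le }

theorem dr_L {o r : W} (hD : Dr D1 D2 S (α ++ a :: (mid ++ o :: r :: β)) A CR Pd N) (hz : z ∉ S)
    (hD1 : D1 ∈ α ++ [a]) (hD2 : D2 ∈ r :: β)
    (hPd : ∀ l o' r', Pd l o' r' → ¬ Nx (a :: (mid ++ [o])) l r' ∧ ¬ (l = o ∧ r' = r))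
    (hPd' : ∀ l o' r', Pd' l o' r' → Pd l o' r' ∨ (l = z ∧ o' = o ∧ r' = r)) :
    Dr D1 D2 (insert z S) (α ++ a :: z :: r :: β) (Aplus (Aplus A z (a :: (mid ++ [o]))) z [r]) CR Pd'
      (N + 2) := by
  obtain ⟨bx, bY, hB, hF⟩ := hD
  obtain ⟨pwx, pws, hCS⟩ := base_pw hB hF
  have hzo : o ≠ z := by rintro rfl; exact hz (hCS _ (by simp))
  obtain ⟨bx', bY', hB', e1, e2, e3, e4, e5, hF'⟩ := dr_birth hB (R := fun _ _ => True)
    (hF.mono (fun px ps h => ⟨h, trivial⟩)) hR0 hz hD1 (List.mem_cons_of_mem _ hD2) 1 0 1 le_rfl le_rfl one_pos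
    (fun m hm => by have := (pw_fan pwx).1 m hm; linarith) (fun _ => le_rfl)
    (Q' := Qs D1 D2 (insert z S) (α ++ a :: z :: o :: r :: β) (Aplus A z (a :: (mid ++ [o]))) CR Pd) (by
      intro px ps q _ g box B bf
      exact ⟨g, box, fun l o r h => pend_old q.good hz B (q.pend l o r h) (hPd l o r h).1⟩)
  have eC : ∀ L : List W, α ++ a :: z :: L = (α ++ [a]) ++ z :: L := by intro L; simp
  have heo := e4 o (by simp)
  have h5 := e5 o hzo
  rw [eC] at hB' hF'
  have := dr_cover (Pd' := Pd') hB' hF' (by rw [e1, e2, heo, h5]; ring)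
    (by simp only [List.mem_append, List.mem_cons, List.not_mem_nil, or_false] at hD1 ⊢; tauto) hD2 (by
      intro l' o' r' h
      refine ⟨?_, (hPd _ _ _ h).2⟩
      rintro ⟨rfl, rfl⟩
      obtain ⟨px, ps, -, q⟩ := hF bx hB.b1 (fun _ _ _ => le_rfl)
      exact hz (q.pend _ _ _ h).lS) hPd'
  rw [← eC, add_assoc] at this
  exact this

theorem strip {ρ : W → ℝ × ℝ} {l o r : W} (h1 : (ρ l).1 < (ρ o).1) (h2 : (ρ o).1 ≤ (ρ r).1) {p : ℝ × ℝ}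
    (hp : It (ρ l) (ρ o) (ρ r) p) : (ρ l).1 < p.1 ∧ p.1 < (ρ r).1 := by
  obtain ⟨x, y, t, x0, y0, t0, hs, hx, hy⟩ := hp
  constructor
  · rw [hx]; exact lt_lc x0 y0 t0 hs le_rfl h1.le (by linarith) (Or.inr (Or.inl h1))
  · rw [hx]; exact lc_lt x0 y0 t0 hs (by linarith) h2 le_rfl (Or.inl (by linarith))

theorem dr_Z {l o r : W} (hD : Dr D1 D2 S (α ++ a :: (mid ++ b :: β)) A CR Pd N) (hz : z ∉ S)
    (hD1 : D1 ∈ α ++ [a]) (hD2 : D2 ∈ b :: β) (hP : Pd l o r) (hn : Nx (a :: (mid ++ [b])) l r)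
    (hPd' : ∀ l' o' r', Pd' l' o' r' → Pd l' o' r' ∧ ¬ Nx (a :: (mid ++ [b])) l' r')
    (hCR : ∀ u v, Aplus A z (a :: (mid ++ [b])) u v → ¬ CR u v l r)
    (hc : ∀ u v u' v', SameE u v z o → SameE u' v' l r → CR u v u' v' ∧ CR u' v' u v) :
    Dr D1 D2 (insert z S) (α ++ a :: z :: b :: β) (Aplus (Aplus A z (a :: (mid ++ [b]))) z [o]) CR Pd'
      (N + 2) := by
  obtain ⟨bx, bY, hB, hF⟩ := hD
  obtain ⟨pwx, pws, hCS⟩ := base_pw hB hF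
  obtain ⟨bx', bY', hB', -, -, -, -, -, hF'⟩ := dr_birth hB (R := fun _ _ => True)
    (hF.mono (fun px ps h => ⟨h, trivial⟩)) hR0 hz hD1 hD2 1 1 2 le_rfl (by norm_num) (by norm_num)
    (fun m hm => by have := (pw_fan pwx).1 m hm; linarith) (fun _ => by norm_num)
    (Q' := Qs D1 D2 (insert z S) (α ++ a :: z :: b :: β)
      (Aplus (Aplus A z (a :: (mid ++ [b]))) z [o]) CR Pd') (by
      intro px ps q _ g box B bf
      have hp := q.pend l o r hP
      have f1 := free_new q.good hz B hn
      have f2 := free_old q.good hz B hp.free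
      have hlrz := B.ori_pair hn
      have hlor := hp.ori
      have xlo : (Rho px ps l).1 < (Rho px ps o).1 := by simp only [Rho]; exact_mod_cast hp.xlo
      have xor : (Rho px ps o).1 ≤ (Rho px ps r).1 := by simp only [Rho]; exact_mod_cast hp.xor
      have slo : (Rho px ps l).2 ≤ (Rho px ps o).2 := by simp only [Rho]; exact_mod_cast hp.slo
      obtain ⟨cl, cr⟩ := B.nx_cases hn
      have xzr : (Rho px ps z).1 < (Rho px ps r).1 := by
        rcases cr with h | rfl
        · have h1 := bf.gm r h
          have h2 := (pw_fan pwx).1 r h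
          simp only [Rho]; exact_mod_cast (by linarith : px z < px r)
        · exact B.xzb
      have hloz : 0 < ori (Rho px ps l) (Rho px ps o) (Rho px ps z) := by
        rcases cl with rfl | h
        · have id : ((Rho px ps r).1 - (Rho px ps l).1) * ori (Rho px ps l) (Rho px ps o) (Rho px ps z) =
            ((Rho px ps o).1 - (Rho px ps l).1) * ori (Rho px ps l) (Rho px ps r) (Rho px ps z) +
            ((Rho px ps z).1 - (Rho px ps l).1) * ori (Rho px ps l) (Rho px ps o) (Rho px ps r) := by
            unfold ori; ring
          have := B.xaz
          have : 0 < ((Rho px ps r).1 - (Rho px ps l).1) * ori (Rho px ps l) (Rho px ps o) (Rho px ps z) := by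
            rw [id]
            exact add_pos (mul_pos (by linarith) hlrz) (mul_pos (by linarith) hlor)
          exact pos_of_mul_pos_right this (by linarith)
        · have h1 := B.xm l h
          have h2 := B.sm l h
          have a1 := mul_pos (sub_pos.2 xlo) (sub_pos.2 h2)
          have a2 := mul_nonneg (sub_nonneg.2 slo) (sub_nonneg.2 h1)
          unfold ori; nlinarith
      have horz : 0 < ori (Rho px ps o) (Rho px ps r) (Rho px ps z) := by
        have id : ((Rho px ps r).1 - (Rho px ps l).1) * ori (Rho px ps o) (Rho px ps r) (Rho px ps z) =
            ((Rho px ps r).1 - (Rho px ps o).1) * ori (Rho px ps l) (Rho px ps r) (Rho px ps z) +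
            ((Rho px ps r).1 - (Rho px ps z).1) * ori (Rho px ps l) (Rho px ps o) (Rho px ps r) := by
            unfold ori; ring
        have : 0 < ((Rho px ps r).1 - (Rho px ps l).1) * ori (Rho px ps o) (Rho px ps r) (Rho px ps z) := by
            rw [id]
            exact add_pos_of_nonneg_of_pos (mul_nonneg (by linarith) hlrz.le) (mul_pos (by linarith) hlor)
        exact pos_of_mul_pos_right this (by linarith)
      have hseg : ∀ p, Sg (Rho px ps z) (Rho px ps o) p → It (Rho px ps z) (Rho px ps l) (Rho px ps r) p ∨
          Sg (Rho px ps l) (Rho px ps r) p ∨ It (Rho px ps l) (Rho px ps o) (Rho px ps r) p :=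
        fun p hp => sg_kite (by unfold ori at *; linarith) horz hlor hlrz hp
      refine ⟨geo_kite g (Or.inl rfl) (Or.inr hp.oS) (by rintro rfl; exact hz hp.oS) (Or.inl hp.lr)
        f1 f2 hseg hCR hc, box, ?_⟩
      intro l' o' r' h'
      obtain ⟨h1, h2⟩ := hPd' l' o' r' h'
      have hp1 := q.pend l' o' r' h1
      have hp' := pend_old q.good hz B hp1 h2
      exact {
          lr := Or.inl hp'.lr, lS := hp'.lS, oS := hp'.oS, rS := hp'.rS
          nx := hp'.nx
          free := by
            refine kite_free g ?_ hp'.free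
            intro p hs hI
            rcases hseg p hs with h | h | h
            · exact (hp1.free p hI).1 (up_old q.good B (B.up_tri hn h))
            · exact (hp1.free p hI).2.2 l r hp.lr h
            · have s1 := strip xlo xor h
              have s2 := strip (ρ := Rho px ps) (by simp only [Rho]; exact_mod_cast hp1.xlo)
                (by simp only [Rho]; exact_mod_cast hp1.xor) hI
              obtain ⟨rfl, rfl⟩ := nx_unique q.good.xs hp.nx s1.1 s1.2 hp1.nx s2.1.le s2.2.le
              exact h2 hn
          ori := hp'.ori, xlo := hp'.xlo, xor := hp'.xor, slo := hp'.slo })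
  exact ⟨bx', bY', hB', hF'⟩

theorem dr_A {d z1 z2 : W} (hD : Dr D1 D2 S (α ++ a :: d :: β) A CR Pd N) (hz1 : z1 ∉ S) (hz2 : z2 ∉ S)
    (hz : z2 ≠ z1) (hD1 : D1 ∈ α ++ [a]) (hD2 : D2 ∈ d :: β)
    (hPd : ∀ l o r, Pd l o r → ¬ (l = a ∧ r = d))
    (hCR : ∀ u v, Aplus (Aplus A z1 [a, d]) z2 [z1, d] u v → ¬ CR u v z1 d)
    (hc : ∀ u v u' v', SameE u v z2 a → SameE u' v' z1 d → CR u v u' v' ∧ CR u' v' u v) :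
    Dr D1 D2 (insert z2 (insert z1 S)) (α ++ a :: z1 :: z2 :: d :: β)
      (Aplus (Aplus (Aplus A z1 [a, d]) z2 [z1, d]) z2 [a]) CR Pd (N + 3) := by
  obtain ⟨bx, bY, hB, hF⟩ := hD
  obtain ⟨pwx, pws, hCS⟩ := base_pw hB hF
  have haS : a ∈ S := hCS _ (by simp)
  have hdS : d ∈ S := hCS _ (by simp)
  have nfan : ∀ l r : W, Nx (a :: ([] ++ [d])) l r → l = a ∧ r = d := by
    intro l r h; simpa [Nx] using h
  let C1 := α ++ a :: z1 :: d :: β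
  let A1 := Aplus A z1 [a, d]
  let R : (W → ℤ) → (W → ℤ) → Prop := fun px ps =>
    Free (Rho px ps) (insert z1 S) C1 A1 z1 a d ∧
    0 < ori (Rho px ps z1) (Rho px ps a) (Rho px ps d) ∧ px a < px z1 ∧ ps a - px a < ps z1 - px z1 ∧
    ∀ l o r, Pd l o r → ∀ p, It (Rho px ps z1) (Rho px ps a) (Rho px ps d) p →
      ¬ It (Rho px ps l) (Rho px ps o) (Rho px ps r) p
  obtain ⟨bx1, bY1, hB1, e1, e2, e3, e4, e5, hF1⟩ := dr_birth (mid := []) hB (R := fun _ _ => True)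
    (hF.mono (fun px ps h => ⟨h, trivial⟩)) hR0 hz1 hD1 hD2 1 0 2 le_rfl le_rfl (by norm_num)
    (fun m hm => by simp at hm) (fun _ => by norm_num)
    (Q' := fun px ps => Qs D1 D2 (insert z1 S) C1 A1 CR Pd px ps ∧ R px ps) (by
      intro px ps q _ g box B bf
      have hn : Nx (a :: ([] ++ [d])) a d := Or.inl ⟨rfl, rfl⟩
      refine ⟨⟨g, box, fun l o r h => pend_old q.good hz1 B (q.pend l o r h)
        (fun h' => hPd _ _ _ h (nfan _ _ h'))⟩, free_new q.good hz1 B hn, ?_, ?_, ?_, ?_⟩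
      · have := B.ori_pair hn
        unfold ori at *; linarith
      · have := bf.ga; linarith
      · have h1 := bf.hz
        have h2 := bf.hc a (by simp)
        have h3 := (pw_fan (mid := []) pws).2.1
        linarith
      · intro l o r h p hp hI
        exact ((q.pend l o r h).free p hI).1 (up_old q.good B (B.up_tri hn hp)))
  have eC : ∀ L : List W, α ++ a :: z1 :: L = (α ++ [a]) ++ z1 :: L := by intro L; simp
  have hd1 := e4 d (by simp)
  have ha1 := e3 a (by simp)
  have hdz : d ≠ z1 := by rintro rfl; exact hz1 hdS
  have hbd := e5 d hdz
  have eC1 : C1 = (α ++ [a]) ++ z1 :: ([] ++ d :: β) := by simp [C1]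
  have hF1' : Flx D1 ((α ++ [a]) ++ z1 :: ([] ++ d :: β)) bx1 bY1 (fun px ps =>
      Qs D1 D2 (insert z1 S) ((α ++ [a]) ++ z1 :: ([] ++ d :: β)) A1 CR Pd px ps ∧ R px ps) := by
    rw [← eC1]; exact hF1
  rw [eC] at hB1
  have hz2' : z2 ∉ (insert z1 S : Set W) := by rintro (h | h); exacts [hz h, hz2 h]
  obtain ⟨bx2, bY2, hB2, -, -, -, -, -, hF2⟩ := dr_birth (mid := []) hB1 (R := R) hF1' (by
      intro px ps px' ps' q hx hs h
      have hR : ∀ w ∈ (insert z1 S : Set W), Rho px' ps' w = Rho px ps w := fun w hw => by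
        unfold Rho; rw [hx w hw, hs w hw]
      obtain ⟨h1, h2, h3, h4, h5⟩ := h
      have k1 := hR z1 (Or.inl rfl)
      have k2 := hR a (Or.inr haS)
      have k3 := hR d (Or.inr hdS)
      rw [← eC1] at q
      refine ⟨Free.congr q.good hR (Or.inl rfl) (Or.inr haS) (Or.inr hdS) h1, ?_, ?_, ?_, ?_⟩
      · rw [k1, k2, k3]; exact h2
      · rw [hx _ (Or.inl rfl), hx _ (Or.inr haS)]; exact h3
      · rw [hx _ (Or.inl rfl), hx _ (Or.inr haS), hs _ (Or.inl rfl), hs _ (Or.inr haS)]; exact h4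
      · intro l o r h
        have hp := q.pend l o r h
        rw [k1, k2, k3, hR l hp.lS, hR o hp.oS, hR r hp.rS]
        exact h5 l o r h) hz2'
    (by simp only [List.mem_append, List.mem_cons, List.not_mem_nil, or_false] at hD1 ⊢; tauto) hD2
    1 0 1 le_rfl le_rfl (by norm_num)
    (fun m hm => by simp at hm) (fun _ => by norm_num)
    (Q' := Qs D1 D2 (insert z2 (insert z1 S)) ((α ++ [a]) ++ z1 :: z2 :: d :: β)
      (Aplus (Aplus A1 z2 [z1, d]) z2 [a]) CR Pd) (by
      intro px ps q hR g box B bf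
      obtain ⟨h1, h2, h3, h4, h5⟩ := hR
      have hn : Nx (z1 :: ([] ++ [d])) z1 d := Or.inl ⟨rfl, rfl⟩
      have f1 := free_new q.good hz2' B hn
      have f2 := free_old q.good hz2' B (by rw [← eC1]; exact h1)
      have hzda := B.ori_pair hn
      have ybf := bf.hz
      have yz1 := bf.hc z1 (by simp)
      have xz12 := bf.ga
      have xz2d := bf.gb
      have yd := bf.hc d (by simp)
      have bad := (pw_fan (mid := []) pwx).2.1
      rw [e2] at yz1
      rw [hd1, hbd, e1] at ybf
      rw [hd1, e1] at xz2d
      rw [hbd] at yd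
      have yy : ps z2 - px z2 = ps z1 - px z1 := by linarith
      have o1 : 0 < ori (Rho px ps z2) (Rho px ps z1) (Rho px ps a) := by
        have : 0 < (px z1 - px z2) * (ps a - ps z2) - (ps z1 - ps z2) * (px a - px z2) := by
          have e : (px z1 - px z2) * (ps a - ps z2) - (ps z1 - ps z2) * (px a - px z2)
            = (px z2 - px z1) * ((ps z1 - px z1) - (ps a - px a)) := by
            have e' : ps z2 = ps z1 - px z1 + px z2 := by linarith
            rw [e']; ring
          rw [e]; exact mul_pos (by linarith) (by linarith)
        simp only [Rho, ori]; exact_mod_cast this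
      have o2 : 0 < ori (Rho px ps a) (Rho px ps d) (Rho px ps z2) := by
        have j1 : px a < px z2 := by linarith
        have j2 : px z2 < px d := by linarith
        have j3 : ps a - px a ≤ ps z2 - px z2 := by linarith
        have j4 : ps d - px d < ps z2 - px z2 := by linarith
        have j5 : ps z2 ≤ ps d := by linarith
        have : 0 < (px d - px a) * (ps z2 - ps a) - (ps d - ps a) * (px z2 - px a) := by nlinarith
        simp only [Rho, ori]; exact_mod_cast this
      have hseg : ∀ p, Sg (Rho px ps z2) (Rho px ps a) p → It (Rho px ps z2) (Rho px ps z1) (Rho px ps d) p ∨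
          Sg (Rho px ps z1) (Rho px ps d) p ∨ It (Rho px ps z1) (Rho px ps a) (Rho px ps d) p :=
        fun p hp => sg_kite o1 o2 h2 hzda hp
      have hA : A1 z1 d := Or.inr (Or.inl ⟨rfl, by simp⟩)
      refine ⟨geo_kite g (Or.inl rfl) (Or.inr (Or.inr haS)) (by rintro rfl; exact hz2 haS)
        (Or.inl hA) f1 f2 hseg hCR hc, box, ?_⟩
      intro l o r h
      have hp1 := q.pend l o r h
      have hlz : l ≠ z1 := by
        rintro rfl
        obtain ⟨px, ps, -, q⟩ := hF bx hB.b1 (fun _ _ _ => le_rfl)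
        exact hz1 (q.pend _ _ _ h).lS
      have hp' := pend_old q.good hz2' B hp1 (by
        intro h'
        rcases h' with ⟨h', -⟩ | h'
        · exact hlz h'
        · exact h'.elim)
      exact {
          lr := Or.inl hp'.lr, lS := hp'.lS, oS := hp'.oS, rS := hp'.rS
          nx := hp'.nx
          free := by
            refine kite_free g ?_ hp'.free
            intro p hs hI
            rcases hseg p hs with h' | h' | h'
            · exact (hp1.free p hI).1 (up_old q.good B (B.up_tri hn h'))
            · exact (hp1.free p hI).2.2 _ _ hA h'
            · exact h5 l o r h p h' hI
          ori := hp'.ori, xlo := hp'.xlo, xor := hp'.xor, slo := hp'.slo })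
  rw [← eC] at hB2 hF2
  refine ⟨bx2, bY2, ?_, hF2⟩
  rw [show N + 3 = N + 2 + 1 by ring]
  exact hB2

end ops

section lists
variable {W : Type}

theorem nx_cons_iff {x c d : W} {l : List W} : Nx (x :: l) c d ↔ (c = x ∧ ∃ l', l = d :: l') ∨ Nx l c d := by
  cases l with
  | nil => simp [Nx]
  | cons y l =>
    simp only [Nx]
    constructor
    · rintro (⟨rfl, rfl⟩ | h)
      · exact Or.inl ⟨rfl, _, rfl⟩
      · exact Or.inr h
    · rintro (⟨rfl, _, h⟩ | h)
      · cases h; exact Or.inl ⟨rfl, rfl⟩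
      · exact Or.inr h

theorem nx_split {c d : W} : ∀ {l : List W}, Nx l c d → ∃ α β, l = α ++ c :: d :: β
  | [], h => h.elim
  | [_], h => h.elim
  | x :: y :: l, h => by
    rcases h with ⟨rfl, rfl⟩ | h
    · exact ⟨[], l, rfl⟩
    · obtain ⟨α, β, e⟩ := nx_split h
      exact ⟨x :: α, β, by rw [e]; rfl⟩

theorem nx_of_split {c d : W} (α β : List W) : Nx (α ++ c :: d :: β) c d := by
  rw [nx_append]; right; left; exact ⟨rfl, rfl⟩

theorem nx_u2 {l : List W} (h : l.Nodup) {c d d' : W} (h1 : Nx l c d) (h2 : Nx l c d') : d = d' := by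
  induction l with
  | nil => exact h1.elim
  | cons x l ih =>
    rw [List.nodup_cons] at h
    rw [nx_cons_iff] at h1 h2
    rcases h1 with ⟨rfl, l', e⟩ | h1 <;> rcases h2 with ⟨h2, l'', e'⟩ | h2
    · rw [e] at e'; cases e'; rfl
    · exact (h.1 h2.mem.1).elim
    · subst h2; exact (h.1 h1.mem.1).elim
    · exact ih h.2 h1 h2

theorem nx_u1 {l : List W} (h : l.Nodup) {c c' d : W} (h1 : Nx l c d) (h2 : Nx l c' d) : c = c' := by
  induction l with
  | nil => exact h1.elim
  | cons x l ih =>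
    rw [nx_cons_iff] at h1 h2
    rw [List.nodup_cons] at h
    have key : ∀ {l' : List W} {c : W}, l = d :: l' → ¬ Nx l c d := by
      intro l' c e hn
      rw [e] at hn h
      rw [List.nodup_cons] at h
      rw [nx_cons_iff] at hn
      rcases hn with ⟨_, l'', rfl⟩ | hn
      · exact h.2.1 (by simp)
      · exact h.2.1 hn.mem.2
    rcases h1 with ⟨rfl, l', e⟩ | h1 <;> rcases h2 with ⟨h2, l'', e'⟩ | h2
    · exact h2.symm
    · exact (key e h2).elim
    · exact (key e' h1).elim
    · exact ih h.2 h1 h2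

theorem nx_snoc {l : List W} {x y c d : W} : Nx (l ++ [x, y]) c d ↔ Nx (l ++ [x]) c d ∨ (c = x ∧ d = y) := by
  rw [nx_append]; simp [Nx]

end lists

namespace Kites
variable {W ι : Type} [Fintype W] (K : Kites W ι) (T : Tri W)

/-- combinatorial contour state -/
structure WSt (S : Set W) (C : List W) : Prop where
  hd : ∃ l, C = K.D1 :: l
  lt : ∃ l, C = l ++ [K.D2]
  nodup : C.Nodup
  sub : ∀ c ∈ C, c ∈ S
  D3 : K.D3 ∉ S
  dart : ∀ a ∈ S, ∀ b ∈ S, ((∃ t, t ∉ S ∧ T.F a b t) ↔ (Nx C a b ∨ (a = K.D2 ∧ b = K.D1)))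
  int : ∀ y ∈ S, y ∉ C → ∀ w, T.E y w → w ∈ S

variable {K T}
variable {S : Set W} {C : List W}

theorem WSt.nD1 (h : K.WSt T S C) {a : W} : ¬ Nx C a K.D1 := by
  intro hn
  obtain ⟨l, e⟩ := h.hd
  have hnd := h.nodup
  rw [e] at hn hnd
  rw [List.nodup_cons] at hnd
  rw [nx_cons_iff] at hn
  rcases hn with ⟨_, l', rfl⟩ | hn
  · simp at hnd
  · exact hnd.1 hn.mem.2

theorem WSt.nD2 (h : K.WSt T S C) {a : W} : ¬ Nx C K.D2 a := by
  intro hn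
  obtain ⟨l, e⟩ := h.lt
  obtain ⟨α, β, e'⟩ := nx_split hn
  have hnd := h.nodup
  rw [e] at e' hnd
  have : l ++ [K.D2] = (α ++ [K.D2]) ++ a :: β := by rw [e']; simp
  have h2 : ∃ γ, a :: β = γ ++ [K.D2] := by
    refine ⟨(a :: β).dropLast, ?_⟩
    have hl : (l ++ [K.D2]).getLast? = ((α ++ [K.D2]) ++ a :: β).getLast? := by rw [this]
    rw [List.getLast?_append, List.getLast?_append] at hl
    simp only [List.getLast?_singleton, Option.some_or] at hl
    have hh : (a :: β).getLast (by simp) = K.D2 := by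
      have := List.getLast?_eq_some_getLast (l := a :: β) (by simp)
      rw [this] at hl
      simpa using hl.symm
    conv_lhs => rw [← List.dropLast_append_getLast (l := a :: β) (by simp)]
    rw [hh]
  obtain ⟨γ, hγ⟩ := h2
  rw [hγ] at this
  rw [this] at hnd
  rw [List.nodup_append] at hnd
  exact hnd.2.2 K.D2 (by simp) K.D2 (by simp) rfl

theorem WSt.F_of_nx (h : K.WSt T S C) {a b : W} (hn : Nx C a b) : ∃ t, t ∉ S ∧ T.F a b t :=
  (h.dart a (h.sub a hn.mem.1) b (h.sub b hn.mem.2)).2 (Or.inl hn)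

theorem WSt.split (h : K.WSt T S C) {v : W} (hv : v ∈ C) (h1 : v ≠ K.D1) (h2 : v ≠ K.D2) :
    ∃ α a b β, C = α ++ a :: v :: b :: β := by
  obtain ⟨α, β, e⟩ := List.append_of_mem hv
  obtain ⟨l1, e1⟩ := h.hd
  obtain ⟨l2, e2⟩ := h.lt
  rcases List.eq_nil_or_concat' α with rfl | ⟨α', a, rfl⟩
  · rw [e] at e1; simp at e1; exact (h1 e1.1).elim
  cases β with
  | nil =>
    rw [e] at e2
    have := List.append_inj' e2 rfl
    simp at this; exact (h2 this.2).elim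
  | cons b β => exact ⟨α', a, b, β, by rw [e]; simp⟩

theorem WSt.mids (h : K.WSt T S C) {α β : List W} {a v b : W} (e : C = α ++ a :: v :: b :: β) :
    K.D1 ∈ α ++ [a] ∧ K.D2 ∈ b :: β ∧ v ≠ K.D1 ∧ v ≠ K.D2 ∧ Nx C a v ∧ Nx C v b := by
  have ha : Nx C a v := by rw [e]; exact nx_of_split _ _
  have hb : Nx C v b := by
    rw [e, show α ++ a :: v :: b :: β = (α ++ [a]) ++ v :: b :: β by simp]; exact nx_of_split _ _
  refine ⟨?_, ?_, ?_, ?_, ha, hb⟩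
  · obtain ⟨l, hl⟩ := h.hd
    rw [e] at hl
    cases α with
    | nil => simp at hl; simp [hl.1]
    | cons x α => simp at hl; simp [hl.1]
  · obtain ⟨l, hl⟩ := h.lt
    rw [e, show α ++ a :: v :: b :: β = (α ++ [a, v]) ++ b :: β by simp] at hl
    have : (b :: β).getLast? = some K.D2 := by
      have h2 := congrArg List.getLast? hl
      rw [List.getLast?_append, List.getLast?_append] at h2
      have := List.getLast?_eq_some_getLast (l := b :: β) (by simp)
      rw [this] at h2 ⊢
      simpa using h2
    exact List.mem_of_getLast? this
  · rintro rfl; exact h.nD1 ha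
  · rintro rfl; exact h.nD2 hb

theorem nx_next {W : Type} {a b p : W} {mid : List W} (hp : p ∈ a :: (mid ++ [b])) (hpb : p ≠ b) :
    ∃ q, Nx (a :: (mid ++ [b])) p q := by
  obtain ⟨x, y, hxy⟩ := List.append_of_mem hp
  cases y with
  | nil =>
    have : (a :: mid) ++ [b] = x ++ [p] := by rw [← hxy]; simp
    have := List.append_inj' this rfl
    simp at this; exact (hpb this.2.symm).elim
  | cons q y => exact ⟨q, by rw [hxy]; exact nx_of_split _ _⟩

theorem fan_fresh {v a x y : W} {l l' : List W} (hl' : l ++ [x] = a :: l')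
    (hF : ∀ u u', Nx (l ++ [x]) u u' → T.F v u u') (hnd : (l ++ [x]).Nodup) (hy : T.F v x y) (hya : y ≠ a) :
    y ∉ l ++ [x] := by
  intro hyl
  obtain ⟨p, q, hpq⟩ := List.append_of_mem hyl
  rcases List.eq_nil_or_concat' p with rfl | ⟨p, w, rfl⟩
  · rw [hl'] at hpq; simp at hpq; exact hya hpq.1.symm
  · have hn : Nx (l ++ [x]) w y := by
      rw [hpq]; simp only [List.append_assoc, List.singleton_append]; exact nx_of_split _ _
    have := T.u2 hy (hF _ _ hn)
    subst this
    rcases List.eq_nil_or_concat' (y :: q) with h | ⟨q', z, h⟩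
    · simp at h
    rw [h, show p ++ [x] ++ (q' ++ [z]) = (p ++ x :: q') ++ [z] by simp] at hpq
    rw [List.nodup_append] at hnd
    exact hnd.2.2 x (by rw [(List.append_inj' hpq rfl).1]; simp) x (by simp) rfl

theorem nx_fanE {a v b : W} {mid : List W} (hF : ∀ u u', Nx (a :: (mid ++ [b])) u u' → T.F v u u') :
    ∀ u ∈ mid, T.E v u := by
  intro u hu
  obtain ⟨m1, m2, rfl⟩ := List.append_of_mem hu
  obtain ⟨c, m3, hc⟩ : ∃ c m3, m2 ++ [b] = c :: m3 := by cases m2 <;> simp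
  have : Nx (a :: ((m1 ++ u :: m2) ++ [b])) u c := by
    have : a :: ((m1 ++ u :: m2) ++ [b]) = (a :: m1) ++ u :: c :: m3 := by simp [hc]
    rw [this]; exact nx_of_split _ _
  exact (hF _ _ this).e12

theorem WSt.fan (h : K.WSt T S C) {α β : List W} {a v b : W} (e : C = α ++ a :: v :: b :: β) :
    ∃ mid : List W, (∀ u u', Nx (a :: (mid ++ [b])) u u' → T.F v u u') ∧
      (a :: (mid ++ [b])).Nodup ∧ (∀ u ∈ a :: (mid ++ [b]), u ∈ S) ∧
      (∀ u ∈ S, T.E v u → u ∈ a :: (mid ++ [b])) := by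
  obtain ⟨hD1, hD2, hv1, hv2, hav, hvb⟩ := h.mids e
  have haS := h.sub a hav.mem.1
  have hbS := h.sub b hvb.mem.2
  have hvS := h.sub v hav.mem.2
  obtain ⟨t, htS, ht⟩ := h.F_of_nx hav
  obtain ⟨t', htS', ht'⟩ := h.F_of_nx hvb
  have hab : a ≠ b := by
    have := h.nodup
    rw [e, List.nodup_append] at this
    have := this.2.1
    simp at this; exact fun hh => this.1.2.1 hh
  have out : ∀ u ∈ S, ∀ u', T.F v u u' → u' ∉ S → u = b := by
    intro u hu u' hF hu'
    rcases (h.dart v hvS u hu).1 ⟨u', hu', hF⟩ with hn | hn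
    · exact nx_u2 h.nodup hn hvb
    · exact (hv2 hn.1).elim
  have inn : ∀ u ∈ S, ∀ u', T.F v u' u → u' ∉ S → u = a := by
    intro u hu u' hF hu'
    rcases (h.dart u hu v hvS).1 ⟨u', hu', hF.cyc2⟩ with hn | hn
    · exact nx_u1 h.nodup hn hav
    · exact (hv1 hn.2).elim
  have main : ∀ n : ℕ, (∃ mid : List W, (∀ u u', Nx (a :: (mid ++ [b])) u u' → T.F v u u') ∧
      (a :: (mid ++ [b])).Nodup ∧ (∀ u ∈ a :: (mid ++ [b]), u ∈ S)) ∨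
      (∃ l : List W, ∃ x, l.length = n ∧ (∃ l', l ++ [x] = a :: l') ∧ (∀ u u', Nx (l ++ [x]) u u' → T.F v u u') ∧
        (l ++ [x]).Nodup ∧ (∀ u ∈ l ++ [x], u ∈ S) ∧ b ∉ l ++ [x] ∧ T.E v x) := by
    intro n
    induction n with
    | zero =>
      right
      refine ⟨[], a, rfl, ⟨[], rfl⟩, by simp [Nx], by simp, by simpa using haS, by simpa using hab.symm, ht.e12.symm⟩
    | succ n ih =>
      rcases ih with ih | ⟨l, x, hl, ⟨l', hl'⟩, hF, hnd, hS, hb, hE⟩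
      · exact Or.inl ih
      obtain ⟨y, hy⟩ := hE
      have hxS : x ∈ S := hS x (by simp)
      have hyS : y ∈ S := by
        by_contra hyS
        exact hb (by rw [← out x hxS y hy hyS]; simp)
      have hyl : y ∉ l ++ [x] := by
        refine fan_fresh hl' hF hnd hy ?_
        rintro rfl
        exact htS (T.u2 hy ht.cyc ▸ hxS)
      have hF' : ∀ u u', Nx (l ++ [x] ++ [y]) u u' → T.F v u u' := by
        intro u u' hn
        rw [List.append_assoc, List.singleton_append, nx_snoc] at hn
        rcases hn with hn | ⟨rfl, rfl⟩
        · exact hF _ _ hn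
        · exact hy
      have hnd' : (l ++ [x] ++ [y]).Nodup := by
        rw [List.nodup_append]
        refine ⟨hnd, by simp, ?_⟩
        intro p hp q hq hpq
        simp only [List.mem_singleton] at hq
        subst hq; subst hpq; exact hyl hp
      have hS' : ∀ u ∈ l ++ [x] ++ [y], u ∈ S := by
        intro u hu
        rcases List.mem_append.1 hu with hu | hu
        · exact hS u hu
        · simp at hu; rw [hu]; exact hyS
      by_cases hyb : y = b
      · left
        subst hyb
        rw [hl'] at hF' hnd' hS'
        exact ⟨l', hF', hnd', hS'⟩
      · right
        refine ⟨l ++ [x], y, by simp [hl], ⟨l' ++ [y], by rw [hl']; simp⟩, hF', hnd', hS', ?_, hy.e31.symm⟩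
        intro hh
        rcases List.mem_append.1 hh with hh | hh
        · exact hb hh
        · simp at hh; exact hyb hh.symm
  rcases main (Fintype.card W) with ⟨mid, h1, h2, h3⟩ | ⟨l, x, hl, -, -, hnd, -⟩
  · refine ⟨mid, h1, h2, h3, ?_⟩
    intro u hu hE
    have := T.link v {w | w ∈ S → w ∈ a :: (mid ++ [b])} a (fun _ => by simp) ht.e12.symm (by
      intro p q hp hF hq
      by_cases hpS : p ∈ S
      · have hp' := hp hpS
        by_cases hpb : p = b
        · subst hpb
          rw [T.u3 hF ht'] at hq
          exact (htS' hq).elim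
        · obtain ⟨q', hq'⟩ := nx_next hp' hpb
          rw [T.u3 hF (h1 _ _ hq')]
          exact hq'.mem.2
      · rw [inn q hq p hF hpS]; simp) u hE
    exact this hu
  · have := hnd.length_le_card
    simp [hl] at this

/-- removing a contour vertex without chords -/
theorem WSt.remove (h : K.WSt T S C) {α β mid : List W} {a v b : W} (e : C = α ++ a :: v :: b :: β)
    (hF : ∀ u u', Nx (a :: (mid ++ [b])) u u' → T.F v u u')
    (hnd : (a :: (mid ++ [b])).Nodup) (hS : ∀ u ∈ a :: (mid ++ [b]), u ∈ S)
    (hall : ∀ u ∈ S, T.E v u → u ∈ a :: (mid ++ [b])) (hm : ∀ u ∈ mid, u ∉ C) :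
    K.WSt T (S \ {v}) (α ++ a :: (mid ++ b :: β)) := by
  obtain ⟨hD1, hD2, hv1, hv2, hav, hvb⟩ := h.mids e
  obtain ⟨t', htS', ht'⟩ := h.F_of_nx hvb
  have hvS := h.sub v hav.mem.2
  have hCn := h.nodup
  rw [e, List.nodup_append] at hCn
  obtain ⟨n1, n2, n3⟩ := hCn
  simp only [List.nodup_cons, List.mem_cons, not_or] at n2
  have hvm : v ∉ mid := fun hh => hm v hh (by rw [e]; simp)
  have hmem : ∀ w, w ∈ α ++ a :: (mid ++ b :: β) ↔ (w ∈ C ∧ w ≠ v) ∨ w ∈ mid := by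
    intro w
    have hva : v ∉ α := fun hh => n3 v hh v (by simp) rfl
    rw [e]
    simp only [List.mem_append, List.mem_cons]
    constructor
    · rintro (h | h | h | h | h)
      · exact Or.inl ⟨Or.inl h, fun e => hva (e ▸ h)⟩
      · exact Or.inl ⟨Or.inr (Or.inl h), fun e => n2.1.1 (by rw [← h, e])⟩
      · exact Or.inr h
      · exact Or.inl ⟨by simp [h], fun e => n2.2.1.1 (by rw [← h, e])⟩
      · exact Or.inl ⟨by simp [h], fun e => n2.2.1.2 (by rw [← e]; exact h)⟩
    · rintro (⟨h | h | h | h | h, h'⟩ | h) <;> simp_all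
  refine ⟨?_, ?_, ?_, ?_, fun hh => h.D3 hh.1, ?_, ?_⟩
  · obtain ⟨l, hl⟩ := h.hd
    rw [e] at hl
    cases α with
    | nil => simp at hl; exact ⟨_, by rw [← hl.1]; rfl⟩
    | cons x α => simp at hl; exact ⟨_, by rw [← hl.1]; rfl⟩
  · obtain ⟨l, hl⟩ := h.lt
    have hl' : (b :: β).getLast (by simp) = K.D2 := by
      rw [e, show α ++ a :: v :: b :: β = (α ++ [a, v]) ++ b :: β by simp] at hl
      have h2 := congrArg List.getLast? hl
      rw [List.getLast?_append, List.getLast?_append] at h2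
      have := List.getLast?_eq_some_getLast (l := b :: β) (by simp)
      rw [this] at h2
      simpa using h2
    refine ⟨α ++ a :: (mid ++ (b :: β).dropLast), ?_⟩
    have := List.dropLast_append_getLast (l := b :: β) (by simp)
    rw [hl'] at this
    conv_lhs => rw [← this]
    simp
  · rw [List.nodup_append, List.nodup_cons, List.nodup_append]
    rw [List.nodup_cons, List.nodup_append] at hnd
    simp only [List.mem_append, List.mem_cons, not_or] at hnd ⊢
    have hmC : ∀ w, w ∈ mid → w ∉ C := hm
    rw [e] at hmC
    simp only [List.mem_append, List.mem_cons, not_or] at hmC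
    simp only [List.mem_cons] at n3
    refine ⟨n1, ⟨⟨hnd.1.1, n2.1.2⟩, hnd.2.1, ?_, ?_⟩, ?_⟩
    · exact List.nodup_cons.2 n2.2.2
    · intro p hp q hq hpq
      subst hpq
      have := hmC p hp
      grind
    · intro p hp q hq hpq
      subst hpq
      have := n3 p hp p
      have := hmC p
      grind
  · intro c hc
    rcases (hmem c).1 hc with ⟨h1, h2⟩ | h1
    · exact ⟨h.sub c h1, h2⟩
    · exact ⟨hS c (by simp [h1]), fun e => hvm (by rw [← e]; exact h1)⟩
  · rintro p ⟨hp, hpv⟩ q ⟨hq, hqv⟩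
    simp only [Set.mem_singleton_iff] at hpv hqv
    rw [nx_old]
    constructor
    · rintro ⟨t, ht, hpqt⟩
      by_cases htS : t ∈ S
      · have htv : t = v := by
          by_contra hne; exact ht ⟨htS, hne⟩
        subst htv
        have hp' := hall p hp hpqt.e31
        left; right; left
        have hpb : p ≠ b := by
          rintro rfl
          rw [T.u3 hpqt.cyc2 ht'] at hq
          exact htS' hq
        obtain ⟨q', hq'⟩ := nx_next hp' hpb
        rw [T.u3 hpqt.cyc2 (hF _ _ hq')]
        exact hq'
      · rcases (h.dart p hp q hq).1 ⟨t, htS, hpqt⟩ with hn | hn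
        · rw [e, nx_new] at hn
          rcases hn with hn | ⟨_, hn⟩ | ⟨hn, _⟩ | hn
          · exact Or.inl (Or.inl hn)
          · exact (hqv hn).elim
          · exact (hpv hn).elim
          · exact Or.inl (Or.inr (Or.inr hn))
        · exact Or.inr hn
    · have key : (Nx C p q ∨ p = K.D2 ∧ q = K.D1) → ∃ t, t ∉ S \ {v} ∧ T.F p q t := by
        intro hn
        obtain ⟨t, ht, ht2⟩ := (h.dart p hp q hq).2 hn
        exact ⟨t, fun hh => ht hh.1, ht2⟩
      rintro ((hn | hn | hn) | hn)
      · exact key (Or.inl (by rw [e, nx_new]; exact Or.inl hn))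
      · exact ⟨v, by simp, (hF _ _ hn).cyc⟩
      · exact key (Or.inl (by rw [e, nx_new]; exact Or.inr (Or.inr (Or.inr hn))))
      · exact key (Or.inr hn)
  · rintro y ⟨hy, hyv⟩ hyC w hw
    simp only [Set.mem_singleton_iff] at hyv
    rw [hmem] at hyC
    push Not at hyC
    have hyC' : y ∉ C := fun hh => hyv (hyC.1 hh)
    refine ⟨h.int y hy hyC' w hw, ?_⟩
    rintro rfl
    have := hall y hy hw.symm
    simp only [List.mem_cons, List.mem_append, List.not_mem_nil, or_false] at this
    rcases this with rfl | h' | rfl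
    · exact hyC' hav.mem.1
    · exact hyC.2 h'
    · exact hyC' hvb.mem.2

end Kites

theorem nx_idx {W : Type} {d : W} {a b : W} : ∀ {l : List W}, Nx l a b ↔
    ∃ i, i + 1 < l.length ∧ a = l.getD i d ∧ b = l.getD (i + 1) d
  | [] => by simp [Nx]
  | [x] => by simp [Nx]
  | x :: y :: l => by
    have ih := nx_idx (d := d) (a := a) (b := b) (l := y :: l)
    simp only [Nx]
    rw [ih]
    constructor
    · rintro (⟨rfl, rfl⟩ | ⟨i, hi, h1, h2⟩)
      · exact ⟨0, by simp, by simp, by simp⟩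
      · exact ⟨i + 1, by simpa using hi, by simpa using h1, by simpa using h2⟩
    · rintro ⟨i, hi, h1, h2⟩
      cases i with
      | zero => left; simpa using ⟨h1, h2⟩
      | succ i => right; exact ⟨i, by simpa using hi, by simpa using h1, by simpa using h2⟩

theorem mem_idx {W : Type} {d x : W} {l : List W} : x ∈ l ↔ ∃ i, i < l.length ∧ x = l.getD i d := by
  rw [List.mem_iff_getElem]
  constructor
  · rintro ⟨i, hi, h⟩; exact ⟨i, hi, by rw [List.getD_eq_getElem _ _ hi, h]⟩
  · rintro ⟨i, hi, h⟩; exact ⟨i, hi, by rw [h, List.getD_eq_getElem _ _ hi]⟩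

theorem inj_idx {W : Type} {d : W} {l : List W} (h : l.Nodup) {i j : ℕ} (hi : i < l.length) (hj : j < l.length)
    (e : l.getD i d = l.getD j d) : i = j := by
  rw [List.getD_eq_getElem _ _ hi, List.getD_eq_getElem _ _ hj] at e
  exact (h.getElem_inj_iff).1 e

theorem tele2 (g : ℕ → ZMod 2) (i j : ℕ) (h : i ≤ j) : ∑ t ∈ Finset.Ico i j, (g t + g (t + 1)) = g i + g j := by
  induction j, h using Nat.le_induction with
  | base => simp [z2self]
  | succ j hj ih =>
    rw [Finset.sum_Ico_succ_top hj, ih]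
    have := z2self (g j)
    linear_combination this

namespace Kites
variable {W ι : Type} [Fintype W] {K : Kites W ι} {T : Tri W} {S : Set W} {C : List W}

open Classical in
theorem WSt.jordan (h : K.WSt T S C) {i j : ℕ} (hij : i < j) (hj : j < C.length)
    {zc : W → W → ZMod 2} {Y : Set W} (hYS : ∀ y ∈ Y, y ∈ S ∧ y ∉ C) (hsym : ∀ a b, zc a b = zc b a)
    (hsup : ∀ a b, zc a b ≠ 0 → T.E a b ∧ (a = C.getD i K.D1 ∨ a = C.getD j K.D1 ∨ a ∈ Y))
    (hdeg : ∀ a, ∑ b, zc a b = (if a = C.getD i K.D1 then 1 else 0) + (if a = C.getD j K.D1 then 1 else 0)) :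
    ∀ k, i < k → k < j → ∀ k', k' < C.length → (k' < i ∨ j < k') →
      ¬ T.E (C.getD k K.D1) (C.getD k' K.D1) ∧
      ∀ x ∈ S, x ∉ C → x ∉ Y → T.E (C.getD k K.D1) x → ¬ T.E x (C.getD k' K.D1) := by
  intro k hik hkj k' hk' hkk
  set w : ℕ → W := fun t => C.getD t K.D1 with hw
  have winj : ∀ {s t : ℕ}, s < C.length → t < C.length → w s = w t → s = t := fun hs ht e => inj_idx h.nodup hs ht e
  have wnx : ∀ t, t + 1 < C.length → Nx C (w t) (w (t + 1)) := fun t ht => nx_idx.2 ⟨t, ht, rfl, rfl⟩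
  have wC : ∀ t, t < C.length → w t ∈ C := fun t ht => mem_idx.2 ⟨t, ht, rfl⟩
  change ¬ T.E (w k) (w k') ∧ ∀ x ∈ S, x ∉ C → x ∉ Y → T.E (w k) x → ¬ T.E x (w k')
  have hsup' : ∀ a b, zc a b ≠ 0 → T.E a b ∧ (a = w i ∨ a = w j ∨ a ∈ Y) := hsup
  let z : W → W → ZMod 2 := fun a b => ∑ t ∈ Finset.Ico i j, ed (w t) (w (t + 1)) a b + zc a b
  have zsym : ∀ a b, z a b = z b a := by
    intro a b; simp only [z]; rw [hsym a b]; congr 1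
    exact Finset.sum_congr rfl (fun t _ => ed_symm _ _ _ _)
  have edz : ∀ t a b, ed (w t) (w (t + 1)) a b ≠ 0 → (a = w t ∧ b = w (t + 1)) ∨ (a = w (t + 1) ∧ b = w t) := by
    intro t a b hne
    unfold ed at hne
    by_contra hh
    rw [if_neg hh] at hne; exact hne rfl
  have zne : ∀ a b, z a b ≠ 0 → (∃ t, i ≤ t ∧ t < j ∧ ((a = w t ∧ b = w (t + 1)) ∨ (a = w (t + 1) ∧ b = w t))) ∨ zc a b ≠ 0 := by
    intro a b hne
    by_contra hh
    push Not at hh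
    apply hne
    simp only [z]
    rw [hh.2, Finset.sum_eq_zero]
    · simp
    · intro t ht
      rw [Finset.mem_Ico] at ht
      by_contra hn
      rcases edz t a b hn with hn | hn
      · exact (hh.1 t ht.1 ht.2).1 hn.1 hn.2
      · exact (hh.1 t ht.1 ht.2).2 hn.1 hn.2
  have zE : ∀ a b, z a b ≠ 0 → T.E a b := by
    intro a b hne
    rcases zne a b hne with ⟨t, h1, h2, h3⟩ | h1
    · obtain ⟨s, _, hs⟩ := h.F_of_nx (wnx t (by omega))
      rcases h3 with ⟨rfl, rfl⟩ | ⟨rfl, rfl⟩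
      · exact hs.e12
      · exact hs.e12.symm
    · exact (hsup a b h1).1
  have zdeg : ∀ a, ∑ b, z a b = 0 := by
    intro a
    simp only [z]
    rw [Finset.sum_add_distrib, hdeg, Finset.sum_comm]
    have : ∀ t ∈ Finset.Ico i j, ∑ b, ed (w t) (w (t + 1)) a b = (fun s => if a = w s then (1 : ZMod 2) else 0) t +
        (fun s => if a = w s then (1 : ZMod 2) else 0) (t + 1) := by
      intro t ht
      rw [Finset.mem_Ico] at ht
      exact ed_deg (by
        obtain ⟨s, _, hs⟩ := h.F_of_nx (wnx t (by omega))
        exact hs.n12) a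
    rw [Finset.sum_congr rfl this, tele2 _ i j hij.le]
    exact z2self _
  obtain ⟨f, hf, hz⟩ := T.sep_of_cycle zsym zE zdeg
  have flip0 : ∀ x y : ZMod 2, x + y = 0 → x = y := by decide
  have zoff : ∀ a, a ∉ C → a ∉ Y → ∀ b, z a b = 0 := by
    intro a ha haY b
    by_contra hne
    rcases zne a b hne with ⟨t, h1, h2, h3⟩ | h1
    · rcases h3 with ⟨rfl, rfl⟩ | ⟨rfl, rfl⟩
      · exact ha (wC _ (by omega))
      · exact ha (wC _ (by omega))
    · rcases (hsup' a b h1).2 with rfl | rfl | hh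
      · exact ha (wC _ (by omega))
      · exact ha (wC _ (by omega))
      · exact haY hh
  have zS : ∀ a, a ∉ S → ∀ b, z a b = 0 := fun a ha =>
    zoff a (fun hh => ha (h.sub a hh)) (fun hh => ha (hYS a hh).1)
  have zout : ∀ t, t < C.length → (t < i ∨ j < t) → ∀ b, z (w t) b = 0 := by
    intro t ht hto b
    by_contra hne
    rcases zne _ b hne with ⟨s, h1, h2, h3⟩ | h1
    · rcases h3 with ⟨h3, _⟩ | ⟨h3, _⟩
      · have := winj ht (by omega) h3; omega
      · have := winj ht (by omega) h3; omega
    · rcases (hsup' _ b h1).2 with hh | hh | hh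
      · have := winj ht (by omega) hh; omega
      · have := winj ht (by omega) hh; omega
      · exact (hYS _ hh).2 (wC _ ht)
  have zin : ∀ t, i < t → t < j → ∀ b, b ≠ w (t - 1) → b ≠ w (t + 1) → z (w t) b = 0 := by
    intro t h1 h2 b hb1 hb2
    by_contra hne
    rcases zne _ b hne with ⟨s, h1, h2, h3⟩ | h1
    · rcases h3 with ⟨h3, h4⟩ | ⟨h3, h4⟩
      · have := winj (by omega) (by omega) h3
        subst this; exact hb2 h4
      · have := winj (by omega) (by omega) h3
        subst this; exact hb1 (by simpa using h4)
    · rcases (hsup' _ b h1).2 with hh | hh | hh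
      · have := winj (by omega) (by omega) hh; omega
      · have := winj (by omega) (by omega) hh; omega
      · exact (hYS _ hh).2 (wC _ (by omega))
  have z1 : ∀ t, i ≤ t → t < j → (i + 1 < j) → (i < t ∨ t + 1 < j) → z (w t) (w (t + 1)) = 1 := by
    intro t h1 h2 h4 h5
    simp only [z]
    have : zc (w t) (w (t + 1)) = 0 := by
      by_contra hne
      have e1 := (hsup' _ _ hne).2
      rw [hsym] at hne
      have e2 := (hsup' _ _ hne).2
      rcases e1 with hh | hh | hh
      · have := winj (by omega) (by omega) hh
        rcases e2 with hh | hh | hh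
        · have := winj (by omega) (by omega) hh; omega
        · have := winj (by omega) (by omega) hh; omega
        · exact (hYS _ hh).2 (wC _ (by omega))
      · have := winj (by omega) (by omega) hh; omega
      · exact (hYS _ hh).2 (wC _ (by omega))
    rw [this, add_zero, Finset.sum_eq_single t]
    · unfold ed; rw [if_pos (Or.inl ⟨rfl, rfl⟩)]
    · intro s hs hst
      rw [Finset.mem_Ico] at hs
      by_contra hne
      rcases edz s _ _ hne with ⟨h3, h4⟩ | ⟨h3, h4⟩
      · exact hst (winj (by omega) (by omega) h3).symm
      · have e1 := winj (by omega) (by omega) h3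
        have e2 := winj (by omega) (by omega) h4
        omega
    · intro hh; exact (hh (Finset.mem_Ico.2 ⟨h1, h2⟩)).elim
  -- boundary darts all on the same side
  have hstep : ∀ t, t + 2 < C.length → f (w t) (w (t + 1)) = f (w (t + 1)) (w (t + 2)) := by
    intro t ht
    have hav := wnx t (by omega)
    have hvb := wnx (t + 1) (by omega)
    obtain ⟨p, hpS, hp⟩ := h.F_of_nx hav
    obtain ⟨q, hqS, hq⟩ := h.F_of_nx hvb
    have := T.link (w (t + 1)) {u | u ∉ S → f (w (t + 1)) u = f (w (t + 1)) (w (t + 2))} (w (t + 2))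
      (fun hh => (hh (h.sub _ hvb.mem.2)).elim) hq.e12 (by
        intro u u' hu hF hu'
        have e1 := hf _ _ _ hF
        have e2 := hf _ _ _ hF.cyc
        have e3 := hz _ _ hF.e31
        rw [zS u' hu'] at e3
        have e4 : f (w (t + 1)) u' = f u' (w (t + 1)) := by
          exact (flip0 _ _ e3).symm
        rw [e4, ← e2, ← e1]
        by_cases huS : u ∈ S
        · have : u = w (t + 2) := by
            rcases (h.dart _ (h.sub _ hvb.mem.1) u huS).1 ⟨u', hu', hF⟩ with hn | hn
            · exact nx_u2 h.nodup hn hvb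
            · rw [hn.1] at hvb; exact (h.nD2 hvb).elim
          rw [this]
        · exact hu huS) p hp.e23
    have h2 := this hpS
    rw [← h2, hf _ _ _ hp]
  have hall : ∀ t, t + 1 < C.length → f (w t) (w (t + 1)) = f (w 0) (w 1) := by
    intro t
    induction t with
    | zero => intro _; rfl
    | succ t ih => intro ht; rw [← hstep t (by omega)]; exact ih (by omega)
  set s := f (w 0) (w 1) with hs
  have flip1 : ∀ x y : ZMod 2, x + y = 1 → y = x + 1 := by decide
  -- inside
  have hin : ∀ u ∈ S, T.E (w k) u → u ≠ w (k + 1) → f (w k) u = s + 1 := by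
    have hav := wnx (k - 1) (by omega)
    rw [show k - 1 + 1 = k by omega] at hav
    have hvb := wnx k (by omega)
    have ha : f (w k) (w (k - 1)) = s + 1 := by
      obtain ⟨p, hpS, hp⟩ := h.F_of_nx hav
      have e3 := hz _ _ hp.e12
      have := hall (k - 1) (by omega)
      rw [show k - 1 + 1 = k by omega] at this
      rw [this] at e3
      have z' := z1 (k - 1) (by omega) (by omega) (by omega) (by omega)
      rw [show k - 1 + 1 = k by omega] at z'
      rw [z'] at e3
      exact flip1 _ _ e3
    obtain ⟨q, hqS, hq⟩ := h.F_of_nx hvb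
    intro u huS huE hub
    have := T.link (w k) {u | u ∈ S → u ≠ w (k + 1) → f (w k) u = s + 1} (w (k + 1))
      (fun _ hh => (hh rfl).elim) hq.e12 (by
        intro u u' hu hF hu' hub
        by_cases hua : u' = w (k - 1)
        · rw [hua]; exact ha
        by_cases huS : u ∈ S
        · by_cases hub' : u = w (k + 1)
          · rw [hub'] at hF
            rw [T.u3 hF hq] at hu'
            exact (hqS hu').elim
          · have e1 := hf _ _ _ hF
            have e2 := hf _ _ _ hF.cyc
            have e3 := hz _ _ hF.e31
            rw [zsym, zin k hik hkj u' hua hub] at e3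
            rw [← flip0 _ _ e3, ← e2, ← e1]
            exact hu huS hub'
        · have : u' = w (k - 1) := by
            rcases (h.dart u' hu' _ (h.sub _ hvb.mem.1)).1 ⟨u, huS, hF.cyc2⟩ with hn | hn
            · exact nx_u1 h.nodup hn hav
            · rw [hn.2] at hav; exact (h.nD1 hav).elim
          exact (hua this).elim) u huE
    exact this huS hub
  -- outside
  have hout : ∀ u, T.E (w k') u → f (w k') u = s := by
    intro u hu
    by_cases hk1 : k' + 1 < C.length
    · have hn := wnx k' hk1
      obtain ⟨p, hpS, hp⟩ := h.F_of_nx hn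
      rw [Tri.side_const hf hz (zout k' hk' hkk) hu hp.e12]
      exact hall k' hk1
    · have hn := wnx (k' - 1) (by omega)
      obtain ⟨p, hpS, hp⟩ := h.F_of_nx hn
      have e := hall (k' - 1) (by omega)
      rw [show k' - 1 + 1 = k' by omega] at *
      rw [Tri.side_const hf hz (zout k' hk' hkk) hu hp.e12.symm]
      have e3 := hz _ _ hp.e12
      rw [zsym, zout k' hk' hkk] at e3
      rw [← flip0 _ _ e3]; exact e
  have hcon : s + 1 ≠ s := by
    rcases z2cases s with hh | hh <;> rw [hh] <;> decide
  constructor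
  · intro hE
    have e1 := hin (w k') (h.sub _ (wC k' hk')) hE (by
      intro hh; have := winj hk' (by omega) hh; omega)
    have e2 := hout _ hE.symm
    have e3 := hz _ _ hE.symm
    rw [zout k' hk' hkk] at e3
    have := flip0 _ _ e3
    rw [e1, e2] at this
    exact hcon this.symm
  · intro x hxS hxC hxY hE hE'
    · have e1 := hin x hxS hE (by rintro rfl; exact hxC (wC _ (by omega)))
      have e2 := hout _ hE'.symm
      have e3 := hz _ _ hE.symm
      have e4 := hz _ _ hE'
      rw [zoff x hxC hxY] at e3 e4
      have := Tri.side_const hf hz (zoff x hxC hxY) hE.symm hE'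
      rw [flip0 _ _ e3, flip0 _ _ e4, e1, e2] at this
      exact hcon this

theorem WSt.jordanE (h : K.WSt T S C) {i j : ℕ} (hij : i < j) (hj : j < C.length)
    (hE : T.E (C.getD i K.D1) (C.getD j K.D1)) :
    ∀ k, i < k → k < j → ∀ k', k' < C.length → (k' < i ∨ j < k') →
      ¬ T.E (C.getD k K.D1) (C.getD k' K.D1) ∧
      ∀ x ∈ S, x ∉ C → T.E (C.getD k K.D1) x → ¬ T.E x (C.getD k' K.D1) := by
  intro k h1 h2 k' h3 h4
  have := h.jordan hij hj (zc := ed (C.getD i K.D1) (C.getD j K.D1)) (Y := ∅) (by simp)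
    (ed_symm _ _) (by
      intro a b hne
      unfold ed at hne
      have : (a = C.getD i K.D1 ∧ b = C.getD j K.D1) ∨ (a = C.getD j K.D1 ∧ b = C.getD i K.D1) := by
        by_contra hh; rw [if_neg hh] at hne; exact hne rfl
      rcases this with ⟨rfl, rfl⟩ | ⟨rfl, rfl⟩
      · exact ⟨hE, Or.inl rfl⟩
      · exact ⟨hE.symm, Or.inr (Or.inl rfl)⟩) (ed_deg hE.ne) k h1 h2 k' h3 h4
  exact ⟨this.1, fun x hx hxC => this.2 x hx hxC (by simp)⟩

open Classical in
theorem WSt.jordanX (h : K.WSt T S C) {i j : ℕ} (hij : i < j) (hj : j < C.length) {y : W} (hyS : y ∈ S) (hyC : y ∉ C)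
    (hE : T.E (C.getD i K.D1) y) (hE' : T.E y (C.getD j K.D1)) :
    ∀ k, i < k → k < j → ∀ k', k' < C.length → (k' < i ∨ j < k') →
      ∀ x ∈ S, x ∉ C → x ≠ y → T.E (C.getD k K.D1) x → ¬ T.E x (C.getD k' K.D1) := by
  intro k h1 h2 k' h3 h4
  have := h.jordan hij hj (zc := fun a b => ed (C.getD i K.D1) y a b + ed y (C.getD j K.D1) a b) (Y := {y})
    (by intro a ha; rw [Set.mem_singleton_iff] at ha; rw [ha]; exact ⟨hyS, hyC⟩)
    (by intro a b; simp only [ed_symm _ _ a b]) (by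
      intro a b hne
      have : ed (C.getD i K.D1) y a b ≠ 0 ∨ ed y (C.getD j K.D1) a b ≠ 0 := by
        by_contra hh; push Not at hh; apply hne; simp only [hh.1, hh.2, add_zero]
      rcases this with hne | hne
      · unfold ed at hne
        have : (a = C.getD i K.D1 ∧ b = y) ∨ (a = y ∧ b = C.getD i K.D1) := by
          by_contra hh; rw [if_neg hh] at hne; exact hne rfl
        rcases this with ⟨rfl, rfl⟩ | ⟨rfl, rfl⟩
        · exact ⟨hE, Or.inl rfl⟩
        · exact ⟨hE.symm, Or.inr (Or.inr rfl)⟩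
      · unfold ed at hne
        have : (a = y ∧ b = C.getD j K.D1) ∨ (a = C.getD j K.D1 ∧ b = y) := by
          by_contra hh; rw [if_neg hh] at hne; exact hne rfl
        rcases this with ⟨rfl, rfl⟩ | ⟨rfl, rfl⟩
        · exact ⟨hE', Or.inr (Or.inr rfl)⟩
        · exact ⟨hE'.symm, Or.inr (Or.inl rfl)⟩) (by
      intro a
      rw [Finset.sum_add_distrib, ed_deg hE.ne, ed_deg hE'.ne]
      have := z2self (if a = y then 1 else 0)
      linear_combination this) k h1 h2 k' h3 h4
  exact fun x hx hxC hxy => this.2 x hx hxC (by simpa using hxy)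

variable (K T)

structure Nrm : Prop where
  X : ∀ i m, T.F (K.X i) (K.κ i m) (K.κ i (m + 1))
  nd : ∀ i m, ¬ T.E (K.κ i m) (K.κ i (m + 2))
  out : T.F K.D2 K.D1 K.D3

structure St (S : Set W) (C : List W) : Prop extends K.WSt T S C where
  Xn : ∀ i, K.X i ∉ C
  kt : ∀ i, K.X i ∉ S → ∃ m, K.κ i m ∉ S

def PdS (S : Set W) (l o r : W) : Prop := ∃ i m, K.X i ∉ S ∧ K.κ i m ∉ S ∧ l = K.κ i (m + 1) ∧
  o = K.κ i (m + 2) ∧ r = K.κ i (m + 3) ∧ l ∈ S ∧ o ∈ S ∧ r ∈ S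

variable {K T}

theorem f4 (m : Fin 4) : m + 1 + 1 = m + 2 ∧ m + 2 + 1 = m + 3 ∧ m + 3 + 1 = m ∧ m + 2 + 2 = m ∧ m + 1 + 2 = m + 3 ∧
    m + 3 + 2 = m + 1 ∧ m + 3 + 3 = m + 2 ∧ m + 2 + 3 = m + 1 ∧ m + 1 + 3 = m := by revert m; decide

theorem f4c (m m' : Fin 4) : m' = m ∨ m' = m + 1 ∨ m' = m + 2 ∨ m' = m + 3 := by revert m m'; decide

theorem f4n (m : Fin 4) : m ≠ m + 1 ∧ m ≠ m + 2 ∧ m ≠ m + 3 ∧ m + 1 ≠ m + 2 ∧ m + 1 ≠ m + 3 ∧ m + 2 ≠ m + 3 := by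
  revert m; decide

theorem Nrm.e (N : K.Nrm T) (i : ι) (m : Fin 4) : T.E (K.κ i m) (K.κ i (m + 1)) := (N.X i m).e23

theorem St.pnx (N : K.Nrm T) (h : K.St T S C) {l o r : W} (hp : K.PdS S l o r) : Nx C l o ∧ Nx C o r := by
  obtain ⟨i, m, hX, hz, rfl, rfl, rfl, hl, ho, hr⟩ := hp
  have e1 := N.X i (m + 1)
  have e2 := N.X i (m + 2)
  rw [(f4 m).1] at e1
  rw [(f4 m).2.1] at e2
  constructor
  · rcases (h.dart _ hl _ ho).1 ⟨_, hX, e1.cyc⟩ with hh | hh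
    · exact hh
    · exact (K.κD2 _ _ hh.1).elim
  · rcases (h.dart _ ho _ hr).1 ⟨_, hX, e2.cyc⟩ with hh | hh
    · exact hh
    · exact (K.κD2 _ _ hh.1).elim

/-- a contour vertex without chords -/
def CL (T : Tri W) (C : List W) (v : W) : Prop := ∀ c ∈ C, T.E v c → Nx C v c ∨ Nx C c v

theorem St.move (N : K.Nrm T) (h : K.St T S C) (hlen : 3 ≤ C.length) :
    (∃ v ∈ C, v ≠ K.D1 ∧ v ≠ K.D2 ∧ CL T C v ∧ (∀ i m, K.X i ∈ S → v ≠ K.κ i m) ∧ ∀ l r, ¬ K.PdS S l v r) ∨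
    (∃ i m, K.X i ∈ S ∧ K.κ i m ∈ C ∧ CL T C (K.κ i m) ∧ K.κ i (m + 2) ∉ C) ∨
    (∃ i m, K.X i ∈ S ∧ Nx C (K.κ i (m + 3)) (K.κ i (m + 2)) ∧ Nx C (K.κ i (m + 2)) (K.κ i (m + 1)) ∧
      Nx C (K.κ i (m + 1)) (K.κ i m)) := by
  classical
  by_contra hgoal
  rw [not_or, not_or] at hgoal
  obtain ⟨g1, g2, g3⟩ := hgoal
  set w : ℕ → W := fun t => C.getD t K.D1 with hw
  have winj : ∀ {s t : ℕ}, s < C.length → t < C.length → w s = w t → s = t := fun hs ht e => inj_idx h.nodup hs ht e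
  have wnx : ∀ t, t + 1 < C.length → Nx C (w t) (w (t + 1)) := fun t ht => nx_idx.2 ⟨t, ht, rfl, rfl⟩
  have wC : ∀ t, t < C.length → w t ∈ C := fun t ht => mem_idx.2 ⟨t, ht, rfl⟩
  have wE : ∀ t, t + 1 < C.length → T.E (w t) (w (t + 1)) := by
    intro t ht
    obtain ⟨s, _, hs⟩ := h.F_of_nx (wnx t ht)
    exact hs.e12
  have w0 : w 0 = K.D1 := by
    obtain ⟨l, hl⟩ := h.hd
    simp [hw, hl]
  have wl : w (C.length - 1) = K.D2 := by
    obtain ⟨l, hl⟩ := h.lt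
    simp [hw, hl]
  have wD : ∀ t, 0 < t → t + 1 < C.length → w t ≠ K.D1 ∧ w t ≠ K.D2 := by
    intro t h1 h2
    constructor
    · intro e; rw [← w0] at e; have := winj (by omega) (by omega) e; omega
    · intro e; rw [← wl] at e; have := winj (by omega) (by omega) e; omega
  -- minimal edge chord
  have hex : ∃ d, ∃ i j, i + 2 ≤ j ∧ j < C.length ∧ T.E (w i) (w j) ∧ j - i = d :=
    ⟨_, 0, C.length - 1, by omega, by omega, by rw [w0, wl]; exact N.out.e12.symm, rfl⟩
  obtain ⟨i, j, hij, hj, hE, hd⟩ := Nat.find_spec hex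
  have hmin : ∀ i' j', i' + 2 ≤ j' → j' < C.length → T.E (w i') (w j') → j - i ≤ j' - i' := by
    intro i' j' h1 h2 h3
    rw [hd]; exact Nat.find_min' hex ⟨i', j', h1, h2, h3, rfl⟩
  have hJ := h.jordanE (by omega : i < j) hj hE
  -- edges inside
  have hin : ∀ s t, i ≤ s → s < t → t ≤ j → T.E (w s) (w t) → t = s + 1 ∨ (s = i ∧ t = j) := by
    intro s t h1 h2 h3 h4
    by_cases h5 : t = s + 1
    · exact Or.inl h5
    · have := hmin s t (by omega) (by omega) h4
      right; omega
  have hCL : ∀ k, i < k → k < j → CL T C (w k) := by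
    intro k h1 h2 c hc hE
    obtain ⟨t, ht, rfl⟩ := mem_idx (d := K.D1).1 hc
    change T.E (w k) (w t) at hE
    change Nx C (w k) (w t) ∨ Nx C (w t) (w k)
    have h3 : i ≤ t ∧ t ≤ j := by
      by_contra hh
      exact (hJ k h1 h2 t ht (by omega)).1 hE
    have : t ≠ k := by rintro rfl; exact hE.ne rfl
    rcases lt_or_gt_of_ne this with h4 | h4
    · right
      rcases hin t k h3.1 h4 h2.le hE.symm with h5 | h5
      · rw [h5]; exact wnx t (by omega)
      · omega
    · left
      rcases hin k t h1.le h4 h3.2 hE with h5 | h5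
      · rw [h5]; exact wnx k (by omega)
      · omega
  have XS : ∀ n m, K.X n ∈ S → K.κ n m ∈ S := fun n m hn => h.int _ hn (h.Xn n) _ (N.X n m).e12
  have hloc : ∀ k, i < k → k < j → (∃ l r, K.PdS S l (w k) r) ∨
      (∃ n m, K.X n ∈ S ∧ w k = K.κ n m ∧ ∃ k', i ≤ k' ∧ k' ≤ j ∧ K.κ n (m + 2) = w k') := by
    intro k h1 h2
    by_cases hl : ∃ l r, K.PdS S l (w k) r
    · exact Or.inl hl
    right
    push Not at hl
    have hD := wD k (by omega) (by omega)
    by_contra hno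
    apply g1
    refine ⟨w k, wC k (by omega), hD.1, hD.2, hCL k h1 h2, ?_, hl⟩
    intro n m hn hk
    apply hno
    refine ⟨n, m, hn, hk, ?_⟩
    by_contra hno'
    apply g2
    refine ⟨n, m, hn, by rw [← hk]; exact wC k (by omega), by rw [← hk]; exact hCL k h1 h2, ?_⟩
    intro hC
    obtain ⟨t, ht, he⟩ := mem_idx (d := K.D1).1 hC
    apply hno'
    refine ⟨t, ?_⟩
    have h3 : i ≤ t ∧ t ≤ j := by
      by_contra hh
      have := (hJ k h1 h2 t ht (by omega)).2 (K.X n) hn (h.Xn n)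
      rw [← he] at this
      change T.E (w k) _ → _ at this
      rw [hk] at this
      exact this (N.X n m).e12.symm (N.X n (m + 2)).e12
    exact ⟨h3.1, h3.2, he⟩
  have hlk : ∀ i' j', i ≤ i' → i' + 2 ≤ j' → j' ≤ j → (∀ k, i' < k → k < j' → ∃ l r, K.PdS S l (w k) r) →
      ∃ n m, K.X n ∉ S ∧ w i' = K.κ n (m + 1) ∧ w j' = K.κ n (m + 3) := by
    intro i' j' h1 h2 h3 h4
    obtain ⟨l, r, hp⟩ := h4 (i' + 1) (by omega) (by omega)
    have hn := h.pnx N hp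
    have el : l = w i' := nx_u1 h.nodup hn.1 (wnx i' (by omega))
    have er : r = w (i' + 2) := nx_u2 h.nodup hn.2 (wnx (i' + 1) (by omega))
    obtain ⟨n, m, hX, hz, e1, e2, e3, hl, ho, hr⟩ := hp
    have : j' = i' + 2 := by
      by_contra hne
      obtain ⟨l', r', hp'⟩ := h4 (i' + 2) (by omega) (by omega)
      obtain ⟨n', m', hX', hz', e1', e2', e3', hl', ho', hr'⟩ := hp'
      rw [← er, e3] at e2'
      obtain ⟨rfl, hm⟩ := K.κinj _ _ _ _ e2'
      have : m' = m + 1 := by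
        exact (by decide : ∀ m m' : Fin 4, m + 3 = m' + 2 → m' = m + 1) m m' hm
      subst this
      rw [← e1] at hz'
      exact hz' hl
    subst this
    exact ⟨n, m, hX, by rw [← el, e1], by rw [← er, e3]⟩
  have hact : ∀ i' j', i ≤ i' → i' + 2 ≤ j' → j' ≤ j →
      (¬ ∃ n m, K.X n ∉ S ∧ w i' = K.κ n (m + 1) ∧ w j' = K.κ n (m + 3)) →
      ∃ k, i' < k ∧ k < j' ∧ (∃ n m, K.X n ∈ S ∧ w k = K.κ n m ∧ ∃ k', i ≤ k' ∧ k' ≤ j ∧ K.κ n (m + 2) = w k') := by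
    intro i' j' h1 h2 h3 h4
    by_contra hno
    push Not at hno
    apply h4
    apply hlk i' j' h1 h2 h3
    intro k hk1 hk2
    rcases hloc k (by omega) (by omega) with hh | ⟨n, m, a1, a2, k', a3, a4, a5⟩
    · exact hh
    · exact (hno k hk1 hk2 n m a1 a2 k' a3 a4 a5).elim
  -- four corners suffice
  have h4 : ∀ n, K.X n ∈ S → ¬ ∀ m, ∃ t, i ≤ t ∧ t ≤ j ∧ K.κ n m = w t := by
    intro n hn hall
    have key : ∀ m, Nx C (K.κ n (m + 1)) (K.κ n m) ∨ (K.κ n m = w i ∧ K.κ n (m + 1) = w j) ∨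
        (K.κ n m = w j ∧ K.κ n (m + 1) = w i) := by
      intro m
      obtain ⟨s, s1, s2, es⟩ := hall m
      obtain ⟨t, t1, t2, et⟩ := hall (m + 1)
      have hE := N.e n m
      rw [es, et] at hE
      have hst : s ≠ t := by rintro rfl; exact hE.ne rfl
      rcases lt_or_gt_of_ne hst with h5 | h5
      · rcases hin s t s1 h5 t2 hE with h6 | ⟨rfl, rfl⟩
        · exfalso
          subst h6
          have hx := wnx s (by omega)
          rw [← es, ← et] at hx
          obtain ⟨p, hp, hF⟩ := h.F_of_nx hx
          rw [T.u3 hF (N.X n m).cyc] at hp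
          exact hp hn
        · exact Or.inr (Or.inl ⟨es, et⟩)
      · rcases hin t s t1 h5 s2 hE.symm with h6 | ⟨rfl, rfl⟩
        · left; rw [es, et, h6]; exact wnx t (by omega)
        · exact Or.inr (Or.inr ⟨es, et⟩)
    have : ∃ m0, ∀ m, m ≠ m0 → Nx C (K.κ n (m + 1)) (K.κ n m) := by
      by_cases hall' : ∀ m, Nx C (K.κ n (m + 1)) (K.κ n m)
      · exact ⟨0, fun m _ => hall' m⟩
      · push Not at hall'
        obtain ⟨m0, hm0⟩ := hall'
        refine ⟨m0, fun m hm => ?_⟩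
        rcases key m with h5 | h5
        · exact h5
        · exfalso
          have h6 := (key m0).resolve_left hm0
          have ki : ∀ {a b}, K.κ n a = K.κ n b → a = b := fun e => (K.κinj _ _ _ _ e).2
          have c4 : ∀ m m0 : Fin 4, m + 1 = m0 → m = m0 + 1 → False := by decide
          rcases h5 with ⟨a, b⟩ | ⟨a, b⟩ <;> rcases h6 with ⟨c, d⟩ | ⟨c, d⟩
          · exact hm (ki (a.trans c.symm))
          · exact c4 _ _ (ki (b.trans c.symm)) (ki (a.trans d.symm))
          · exact c4 _ _ (ki (b.trans c.symm)) (ki (a.trans d.symm))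
          · exact hm (ki (a.trans c.symm))
    obtain ⟨m0, hm0⟩ := this
    apply g3
    refine ⟨n, m0 + 1, hn, ?_, ?_, ?_⟩
    · have := hm0 (m0 + 3) ((by decide : ∀ m : Fin 4, m + 3 ≠ m) m0)
      rw [(f4 m0).2.2.2.2.2.2.2.2, (f4 m0).2.2.2.2.1]; rw [(f4 m0).2.2.1] at this; exact this
    · have := hm0 (m0 + 2) ((by decide : ∀ m : Fin 4, m + 2 ≠ m) m0)
      rw [(f4 m0).2.2.2.2.1, (f4 m0).1]; rw [(f4 m0).2.1] at this; exact this
    · have := hm0 (m0 + 1) ((by decide : ∀ m : Fin 4, m + 1 ≠ m) m0)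
      exact this
  -- kite chords
  obtain ⟨k, hk1, hk2, n, m, hn, hkn, k', hk1', hk2', hkn'⟩ := hact i j le_rfl hij le_rfl (by
    rintro ⟨n, m, hX, e1, e2⟩
    rw [e1, e2] at hE
    have := N.nd n (m + 1)
    rw [(f4 m).2.2.2.2.1] at this
    exact this hE)
  have hex2 : ∃ d, ∃ p q, i ≤ p ∧ p < q ∧ q ≤ j ∧ (∃ n m, K.X n ∈ S ∧ w p = K.κ n m ∧ w q = K.κ n (m + 2)) ∧
      q - p = d := by
    have hne : k ≠ k' := by
      rintro rfl
      rw [← hkn'] at hkn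
      exact (fin4_ne m).2.1 (K.κinj _ _ _ _ hkn).2.symm
    rcases lt_or_gt_of_ne hne with h5 | h5
    · exact ⟨_, k, k', hk1.le, h5, hk2', ⟨n, m, hn, hkn, hkn'.symm⟩, rfl⟩
    · exact ⟨_, k', k, hk1', h5, hk2.le, ⟨n, m + 2, hn, hkn'.symm, by rw [(f4 m).2.2.2.1]; exact hkn⟩, rfl⟩
  clear hkn hkn' hk1 hk2 hk1' hk2' hn
  obtain ⟨p, q, hp, hpq, hq, ⟨n, m, hn, ep, eq⟩, hd2⟩ := Nat.find_spec hex2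
  have hmin2 : ∀ p' q', i ≤ p' → p' < q' → q' ≤ j → (∃ n m, K.X n ∈ S ∧ w p' = K.κ n m ∧ w q' = K.κ n (m + 2)) →
      q - p ≤ q' - p' := by
    intro p' q' h1 h2 h3 h5
    rw [hd2]; exact Nat.find_min' hex2 ⟨p', q', h1, h2, h3, h5, rfl⟩
  have hpq2 : p + 2 ≤ q := by
    by_contra hh
    have : q = p + 1 := by omega
    subst this
    have := wE p (by omega)
    rw [ep, eq] at this
    exact N.nd _ _ this
  obtain ⟨u, hu1, hu2, n', m', hn', eu, v, hv1, hv2, ev⟩ := hact p q hp hpq2 hq (by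
    rintro ⟨n', m', hX, e1, e2⟩
    rw [ep] at e1
    obtain ⟨rfl, _⟩ := K.κinj _ _ _ _ e1
    exact hX hn)
  by_cases hnn : n' = n
  · subst hnn
    apply h4 n' hn
    have hm1 : m' ≠ m := by
      rintro rfl
      have := winj (by omega) (by omega) (eu.trans ep.symm); omega
    have hm2 : m' ≠ m + 2 := by
      rintro rfl
      have := winj (by omega) (by omega) (eu.trans eq.symm); omega
    have c4 : ∀ m m' : Fin 4, m' ≠ m → m' ≠ m + 2 → ∀ x, x = m ∨ x = m + 2 ∨ x = m' ∨ x = m' + 2 := by decide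
    intro x
    rcases c4 m m' hm1 hm2 x with rfl | rfl | rfl | rfl
    · exact ⟨p, hp, by omega, ep.symm⟩
    · exact ⟨q, by omega, hq, eq.symm⟩
    · exact ⟨u, by omega, by omega, eu.symm⟩
    · exact ⟨v, hv1, hv2, ev⟩
  · have hvp : v ≠ p := by
      rintro rfl
      exact hnn (K.κinj _ _ _ _ (ev.trans ep)).1
    have hvq : v ≠ q := by
      rintro rfl
      exact hnn (K.κinj _ _ _ _ (ev.trans eq)).1
    have E1 : T.E (w p) (K.X n) := by rw [ep]; exact (N.X n m).e12.symm
    have E2 : T.E (K.X n) (w q) := by rw [eq]; exact (N.X n (m + 2)).e12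
    have E3 : T.E (w u) (K.X n') := by rw [eu]; exact (N.X n' m').e12.symm
    have E4 : T.E (K.X n') (w v) := by rw [← ev]; exact (N.X n' (m' + 2)).e12
    by_cases hv : v < p ∨ q < v
    · exact h.jordanX hpq (by omega) hn (h.Xn n) E1 E2 u hu1 hu2 v (by omega) hv (K.X n') hn' (h.Xn n')
        (fun e => hnn (K.Xinj _ _ e)) E3 E4
    · have huv : u ≠ v := by
        rintro rfl
        rw [← ev] at eu
        exact (fin4_ne m').2.1 (K.κinj _ _ _ _ eu).2.symm
      rcases lt_or_gt_of_ne huv with h5 | h5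
      · have := hmin2 u v (by omega) h5 (by omega) ⟨n', m', hn', eu, ev.symm⟩
        omega
      · have := hmin2 v u (by omega) h5 (by omega) ⟨n', m' + 2, hn', ev.symm, by rw [(f4 m').2.2.2.1]; exact eu⟩
        omega

end Kites

section
variable {W : Type} {D1 D2 : W} {S : Set W} {C : List W} {A A' : W → W → Prop}
    {CR : W → W → W → W → Prop} {Pd : W → W → W → Prop} {N N' : ℤ}

theorem dr_mono (hD : Dr D1 D2 S C A CR Pd N) (hA : ∀ u v, A' u v → A u v)
    (hP : ∀ l o r, Pd l o r → A' l r) (hN : N ≤ N') : Dr D1 D2 S C A' CR Pd N' := by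
  obtain ⟨bx, bY, hB, hF⟩ := hD
  refine ⟨bx, bY, ⟨hB.b1, hB.y1, hB.y2, hB.wd.trans hN, hB.ypos⟩, hF.mono ?_⟩
  intro px ps q
  refine ⟨q.good.mono hA, q.box, ?_⟩
  intro l o r h
  have hp := q.pend l o r h
  exact ⟨hP l o r h, hp.lS, hp.oS, hp.rS, hp.nx, fun p hi => ⟨(hp.free p hi).1, (hp.free p hi).2.1,
    fun u v ha => (hp.free p hi).2.2 u v (hA u v ha)⟩, hp.ori, hp.xlo, hp.xor, hp.slo⟩

theorem dr_base (h12 : D1 ≠ D2) : Dr D1 D2 {D1, D2} [D1, D2] (fun u v => SameE u v D1 D2) CR (fun _ _ _ => False) 1 := by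
  classical
  refine ⟨fun w => if w = D2 then 1 else 0, fun _ => 0, ⟨by simp [h12], rfl, rfl, by simp, fun _ _ => le_rfl⟩, ?_⟩
  intro x' h0 hg
  have h2 : 1 ≤ x' D2 := by
    have := hg D1 D2 (nx_of_split [] [])
    simp [h12, h0] at this; exact this
  have h2' : (1:ℝ) ≤ (x' D2 : ℝ) := by exact_mod_cast h2
  have hnx : ∀ c d, Nx [D1, D2] c d → c = D1 ∧ d = D2 := by
    intro c d h; simp [Nx] at h; exact ⟨h.1, h.2⟩
  have hUp : ∀ p : ℝ × ℝ, p.1 = p.2 → ¬ Up (Rho x' x') [D1, D2] p := by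
    rintro p hp ⟨a, b, hn, -, -, h3⟩
    obtain ⟨rfl, rfl⟩ := hnx _ _ hn
    simp only [ori, Rho, h0, hp] at h3
    push_cast at h3
    have : (((x' b : ℝ) - 0) * (p.2 - 0) - ((x' b : ℝ) - 0) * (p.2 - 0)) = 0 := by ring
    linarith
  refine ⟨x', x', by simp, ⟨⟨?_, ?_, ?_, ?_, ?_, ?_, ?_, ?_, ?_⟩, ?_, fun _ _ _ h => h.elim⟩⟩
  · intro u hu v hv h
    simp only [Set.mem_insert_iff, Set.mem_singleton_iff] at hu hv
    have : x' u = x' v := by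
      have := congrArg Prod.fst h; simpa [Rho] using this
    rcases hu with rfl | rfl <;> rcases hv with rfl | rfl <;> first | rfl | (exfalso; omega)
  · rintro u v (⟨rfl, rfl⟩ | ⟨rfl, rfl⟩)
    · exact ⟨by simp, by simp, h12⟩
    · exact ⟨by simp, by simp, h12.symm⟩
  · simp
  · intro c d h
    obtain ⟨rfl, rfl⟩ := hnx _ _ h
    simp only [Rho, h0]; push_cast; linarith
  · intro c d h
    obtain ⟨rfl, rfl⟩ := hnx _ _ h
    simp only [Rho, h0]; push_cast; linarith
  · intro u hu; exact hUp _ rfl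
  · rintro u v - p ⟨t, -, -, e1, e2⟩
    refine hUp _ ?_
    rw [e1, e2]; rfl
  · rintro u v h w hw ⟨t, t0, t1, e1, e2⟩
    simp only [Set.mem_insert_iff, Set.mem_singleton_iff] at hw
    rcases h with ⟨rfl, rfl⟩ | ⟨rfl, rfl⟩ <;> rcases hw with rfl | rfl <;> simp only [Rho, h0] at e1 <;>
      push_cast at e1 <;> nlinarith
  · rintro u v u' v' h h' p - -
    left
    rcases h with ⟨rfl, rfl⟩ | ⟨rfl, rfl⟩ <;> rcases h' with ⟨rfl, rfl⟩ | ⟨rfl, rfl⟩ <;> simp [SameE]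
  · intro w hw
    simp only [Set.mem_insert_iff, Set.mem_singleton_iff] at hw
    tauto
end

namespace Kites
variable {W ι : Type} [Fintype W] (K : Kites W ι) (T : Tri W)

def SD (S : Set W) : Set W := {w | w ∈ S ∧ ∀ i, w ≠ K.X i}

def PO (S : Set W) (w : W) : Prop := ∃ l r, K.PdS S l w r

open Classical in
noncomputable def Dc (S : Set W) (C : List W) : List W := C.filter (fun w => ¬ K.PO S w)

def AS (S : Set W) (u v : W) : Prop := u ∈ S ∧ v ∈ S ∧ ((T.E u v ∧ (∀ i, u ≠ K.X i) ∧ (∀ i, v ≠ K.X i)) ∨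
  (∃ i m, K.X i ∈ S ∧ u = K.κ i m ∧ v = K.κ i (m + 2)) ∨ ∃ o, K.PdS S u o v ∨ K.PdS S v o u)

def CRK (u v u' v' : W) : Prop := ∃ i m, SameE u v (K.κ i m) (K.κ i (m + 2)) ∧
  SameE u' v' (K.κ i (m + 1)) (K.κ i (m + 3))

def NN (c : ℕ) : ℤ := max ((c : ℤ) - 1) (2 * (c : ℤ) - 5)

def DRW (S : Set W) (C : List W) : Prop :=
  Dr K.D1 K.D2 (K.SD S) (K.Dc S C) (K.AS T S) K.CRK (K.PdS S) (NN (K.SD S).ncard)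

variable {K T}
variable {S S' : Set W} {C : List W}

theorem PdS.as {l o r : W} (h : K.PdS S l o r) : K.AS T S l r := by
  have := h
  obtain ⟨i, m, hX, hz, rfl, rfl, rfl, hl, ho, hr⟩ := h
  exact ⟨hl, hr, Or.inr (Or.inr ⟨_, Or.inl this⟩)⟩

theorem PdS.nE (N : K.Nrm T) {l o r : W} (h : K.PdS S l o r) : ¬ T.E l r := by
  obtain ⟨i, m, hX, hz, rfl, rfl, rfl, hl, ho, hr⟩ := h
  have := N.nd i (m + 1)
  rwa [(f4 m).2.2.2.2.1] at this

theorem PdS.uniq {l o r l' o' r' : W} (h : K.PdS S l o r) (h' : K.PdS S l' o' r')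
    (hh : ∃ w, (w = l ∨ w = o ∨ w = r) ∧ (w = l' ∨ w = o' ∨ w = r')) : l = l' ∧ o = o' ∧ r = r' := by
  obtain ⟨i, m, hX, hz, rfl, rfl, rfl, hl, ho, hr⟩ := h
  obtain ⟨i', m', hX', hz', rfl, rfl, rfl, hl', ho', hr'⟩ := h'
  have hi : i = i' := by
    obtain ⟨w, h1, h2⟩ := hh
    rcases h1 with rfl | rfl | rfl <;> rcases h2 with h2 | h2 | h2 <;> exact (K.κinj _ _ _ _ h2).1
  subst hi
  have hm : m = m' := by
    by_contra hne
    have : m = m' + 1 ∨ m = m' + 2 ∨ m = m' + 3 :=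
      (by decide : ∀ m m' : Fin 4, m ≠ m' → m = m' + 1 ∨ m = m' + 2 ∨ m = m' + 3) m m' hne
    rcases this with rfl | rfl | rfl <;> contradiction
  subst hm
  exact ⟨rfl, rfl, rfl⟩

theorem PdS.mem {l o r : W} (h : K.PdS S l o r) : l ∈ S ∧ o ∈ S ∧ r ∈ S := by
  obtain ⟨i, m, hX, hz, rfl, rfl, rfl, hl, ho, hr⟩ := h
  exact ⟨hl, ho, hr⟩

theorem dc_append (C C' : List W) : K.Dc S (C ++ C') = K.Dc S C ++ K.Dc S C' := by simp [Dc]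
theorem dc_keep {w : W} (h : ¬ K.PO S w) (C : List W) : K.Dc S (w :: C) = w :: K.Dc S C := by
  simp [Dc, h]
theorem dc_drop {w : W} (h : K.PO S w) (C : List W) : K.Dc S (w :: C) = K.Dc S C := by
  simp [Dc, h]
theorem dc_congr {C : List W} (h : ∀ w ∈ C, K.PO S w ↔ K.PO S' w) : K.Dc S C = K.Dc S' C := by
  unfold Dc
  apply List.filter_congr
  intro w hw
  simp [h w hw]
theorem dc_self {C : List W} (h : ∀ w ∈ C, ¬ K.PO S w) : K.Dc S C = C := by
  unfold Dc
  apply List.filter_eq_self.2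
  intro w hw
  simp [h w hw]
theorem dc_mem {C : List W} {w : W} : w ∈ K.Dc S C ↔ w ∈ C ∧ ¬ K.PO S w := by simp [Dc]

theorem sd_card (h : ∀ w ∈ ({K.D1, K.D2} : Set W), w ∈ S) {x y : W} (hx : x ∈ K.SD S) (hy : y ∈ K.SD S)
    (h1 : x ≠ K.D1) (h2 : x ≠ K.D2) (h3 : y ≠ K.D1) (h4 : y ≠ K.D2) (h5 : x ≠ y) (h6 : K.D1 ≠ K.D2) :
    4 ≤ (K.SD S).ncard := by
  classical
  have : ({x, y, K.D1, K.D2} : Finset W).card = 4 := by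
    rw [Finset.card_insert_of_notMem (by simp [*]), Finset.card_insert_of_notMem (by simp [*]), Finset.card_pair h6]
  rw [← this, ← Set.ncard_coe_finset]
  apply Set.ncard_le_ncard _ (Set.toFinite _)
  intro w hw
  simp only [Finset.coe_insert, Finset.coe_singleton, Set.mem_insert_iff, Set.mem_singleton_iff] at hw
  rcases hw with rfl | rfl | rfl | rfl
  · exact hx
  · exact hy
  · exact ⟨h _ (by simp), fun i => (K.XD1 i).symm⟩
  · exact ⟨h _ (by simp), fun i => (K.XD2 i).symm⟩

theorem WSt.mD (h : K.WSt T S C) : ∀ w ∈ ({K.D1, K.D2} : Set W), w ∈ S := by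
  intro w hw
  obtain ⟨l, e⟩ := h.hd
  obtain ⟨l', e'⟩ := h.lt
  rcases hw with rfl | rfl
  · exact h.sub _ (by rw [e]; simp)
  · exact h.sub _ (by rw [e']; simp)

theorem Nrm.d12 (N : K.Nrm T) : K.D1 ≠ K.D2 := N.out.n12.symm

theorem sd_insert {v : W} (hv : v ∈ S) (hX : ∀ i, v ≠ K.X i) : K.SD S = insert v (K.SD (S \ {v})) := by
  ext w
  simp only [SD, Set.mem_ofPred_eq, Set.mem_insert_iff, Set.mem_diff, Set.mem_singleton_iff]
  by_cases e : w = v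
  · subst e; simp [hv, hX]
  · simp [e]

theorem sd_X (i : ι) : K.SD (S \ {K.X i}) = K.SD S := by
  ext w
  simp only [SD, Set.mem_ofPred_eq, Set.mem_diff, Set.mem_singleton_iff]
  constructor
  · rintro ⟨h1, h2⟩; exact ⟨h1.1, h2⟩
  · rintro ⟨h1, h2⟩; exact ⟨⟨h1, h2 i⟩, h2⟩

end Kites

namespace Kites
variable {W ι : Type} [Fintype W] {K : Kites W ι} {T : Tri W} {S : Set W} {C : List W}

theorem NN1 (c : ℕ) : NN c + 1 ≤ NN (c + 1) := by unfold NN; push_cast; omega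
theorem NN2 (c : ℕ) (h : 4 ≤ c) : NN c + 2 ≤ NN (c + 1) := by unfold NN; push_cast; omega
theorem NN3 (c : ℕ) (h : 4 ≤ c) : NN c + 3 ≤ NN (c + 1 + 1) := by unfold NN; push_cast; omega

theorem Nrm.nb (N : K.Nrm T) {v : W} {i : ι} (h : T.E v (K.X i)) : ∃ m, v = K.κ i m :=
  Kites.nbr_done (N.X i) h.symm

theorem dc_D {α : List W} {x : W} (hx : x ∈ α) (h : ¬ K.PO S x) : x ∈ K.Dc S α := dc_mem.2 ⟨hx, h⟩

theorem po_D1 : ¬ K.PO S K.D1 := by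
  rintro ⟨l, r, i, m, -, -, -, e, -⟩; exact K.κD1 _ _ e.symm
theorem po_D2 : ¬ K.PO S K.D2 := by
  rintro ⟨l, r, i, m, -, -, -, e, -⟩; exact K.κD2 _ _ e.symm

theorem dcD1 {α : List W} {a : W} (h : K.D1 ∈ α ++ [a]) : K.D1 ∈ K.Dc S α ++ [a] := by
  simp only [List.mem_append, List.mem_singleton] at h ⊢
  rcases h with h | h
  · exact Or.inl (dc_D h po_D1)
  · exact Or.inr h
theorem dcD2 {β : List W} {b : W} (h : K.D2 ∈ b :: β) : K.D2 ∈ b :: K.Dc S β := by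
  simp only [List.mem_cons] at h ⊢
  rcases h with h | h
  · exact Or.inl h
  · exact Or.inr (dc_D h po_D2)

theorem clmid (h : K.WSt T S C) {α β mid : List W} {a v b : W} (e : C = α ++ a :: v :: b :: β) (hC : CL T C v)
    (hF : ∀ u u', Nx (a :: (mid ++ [b])) u u' → T.F v u u')
    (hnd : (a :: (mid ++ [b])).Nodup) : ∀ u ∈ mid, u ∉ C := by
  intro u hu huC
  obtain ⟨-, -, -, -, h1, h2⟩ := h.mids e
  have : T.E v u := nx_fanE hF u hu
  rcases hC u huC this with hh | hh
  · have := nx_u2 h.nodup hh h2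
    subst this
    simp [List.nodup_append] at hnd
    grind
  · have := nx_u1 h.nodup hh h1
    subst this
    simp at hnd
    grind

theorem PdS.ne {l o r : W} (hp : K.PdS S l o r) : l ≠ o ∧ o ≠ r ∧ l ≠ r := by
  obtain ⟨i, m, -, -, rfl, rfl, rfl, -⟩ := hp
  have hm : m + 1 ≠ m + 2 ∧ m + 2 ≠ m + 3 ∧ m + 1 ≠ m + 3 := by revert m; decide
  exact ⟨fun h => hm.1 (K.κinj _ _ _ _ h).2, fun h => hm.2.1 (K.κinj _ _ _ _ h).2, fun h => hm.2.2 (K.κinj _ _ _ _ h).2⟩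

set_option maxHeartbeats 1000000 in
theorem St.m1 (N : K.Nrm T) (h : K.St T S C)
    (IH : ∀ S' C', S'.ncard < S.ncard → K.St T S' C' → K.DRW T S' C')
    {v : W} (hvC : v ∈ C) (hv1 : v ≠ K.D1) (hv2 : v ≠ K.D2) (hCL : CL T C v) (hk : ∀ i m, K.X i ∈ S → v ≠ K.κ i m)
    (ho : ∀ l r, ¬ K.PdS S l v r) : K.DRW T S C := by
  obtain ⟨α, a, b, β, e⟩ := h.split hvC hv1 hv2
  obtain ⟨hD1, hD2, -, -, hav, hvb⟩ := h.mids e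
  obtain ⟨mid, hF, hnd, hS, hall⟩ := h.fan e
  have hm := clmid h.toWSt e hCL hF hnd
  have hvS := h.sub v hvC
  have hvX : ∀ i, v ≠ K.X i := by rintro i rfl; exact h.Xn i hvC
  have hR := h.toWSt.remove e hF hnd hS hall hm
  have hEmid : ∀ u ∈ a :: (mid ++ [b]), ∀ i, u ≠ K.X i := by
    rintro u hu i rfl
    have : T.E v (K.X i) := by
      simp only [List.mem_cons, List.mem_append, List.not_mem_nil, or_false] at hu
      rcases hu with hu | hu | hu
      · exact (h.Xn i (hu ▸ hav.mem.1)).elim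
      · exact nx_fanE hF _ hu
      · exact (h.Xn i (hu ▸ hvb.mem.2)).elim
    obtain ⟨m, e⟩ := N.nb this
    exact hk i m (hS _ hu) e
  have hSt : K.St T (S \ {v}) (α ++ a :: (mid ++ b :: β)) := by
    refine ⟨hR, ?_, ?_⟩
    · intro i hi
      have hXC := h.Xn i
      have := hEmid (K.X i)
      rw [e] at hXC
      simp only [List.mem_append, List.mem_cons] at hi hXC this
      grind
    · intro i hi
      obtain ⟨m, hm⟩ := h.kt i (fun hh => hi ⟨hh, fun h' => hvX i h'.symm⟩)
      exact ⟨m, fun hh => hm hh.1⟩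
  have hD := IH _ _ (Set.ncard_diff_singleton_lt_of_mem hvS) hSt
  unfold DRW at hD ⊢
  have hXS : ∀ i, K.X i ∈ S \ {v} ↔ K.X i ∈ S := fun i => ⟨fun h => h.1, fun h => ⟨h, fun h' => hvX i h'.symm⟩⟩
  -- pendings
  have hsub : ∀ l o r, K.PdS (S \ {v}) l o r → K.PdS S l o r := by
    rintro l o r ⟨i, m, hX, hz, rfl, rfl, rfl, hl, ho, hr⟩
    rw [hXS] at hX
    refine ⟨i, m, hX, ?_, rfl, rfl, rfl, hl.1, ho.1, hr.1⟩
    obtain ⟨m', hm'⟩ := h.kt i hX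
    intro hz'
    rcases f4c m m' with rfl | rfl | rfl | rfl
    · exact hm' hz'
    · exact hm' hl.1
    · exact hm' ho.1
    · exact hm' hr.1
  have hsup : ∀ l o r, K.PdS S l o r → l ≠ v → r ≠ v → K.PdS (S \ {v}) l o r := by
    intro l o r hp h1 h2
    have h3 : o ≠ v := by rintro rfl; exact ho _ _ hp
    obtain ⟨i, m, hX, hz, e1, e2, e3, hl, ho, hr⟩ := hp
    exact ⟨i, m, fun h' => hX h'.1, fun h' => hz h'.1, e1, e2, e3, ⟨hl, h1⟩, ⟨ho, h3⟩, ⟨hr, h2⟩⟩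
  have hvP : ¬ K.PO S v := by rintro ⟨l, r, hp⟩; exact ho l r hp
  have hmP : ∀ w ∈ mid, ¬ K.PO (S \ {v}) w := by
    rintro w hw ⟨l, r, hp⟩
    exact hm w hw (h.pnx N (hsub _ _ _ hp)).1.mem.2
  have hnE : ∀ l o r, K.PdS (S \ {v}) l o r → ¬ Nx (a :: (mid ++ [b])) l r := by
    intro l o r hp hn
    exact hp.nE N (hF _ _ hn).e23
  have haS : ∀ u w, K.AS T S u w → u ≠ v → w ≠ v → K.AS T (S \ {v}) u w := by
    rintro u w ⟨h1, h2, h3⟩ hu hw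
    refine ⟨⟨h1, hu⟩, ⟨h2, hw⟩, ?_⟩
    rcases h3 with h3 | ⟨i, m, h3, e⟩ | ⟨o, h3 | h3⟩
    · exact Or.inl h3
    · exact Or.inr (Or.inl ⟨i, m, (hXS i).2 h3, e⟩)
    · exact Or.inr (Or.inr ⟨o, Or.inl (hsup _ _ _ h3 hu hw)⟩)
    · exact Or.inr (Or.inr ⟨o, Or.inr (hsup _ _ _ h3 hw hu)⟩)
  have haS1 : ∀ w, K.AS T S v w → w ∈ a :: (mid ++ [b]) ∨ (∃ o, K.PdS S v o w ∨ K.PdS S w o v) := by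
    rintro w ⟨h1, h2, h3 | ⟨i, m, h3, e, -⟩ | h3⟩
    · exact Or.inl (hall w h2 h3.1)
    · exact (hk i m h3 e).elim
    · exact Or.inr h3
  have haS2 : ∀ w, K.AS T S w v → w ∈ a :: (mid ++ [b]) ∨ (∃ o, K.PdS S v o w ∨ K.PdS S w o v) := by
    rintro w ⟨h1, h2, h3 | ⟨i, m, h3, -, e⟩ | ⟨o, h3⟩⟩
    · exact Or.inl (hall w h1 h3.1.symm)
    · exact (hk i _ h3 e).elim
    · exact Or.inr ⟨o, h3.symm⟩
  have hz : v ∉ K.SD (S \ {v}) := fun hh => hh.1.2 rfl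
  have hSD := sd_insert hvS hvX
  have hcard : (K.SD S).ncard = (K.SD (S \ {v})).ncard + 1 := by
    rw [hSD, Set.ncard_insert_of_notMem hz (Set.toFinite _)]
  have hndC := h.nodup
  rw [e] at hndC
  have haP : ∀ l o r, K.PdS S l o r → ¬ (l = o) ∧ ¬ (o = r) := fun l o r hp => ⟨hp.ne.1, hp.ne.2.1⟩
  have key : ∀ w ∈ C, w ≠ a → w ≠ b → w ≠ v → (K.PO S w ↔ K.PO (S \ {v}) w) := by
    intro w hw h1 h2 h3
    constructor
    · rintro ⟨l, r, hp⟩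
      refine ⟨l, r, hsup _ _ _ hp ?_ ?_⟩
      · rintro rfl; exact h2 (nx_u2 h.nodup (h.pnx N hp).1 hvb)
      · rintro rfl; exact h1 (nx_u1 h.nodup (h.pnx N hp).2 hav)
    · rintro ⟨l, r, hp⟩; exact ⟨l, r, hsub _ _ _ hp⟩
  have nd1 : ∀ w ∈ α, w ∈ C ∧ w ≠ a ∧ w ≠ b ∧ w ≠ v := by
    intro w hw
    refine ⟨by rw [e]; simp [hw], ?_⟩
    simp only [List.nodup_append, List.mem_cons] at hndC
    have := hndC.2.2 w hw
    grind
  have nd2 : ∀ w ∈ β, w ∈ C ∧ w ≠ a ∧ w ≠ b ∧ w ≠ v := by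
    intro w hw
    refine ⟨by rw [e]; simp [hw], ?_⟩
    simp only [List.nodup_append, List.nodup_cons, List.mem_cons] at hndC
    have := hndC.2.1
    grind
  have hα : K.Dc S α = K.Dc (S \ {v}) α := dc_congr (fun w hw =>
    key w (nd1 w hw).1 (nd1 w hw).2.1 (nd1 w hw).2.2.1 (nd1 w hw).2.2.2)
  have hβ : K.Dc S β = K.Dc (S \ {v}) β := dc_congr (fun w hw =>
    key w (nd2 w hw).1 (nd2 w hw).2.1 (nd2 w hw).2.2.1 (nd2 w hw).2.2.2)
  have gen : ∀ w l o r, K.PdS S l o r → w = l ∨ w = r → ¬ K.PO S w := by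
    rintro w l o r hp hw ⟨l', r', hp'⟩
    have := hp.uniq hp' ⟨w, by tauto, by tauto⟩
    obtain ⟨rfl, rfl, rfl⟩ := this
    have := haP _ _ _ hp
    rcases hw with rfl | rfl <;> simp_all
  by_cases hcr : ∃ l o, K.PdS S l o v
  · obtain ⟨l, o, hp⟩ := hcr
    obtain ⟨n1, n2⟩ := h.pnx N hp
    have : o = a := nx_u1 h.nodup n2 hav
    subst this
    -- α ends with l
    obtain ⟨α0, hα0⟩ : ∃ α0, α = α0 ++ [l] := by
      rcases List.eq_nil_or_concat α with h0 | ⟨α0, x, h0⟩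
      · subst h0
        obtain ⟨tl, htl⟩ := h.hd
        rw [e] at htl
        simp at htl
        exact (po_D1 (K := K) (S := S) ⟨_, _, htl.1 ▸ hp⟩).elim
      · have hx : Nx C x o := by
          rw [e, h0]; simp only [List.append_assoc, List.concat_eq_append]; exact nx_of_split α0 _
        have := nx_u1 h.nodup hx n1
        subst this
        exact ⟨α0, by rw [h0]; simp⟩
    subst hα0
    have hPa : ¬ K.PO (S \ {v}) o := by
      rintro ⟨l', r', hp'⟩
      have := (hsub _ _ _ hp').uniq hp ⟨o, by simp, by simp⟩
      obtain ⟨rfl, -, rfl⟩ := this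
      exact hp'.mem.2.2.2 rfl
    have hPb : ¬ K.PO S b := by
      rintro ⟨l', r', hp'⟩
      have h1 := nx_u1 h.nodup (h.pnx N hp').1 hvb
      subst h1
      obtain ⟨q, -, -⟩ := hp.uniq hp' ⟨l', by simp, by simp⟩
      exact hp.ne.2.2 q
    have hPb' : ¬ K.PO (S \ {v}) b := by
      rintro ⟨l', r', hp'⟩; exact hPb ⟨_, _, hsub _ _ _ hp'⟩
    have hPl : ¬ K.PO S l := gen l _ _ _ hp (by simp)
    have hPl' : ¬ K.PO (S \ {v}) l := by
      rintro ⟨l', r', hp'⟩; exact hPl ⟨_, _, hsub _ _ _ hp'⟩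
    have hPo : K.PO S o := ⟨_, _, hp⟩
    have e1 : K.Dc S C = K.Dc (S \ {v}) α0 ++ l :: v :: b :: K.Dc (S \ {v}) β := by
      rw [e, dc_append, hα, dc_drop hPo, dc_keep hvP, dc_keep hPb, hβ, dc_append, dc_keep hPl']
      simp [Dc]
    have e2 : K.Dc (S \ {v}) ((α0 ++ [l]) ++ o :: (mid ++ b :: β)) =
        K.Dc (S \ {v}) α0 ++ l :: (o :: mid ++ b :: K.Dc (S \ {v}) β) := by
      rw [dc_append, dc_append, dc_keep hPa, dc_append, dc_self hmP, dc_keep hPb', dc_keep hPl']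
      simp [Dc]
    rw [e2] at hD
    have hlS : l ≠ v := hp.ne.2.2
    have := dr_R (Pd' := K.PdS S) hD hz (dcD1 (by
        simp only [List.mem_append, List.mem_singleton] at hD1 ⊢
        rcases hD1 with hD1 | hD1
        · exact hD1
        · exact (po_D1 (K := K) (S := S) (hD1 ▸ hPo)).elim)) (dcD2 hD2) (by
      intro l' o' r' hp' hn
      rw [List.cons_append, nx_cons_iff] at hn
      rcases hn with ⟨rfl, -⟩ | hn
      · obtain ⟨-, -, rfl⟩ := (hsub _ _ _ hp').uniq hp ⟨l', by simp, by simp⟩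
        exact hp'.mem.2.2.2 rfl
      · exact hnE _ _ _ hp' hn) (by
      intro l' o' r' hp'
      by_cases h1 : l' = v
      · exact Or.inr (hp'.uniq hp ⟨v, by simp [h1], by simp⟩)
      · by_cases h2 : r' = v
        · exact Or.inr (hp'.uniq hp ⟨v, by simp [h2], by simp⟩)
        · exact Or.inl (hsup _ _ _ hp' h1 h2))
    rw [e1, hSD]
    refine dr_mono this ?_ (fun l o r hp => hp.as) (by rw [← hSD, hcard]; exact NN1 _)
    have hx : ∀ w, (w ∈ o :: (mid ++ [b]) ∨ (∃ o, K.PdS S v o w ∨ K.PdS S w o v)) → w ∈ l :: (o :: mid ++ [b]) := by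
      rintro w (hw | ⟨o', hp' | hp'⟩)
      · exact List.mem_cons_of_mem _ hw
      · obtain ⟨rfl, -⟩ := hp'.uniq hp ⟨v, by simp [*], by simp [*]⟩
        exact (hlS rfl).elim
      · obtain ⟨rfl, -⟩ := hp'.uniq hp ⟨v, by simp [*], by simp [*]⟩
        simp
    intro u w ha
    by_cases h1 : u = v
    · subst h1; exact Or.inr (Or.inl ⟨rfl, hx _ (haS1 _ ha)⟩)
    · by_cases h2 : w = v
      · subst h2; exact Or.inr (Or.inr ⟨rfl, hx _ (haS2 _ ha)⟩)
      · exact Or.inl (haS _ _ ha h1 h2)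
  have hPa : ¬ K.PO S a := by
    rintro ⟨l, r, hp⟩
    have := nx_u2 h.nodup (h.pnx N hp).2 hav
    subst this
    exact hcr ⟨_, _, hp⟩
  have hPa' : ¬ K.PO (S \ {v}) a := by
    rintro ⟨l', r', hp'⟩; exact hPa ⟨_, _, hsub _ _ _ hp'⟩
  by_cases hcl : ∃ o r, K.PdS S v o r
  · obtain ⟨o, r, hp⟩ := hcl
    obtain ⟨n1, n2⟩ := h.pnx N hp
    have : o = b := nx_u2 h.nodup n1 hvb
    subst this
    obtain ⟨β0, hβ0⟩ : ∃ β0, β = r :: β0 := by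
      rcases β with _ | ⟨x, β0⟩
      · obtain ⟨tl, htl⟩ := h.lt
        rw [e] at htl
        have h3 := congrArg List.getLast? htl
        simp at h3
        exact (po_D2 (K := K) (S := S) ⟨_, _, h3 ▸ hp⟩).elim
      · have hx : Nx C o x := by
          rw [e]
          have : α ++ a :: v :: o :: x :: β0 = (α ++ [a, v]) ++ o :: x :: β0 := by simp
          rw [this]; exact nx_of_split _ _
        have := nx_u2 h.nodup hx n2
        subst this
        exact ⟨β0, rfl⟩
    subst hβ0
    have hPo : K.PO S o := ⟨_, _, hp⟩
    have hPo' : ¬ K.PO (S \ {v}) o := by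
      rintro ⟨l', r', hp'⟩
      have := (hsub _ _ _ hp').uniq hp ⟨o, by simp, by simp⟩
      obtain ⟨rfl, -, rfl⟩ := this
      exact hp'.mem.1.2 rfl
    have hPr : ¬ K.PO S r := gen r _ _ _ hp (by simp)
    have hPr' : ¬ K.PO (S \ {v}) r := by
      rintro ⟨l', r', hp'⟩; exact hPr ⟨_, _, hsub _ _ _ hp'⟩
    have e1 : K.Dc S C = K.Dc (S \ {v}) α ++ a :: v :: r :: K.Dc (S \ {v}) β0 := by
      rw [e, dc_append, hα, dc_keep hPa, dc_keep hvP, dc_drop hPo, hβ, dc_keep hPr']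
    have e2 : K.Dc (S \ {v}) (α ++ a :: (mid ++ o :: r :: β0)) =
        K.Dc (S \ {v}) α ++ a :: (mid ++ o :: r :: K.Dc (S \ {v}) β0) := by
      rw [dc_append, dc_keep hPa', dc_append, dc_self hmP, dc_keep hPo', dc_keep hPr']
    rw [e2] at hD
    have hrv : r ≠ v := hp.ne.2.2.symm
    have hor := (haP _ _ _ hp).2
    have hDr := dr_L (Pd' := K.PdS S) hD hz (dcD1 hD1) (dcD2 (by
        simp only [List.mem_cons] at hD2 ⊢
        rcases hD2 with hD2 | hD2
        · exact (po_D2 (K := K) (S := S) (hD2 ▸ hPo)).elim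
        · exact hD2)) (by
      intro l' o' r' hp'
      refine ⟨hnE _ _ _ hp', ?_⟩
      rintro ⟨rfl, rfl⟩
      obtain ⟨q, -, -⟩ := (hsub _ _ _ hp').uniq hp ⟨l', by simp, by simp⟩
      exact hp'.mem.1.2 q) (by
      intro l' o' r' hp'
      by_cases h1 : l' = v
      · exact Or.inr (hp'.uniq hp ⟨v, by simp [h1], by simp⟩)
      · by_cases h2 : r' = v
        · exact Or.inr (hp'.uniq hp ⟨v, by simp [h2], by simp⟩)
        · exact Or.inl (hsup _ _ _ hp' h1 h2))
    rw [e1, hSD]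
    refine dr_mono hDr ?_ (fun l o r hp => hp.as) (by
      rw [← hSD, hcard]; apply NN2
      obtain ⟨i, m, hX, hz, q1, q2, q3, hl, ho, hr⟩ := hp
      refine sd_card hR.mD (x := o) (y := r) ⟨⟨ho, ?_⟩, ?_⟩ ⟨⟨hr, hrv⟩, ?_⟩ ?_ ?_ ?_ ?_ hor N.d12
      · intro hh; exact (haP v o r ⟨i, m, hX, hz, q1, q2, q3, hl, ho, hr⟩).1 (Eq.symm hh)
      · rw [q2]; exact fun i' hh => K.Xκ _ _ _ hh.symm
      · rw [q3]; exact fun i' hh => K.Xκ _ _ _ hh.symm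
      · rw [q2]; exact K.κD1 _ _
      · rw [q2]; exact K.κD2 _ _
      · rw [q3]; exact K.κD1 _ _
      · rw [q3]; exact K.κD2 _ _)
    have hx : ∀ w, (w ∈ a :: (mid ++ [o]) ∨ (∃ o, K.PdS S v o w ∨ K.PdS S w o v)) → w ∈ a :: (mid ++ [o]) ∨ w = r := by
      rintro w (hw | ⟨o', hp' | hp'⟩)
      · exact Or.inl hw
      · obtain ⟨-, -, rfl⟩ := hp'.uniq hp ⟨v, by simp [*], by simp [*]⟩
        simp
      · obtain ⟨-, -, rfl⟩ := hp'.uniq hp ⟨v, by simp [*], by simp [*]⟩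
        exact (hrv rfl).elim
    intro u w ha
    by_cases h1 : u = v
    · subst h1
      rcases hx _ (haS1 _ ha) with hh | hh
      · exact Or.inl (Or.inr (Or.inl ⟨rfl, hh⟩))
      · exact Or.inr (Or.inl ⟨rfl, by simp [hh]⟩)
    · by_cases h2 : w = v
      · subst h2
        rcases hx _ (haS2 _ ha) with hh | hh
        · exact Or.inl (Or.inr (Or.inr ⟨rfl, hh⟩))
        · exact Or.inr (Or.inr ⟨rfl, by simp [hh]⟩)
      · exact Or.inl (Or.inl (haS _ _ ha h1 h2))
  have hPb : ¬ K.PO S b := by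
    rintro ⟨l, r, hp⟩
    have := nx_u1 h.nodup (h.pnx N hp).1 hvb
    subst this
    exact hcl ⟨_, _, hp⟩
  have hPb' : ¬ K.PO (S \ {v}) b := by
    rintro ⟨l', r', hp'⟩; exact hPb ⟨_, _, hsub _ _ _ hp'⟩
  have e1 : K.Dc S C = K.Dc (S \ {v}) α ++ a :: v :: b :: K.Dc (S \ {v}) β := by
    rw [e, dc_append, hα, dc_keep hPa, dc_keep hvP, dc_keep hPb, hβ]
  have e2 : K.Dc (S \ {v}) (α ++ a :: (mid ++ b :: β)) =
      K.Dc (S \ {v}) α ++ a :: (mid ++ b :: K.Dc (S \ {v}) β) := by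
    rw [dc_append, dc_keep hPa', dc_append, dc_self hmP, dc_keep hPb']
  rw [e2] at hD
  have hPe : K.PdS (S \ {v}) = K.PdS S := by
    ext l o r
    refine ⟨hsub _ _ _, fun hp => hsup _ _ _ hp ?_ ?_⟩
    · rintro rfl; exact hcl ⟨_, _, hp⟩
    · rintro rfl; exact hcr ⟨_, _, hp⟩
  have hDr := dr_N hD hz (dcD1 hD1) (dcD2 hD2) hnE
  rw [e1, hSD, ← hPe]
  refine dr_mono hDr ?_ (fun l o r hp => (hsub _ _ _ hp).as) (by rw [← hSD, hcard]; exact NN1 _)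
  intro u w ha
  have hx : ¬ ∃ w o, K.PdS S v o w ∨ K.PdS S w o v := by
    rintro ⟨w, o, hh | hh⟩
    · exact hcl ⟨_, _, hh⟩
    · exact hcr ⟨_, _, hh⟩
  by_cases h1 : u = v
  · subst h1; exact Or.inr (Or.inl ⟨rfl, (haS1 _ ha).resolve_right (fun hh => hx ⟨_, hh⟩)⟩)
  · by_cases h2 : w = v
    · subst h2; exact Or.inr (Or.inr ⟨rfl, (haS2 _ ha).resolve_right (fun hh => hx ⟨_, hh⟩)⟩)
    · exact Or.inl (haS _ _ ha h1 h2)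

theorem PdS.kit {l o r : W} (hp : K.PdS S l o r) {i : ι} (hX : K.X i ∈ S) : ∃ j m, j ≠ i ∧ K.X j ∉ S ∧ K.κ j m ∉ S ∧
    l = K.κ j (m + 1) ∧ o = K.κ j (m + 2) ∧ r = K.κ j (m + 3) := by
  obtain ⟨j, m, h1, h2, h3, h4, h5, -⟩ := hp
  exact ⟨j, m, by rintro rfl; exact h1 hX, h1, h2, h3, h4, h5⟩

theorem κne (i j : ι) {m m' : Fin 4} (h : m ≠ m') : K.κ i m ≠ K.κ j m' := fun e => h (K.κinj _ _ _ _ e).2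

theorem κnX (i j : ι) (m : Fin 4) : K.κ i m ≠ K.X j := fun e => K.Xκ _ _ _ e.symm

set_option maxHeartbeats 1000000 in
theorem St.m2 (N : K.Nrm T) (h : K.St T S C)
    (IH : ∀ S' C', S'.ncard < S.ncard → K.St T S' C' → K.DRW T S' C')
    {i : ι} {m : Fin 4} (hX : K.X i ∈ S) (hzC : K.κ i m ∈ C) (hCL : CL T C (K.κ i m))
    (hoC : K.κ i (m + 2) ∉ C) : K.DRW T S C := by
  obtain ⟨z, hz⟩ : ∃ z, z = K.κ i m := ⟨_, rfl⟩
  obtain ⟨l, hl⟩ : ∃ z, z = K.κ i (m + 1) := ⟨_, rfl⟩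
  obtain ⟨o, ho⟩ : ∃ z, z = K.κ i (m + 2) := ⟨_, rfl⟩
  obtain ⟨r, hr⟩ : ∃ z, z = K.κ i (m + 3) := ⟨_, rfl⟩
  obtain ⟨x, hx⟩ : ∃ z, z = K.X i := ⟨_, rfl⟩
  have F1 : T.F x z l := by rw [hx, hz, hl]; exact N.X i m
  have F2 : T.F x l o := by have := N.X i (m + 1); rw [(f4 m).1] at this; rwa [hx, hl, ho]
  have F3 : T.F x o r := by have := N.X i (m + 2); rw [(f4 m).2.1] at this; rwa [hx, ho, hr]
  have F4 : T.F x r z := by have := N.X i (m + 3); rw [(f4 m).2.2.1] at this; rwa [hx, hr, hz]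
  have nzo : ¬ T.E z o := by rw [hz, ho]; exact N.nd i m
  have nlr : ¬ T.E l r := by have := N.nd i (m + 1); rw [(f4 m).2.2.2.2.1] at this; rwa [hl, hr]
  have hcor : ∀ m', K.κ i m' = z ∨ K.κ i m' = l ∨ K.κ i m' = o ∨ K.κ i m' = r := by
    intro m'
    rcases f4c m m' with rfl | rfl | rfl | rfl <;> simp [*]
  have d : z ≠ l ∧ z ≠ o ∧ z ≠ r ∧ l ≠ o ∧ l ≠ r ∧ o ≠ r := by
    obtain ⟨h1, h2, h3, h4, h5, h6⟩ := f4n m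
    subst hz hl ho hr
    exact ⟨κne _ _ h1, κne _ _ h2, κne _ _ h3, κne _ _ h4, κne _ _ h5, κne _ _ h6⟩
  obtain ⟨dzl, dzo, dzr, dlo, dlr, dor⟩ := d
  have nX : ∀ j, z ≠ K.X j ∧ l ≠ K.X j ∧ o ≠ K.X j ∧ r ≠ K.X j := by
    intro j; subst hz hl ho hr; exact ⟨κnX _ _ _, κnX _ _ _, κnX _ _ _, κnX _ _ _⟩
  have hxS : x ∈ S := hx ▸ hX
  have hxC : x ∉ C := hx ▸ h.Xn i
  rw [← hz] at hzC hCL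
  rw [← ho] at hoC
  have hlS : l ∈ S := h.int x hxS hxC _ F2.e12
  have hoS : o ∈ S := h.int x hxS hxC _ F3.e12
  have hrS : r ∈ S := h.int x hxS hxC _ F4.e12
  have hzS : z ∈ S := h.sub z hzC
  obtain ⟨α, a, b, β, e⟩ := h.split hzC (by rw [hz]; exact K.κD1 _ _) (by rw [hz]; exact K.κD2 _ _)
  obtain ⟨hD1, hD2, -, -, hav, hvb⟩ := h.mids e
  obtain ⟨mid, hF, hnd, hS, hall⟩ := h.fan e
  have hm := clmid h.toWSt e hCL hF hnd
  have hR := h.toWSt.remove e hF hnd hS hall hm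
  have hxm : x ∈ mid := by
    have := hall x hxS F1.e12.symm
    simp only [List.mem_cons, List.mem_append, List.not_mem_nil, or_false] at this
    rcases this with rfl | hh | rfl
    · exact (hxC hav.mem.1).elim
    · exact hh
    · exact (hxC hvb.mem.2).elim
  have hom : o ∉ mid := fun hh => nzo (nx_fanE hF o hh)
  have hoa : o ≠ a := by rintro rfl; exact hoC hav.mem.1
  have hob : o ≠ b := by rintro rfl; exact hoC hvb.mem.2
  obtain ⟨mid1, mid2, rfl⟩ := List.append_of_mem hxm
  obtain ⟨γ, hγ⟩ : ∃ γ, a :: mid1 = γ ++ [l] := by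
    rcases List.eq_nil_or_concat (a :: mid1) with h0 | ⟨γ, y, h0⟩
    · simp at h0
    · have hn : Nx (a :: ((mid1 ++ x :: mid2) ++ [b])) y x := by
        have : a :: ((mid1 ++ x :: mid2) ++ [b]) = γ ++ y :: x :: (mid2 ++ [b]) := by
          have : a :: ((mid1 ++ x :: mid2) ++ [b]) = (a :: mid1) ++ x :: (mid2 ++ [b]) := by simp
          rw [this, h0]; simp
        rw [this]; exact nx_of_split _ _
      have := T.u2 (hF _ _ hn) F1.cyc
      subst this
      exact ⟨γ, by rw [h0]; simp⟩
  obtain ⟨δ, hδ⟩ : ∃ δ, mid2 ++ [b] = r :: δ := by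
    rcases h0 : mid2 ++ [b] with _ | ⟨y, δ⟩
    · simp at h0
    · have hn : Nx (a :: ((mid1 ++ x :: mid2) ++ [b])) x y := by
        have : a :: ((mid1 ++ x :: mid2) ++ [b]) = (a :: mid1) ++ x :: y :: δ := by
          have : a :: ((mid1 ++ x :: mid2) ++ [b]) = (a :: mid1) ++ x :: (mid2 ++ [b]) := by simp
          rw [this, h0]
        rw [this]; exact nx_of_split _ _
      have := T.u3 (hF _ _ hn) F4.cyc2
      subst this
      exact ⟨δ, rfl⟩
  have eC1 : α ++ a :: ((mid1 ++ x :: mid2) ++ b :: β) = (α ++ γ) ++ l :: x :: r :: (δ ++ β) := by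
    have : α ++ a :: ((mid1 ++ x :: mid2) ++ b :: β) = α ++ (a :: mid1) ++ x :: ((mid2 ++ [b]) ++ β) := by simp
    rw [this, hγ, hδ]; simp
  have hxz : x ≠ z := F1.n12
  have hR2 := hR.remove (mid := [o]) eC1 (by
      intro u u' hn
      simp only [List.cons_append, List.nil_append, nx_cons_iff] at hn
      rcases hn with ⟨rfl, _, hn⟩ | ⟨rfl, _, hn⟩ | ⟨rfl, _, hn⟩ | hn
      · simp at hn; rw [← hn.1]; exact F2
      · simp at hn; rw [← hn.1]; exact F3
      · simp at hn
      · simp [Nx] at hn) (by simp [dlo, dlr, dor]) (by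
      intro u hu
      simp at hu
      rcases hu with rfl | rfl | rfl
      · exact ⟨hlS, dzl.symm⟩
      · exact ⟨hoS, dzo.symm⟩
      · exact ⟨hrS, dzr.symm⟩) (by
      intro u hu hE
      have : T.E u (K.X i) := by rw [← hx]; exact hE.symm
      obtain ⟨m', rfl⟩ := N.nb this
      have := hcor m'
      have h2 : K.κ i m' ≠ z := hu.2
      simp only [List.cons_append, List.nil_append, List.mem_cons, List.not_mem_nil, or_false]
      tauto) (by
      intro u hu hC
      simp only [List.mem_singleton] at hu
      subst hu
      rw [e] at hoC
      simp only [List.mem_append, List.mem_cons] at hC hoC hom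
      tauto)
  obtain ⟨S2, hS2⟩ : ∃ S2, S2 = (S \ {z}) \ {x} := ⟨_, rfl⟩
  have mS2 : ∀ w, w ∈ S2 ↔ w ∈ S ∧ w ≠ z ∧ w ≠ x := by intro w; rw [hS2]; simp [and_assoc]
  rw [← hS2] at hR2
  have hsub2 : S2 ⊆ S := fun w hw => ((mS2 w).1 hw).1
  have hXS : ∀ j, K.X j ∈ S2 ↔ K.X j ∈ S ∧ j ≠ i := by
    intro j
    rw [mS2]
    constructor
    · rintro ⟨h1, h2, h3⟩; exact ⟨h1, fun hh => h3 (by rw [hx, hh])⟩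
    · rintro ⟨h1, h2⟩; exact ⟨h1, fun hh => (nX j).1 hh.symm, fun hh => h2 (K.Xinj _ _ (hh.trans hx))⟩
  have hSt : K.St T S2 (α ++ γ ++ l :: ([o] ++ r :: (δ ++ β))) := by
    refine ⟨hR2, ?_, ?_⟩
    · intro j hj
      have hjS : K.X j ∈ S2 := hR2.sub _ hj
      rw [hXS] at hjS
      have h1 := h.Xn j
      rw [e] at h1
      have hjx : K.X j ≠ x := fun hh => hjS.2 (K.Xinj _ _ (hh.trans hx))
      have h2 : K.X j ∈ α ++ a :: ((mid1 ++ x :: mid2) ++ b :: β) := by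
        rw [eC1]
        have := (nX j).2.2.1
        simp only [List.mem_append, List.mem_cons, List.not_mem_nil, or_false] at hj ⊢
        grind
      have h3 : K.X j ∈ mid1 ++ x :: mid2 := by
        simp only [List.mem_append, List.mem_cons] at h1 h2 ⊢
        grind
      have h4 := nx_fanE hF _ h3
      obtain ⟨m', e'⟩ := N.nb h4
      exact hjS.2 (K.κinj _ _ _ _ (hz.symm.trans e')).1.symm
    · intro j hj
      by_cases hji : j = i
      · subst hji; exact ⟨m, by rw [← hz, mS2]; simp⟩
      · obtain ⟨m', hm'⟩ := h.kt j (fun hh => hj ((hXS j).2 ⟨hh, hji⟩))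
        exact ⟨m', fun hh => hm' (hsub2 hh)⟩
  have hlt : S2.ncard < S.ncard := Set.ncard_lt_ncard ⟨hsub2, fun hh => ((mS2 z).1 (hh hzS)).2.1 rfl⟩ (Set.toFinite _)
  have hD := IH _ _ hlt hSt
  have hlS2 : l ∈ S2 := (mS2 l).2 ⟨hlS, dzl.symm, by rw [hx]; exact (nX i).2.1⟩
  have hoS2 : o ∈ S2 := (mS2 o).2 ⟨hoS, dzo.symm, by rw [hx]; exact (nX i).2.2.1⟩
  have hrS2 : r ∈ S2 := (mS2 r).2 ⟨hrS, dzr.symm, by rw [hx]; exact (nX i).2.2.2⟩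
  have hpn : K.PdS S2 l o r := ⟨i, m, by rw [hXS]; simp, by rw [← hz, mS2]; simp, hl, ho, hr, hlS2, hoS2, hrS2⟩
  have hup : ∀ l' o' r', K.PdS S l' o' r' → K.PdS S2 l' o' r' := by
    intro l' o' r' hp
    obtain ⟨j, m', hji, h1, h2, h3, h4, h5⟩ := hp.kit hX
    obtain ⟨q1, q2, q3⟩ := hp.mem
    have aux : ∀ m', K.κ j m' ∈ S → K.κ j m' ∈ S2 := fun m' hh => (mS2 _).2 ⟨hh, fun hh => hji (K.κinj _ _ _ _ (hh.trans hz)).1,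
      by rw [hx]; exact κnX _ _ _⟩
    refine ⟨j, m', fun hh => h1 (hsub2 hh), fun hh => h2 (hsub2 hh), h3, h4, h5, ?_, ?_, ?_⟩
    · rw [h3] at q1 ⊢; exact aux _ q1
    · rw [h4] at q2 ⊢; exact aux _ q2
    · rw [h5] at q3 ⊢; exact aux _ q3
  have hdn : ∀ l' o' r', K.PdS S2 l' o' r' → K.PdS S l' o' r' ∨ (l' = l ∧ o' = o ∧ r' = r) := by
    intro l' o' r' hp
    have hp0 := hp
    obtain ⟨j, m', h1, h2, h3, h4, h5, h6, h7, h8⟩ := hp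
    by_cases hji : j = i
    · subst hji
      right
      refine hp0.uniq hpn ⟨l', by simp, ?_⟩
      have := hcor (m' + 1)
      rw [← h3] at this
      have := ((mS2 l').1 h6).2.1
      tauto
    · left
      refine ⟨j, m', fun hh => h1 ((hXS j).2 ⟨hh, hji⟩), fun hh => h2 ((mS2 _).2 ⟨hh, fun hh => hji (K.κinj _ _ _ _ (hh.trans hz)).1,
      by rw [hx]; exact κnX _ _ _⟩), h3, h4, h5, hsub2 h6, hsub2 h7, hsub2 h8⟩
  have npo : ∀ w, w = z ∨ w = l ∨ w = o ∨ w = r → ¬ K.PO S w := by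
    rintro w hw ⟨l', r', hp⟩
    obtain ⟨j, m', hji, h1, h2, h3, h4, h5⟩ := hp.kit hX
    have : ∃ m'', w = K.κ i m'' := by rcases hw with rfl | rfl | rfl | rfl <;> exact ⟨_, by assumption⟩
    obtain ⟨m'', e'⟩ := this
    exact hji (K.κinj _ _ _ _ (h4.symm.trans e')).1
  have npo' : ∀ l' o' r', K.PdS S l' o' r' → (l' ≠ z ∧ l' ≠ l) ∧ r' ≠ z := by
    intro l' o' r' hp
    obtain ⟨j, m', hji, h1, h2, h3, h4, h5⟩ := hp.kit hX
    refine ⟨⟨?_, ?_⟩, ?_⟩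
    · intro e'; exact hji (K.κinj _ _ _ _ (h3.symm.trans (e'.trans hz))).1
    · intro e'; exact hji (K.κinj _ _ _ _ (h3.symm.trans (e'.trans hl))).1
    · intro e'; exact hji (K.κinj _ _ _ _ (h5.symm.trans (e'.trans hz))).1
  have poi : ∀ w, w ≠ o → (K.PO S w ↔ K.PO S2 w) := by
    intro w hw
    constructor
    · rintro ⟨l', r', hp⟩; exact ⟨l', r', hup _ _ _ hp⟩
    · rintro ⟨l', r', hp⟩
      rcases hdn _ _ _ hp with hp | hp
      · exact ⟨_, _, hp⟩
      · exact (hw hp.2.1).elim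
  have hPa : ¬ K.PO S a := by
    rintro ⟨l', r', hp⟩
    have := nx_u2 h.nodup (h.pnx N hp).2 hav
    exact (npo' _ _ _ hp).2 this
  have hPb : ¬ K.PO S b := by
    rintro ⟨l', r', hp⟩
    have := nx_u1 h.nodup (h.pnx N hp).1 hvb
    exact (npo' _ _ _ hp).1.1 this
  have hPm : ∀ w ∈ mid1 ++ x :: mid2, ¬ K.PO S2 w := by
    intro w hw
    rw [← poi w (by rintro rfl; exact hom hw)]
    rintro ⟨l', r', hp⟩
    exact hm w hw (h.pnx N hp).1.mem.2
  have hndC := h.nodup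
  rw [e] at hndC
  have hαβ : ∀ w ∈ C, K.PO S w ↔ K.PO S2 w := by
    intro w hw; exact poi w (by rintro rfl; exact hoC hw)
  have e1 : K.Dc S C = K.Dc S2 α ++ a :: z :: b :: K.Dc S2 β := by
    rw [dc_congr hαβ, e, dc_append, dc_keep, dc_keep, dc_keep]
    · rwa [← hαβ b hvb.mem.2]
    · rw [← hαβ z hzC]; exact npo z (by simp)
    · rwa [← hαβ a hav.mem.1]
  have e2 : K.Dc S2 (α ++ γ ++ l :: ([o] ++ r :: (δ ++ β))) = K.Dc S2 α ++ a :: ((mid1 ++ mid2) ++ b :: K.Dc S2 β) := by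
    have : α ++ γ ++ l :: ([o] ++ r :: (δ ++ β)) = α ++ (a :: mid1) ++ o :: ((mid2 ++ [b]) ++ β) := by
      rw [hγ, hδ]; simp
    have h1 : K.Dc S2 (a :: mid1) = a :: mid1 := by
      apply dc_self
      intro w hw
      rcases List.mem_cons.1 hw with rfl | hw
      · rwa [← hαβ w hav.mem.1]
      · exact hPm w (by simp [hw])
    have h2 : K.Dc S2 (mid2 ++ [b]) = mid2 ++ [b] := by
      apply dc_self
      intro w hw
      rcases List.mem_append.1 hw with hw | hw
      · exact hPm w (by simp [hw])
      · rw [List.mem_singleton.1 hw]; rwa [← hαβ b hvb.mem.2]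
    rw [this, dc_append, dc_append, dc_drop ⟨_, _, hpn⟩, dc_append, h1, h2]
    simp
  unfold DRW at hD ⊢
  rw [e2] at hD
  have hsd : K.SD S = insert z (K.SD S2) := by
    rw [sd_insert hzS (fun j => (nX j).1), hS2, hx, sd_X]
  have hzn : z ∉ K.SD S2 := fun hh => ((mS2 z).1 hh.1).2.1 rfl
  have hcard : (K.SD S).ncard = (K.SD S2).ncard + 1 := by
    rw [hsd, Set.ncard_insert_of_notMem hzn (Set.toFinite _)]
  have hfan : ∀ w, w ∈ a :: ((mid1 ++ mid2) ++ [b]) ↔ w ∈ a :: ((mid1 ++ x :: mid2) ++ [b]) ∧ w ≠ x := by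
    intro w
    have q : x ∉ mid1 ∧ x ∉ mid2 := by
      have q0 : (a :: mid1 ++ x :: (mid2 ++ [b])).Nodup := by simpa using hnd
      rw [List.nodup_middle, List.nodup_cons] at q0
      have q1 := q0.1
      simp only [List.mem_append, List.mem_cons] at q1
      exact ⟨fun hh => q1 (Or.inl (Or.inr hh)), fun hh => q1 (Or.inr (Or.inl hh))⟩
    obtain ⟨q1, q2⟩ := q
    simp only [List.cons_append, List.mem_append, List.mem_cons,
      List.not_mem_nil, or_false, List.append_assoc]
    have hxa : x ≠ a := by rintro rfl; exact hxC hav.mem.1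
    have hxb : x ≠ b := by rintro rfl; exact hxC hvb.mem.2
    clear * - q1 q2 hxa hxb
    constructor
    · rintro (h | h | h | h)
      · exact ⟨Or.inl h, by rw [h]; exact hxa.symm⟩
      · exact ⟨by tauto, by rintro rfl; exact q1 h⟩
      · exact ⟨by tauto, by rintro rfl; exact q2 h⟩
      · exact ⟨by tauto, by rw [h]; exact hxb.symm⟩
    · tauto
  have hnx : ∀ u u', Nx (a :: ((mid1 ++ mid2) ++ [b])) u u' ↔
      (u = l ∧ u' = r) ∨ (Nx (a :: mid1) u u') ∨ Nx (mid2 ++ [b]) u u' := by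
    intro u u'
    have : a :: ((mid1 ++ mid2) ++ [b]) = γ ++ l :: (r :: δ) := by
      rw [← hδ]
      have : a :: ((mid1 ++ mid2) ++ [b]) = (a :: mid1) ++ (mid2 ++ [b]) := by simp
      rw [this, hγ]; simp
    rw [this, nx_append, nx_cons_iff, hγ, hδ]
    constructor
    · rintro (h | ⟨h, _, h'⟩ | h)
      · exact Or.inr (Or.inl h)
      · injection h' with h1 h2; exact Or.inl ⟨h, h1.symm⟩
      · exact Or.inr (Or.inr h)
    · rintro (⟨h, h'⟩ | h | h)
      · exact Or.inr (Or.inl ⟨h, _, by rw [h']⟩)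
      · exact Or.inl h
      · exact Or.inr (Or.inr h)
  have hDr := dr_Z (Pd' := K.PdS S) hD hzn (dcD1 hD1) (dcD2 hD2) hpn ((hnx _ _).2 (Or.inl ⟨rfl, rfl⟩)) (by
      intro l' o' r' hp
      refine ⟨hup _ _ _ hp, ?_⟩
      rw [hnx]
      rintro (hh | hh | hh)
      · exact (npo' _ _ _ hp).1.2 hh.1
      · apply hp.nE N
        refine (hF l' r' ?_).e23
        have : a :: ((mid1 ++ x :: mid2) ++ [b]) = γ ++ l :: (x :: (mid2 ++ [b])) := by
          have : a :: ((mid1 ++ x :: mid2) ++ [b]) = (a :: mid1) ++ x :: (mid2 ++ [b]) := by simp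
          rw [this, hγ]; simp
        rw [this, nx_append, ← hγ]; exact Or.inl hh
      · apply hp.nE N
        refine (hF l' r' ?_).e23
        have : a :: ((mid1 ++ x :: mid2) ++ [b]) = (a :: mid1) ++ x :: (mid2 ++ [b]) := by simp
        rw [this, nx_append]; exact Or.inr (nx_cons hh)) (by
      rintro u v hA ⟨j, m', h1, h2⟩
      have hj : j = i := by
        rcases h2 with ⟨h2, -⟩ | ⟨h2, -⟩ <;> exact (K.κinj _ _ _ _ (h2.symm.trans hl)).1
      subst hj
      have h3 : SameE u v z o := by
        have : m' = m ∨ m' = m + 2 := by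
          rcases h2 with ⟨h2, -⟩ | ⟨h2, -⟩
          · have := (K.κinj _ _ _ _ (h2.symm.trans hl)).2
            left; exact (by decide : ∀ m m' : Fin 4, m' + 1 = m + 1 → m' = m) m m' this
          · have := (K.κinj _ _ _ _ (h2.symm.trans hl)).2
            right
            exact (by decide : ∀ m m' : Fin 4, m' + 3 = m + 1 → m' = m + 2) m m' this
        rcases this with rfl | rfl
        · rw [hz, ho]; exact h1
        · rw [(f4 m).2.2.2.1] at h1; rw [hz, ho]
          rcases h1 with h1 | h1
          · exact Or.inr h1
          · exact Or.inl h1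
      have hoF : o ∉ a :: ((mid1 ++ mid2) ++ [b]) := by
        rw [hfan]; rintro ⟨hh, -⟩
        simp only [List.mem_cons, List.mem_append] at hh hom
        simp at hh; tauto
      have hAz : ∀ u v, K.AS T S2 u v → u ≠ z ∧ v ≠ z := fun u v hh =>
        ⟨((mS2 _).1 hh.1).2.1, ((mS2 _).1 hh.2.1).2.1⟩
      rcases h3 with ⟨rfl, rfl⟩ | ⟨rfl, rfl⟩
      · rcases hA with hA | ⟨-, hA⟩ | ⟨hA, -⟩
        · exact (hAz _ _ hA).1 rfl
        · exact hoF hA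
        · exact dzo hA.symm
      · rcases hA with hA | ⟨hA, -⟩ | ⟨-, hA⟩
        · exact (hAz _ _ hA).2 rfl
        · exact dzo hA.symm
        · exact hoF hA) (by
      intro u v u' v' h1 h2
      constructor
      · exact ⟨i, m, by rw [← hz, ← ho]; exact h1, by rw [← hl, ← hr]; exact h2⟩
      · refine ⟨i, m + 1, ?_, ?_⟩
        · rw [(f4 m).2.2.2.2.1, ← hl, ← hr]; exact h2
        · rw [(f4 m).1, (f4 m).2.2.2.2.2.2.2.2, ← hz, ← ho]
          rcases h1 with h1 | h1
          · exact Or.inr h1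
          · exact Or.inl h1)
  rw [e1, hsd]
  refine dr_mono hDr ?_ (fun l o r hp => hp.as) (by
      rw [← hsd, hcard]; apply NN2
      refine sd_card hR2.mD (x := o) (y := r) ⟨hoS2, fun j => (nX j).2.2.1⟩ ⟨hrS2, fun j => (nX j).2.2.2⟩ ?_ ?_ ?_ ?_ dor N.d12
      · rw [ho]; exact K.κD1 _ _
      · rw [ho]; exact K.κD2 _ _
      · rw [hr]; exact K.κD1 _ _
      · rw [hr]; exact K.κD2 _ _)
  have hA1 : ∀ w, K.AS T S z w ∨ K.AS T S w z → w ∈ a :: ((mid1 ++ mid2) ++ [b]) ∨ w = o := by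
    have hE : ∀ w, w ∈ S → T.E z w → (∀ i, w ≠ K.X i) → w ∈ a :: ((mid1 ++ mid2) ++ [b]) := by
      intro w hw hE hX
      rw [hfan]
      exact ⟨hall w hw hE, by rw [hx]; exact hX i⟩
    rintro w (⟨h1, h2, h3⟩ | ⟨h1, h2, h3⟩)
    · rcases h3 with h3 | ⟨j, m', h3, h4, h5⟩ | ⟨o', h3 | h3⟩
      · exact Or.inl (hE w h2 h3.1 h3.2.2)
      · obtain ⟨rfl, rfl⟩ := K.κinj _ _ _ _ (hz.symm.trans h4)
        exact Or.inr (h5.trans ho.symm)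
      · exact ((npo' _ _ _ h3).1.1 rfl).elim
      · exact ((npo' _ _ _ h3).2 rfl).elim
    · rcases h3 with h3 | ⟨j, m', h3, h4, h5⟩ | ⟨o', h3 | h3⟩
      · exact Or.inl (hE w h1 h3.1.symm h3.2.1)
      · obtain ⟨rfl, e'⟩ := K.κinj _ _ _ _ (hz.symm.trans h5)
        rw [e', (f4 m').2.2.2.1] at ho
        exact Or.inr (h4.trans ho.symm)
      · exact ((npo' _ _ _ h3).2 rfl).elim
      · exact ((npo' _ _ _ h3).1.1 rfl).elim
  intro u w ha
  by_cases h1 : u = z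
  · subst h1
    rcases hA1 w (Or.inl ha) with hh | hh
    · exact Or.inl (Or.inr (Or.inl ⟨rfl, hh⟩))
    · exact Or.inr (Or.inl ⟨rfl, by simp [hh]⟩)
  · by_cases h2 : w = z
    · subst h2
      rcases hA1 u (Or.inr ha) with hh | hh
      · exact Or.inl (Or.inr (Or.inr ⟨rfl, hh⟩))
      · exact Or.inr (Or.inr ⟨rfl, by simp [hh]⟩)
    · left; left
      obtain ⟨q1, q2, q3⟩ := ha
      have wx : ∀ w, (∀ j, w ≠ K.X j) → w ≠ x := fun w hh => by rw [hx]; exact hh i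
      rcases q3 with q3 | ⟨j, m', q3, q4, q5⟩ | ⟨o', q3 | q3⟩
      · exact ⟨(mS2 _).2 ⟨q1, h1, wx _ q3.2.1⟩, (mS2 _).2 ⟨q2, h2, wx _ q3.2.2⟩, Or.inl q3⟩
      · have b1 : u ∈ S2 := (mS2 _).2 ⟨q1, h1, wx _ (by rw [q4]; exact fun j' => κnX _ _ _)⟩
        have b2 : w ∈ S2 := (mS2 _).2 ⟨q2, h2, wx _ (by rw [q5]; exact fun j' => κnX _ _ _)⟩
        refine ⟨b1, b2, ?_⟩
        by_cases hj : j = i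
        · subst hj
          right; right
          rcases f4c m m' with rfl | rfl | rfl | rfl
          · exact (h1 (q4.trans hz.symm)).elim
          · rw [(f4 m).2.2.2.2.1, ← hr] at q5
            rw [← hl] at q4
            subst q4 q5
            exact ⟨o, Or.inl hpn⟩
          · rw [(f4 m).2.2.2.1] at q5
            exact (h2 (q5.trans hz.symm)).elim
          · rw [(f4 m).2.2.2.2.2.1, ← hl] at q5
            rw [← hr] at q4
            subst q4 q5
            exact ⟨o, Or.inr hpn⟩
        · exact Or.inr (Or.inl ⟨j, m', (hXS j).2 ⟨q3, hj⟩, q4, q5⟩)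
      · have := hup _ _ _ q3
        exact this.as
      · have := hup _ _ _ q3
        exact ⟨this.mem.2.2, this.mem.1, Or.inr (Or.inr ⟨_, Or.inr this⟩)⟩

theorem fan_nil {a v b : W} {mid : List W} (hF : ∀ u u', Nx (a :: (mid ++ [b])) u u' → T.F v u u')
    (hnd : (a :: (mid ++ [b])).Nodup) (h : T.F v a b) : mid = [] := by
  rcases mid with _ | ⟨y, mid⟩
  · rfl
  · have := T.u3 (hF a y (by simp [Nx])) h
    subst this
    simp at hnd

theorem fan_one {a v b x : W} {mid : List W} (hF : ∀ u u', Nx (a :: (mid ++ [b])) u u' → T.F v u u')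
    (hnd : (a :: (mid ++ [b])).Nodup) (h : T.F v a x) (h2 : T.F v x b) (hx : x ≠ b) : mid = [x] := by
  rcases mid with _ | ⟨y, mid⟩
  · have := T.u3 (hF a b (by simp [Nx])) h
    exact (hx this.symm).elim
  · have := T.u3 (hF a y (by simp [Nx])) h
    subst this
    rw [List.nodup_cons] at hnd
    rw [fan_nil (a := y) (mid := mid) (fun u u' hn => hF u u' (nx_cons hn)) hnd.2 h2]

theorem St.m3split (N : K.Nrm T) (h : K.St T S C) {a b c d : W} (hb1 : b ≠ K.D1) (hb2 : b ≠ K.D2)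
    (hc2 : c ≠ K.D2) (h1 : Nx C a b) (h2 : Nx C b c) (h3 : Nx C c d) :
    ∃ α β, C = α ++ a :: b :: c :: d :: β := by
  obtain ⟨α, a', c', β, e⟩ := h.split h1.mem.2 hb1 hb2
  have e1 : a' = a := nx_u1 h.nodup (by rw [e]; exact nx_of_split _ _) h1
  have e2 : c' = c := by
    refine nx_u2 h.nodup ?_ h2
    rw [e, show α ++ a' :: b :: c' :: β = (α ++ [a']) ++ b :: c' :: β by simp]; exact nx_of_split _ _
  subst e1 e2
  rcases β with _ | ⟨d', β⟩
  · obtain ⟨l, hl⟩ := h.lt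
    rw [hl] at e
    have : l ++ [K.D2] = (α ++ [a', b]) ++ [c'] := by rw [e]; simp
    have := (List.append_inj' this rfl).2
    simp at this
    exact (hc2 this.symm).elim
  · have e3 : d' = d := by
      refine nx_u2 h.nodup ?_ h3
      rw [e, show α ++ a' :: b :: c' :: d' :: β = (α ++ [a', b]) ++ c' :: d' :: β by simp]; exact nx_of_split _ _
    subst e3
    exact ⟨α, β, e⟩

set_option maxHeartbeats 1000000 in
theorem St.m3 (N : K.Nrm T) (h : K.St T S C)
    (IH : ∀ S' C', S'.ncard < S.ncard → K.St T S' C' → K.DRW T S' C')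
    {i : ι} {m : Fin 4} (hX : K.X i ∈ S) (n1 : Nx C (K.κ i (m + 3)) (K.κ i (m + 2)))
    (n2 : Nx C (K.κ i (m + 2)) (K.κ i (m + 1))) (n3 : Nx C (K.κ i (m + 1)) (K.κ i m)) : K.DRW T S C := by
  obtain ⟨d, hd⟩ : ∃ z, z = K.κ i m := ⟨_, rfl⟩
  obtain ⟨c, hc⟩ : ∃ z, z = K.κ i (m + 1) := ⟨_, rfl⟩
  obtain ⟨b, hb⟩ : ∃ z, z = K.κ i (m + 2) := ⟨_, rfl⟩
  obtain ⟨a, ha⟩ : ∃ z, z = K.κ i (m + 3) := ⟨_, rfl⟩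
  obtain ⟨x, hx⟩ : ∃ z, z = K.X i := ⟨_, rfl⟩
  have F1 : T.F x d c := by rw [hx, hd, hc]; exact N.X i m
  have F2 : T.F x c b := by have := N.X i (m + 1); rw [(f4 m).1] at this; rwa [hx, hc, hb]
  have F3 : T.F x b a := by have := N.X i (m + 2); rw [(f4 m).2.1] at this; rwa [hx, hb, ha]
  have F4 : T.F x a d := by have := N.X i (m + 3); rw [(f4 m).2.2.1] at this; rwa [hx, ha, hd]
  rw [← ha, ← hb] at n1
  rw [← hc, ← hb] at n2
  rw [← hc, ← hd] at n3
  have hmm := f4c m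
  have hcor : ∀ m', K.κ i m' = d ∨ K.κ i m' = c ∨ K.κ i m' = b ∨ K.κ i m' = a := by
    intro m'
    rcases hmm m' with rfl | rfl | rfl | rfl <;> simp [*]
  have dd : d ≠ c ∧ d ≠ b ∧ d ≠ a ∧ c ≠ b ∧ c ≠ a ∧ b ≠ a := by
    obtain ⟨h1, h2, h3, h4, h5, h6⟩ := f4n m
    subst hd hc hb ha
    exact ⟨κne _ _ h1, κne _ _ h2, κne _ _ h3, κne _ _ h4, κne _ _ h5, κne _ _ h6⟩
  obtain ⟨ddc, ddb, dda, dcb, dca, dba⟩ := dd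
  have nX : ∀ j, d ≠ K.X j ∧ c ≠ K.X j ∧ b ≠ K.X j ∧ a ≠ K.X j := by
    intro j; subst hd hc hb ha; exact ⟨κnX _ _ _, κnX _ _ _, κnX _ _ _, κnX _ _ _⟩
  have nD : ∀ z, (∃ m', z = K.κ i m') → z ≠ K.D1 ∧ z ≠ K.D2 := by
    rintro z ⟨m', rfl⟩; exact ⟨K.κD1 _ _, K.κD2 _ _⟩
  have hxS : x ∈ S := hx ▸ hX
  have hxC : x ∉ C := hx ▸ h.Xn i
  have haS : a ∈ S := h.sub _ n1.mem.1
  have hbS : b ∈ S := h.sub _ n1.mem.2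
  have hcS : c ∈ S := h.sub _ n2.mem.2
  have hdS : d ∈ S := h.sub _ n3.mem.2
  obtain ⟨α, β, e⟩ := St.m3split N h (nD b ⟨_, hb⟩).1 (nD b ⟨_, hb⟩).2 (nD c ⟨_, hc⟩).2 n1 n2 n3
  obtain ⟨hD1, -, -, -, -, -⟩ := h.mids e
  have hD2 : K.D2 ∈ d :: β := by
    have := (h.mids (α := α ++ [a]) (a := b) (v := c) (b := d) (β := β) (by rw [e]; simp)).2.1
    exact this
  have hndC := h.nodup
  obtain ⟨mid, hF, hnd, hS, hall⟩ := h.fan e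
  have hmid := fan_one hF hnd F3.cyc F2.cyc2 (by rw [hx]; exact (nX i).2.1.symm)
  subst hmid
  have hR1 := h.remove e hF hnd hS hall (by simpa using hxC)
  have e1 : α ++ a :: ([x] ++ c :: d :: β) = (α ++ [a]) ++ x :: c :: d :: β := by simp
  obtain ⟨mid2, hF2, hnd2, hS2, hall2⟩ := hR1.fan e1
  have hmid2 := fan_nil hF2 hnd2 F1.cyc2
  subst hmid2
  have hR2 := hR1.remove e1 hF2 hnd2 hS2 hall2 (by simp)
  have e2 : α ++ [a] ++ x :: ([] ++ d :: β) = α ++ a :: x :: d :: β := by simp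
  have hR3 := hR2.remove (mid := []) e2 (by
      intro u u' hn
      simp [Nx] at hn
      rw [hn.1, hn.2]; exact F4) (by simp [dda.symm]) (by
      intro u hu
      simp at hu
      rcases hu with rfl | rfl
      · exact ⟨⟨haS, dba.symm⟩, dca.symm⟩
      · exact ⟨⟨hdS, ddb⟩, ddc⟩) (by
      intro u hu hE
      have : T.E u (K.X i) := by rw [← hx]; exact hE.symm
      obtain ⟨m', rfl⟩ := N.nb this
      have := hcor m'
      have h2 : K.κ i m' ≠ c := hu.2
      have h3 : K.κ i m' ≠ b := hu.1.2
      simp only [List.nil_append, List.mem_cons, List.not_mem_nil, or_false]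
      tauto) (by simp)
  obtain ⟨S3, hS3⟩ : ∃ S3, S3 = ((S \ {b}) \ {c}) \ {x} := ⟨_, rfl⟩
  have mS3 : ∀ w, w ∈ S3 ↔ w ∈ S ∧ w ≠ b ∧ w ≠ c ∧ w ≠ x := by intro w; rw [hS3]; simp [and_assoc]
  rw [← hS3] at hR3
  have hsub3 : S3 ⊆ S := fun w hw => ((mS3 w).1 hw).1
  have hXS : ∀ j, K.X j ∈ S3 ↔ K.X j ∈ S ∧ j ≠ i := by
    intro j
    rw [mS3]
    constructor
    · rintro ⟨h1, h2, h3, h4⟩; exact ⟨h1, fun hh => h4 (by rw [hx, hh])⟩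
    · rintro ⟨h1, h2⟩; exact ⟨h1, fun hh => (nX j).2.2.1 hh.symm, fun hh => (nX j).2.1 hh.symm, fun hh => h2 (K.Xinj _ _ (hh.trans hx))⟩
  have hKS : ∀ j m', j ≠ i → (K.κ j m' ∈ S3 ↔ K.κ j m' ∈ S) := by
    intro j m' hj
    rw [mS3]
    constructor
    · exact fun hh => hh.1
    · intro hh
      exact ⟨hh, fun h' => hj (K.κinj _ _ _ _ (h'.trans hb)).1, fun h' => hj (K.κinj _ _ _ _ (h'.trans hc)).1,
        by rw [hx]; exact κnX _ _ _⟩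
  have hSt : K.St T S3 (α ++ a :: ([] ++ d :: β)) := by
    refine ⟨hR3, ?_, ?_⟩
    · intro j hj
      apply h.Xn j
      rw [e]
      simp only [List.mem_append, List.mem_cons, List.nil_append] at hj ⊢
      tauto
    · intro j hj
      by_cases hji : j = i
      · subst hji; exact ⟨m + 2, by rw [← hb, mS3]; simp⟩
      · obtain ⟨m', hm'⟩ := h.kt j (fun hh => hj ((hXS j).2 ⟨hh, hji⟩))
        exact ⟨m', fun hh => hm' (hsub3 hh)⟩
  have hlt : S3.ncard < S.ncard := Set.ncard_lt_ncard ⟨hsub3, fun hh => ((mS3 b).1 (hh hbS)).2.1 rfl⟩ (Set.toFinite _)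
  have hD := IH _ _ hlt hSt
  have haS3 : a ∈ S3 := (mS3 a).2 ⟨haS, dba.symm, dca.symm, by rw [hx]; exact (nX i).2.2.2⟩
  have hdS3 : d ∈ S3 := (mS3 d).2 ⟨hdS, ddb, ddc, by rw [hx]; exact (nX i).1⟩
  have hPP : K.PdS S3 = K.PdS S := by
    funext l' o' r'
    apply propext
    constructor
    · rintro ⟨j, m', h1, h2, h3, h4, h5, h6, h7, h8⟩
      by_cases hji : j = i
      · exfalso
        subst hji
        have key : ∀ m'', K.κ j m'' ∈ S3 → m'' = m ∨ m'' = m + 3 := by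
          intro m'' hh
          rw [mS3] at hh
          rcases hmm m'' with h | h | h | h
          · exact Or.inl h
          · exact (hh.2.2.1 (by rw [h, hc])).elim
          · exact (hh.2.1 (by rw [h, hb])).elim
          · exact Or.inr h
        rw [h3] at h6
        rw [h4] at h7
        rw [h5] at h8
        have k1 := key _ h6
        have k2 := key _ h7
        have k3 := key _ h8
        exact (by decide : ∀ m m' : Fin 4, (m' + 1 = m ∨ m' + 1 = m + 3) → (m' + 2 = m ∨ m' + 2 = m + 3) →
          (m' + 3 = m ∨ m' + 3 = m + 3) → False) m m' k1 k2 k3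
      · exact ⟨j, m', fun hh => h1 ((hXS j).2 ⟨hh, hji⟩), fun hh => h2 ((hKS _ _ hji).2 hh), h3, h4, h5,
          hsub3 h6, hsub3 h7, hsub3 h8⟩
    · intro hp
      obtain ⟨j, m', hji, h1, h2, h3, h4, h5⟩ := hp.kit hX
      obtain ⟨q1, q2, q3⟩ := hp.mem
      refine ⟨j, m', fun hh => h1 (hsub3 hh), fun hh => h2 (hsub3 hh), h3, h4, h5, ?_, ?_, ?_⟩
      · rw [h3] at q1 ⊢; exact (hKS _ _ hji).2 q1
      · rw [h4] at q2 ⊢; exact (hKS _ _ hji).2 q2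
      · rw [h5] at q3 ⊢; exact (hKS _ _ hji).2 q3
  have hPO : ∀ w, K.PO S3 w ↔ K.PO S w := by intro w; unfold PO; rw [hPP]
  have npo : ∀ l' o' r' m', K.PdS S l' o' r' → l' ≠ K.κ i m' ∧ o' ≠ K.κ i m' ∧ r' ≠ K.κ i m' := by
    intro l' o' r' m'' hp
    obtain ⟨j, m', hji, h1, h2, h3, h4, h5⟩ := hp.kit hX
    subst h3 h4 h5
    exact ⟨fun e' => hji (K.κinj _ _ _ _ e').1, fun e' => hji (K.κinj _ _ _ _ e').1, fun e' => hji (K.κinj _ _ _ _ e').1⟩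
  have nPO : ∀ m', ¬ K.PO S3 (K.κ i m') := by
    intro m'
    rw [hPO]
    rintro ⟨l, r, hp⟩
    exact (npo _ _ _ m' hp).2.1 rfl
  have pa : ¬ K.PO S3 a := by rw [ha]; exact nPO _
  have pb : ¬ K.PO S3 b := by rw [hb]; exact nPO _
  have pc : ¬ K.PO S3 c := by rw [hc]; exact nPO _
  have pd : ¬ K.PO S3 d := by rw [hd]; exact nPO _
  have e3 : K.Dc S C = K.Dc S3 α ++ a :: b :: c :: d :: K.Dc S3 β := by
    rw [dc_congr (fun w _ => (hPO w).symm), e, dc_append, dc_keep pa, dc_keep pb, dc_keep pc, dc_keep pd]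
  have e4 : K.Dc S3 (α ++ a :: ([] ++ d :: β)) = K.Dc S3 α ++ a :: d :: K.Dc S3 β := by
    rw [List.nil_append, dc_append, dc_keep pa, dc_keep pd]
  unfold DRW at hD ⊢
  rw [e4, hPP] at hD
  have hsd : K.SD S = insert c (insert b (K.SD S3)) := by
    rw [sd_insert hbS (fun j => (nX j).2.2.1), sd_insert (v := c) (S := S \ {b}) ⟨hcS, dcb⟩ (fun j => (nX j).2.1), hS3, hx, sd_X,
      Set.insert_comm]
  have hbn : b ∉ K.SD S3 := fun hh => ((mS3 b).1 hh.1).2.1 rfl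
  have hcn : c ∉ K.SD S3 := fun hh => ((mS3 c).1 hh.1).2.2.1 rfl
  have hcard : (K.SD S).ncard = (K.SD S3).ncard + 1 + 1 := by
    rw [hsd, Set.ncard_insert_of_notMem (by simp [hcn, dcb]) (Set.toFinite _), Set.ncard_insert_of_notMem hbn (Set.toFinite _)]
  have hAz : ∀ u v, K.AS T S3 u v → u ≠ c ∧ v ≠ c := fun u v hh =>
    ⟨((mS3 _).1 hh.1).2.2.1, ((mS3 _).1 hh.2.1).2.2.1⟩
  have hDr := dr_A hD hbn hcn dcb (dcD1 hD1) (dcD2 hD2) (by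
      rintro l o r hp ⟨h1, h2⟩
      exact (npo _ _ _ (m + 3) hp).1 (h1.trans ha)) (by
      rintro u v hA ⟨j, m', h1, h2⟩
      have hj : j = i := by
        rcases h2 with ⟨h2, -⟩ | ⟨h2, -⟩ <;> exact (K.κinj _ _ _ _ (h2.symm.trans hb)).1
      subst hj
      have h3 : SameE u v c a := by
        have : m' = m + 1 ∨ m' = m + 3 := by
          rcases h2 with ⟨h2, -⟩ | ⟨h2, -⟩
          · have := (K.κinj _ _ _ _ (h2.symm.trans hb)).2
            left; exact (by decide : ∀ m m' : Fin 4, m' + 1 = m + 2 → m' = m + 1) m m' this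
          · have := (K.κinj _ _ _ _ (h2.symm.trans hb)).2
            right
            exact (by decide : ∀ m m' : Fin 4, m' + 3 = m + 2 → m' = m + 3) m m' this
        rcases this with rfl | rfl
        · rw [(f4 m).2.2.2.2.1, ← ha, ← hc] at h1; exact h1
        · rw [(f4 m).2.2.2.2.2.1, ← ha, ← hc] at h1
          rcases h1 with h1 | h1
          · exact Or.inr h1
          · exact Or.inl h1
      unfold Aplus at hA
      simp only [List.mem_cons, List.not_mem_nil, or_false] at hA
      rcases h3 with ⟨rfl, rfl⟩ | ⟨rfl, rfl⟩
      · rcases hA with (hA | ⟨hA, -⟩ | ⟨hA, -⟩) | ⟨-, hA | hA⟩ | ⟨hA, -⟩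
        · exact (hAz _ _ hA).1 rfl
        · exact dcb hA
        · exact dba hA.symm
        · exact dba hA.symm
        · exact dda hA.symm
        · exact dca hA.symm
      · rcases hA with (hA | ⟨hA, -⟩ | ⟨hA, -⟩) | ⟨hA, -⟩ | ⟨-, hA | hA⟩
        · exact (hAz _ _ hA).2 rfl
        · exact dba hA.symm
        · exact dcb hA
        · exact dca hA.symm
        · exact dba hA.symm
        · exact dda hA.symm) (by
      intro u v u' v' h1 h2
      constructor
      · refine ⟨i, m + 1, ?_, ?_⟩
        · rw [(f4 m).2.2.2.2.1, ← hc, ← ha]; exact h1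
        · rw [(f4 m).1, (f4 m).2.2.2.2.2.2.2.2, ← hb, ← hd]; exact h2
      · refine ⟨i, m, ?_, ?_⟩
        · rw [← hb, ← hd]
          rcases h2 with h2 | h2
          · exact Or.inr h2
          · exact Or.inl h2
        · rw [← hc, ← ha]; exact h1)
  rw [e3, hsd]
  refine dr_mono hDr ?_ (fun l o r hp => hp.as) (by
      rw [← hsd, hcard]; apply NN3
      refine sd_card hR3.mD (x := a) (y := d) ⟨haS3, fun j => (nX j).2.2.2⟩ ⟨hdS3, fun j => (nX j).1⟩ ?_ ?_ ?_ ?_ dda.symm N.d12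
      · exact (nD a ⟨_, ha⟩).1
      · exact (nD a ⟨_, ha⟩).2
      · exact (nD d ⟨_, hd⟩).1
      · exact (nD d ⟨_, hd⟩).2)
  have hb' : ∀ w, K.AS T S b w ∨ K.AS T S w b → w = a ∨ w = d ∨ w = c := by
    have hE : ∀ w, w ∈ S → T.E b w → (∀ i, w ≠ K.X i) → w = a ∨ w = d ∨ w = c := by
      intro w hw hE hX
      have h1 := hall w hw hE
      have h2 : w ≠ x := by rw [hx]; exact hX i
      simp at h1
      tauto
    rintro w (⟨h1, h2, h3⟩ | ⟨h1, h2, h3⟩)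
    · rcases h3 with h3 | ⟨j, m', h3, h4, h5⟩ | ⟨o', h3 | h3⟩
      · exact hE w h2 h3.1 h3.2.2
      · obtain ⟨rfl, rfl⟩ := K.κinj _ _ _ _ (hb.symm.trans h4)
        rw [(f4 m).2.2.2.1] at h5
        exact Or.inr (Or.inl (h5.trans hd.symm))
      · exact ((npo _ _ _ _ h3).1 hb).elim
      · exact ((npo _ _ _ _ h3).2.2 hb).elim
    · rcases h3 with h3 | ⟨j, m', h3, h4, h5⟩ | ⟨o', h3 | h3⟩
      · exact hE w h1 h3.1.symm h3.2.1
      · obtain ⟨rfl, e'⟩ := K.κinj _ _ _ _ (hb.symm.trans h5)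
        have : m' = m := (by decide : ∀ m m' : Fin 4, m + 2 = m' + 2 → m' = m) m m' e'
        subst this
        exact Or.inr (Or.inl (h4.trans hd.symm))
      · exact ((npo _ _ _ _ h3).2.2 hb).elim
      · exact ((npo _ _ _ _ h3).1 hb).elim
  have hc' : ∀ w, K.AS T S c w ∨ K.AS T S w c → w = a ∨ w = d ∨ w = b := by
    have hE : ∀ w, w ∈ S → T.E c w → (∀ i, w ≠ K.X i) → w = a ∨ w = d ∨ w = b := by
      intro w hw hE hX
      by_cases hwb : w = b
      · exact Or.inr (Or.inr hwb)
      have h1 := hall2 w ⟨hw, hwb⟩ hE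
      have h2 : w ≠ x := by rw [hx]; exact hX i
      simp at h1
      tauto
    rintro w (⟨h1, h2, h3⟩ | ⟨h1, h2, h3⟩)
    · rcases h3 with h3 | ⟨j, m', h3, h4, h5⟩ | ⟨o', h3 | h3⟩
      · exact hE w h2 h3.1 h3.2.2
      · obtain ⟨rfl, rfl⟩ := K.κinj _ _ _ _ (hc.symm.trans h4)
        rw [(f4 m).2.2.2.2.1] at h5
        exact Or.inl (h5.trans ha.symm)
      · exact ((npo _ _ _ _ h3).1 hc).elim
      · exact ((npo _ _ _ _ h3).2.2 hc).elim
    · rcases h3 with h3 | ⟨j, m', h3, h4, h5⟩ | ⟨o', h3 | h3⟩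
      · exact hE w h1 h3.1.symm h3.2.1
      · obtain ⟨rfl, e'⟩ := K.κinj _ _ _ _ (hc.symm.trans h5)
        have : m' = m + 3 := (by decide : ∀ m m' : Fin 4, m + 1 = m' + 2 → m' = m + 3) m m' e'
        subst this
        exact Or.inl (h4.trans ha.symm)
      · exact ((npo _ _ _ _ h3).2.2 hc).elim
      · exact ((npo _ _ _ _ h3).1 hc).elim
  intro u w hA
  by_cases h1 : u = c
  · subst h1
    rcases hc' w (Or.inl hA) with hh | hh | hh
    · exact Or.inr (Or.inl ⟨rfl, by simp [hh]⟩)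
    · exact Or.inl (Or.inr (Or.inl ⟨rfl, by simp [hh]⟩))
    · exact Or.inl (Or.inr (Or.inl ⟨rfl, by simp [hh]⟩))
  by_cases h2 : w = c
  · subst h2
    rcases hc' u (Or.inr hA) with hh | hh | hh
    · exact Or.inr (Or.inr ⟨rfl, by simp [hh]⟩)
    · exact Or.inl (Or.inr (Or.inr ⟨rfl, by simp [hh]⟩))
    · exact Or.inl (Or.inr (Or.inr ⟨rfl, by simp [hh]⟩))
  left; left
  by_cases h3 : u = b
  · subst h3
    rcases hb' w (Or.inl hA) with hh | hh | hh
    · exact Or.inr (Or.inl ⟨rfl, by simp [hh]⟩)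
    · exact (Or.inr (Or.inl ⟨rfl, by simp [hh]⟩))
    · exact (h2 hh).elim
  by_cases h4 : w = b
  · subst h4
    rcases hb' u (Or.inr hA) with hh | hh | hh
    · exact Or.inr (Or.inr ⟨rfl, by simp [hh]⟩)
    · exact (Or.inr (Or.inr ⟨rfl, by simp [hh]⟩))
    · exact (h1 hh).elim
  left
  obtain ⟨q1, q2, q3⟩ := hA
  have wx : ∀ w, (∀ j, w ≠ K.X j) → w ≠ x := fun w hh => by rw [hx]; exact hh i
  rcases q3 with q3 | ⟨j, m', q3, q4, q5⟩ | ⟨o', q3 | q3⟩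
  · exact ⟨(mS3 _).2 ⟨q1, h3, h1, wx _ q3.2.1⟩, (mS3 _).2 ⟨q2, h4, h2, wx _ q3.2.2⟩, Or.inl q3⟩
  · have b1 : u ∈ S3 := (mS3 _).2 ⟨q1, h3, h1, wx _ (by rw [q4]; exact fun j' => κnX _ _ _)⟩
    have b2 : w ∈ S3 := (mS3 _).2 ⟨q2, h4, h2, wx _ (by rw [q5]; exact fun j' => κnX _ _ _)⟩
    refine ⟨b1, b2, ?_⟩
    by_cases hj : j = i
    · exfalso
      subst hj
      rcases hmm m' with rfl | rfl | rfl | rfl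
      · exact h4 (q5.trans hb.symm)
      · exact h1 (q4.trans hc.symm)
      · exact h3 (q4.trans hb.symm)
      · rw [(f4 m).2.2.2.2.2.1, ← hc] at q5
        exact h2 q5
    · exact Or.inr (Or.inl ⟨j, m', (hXS j).2 ⟨q3, hj⟩, q4, q5⟩)
  · rw [← hPP] at q3
    exact q3.as
  · rw [← hPP] at q3
    exact ⟨q3.mem.2.2, q3.mem.1, Or.inr (Or.inr ⟨_, Or.inr q3⟩)⟩

theorem linkpath {v a b : W} (ht : T.F v b a) :
    ∃ mid : List W, (∀ u u', Nx (a :: (mid ++ [b])) u u' → T.F v u u') ∧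
      (a :: (mid ++ [b])).Nodup ∧ (∀ u, T.E v u → u ∈ a :: (mid ++ [b])) := by
  have hab : a ≠ b := ht.n23.symm
  have main : ∀ n : ℕ, (∃ mid : List W, (∀ u u', Nx (a :: (mid ++ [b])) u u' → T.F v u u') ∧
      (a :: (mid ++ [b])).Nodup) ∨
      (∃ l : List W, ∃ x, l.length = n ∧ (∃ l', l ++ [x] = a :: l') ∧ (∀ u u', Nx (l ++ [x]) u u' → T.F v u u') ∧
        (l ++ [x]).Nodup ∧ b ∉ l ++ [x] ∧ T.E v x) := by
    intro n
    induction n with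
    | zero =>
      right
      refine ⟨[], a, rfl, ⟨[], rfl⟩, by simp [Nx], by simp, by simpa using hab.symm, ht.e31.symm⟩
    | succ n ih =>
      rcases ih with ih | ⟨l, x, hl, ⟨l', hl'⟩, hF, hnd, hb, hE⟩
      · exact Or.inl ih
      obtain ⟨y, hy⟩ := hE
      have hyl : y ∉ l ++ [x] := by
        refine fan_fresh hl' hF hnd hy ?_
        rintro rfl
        apply hb; simp [T.u2 hy ht]
      have hF' : ∀ u u', Nx (l ++ [x] ++ [y]) u u' → T.F v u u' := by
        intro u u' hn
        rw [List.append_assoc, List.singleton_append, nx_snoc] at hn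
        rcases hn with hn | ⟨rfl, rfl⟩
        · exact hF _ _ hn
        · exact hy
      have hnd' : (l ++ [x] ++ [y]).Nodup := by
        rw [List.nodup_append]
        refine ⟨hnd, by simp, ?_⟩
        intro p hp q hq hpq
        simp only [List.mem_singleton] at hq
        subst hq; subst hpq; exact hyl hp
      by_cases hyb : y = b
      · left
        subst hyb
        rw [hl'] at hF' hnd'
        exact ⟨l', hF', hnd'⟩
      · right
        refine ⟨l ++ [x], y, by simp [hl], ⟨l' ++ [y], by rw [hl']; simp⟩, hF', hnd', ?_, hy.e31.symm⟩
        intro hh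
        rcases List.mem_append.1 hh with hh | hh
        · exact hb hh
        · simp at hh; exact hyb hh.symm
  rcases main (Fintype.card W) with ⟨mid, h1, h2⟩ | ⟨l, x, hl, -, -, hnd, -⟩
  · refine ⟨mid, h1, h2, ?_⟩
    intro u hE
    exact T.link v {w | w ∈ a :: (mid ++ [b])} a (by simp) ht.e31.symm (by
      intro p q hp hF
      by_cases hpb : p = b
      · subst hpb
        rw [T.u3 hF ht]; simp
      · obtain ⟨q', hq'⟩ := nx_next hp hpb
        rw [T.u3 hF (h1 _ _ hq')]
        exact hq'.mem.2) u hE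
  · have := hnd.length_le_card
    simp [hl] at this

theorem St.start (N : K.Nrm T) : ∃ C, K.St T {w | w ≠ K.D3} C := by
  have ht : T.F K.D3 K.D2 K.D1 := N.out.cyc2
  obtain ⟨mid, h1, h2, h3⟩ := linkpath ht
  have hD : ∀ u ∈ K.D1 :: (mid ++ [K.D2]), T.E K.D3 u := by
    intro u hu
    rcases List.mem_cons.1 hu with rfl | hu
    · exact ht.e31.symm
    rcases List.mem_append.1 hu with hu | hu
    · exact nx_fanE h1 u hu
    · rw [List.mem_singleton.1 hu]; exact ht.e12
  have hX : ∀ i, ¬ T.E K.D3 (K.X i) := by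
    intro i hE
    obtain ⟨m, hm⟩ := N.nb hE
    exact K.κD3 i m hm.symm
  refine ⟨K.D1 :: (mid ++ [K.D2]), ⟨⟨_, rfl⟩, ⟨K.D1 :: mid, by simp⟩, h2, ?_, ?_, ?_, ?_⟩, ?_, ?_⟩
  · intro u hu; exact (hD u hu).ne.symm
  · simp
  · intro a ha b hb
    constructor
    · rintro ⟨t, ht', hF⟩
      have : t = K.D3 := by simpa using ht'
      subst this
      have hF' := hF.cyc2
      by_cases hab : a = K.D2
      · subst hab
        exact Or.inr ⟨rfl, T.u3 hF' ht⟩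
      · left
        have ha' := h3 a hF'.e12
        obtain ⟨q', hn⟩ := nx_next ha' hab
        rw [T.u3 hF' (h1 _ _ hn)]; exact hn
    · rintro (hn | ⟨rfl, rfl⟩)
      · exact ⟨K.D3, by simp, (h1 _ _ hn).cyc⟩
      · exact ⟨K.D3, by simp, N.out⟩
  · intro y hy hyC w hE hw
    have : w = K.D3 := by simpa using hw
    subst this
    exact hyC (h3 y hE.symm)
  · intro i hi
    exact hX i (hD _ hi)
  · intro i hi
    exact (hi (K.XD3 i)).elim

theorem St.base (N : K.Nrm T) (h : K.St T S C) (hlen : C.length < 3) : K.DRW T S C := by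
  have h12 := N.d12
  have hC : C = [K.D1, K.D2] := by
    obtain ⟨l, hl⟩ := h.hd
    obtain ⟨l', hl'⟩ := h.lt
    subst hl
    rcases l with _ | ⟨x, _ | ⟨y, l⟩⟩
    · rcases l' with _ | ⟨z, l'⟩
      · simp at hl'; exact (h12 hl').elim
      · simp at hl'
    · rcases l' with _ | ⟨z, _ | ⟨z', l'⟩⟩
      · simp at hl'
      · simp at hl'; rw [hl'.2]
      · simp at hl'
    · simp at hlen; omega
  subst hC
  have m1 : K.D1 ∈ S := h.sub _ (by simp)
  have m2 : K.D2 ∈ S := h.sub _ (by simp)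
  obtain ⟨t, htS, ht⟩ := (h.dart _ m1 _ m2).2 (Or.inl (by simp [Nx]))
  obtain ⟨t', htS', ht'⟩ := (h.dart _ m2 _ m1).2 (Or.inr ⟨rfl, rfl⟩)
  have hInt : ∀ y ∈ S \ {K.D1, K.D2}, ∀ w, T.E y w → w ∈ S := by
    intro y hy w hE
    exact h.int y hy.1 (by simpa using hy.2) w hE
  have k1 : ∀ y ∈ S \ {K.D1, K.D2}, ¬ T.E K.D1 y := by
    intro y hy hE
    have := T.link K.D1 (S \ {K.D1, K.D2}) y hy hE (by
      intro a b ha hF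
      refine ⟨hInt a ha b hF.e23, ?_⟩
      rintro (rfl | rfl)
      · exact hF.n31 rfl
      · rw [T.u3 ht' hF.cyc2] at htS'; exact htS' ha.1) K.D2 ht.e12
    exact this.2 (by simp)
  have k2 : ∀ y ∈ S \ {K.D1, K.D2}, ¬ T.E K.D2 y := by
    intro y hy hE
    have := T.link K.D2 (S \ {K.D1, K.D2}) y hy hE (by
      intro a b ha hF
      refine ⟨hInt a ha b hF.e23, ?_⟩
      rintro (rfl | rfl)
      · rw [T.u3 ht hF.cyc2] at htS; exact htS ha.1
      · exact hF.n31 rfl) K.D1 ht'.e12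
    exact this.2 (by simp)
  have hS : S = {K.D1, K.D2} := by
    by_contra hne
    have : (S \ {K.D1, K.D2}).Nonempty := by
      by_contra he
      apply hne
      rw [Set.not_nonempty_iff_eq_empty, Set.diff_eq_empty] at he
      apply Set.Subset.antisymm he
      rintro w (rfl | rfl) <;> assumption
    have := T.conn _ this (by
      intro a b c ha hF
      refine ⟨hInt a ha b hF.e12, ?_⟩
      rintro (rfl | rfl)
      · exact k1 a ha hF.e12.symm
      · exact k2 a ha hF.e12.symm) K.D1
    exact this.2 (by simp)
  have hP : ∀ l o r, ¬ K.PdS S l o r := by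
    rintro l o r hp
    have := hp.mem.1
    obtain ⟨i, m, -, -, rfl, -⟩ := hp
    rw [hS] at this
    rcases this with h | h
    · exact K.κD1 _ _ h
    · exact K.κD2 _ _ h
  have hP' : K.PdS S = fun _ _ _ => False := by
    funext l o r; simp [hP]
  have hsd : K.SD S = {K.D1, K.D2} := by
    ext w
    constructor
    · intro hw; rw [← hS]; exact hw.1
    · intro hw
      refine ⟨by rw [hS]; exact hw, ?_⟩
      rintro i rfl
      rcases hw with h | h
      · exact K.XD1 _ h
      · exact K.XD2 _ h
  have hdc : K.Dc S [K.D1, K.D2] = [K.D1, K.D2] := dc_self (by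
    rintro w - ⟨l, r, hp⟩; exact hP _ _ _ hp)
  unfold DRW
  rw [hP', hsd, hdc, Set.ncard_pair h12]
  refine dr_mono (dr_base h12) ?_ (by simp) (by unfold NN; simp)
  rintro u v ⟨hu, hv, hA⟩
  rcases hA with hA | ⟨i, m, hA, -⟩ | ⟨o, hA | hA⟩
  · rw [hS] at hu hv
    have := hA.1.ne
    rcases hu with rfl | rfl <;> rcases hv with rfl | rfl
    · exact (this rfl).elim
    · exact Or.inl ⟨rfl, rfl⟩
    · exact Or.inr ⟨rfl, rfl⟩
    · exact (this rfl).elim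
  · exfalso
    rw [hS] at hA
    rcases hA with h | h
    · exact K.XD1 _ h
    · exact K.XD2 _ h
  · exact (hP _ _ _ hA).elim
  · exact (hP _ _ _ hA).elim

theorem St.drw (N : K.Nrm T) : ∀ (n : ℕ) (S : Set W) (C : List W), S.ncard = n → K.St T S C → K.DRW T S C := by
  intro n
  induction n using Nat.strong_induction_on with
  | _ n ih =>
    intro S C hn h
    have IH : ∀ S' C', S'.ncard < S.ncard → K.St T S' C' → K.DRW T S' C' :=
      fun S' C' hlt h' => ih _ (hn ▸ hlt) S' C' rfl h'
    by_cases hlen : C.length < 3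
    · exact h.base N hlen
    push Not at hlen
    rcases h.move N hlen with ⟨v, hvC, hv1, hv2, hCL, hk, ho⟩ | ⟨i, m, hX, hz, hCL, ho⟩ | ⟨i, m, hX, n1, n2, n3⟩
    · exact h.m1 N IH hvC hv1 hv2 hCL hk ho
    · exact h.m2 N IH hX hz hCL ho
    · exact h.m3 N IH hX n1 n2 n3

theorem Nrm.final (N : K.Nrm T) : ∃ px ps : W → ℤ, Qs K.D1 K.D2 (K.SD {w | w ≠ K.D3})
    (K.Dc {w | w ≠ K.D3} ((St.start N).choose)) (K.AS T {w | w ≠ K.D3}) K.CRK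
    (K.PdS {w | w ≠ K.D3}) px ps ∧ px K.D2 ≤ NN (K.SD {w | w ≠ K.D3}).ncard := by
  have h := (St.start N).choose_spec
  obtain ⟨bx, bY, hB, hF⟩ := St.drw N _ _ _ rfl h
  obtain ⟨px, ps, hp, hQ⟩ := hF bx hB.b1 (fun _ _ _ => le_rfl)
  refine ⟨px, ps, hQ, ?_⟩
  rw [(hp K.D2 (dc_mem.2 ⟨?_, po_D2⟩)).1]
  · exact hB.wd
  · obtain ⟨l, hl⟩ := h.lt
    rw [hl]; simp

end Kites

/-- point of a segment -/
def Lp (x y : ℝ × ℝ) (t : ℝ) : ℝ × ℝ := (x.1 + t * (y.1 - x.1), x.2 + t * (y.2 - x.2))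

theorem ori_L (a b x y : ℝ × ℝ) (t : ℝ) :
    ori a b (Lp x y t) = (1 - t) * ori a b x + t * ori a b y := by
  unfold ori Lp; ring

theorem ori_rot (a b c : ℝ × ℝ) : ori b c a = ori a b c := by unfold ori; ring
theorem ori_sw (a b c : ℝ × ℝ) : ori b a c = - ori a b c := by unfold ori; ring
theorem ori_sw2 (a b c : ℝ × ℝ) : ori a c b = - ori a b c := by unfold ori; ring
theorem ori_01 (a b : ℝ × ℝ) : ori a b a = 0 := by unfold ori; ring
theorem ori_11 (a b : ℝ × ℝ) : ori a b b = 0 := by unfold ori; ring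
theorem ori_gp (u v a b c : ℝ × ℝ) :
    ori u v a * ori u b c - ori u v b * ori u a c + ori u v c * ori u a b = 0 := by
  unfold ori; ring
theorem Lp_symm (x y : ℝ × ℝ) (t : ℝ) : Lp x y t = Lp y x (1 - t) := by
  unfold Lp; ext <;> simp <;> ring
theorem Lp_zero (x y : ℝ × ℝ) : Lp x y 0 = x := by unfold Lp; simp
theorem Lp_one (x y : ℝ × ℝ) : Lp x y 1 = y := by unfold Lp; simp
theorem Lp_Lp (x y : ℝ × ℝ) (s t : ℝ) : Lp (Lp x y s) y t = Lp x y (s + t * (1 - s)) := by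
  unfold Lp; ext <;> simp <;> ring

theorem sgL {x y : ℝ × ℝ} {t : ℝ} (h : 0 < t) (h' : t < 1) : Sg x y (Lp x y t) :=
  ⟨t, h, h', rfl, rfl⟩
theorem Sg.toL {x y z : ℝ × ℝ} (h : Sg x y z) : ∃ t, 0 < t ∧ t < 1 ∧ z = Lp x y t := by
  obtain ⟨t, h1, h2, h3, h4⟩ := h
  exact ⟨t, h1, h2, Prod.ext h3 h4⟩

theorem Sg.ori0 {x y z : ℝ × ℝ} (h : Sg x y z) : ori x y z = 0 := by
  obtain ⟨t, -, -, rfl⟩ := h.toL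
  rw [ori_L, ori_01, ori_11]; ring

theorem ang_first {W : Type} [Finite W] (p : W → ℝ × ℝ) (u d : ℝ × ℝ) (N : Set W)
    (hne : N.Nonempty) (h : ∀ a ∈ N, 0 < ori u d (p a)) :
    ∃ w ∈ N, ∀ c ∈ N, 0 ≤ ori u (p w) (p c) := by
  obtain ⟨w, hw, hm⟩ := Set.exists_max_image N (fun a => ((d.1 - u.1) * ((p a).1 - u.1) +
    (d.2 - u.2) * ((p a).2 - u.2)) / ori u d (p a)) (Set.toFinite N) hne
  refine ⟨w, hw, fun c hc => ?_⟩
  have h1 := h w hw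
  have h2 := h c hc
  have h3 := hm c hc
  simp only [div_le_div_iff₀ h2 h1] at h3
  by_contra hcon
  push Not at hcon
  have h4 : 0 < (d.1 - u.1) ^ 2 + (d.2 - u.2) ^ 2 := by
    by_contra hd
    have e1 : d.1 - u.1 = 0 := by nlinarith [sq_nonneg (d.1 - u.1), sq_nonneg (d.2 - u.2)]
    have e2 : d.2 - u.2 = 0 := by nlinarith [sq_nonneg (d.1 - u.1), sq_nonneg (d.2 - u.2)]
    unfold ori at h1; rw [e1, e2] at h1; simp at h1
  have h5 := mul_pos h4 (neg_pos.2 hcon)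
  have : ((d.1 - u.1) ^ 2 + (d.2 - u.2) ^ 2) * -ori u (p w) (p c) =
    ((d.1 - u.1) * ((p c).1 - u.1) + (d.2 - u.2) * ((p c).2 - u.2)) * ori u d (p w) -
    ((d.1 - u.1) * ((p w).1 - u.1) + (d.2 - u.2) * ((p w).2 - u.2)) * ori u d (p c) := by
    unfold ori; ring
  linarith

/-- mirror image -/
def mir (x : ℝ × ℝ) : ℝ × ℝ := (-x.1, x.2)
theorem ori_mir (a b c : ℝ × ℝ) : ori (mir a) (mir b) (mir c) = - ori a b c := by
  unfold ori mir; ring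
theorem mir_mir (a : ℝ × ℝ) : mir (mir a) = a := by unfold mir; simp
theorem Lp_mir (a b : ℝ × ℝ) (t : ℝ) : Lp (mir a) (mir b) t = mir (Lp a b t) := by
  unfold Lp mir; ext <;> simp; ring
theorem Sg.mir {a b c : ℝ × ℝ} (h : Sg a b c) : Sg (mir a) (mir b) (mir c) := by
  obtain ⟨t, h1, h2, rfl⟩ := h.toL
  rw [← Lp_mir]; exact sgL h1 h2

theorem ang_last {W : Type} [Finite W] (p : W → ℝ × ℝ) (u d : ℝ × ℝ) (N : Set W)
    (hne : N.Nonempty) (h : ∀ a ∈ N, 0 < ori u d (p a)) :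
    ∃ w ∈ N, ∀ c ∈ N, 0 ≤ ori u (p c) (p w) := by
  obtain ⟨w, hw, hm⟩ := ang_first (fun a => mir (p a)) (mir u) (mir (Lp u d (-1))) N hne
    (fun a ha => by
      have e : ori u (Lp u d (-1)) (p a) = - ori u d (p a) := by unfold ori Lp; ring
      rw [ori_mir, e]; have := h a ha; linarith)
  refine ⟨w, hw, fun c hc => ?_⟩
  have := hm c hc
  rw [ori_mir] at this
  rw [ori_sw2]; exact this

theorem exit0 {a b a' b' : ℝ} (ha : 0 < a) (hb : 0 < b) (h : ¬ (0 < a' ∧ 0 < b')) :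
    ∃ t, 0 < t ∧ t ≤ 1 ∧ (((1 - t) * a + t * a' = 0 ∧ 0 ≤ (1 - t) * b + t * b') ∨
      ((1 - t) * b + t * b' = 0 ∧ 0 ≤ (1 - t) * a + t * a')) := by
  have key : ∀ a b a' b' : ℝ, 0 < a → 0 < b → a' ≤ 0 → b * a' ≤ a * b' →
      ∃ t, 0 < t ∧ t ≤ 1 ∧ ((1 - t) * a + t * a' = 0 ∧ 0 ≤ (1 - t) * b + t * b') := by
    intro a b a' b' ha hb h1 h2
    have hd : 0 < a - a' := by linarith
    refine ⟨a / (a - a'), by positivity, by rw [div_le_one hd]; linarith, by field_simp; ring, ?_⟩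
    have : (1 - a / (a - a')) * b + a / (a - a') * b' = (a * b' - b * a') / (a - a') := by
      field_simp; ring
    rw [this]; exact div_nonneg (by linarith) hd.le
  by_cases h1 : a' ≤ 0 ∧ b * a' ≤ a * b'
  · obtain ⟨t, x, y, z⟩ := key a b a' b' ha hb h1.1 h1.2
    exact ⟨t, x, y, Or.inl z⟩
  · obtain ⟨t, x, y, z⟩ := key b a b' a' hb ha (by
      by_contra hc
      push Not at hc
      have h3 : a' ≤ 0 := by by_contra hh; exact h ⟨by linarith, hc⟩
      exact h1 ⟨h3, by nlinarith⟩) (by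
      by_contra hc
      push Not at hc
      have h3 : 0 < a' := by by_contra hh; exact h1 ⟨by linarith, by linarith⟩
      have h4 : b' ≤ 0 := by by_contra hh; exact h ⟨h3, by linarith⟩
      nlinarith)
    exact ⟨t, x, y, Or.inr z⟩

/-- leaving a triangle with apex `x` through one of the sides `xa`, `xb` -/
theorem exit1 {x a b y e c d : ℝ × ℝ} (h0 : 0 < ori x a b) (ka : ori c d a ≤ 0)
    (kb : ori c d b ≤ 0) (kx : 0 < ori c d x) (ky : 0 ≤ ori c d y) (ke : 0 < ori c d e)
    (hy : 0 < ori x a y) (hy' : 0 < ori b x y) (hne : ¬ (0 < ori x a e ∧ 0 < ori b x e)) :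
    ∃ t, 0 < t ∧ t ≤ 1 ∧ ∃ r, 0 ≤ r ∧ r < 1 ∧ (Lp y e t = Lp x a r ∨ Lp y e t = Lp x b r) := by
  obtain ⟨t, t0, t1, h⟩ := exit0 hy hy' hne
  refine ⟨t, t0, t1, ?_⟩
  rw [← ori_L, ← ori_L] at h
  have hk : 0 < ori c d (Lp y e t) := by rw [ori_L]; nlinarith
  generalize Lp y e t = Y at *
  have id1 : ori x a b * (Y.1 - x.1) = ori x a Y * (b.1 - x.1) + ori b x Y * (a.1 - x.1) := by
    unfold ori; ring
  have id2 : ori x a b * (Y.2 - x.2) = ori x a Y * (b.2 - x.2) + ori b x Y * (a.2 - x.2) := by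
    unfold ori; ring
  rcases h with ⟨h1, h2⟩ | ⟨h1, h2⟩
  · have e : Y = Lp x a (ori b x Y / ori x a b) := by
      rw [h1] at id1 id2
      unfold Lp; ext <;> simp <;> field_simp <;> linarith
    refine ⟨_, div_nonneg h2 h0.le, ?_, Or.inl e⟩
    by_contra hc
    rw [e, ori_L] at hk
    nlinarith
  · have e : Y = Lp x b (ori x a Y / ori x a b) := by
      rw [h1] at id1 id2
      unfold Lp; ext <;> simp <;> field_simp <;> linarith
    refine ⟨_, div_nonneg h2 h0.le, ?_, Or.inr e⟩
    by_contra hc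
    rw [e, ori_L] at hk
    nlinarith

theorem star1 {u q t x : ℝ × ℝ} (h : ori u t q ≠ 0) (h1 : Sg u q x) (h2 : Sg u t x) : False := by
  obtain ⟨r, r0, r1, rfl⟩ := h1.toL
  have := h2.ori0
  rw [ori_L, ori_01] at this
  rcases mul_eq_zero.1 (by linarith : r * ori u t q = 0) with h' | h'
  · linarith
  · exact h h'

/-- maximal plane straight-line graph in general position -/
structure Cfg {W : Type} (p : W → ℝ × ℝ) (E : W → W → Prop) : Prop where
  inj : ∀ a b, p a = p b → a = b
  g1 : ∀ a b c, a ≠ b → b ≠ c → a ≠ c → ori (p a) (p b) (p c) ≠ 0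
  symm : ∀ a b, E a b → E b a
  ne : ∀ a b, E a b → a ≠ b
  nc : ∀ a b c d x, E a b → E c d → Sg (p a) (p b) x → Sg (p c) (p d) x → SameE a b c d
  max : ∀ a b, a ≠ b → ¬ E a b → ∃ c d x, E c d ∧ Sg (p a) (p b) x ∧ Sg (p c) (p d) x

namespace Cfg
variable {W : Type} {p : W → ℝ × ℝ} {E : W → W → Prop}

theorem refl (C : Cfg p E) : Cfg (fun w => mir (p w)) E where
  inj a b h := C.inj a b (by have := congrArg mir h; simpa only [mir_mir] using this)
  g1 a b c h1 h2 h3 := by rw [ori_mir]; exact neg_ne_zero.2 (C.g1 a b c h1 h2 h3)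
  symm := C.symm
  ne := C.ne
  nc a b c d x h1 h2 h3 h4 := by
    have h3 := h3.mir; have h4 := h4.mir
    simp only [mir_mir] at h3 h4
    exact C.nc a b c d _ h1 h2 h3 h4
  max a b h1 h2 := by
    obtain ⟨c, d, x, h3, h4, h5⟩ := C.max a b h1 h2
    exact ⟨c, d, _, h3, h4.mir, h5.mir⟩

theorem noOn (C : Cfg p E) {s t e : W} (h : s ≠ t) : ¬ Sg (p s) (p t) (p e) := by
  intro hs
  have key : ∀ s t, s ≠ t → ¬ Sg (p s) (p t) (p s) := by
    rintro s t h ⟨r, h1, h2, h3, h4⟩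
    apply h; apply C.inj
    ext <;> nlinarith
  by_cases h1 : e = s
  · subst h1; exact key _ _ h hs
  by_cases h2 : e = t
  · subst h2; exact key _ _ h.symm hs.symm
  exact C.g1 s t e h (Ne.symm h2) (Ne.symm h1) hs.ori0

/-- two segments from a common vertex do not meet -/
theorem star (C : Cfg p E) {u q t : W} {x : ℝ × ℝ} (hu : u ≠ q) (hut : u ≠ t) (hq : q ≠ t)
    (h1 : Sg (p u) (p q) x) (h2 : Sg (p u) (p t) x) : False :=
  star1 (C.g1 u t q hut hq.symm hu) h1 h2

theorem nc' (C : Cfg p E) {e f s t : W} {y Y : ℝ × ℝ} {τ : ℝ} (h : E f e) (hy : Sg (p f) (p e) y)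
    (h0 : 0 < τ) (h1 : τ ≤ 1) (hY : Lp y (p e) τ = Y) (hs : E s t) (hS : Sg (p s) (p t) Y) :
    SameE f e s t := by
  rcases h1.lt_or_eq with h1 | h1
  · obtain ⟨r, r0, r1, rfl⟩ := hy.toL
    rw [Lp_Lp] at hY
    refine C.nc f e s t Y h hs ?_ hS
    rw [← hY]; exact sgL (by nlinarith) (by nlinarith)
  · rw [h1, Lp_one] at hY
    rw [← hY] at hS
    exact (C.noOn (C.ne _ _ hs) hS).elim

theorem dich {a b s t x : ℝ × ℝ} {k : ℝ} (h : Sg s t x) (hx : k ≤ ori a b x) :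
    k ≤ ori a b s ∨ k ≤ ori a b t := by
  obtain ⟨r, r0, r1, rfl⟩ := h.toL
  rw [ori_L] at hx
  by_contra hc
  push Not at hc
  nlinarith [hc.1, hc.2]

theorem dich0 (C : Cfg p E) {a b s t : W} {x : ℝ × ℝ} (hab : a ≠ b) (hst : s ≠ t)
    (h : Sg (p s) (p t) x) (hx : ori (p a) (p b) x = 0) :
    0 < ori (p a) (p b) (p s) ∧ ori (p a) (p b) (p t) < 0 ∨
    0 < ori (p a) (p b) (p t) ∧ ori (p a) (p b) (p s) < 0 ∨ SameE a b s t := by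
  obtain ⟨r, r0, r1, rfl⟩ := h.toL
  rw [ori_L] at hx
  have z : ∀ w, ori (p a) (p b) (p w) = 0 → w = a ∨ w = b := by
    intro w hw
    by_contra hc
    push Not at hc
    exact C.g1 a b w hab hc.2.symm hc.1.symm hw
  rcases lt_trichotomy (ori (p a) (p b) (p s)) 0 with h1 | h1 | h1
  · exact Or.inr (Or.inl ⟨by nlinarith, h1⟩)
  · have : ori (p a) (p b) (p t) = 0 := by
      rw [h1] at hx; rcases mul_eq_zero.1 (by linarith : r * ori (p a) (p b) (p t) = 0) with h | h
      · linarith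
      · exact h
    right; right
    rcases z s h1 with rfl | rfl <;> rcases z t this with rfl | rfl
    · exact (hst rfl).elim
    · exact Or.inl ⟨rfl, rfl⟩
    · exact Or.inr ⟨rfl, rfl⟩
    · exact (hst rfl).elim
  · exact Or.inl ⟨h1, by nlinarith⟩

theorem same (C : Cfg p E) {a b s t : W} (h : SameE a b s t) (hs : E s t) : E a b := by
  rcases h with ⟨rfl, rfl⟩ | ⟨rfl, rfl⟩
  · exact hs
  · exact C.symm _ _ hs

variable [Finite W]

theorem vl_core (C : Cfg p E) {u q s t : W} {τ : ℝ} (h0 : 0 < τ) (h1 : τ < 1) (huq : u ≠ q)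
    (hmin : ∀ c d r, 0 < r → r < τ → E c d → ¬ Sg (p c) (p d) (Lp (p u) (p q) r))
    (hst : E s t) (hx : Sg (p t) (p s) (Lp (p u) (p q) τ)) (hs : 0 < ori (p u) (p q) (p s)) :
    ∃ v, E u v ∧ ∃ c1 c2, 0 ≤ c1 ∧ 0 < c2 ∧
      (p v).1 - (p u).1 = c1 * ((p q).1 - (p u).1) + c2 * ((p s).1 - (p u).1) ∧
      (p v).2 - (p u).2 = c1 * ((p q).2 - (p u).2) + c2 * ((p s).2 - (p u).2) := by
  set x := Lp (p u) (p q) τ with hxdef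
  have hux : ∀ w, ori (p u) x w = τ * ori (p u) (p q) w := by
    intro w; rw [hxdef]; unfold ori Lp; ring
  have hts : t ≠ s := (C.ne _ _ hst).symm
  have hxs : ∀ w, ori (p t) (p s) w = 0 → ori x (p s) w = 0 := by
    intro w hw
    obtain ⟨r, r0, r1, e⟩ := hx.toL
    rw [e, show ori (Lp (p t) (p s) r) (p s) w = (1 - r) * ori (p t) (p s) w by
      unfold ori Lp; ring, hw, mul_zero]
  obtain ⟨v, ⟨hv1, hv2⟩, hv⟩ := ang_first p (p u) x {w | 0 < ori (p u) x (p w) ∧ 0 ≤ ori x (p s) (p w)}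
    ⟨s, by rw [hux]; positivity, by rw [ori_11]⟩ (fun a ha => ha.1)
  have huv : u ≠ v := by rintro rfl; rw [ori_01] at hv1; linarith
  have hsS := hv s ⟨by rw [hux]; positivity, by rw [ori_11]⟩
  have hxu : 0 < ori (p u) x (p s) := by rw [hux]; positivity
  refine ⟨v, ?_, ori (p u) (p v) (p s) / ori (p u) (p q) (p s),
    ori (p u) (p q) (p v) / ori (p u) (p q) (p s), by positivity, ?_, ?_, ?_⟩
  · by_contra hE
    obtain ⟨e, f, y, hef, hy, hy'⟩ := C.max u v huv hE
    -- orient the crossing edge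
    obtain ⟨e, f, hef, hy', he⟩ : ∃ e f, E f e ∧ Sg (p f) (p e) y ∧ ori (p u) (p v) (p e) < 0 := by
      rcases C.dich0 huv (C.ne _ _ hef) hy' hy.ori0 with h | h | h
      · exact ⟨f, e, hef, hy', h.2⟩
      · exact ⟨e, f, C.symm _ _ hef, hy'.symm, h.2⟩
      · exact (hE (C.same h hef)).elim
    have hyv := hy.ori0
    obtain ⟨σ, σ0, σ1, ey⟩ := hy.toL
    have hay : 0 < ori x (p s) y := by
      rw [ey, ori_L, ori_rot]; nlinarith
    have hby : 0 < ori (p u) x y := by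
      rw [ey, ori_L, ori_01]; nlinarith
    obtain ⟨τ', t0, t1, r, r0, r1, hY⟩ := exit1 (x := x) (a := p s) (b := p u) (c := p v) (d := p u)
      (y := y) (e := p e) (by rw [ori_rot]; exact hxu) (by rw [ori_sw]; linarith) (by rw [ori_11])
      (by rw [show ori (p v) (p u) x = ori (p u) x (p v) from (ori_rot _ _ _).symm]; exact hv1)
      (by rw [ori_sw]; linarith) (by rw [ori_sw]; linarith) hay hby
      (fun h => by have := hv e ⟨h.2, h.1.le⟩; linarith)
    have A : ∀ r, 0 ≤ r → r < 1 → Lp y (p e) τ' = Lp x (p s) r → False := by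
      intro r r0 r1 h
      obtain ⟨ς, ς0, ς1, ex⟩ := hx.toL
      rw [ex, Lp_Lp] at h
      have := C.nc' hef hy' t0 t1 h (C.symm _ _ hst) (sgL (by nlinarith) (by nlinarith))
      have hz : ori (p t) (p s) y = 0 := by
        rcases this with ⟨rfl, rfl⟩ | ⟨rfl, rfl⟩
        · exact hy'.ori0
        · exact hy'.symm.ori0
      exact hay.ne' (hxs _ hz)
    rcases hY with hY | hY
    · exact A r r0 r1 hY
    · rcases r0.eq_or_lt with r0 | r0
      · subst r0
        rw [Lp_zero] at hY
        exact A 0 le_rfl one_pos (by rw [hY, Lp_zero])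
      · have e2 : Lp x (p u) r = Lp (p u) (p q) (τ * (1 - r)) := by
          rw [hxdef]; unfold Lp; ext <;> simp <;> ring
        rw [e2] at hY
        have g1 : 0 < τ * (1 - r) := mul_pos h0 (by linarith)
        have g2 : τ * (1 - r) < τ := by nlinarith
        rcases t1.lt_or_eq with t1 | t1
        · refine hmin f e _ g1 g2 hef ?_
          rw [← hY]
          obtain ⟨r', r0', r1', e3⟩ := hy'.toL
          rw [e3, Lp_Lp]; exact sgL (by nlinarith) (by nlinarith)
        · rw [t1, Lp_one] at hY
          exact C.noOn huq (hY ▸ sgL g1 (by linarith))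
  · rw [hux] at hv1
    exact div_pos (by by_contra hc; nlinarith) hs
  · field_simp; unfold ori; ring
  · field_simp; unfold ori; ring

/-- if some vertex is further in a direction, then so is some neighbour -/
theorem vl (C : Cfg p E) (A B : ℝ) {u q : W}
    (hq : A * (p u).1 + B * (p u).2 < A * (p q).1 + B * (p q).2) :
    ∃ v, E u v ∧ A * (p u).1 + B * (p u).2 < A * (p v).1 + B * (p v).2 := by
  by_cases hE : E u q
  · exact ⟨q, hE, hq⟩
  have huq : u ≠ q := by rintro rfl; exact lt_irrefl _ hq
  obtain ⟨c0, d0, x0, h1, h2, h3⟩ := C.max u q huq hE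
  have hform : ∀ c d r, E c d → Sg (p c) (p d) (Lp (p u) (p q) r) →
      r = ori (p c) (p d) (p u) / (ori (p c) (p d) (p u) - ori (p c) (p d) (p q)) := by
    intro c d r hcd h
    have h0 := h.ori0
    rw [ori_L] at h0
    have hne := C.ne _ _ hcd
    rw [eq_div_iff]
    · linarith
    · intro hz
      have e1 : ori (p c) (p d) (p u) = 0 := by rw [sub_eq_zero] at hz; rw [← hz] at h0; linarith
      have e2 : ori (p c) (p d) (p q) = 0 := by linarith
      have z : ∀ w, ori (p c) (p d) (p w) = 0 → w = c ∨ w = d := by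
        intro w hw
        by_contra hc
        push Not at hc
        exact C.g1 c d w hne hc.2.symm hc.1.symm hw
      rcases z u e1 with rfl | rfl <;> rcases z q e2 with rfl | rfl
      · exact huq rfl
      · exact hE hcd
      · exact hE (C.symm _ _ hcd)
      · exact huq rfl
  obtain ⟨r0, r0p, r0l, rfl⟩ := h2.toL
  obtain ⟨⟨s, t⟩, ⟨τ, τ0, τ1, hst, hx⟩, hm⟩ := Set.exists_min_image
    {c : W × W | ∃ r, 0 < r ∧ r < 1 ∧ E c.1 c.2 ∧ Sg (p c.1) (p c.2) (Lp (p u) (p q) r)}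
    (fun c => ori (p c.1) (p c.2) (p u) / (ori (p c.1) (p c.2) (p u) - ori (p c.1) (p c.2) (p q)))
    (Set.toFinite _) ⟨(c0, d0), r0, r0p, r0l, h1, h3⟩
  have hmin : ∀ c d r, 0 < r → r < τ → E c d → ¬ Sg (p c) (p d) (Lp (p u) (p q) r) := by
    intro c d r hr0 hr1 hcd hS
    have := hm (c, d) ⟨r, hr0, by linarith, hcd, hS⟩
    simp only at this hst hx
    rw [← hform c d r hcd hS, ← hform s t τ hst hx] at this
    linarith
  simp only at hst hx
  clear hm h1 h3
  -- upper endpoint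
  have key : ∀ s t, E s t → Sg (p t) (p s) (Lp (p u) (p q) τ) →
      A * (p u).1 + B * (p u).2 < A * (p s).1 + B * (p s).2 →
      ∃ v, E u v ∧ A * (p u).1 + B * (p u).2 < A * (p v).1 + B * (p v).2 := by
    intro s t hst hx hs
    have fin : ∀ (v : W) (c1 c2 : ℝ), 0 ≤ c1 → 0 < c2 →
      (p v).1 - (p u).1 = c1 * ((p q).1 - (p u).1) + c2 * ((p s).1 - (p u).1) →
      (p v).2 - (p u).2 = c1 * ((p q).2 - (p u).2) + c2 * ((p s).2 - (p u).2) →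
      A * (p u).1 + B * (p u).2 < A * (p v).1 + B * (p v).2 := by
      intro v c1 c2 g1 g2 g3 g4
      have i1 := mul_nonneg g1 (sub_nonneg.2 hq.le)
      have i2 := mul_pos g2 (sub_pos.2 hs)
      have : A * (p v).1 + B * (p v).2 - (A * (p u).1 + B * (p u).2) =
        A * ((p v).1 - (p u).1) + B * ((p v).2 - (p u).2) := by ring
      rw [g3, g4] at this
      linarith
    rcases lt_trichotomy (ori (p u) (p q) (p s)) 0 with h | h | h
    · obtain ⟨v, hv, c1, c2, g1, g2, g3, g4⟩ := C.refl.vl_core (u := u) (q := q) (s := s) (t := t)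
        τ0 τ1 huq (by
          intro c d r a1 a2 a3 a4
          have := a4.mir
          simp only [Lp_mir, mir_mir] at this
          exact hmin c d r a1 a2 a3 this) hst (by rw [Lp_mir]; exact hx.mir)
          (by rw [ori_mir]; linarith)
      simp only [mir] at g3 g4
      exact ⟨v, hv, fin v c1 c2 g1 g2 (by linarith) g4⟩
    · exfalso
      have hne := C.ne _ _ hst
      have hsS := sgL (x := p u) (y := p q) τ0 τ1
      have : s = u ∨ s = q := by
        by_contra hc
        push Not at hc
        exact C.g1 u q s huq hc.2.symm hc.1.symm h
      rcases this with rfl | rfl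
      · linarith
      · refine C.star huq.symm hne ?_ hsS.symm hx.symm
        rintro rfl; exact hE (C.symm _ _ hst)
    · obtain ⟨v, hv, c1, c2, g1, g2, g3, g4⟩ := C.vl_core τ0 τ1 huq hmin hst hx h
      exact ⟨v, hv, fin v c1 c2 g1 g2 g3 g4⟩
  by_cases hs : A * (p u).1 + B * (p u).2 < A * (p s).1 + B * (p s).2
  · exact key s t hst hx.symm hs
  · refine key t s (C.symm _ _ hst) hx ?_
    obtain ⟨r, r0, r1, e1, e2⟩ := hx
    simp only [Lp] at e1 e2
    have : A * ((p u).1 + τ * ((p q).1 - (p u).1)) + B * ((p u).2 + τ * ((p q).2 - (p u).2)) =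
      A * ((p s).1 + r * ((p t).1 - (p s).1)) + B * ((p s).2 + r * ((p t).2 - (p s).2)) := by
      rw [e1, e2]
    nlinarith [mul_pos τ0 (sub_pos.2 hq)]

/-- consecutive neighbours bound an empty triangle -/
theorem cl (C : Cfg p E) {u a b : W} (ha : E u a) (hb : E u b) (h : 0 < ori (p u) (p a) (p b))
    (hw : ∀ c, E u c → ¬ (0 < ori (p u) (p a) (p c) ∧ 0 < ori (p b) (p u) (p c))) :
    E a b ∧ ∀ w, ¬ (0 < ori (p u) (p a) (p w) ∧ 0 < ori (p b) (p u) (p w) ∧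
      0 < ori (p a) (p b) (p w)) := by
  have hab : a ≠ b := by rintro rfl; rw [ori_11] at h; linarith
  have hua := C.ne _ _ ha
  have hub := C.ne _ _ hb
  have h' : 0 < ori (p a) (p b) (p u) := by rw [ori_rot]; exact h
  have K : ∀ x s t, 0 < ori (p u) (p a) x → 0 < ori (p b) (p u) x → 0 ≤ ori (p a) (p b) x →
      E s t → Sg (p s) (p t) x → 0 < ori (p a) (p b) (p t) →
      ¬ (0 < ori (p u) (p a) (p t) ∧ 0 < ori (p b) (p u) (p t)) → t ≠ u → s ≠ u → False := by
    intro x s t h1 h2 h3 hst hx h4 h5 htu hsu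
    obtain ⟨τ', t0, t1, r, r0, r1, hY⟩ := exit1 (x := p u) (a := p a) (b := p b) (c := p a)
      (d := p b) (y := x) (e := p t) h (by rw [ori_01]) (by rw [ori_11]) h' h3 h4 h1 h2 h5
    have fin : ∀ a, E u a → Lp x (p t) τ' = Lp (p u) (p a) r → False := by
      intro a ha hY
      rcases r0.eq_or_lt with r0 | r0
      · subst r0
        rw [Lp_zero] at hY
        rcases t1.lt_or_eq with t1 | t1
        · obtain ⟨r', r0', r1', e3⟩ := hx.toL
          rw [e3, Lp_Lp] at hY
          exact C.noOn (C.ne _ _ hst) (hY ▸ sgL (by nlinarith) (by nlinarith))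
        · rw [t1, Lp_one] at hY
          exact htu (C.inj _ _ hY)
      · rcases C.nc' hst hx t0 t1 hY ha (sgL r0 r1) with ⟨e, -⟩ | ⟨-, e⟩
        · exact hsu e
        · exact htu e
    rcases hY with hY | hY
    · exact fin a ha hY
    · exact fin b hb hY
  have sum : ∀ w, ori (p a) (p b) w + ori (p u) (p a) w + ori (p b) (p u) w =
    ori (p u) (p a) (p b) := by intro w; unfold ori; ring
  have hemp : ∀ w, ¬ (0 < ori (p u) (p a) (p w) ∧ 0 < ori (p b) (p u) (p w) ∧
      0 < ori (p a) (p b) (p w)) := by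
    intro w0 hw0
    obtain ⟨q, ⟨q1, q2, q3⟩, hq⟩ := Set.exists_max_image {w | 0 < ori (p u) (p a) (p w) ∧
      0 < ori (p b) (p u) (p w) ∧ 0 < ori (p a) (p b) (p w)} (fun w => ori (p a) (p b) (p w))
      (Set.toFinite _) ⟨w0, hw0⟩
    have huq : u ≠ q := by rintro rfl; rw [ori_01] at q1; linarith
    have hE : ¬ E u q := fun hE => hw q hE ⟨q1, q2⟩
    obtain ⟨s, t, x, hst, hx, hx'⟩ := C.max u q huq hE
    have hu1 : ∀ s t, E s t → Sg (p s) (p t) x → s ≠ u := by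
      rintro s t hst hx' rfl
      exact C.star huq (C.ne _ _ hst) (by rintro rfl; exact hE hst) hx hx'
    obtain ⟨σ, σ0, σ1, ex⟩ := hx.toL
    have g1 : 0 < ori (p u) (p a) x := by rw [ex, ori_L, ori_01]; nlinarith
    have g2 : 0 < ori (p b) (p u) x := by rw [ex, ori_L, ori_11]; nlinarith
    have g3 : ori (p a) (p b) (p q) < ori (p a) (p b) x := by
      rw [ex, ori_L, ori_rot (p u)]; have := sum (p q); nlinarith
    have fin : ∀ s t, E s t → Sg (p s) (p t) x → ori (p a) (p b) x ≤ ori (p a) (p b) (p t) →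
        False := by
      intro s t hst hx' ht
      refine K x s t g1 g2 (by linarith) hst hx' (by linarith) (fun hc => ?_)
        (hu1 _ _ (C.symm _ _ hst) hx'.symm) (hu1 _ _ hst hx')
      have := hq t ⟨hc.1, hc.2, by linarith⟩
      linarith
    rcases dich (a := p a) (b := p b) hx' le_rfl with h | h
    · exact fin t s (C.symm _ _ hst) hx'.symm h
    · exact fin s t hst hx' h
  refine ⟨?_, hemp⟩
  by_contra hE
  obtain ⟨s, t, x, hst, hx, hx'⟩ := C.max a b hab hE
  have g3 := hx.ori0
  obtain ⟨σ, σ0, σ1, ex⟩ := hx.toL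
  have g1 : 0 < ori (p u) (p a) x := by rw [ex, ori_L, ori_11]; nlinarith
  have g2 : 0 < ori (p b) (p u) x := by
    rw [ex, ori_L, ori_01, show ori (p b) (p u) (p a) = ori (p u) (p a) (p b) from
      (ori_rot _ _ _).symm]; nlinarith
  have fin : ∀ s t, E s t → Sg (p s) (p t) x → 0 < ori (p a) (p b) (p t) →
      ori (p a) (p b) (p s) < 0 → False := by
    intro s t hst hx' ht hs
    have hsu : s ≠ u := by rintro rfl; linarith
    by_cases htu : t = u
    · subst htu
      refine hw s (C.symm _ _ hst) ?_
      obtain ⟨r, r0, r1, e⟩ := hx'.toL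
      rw [e, ori_L, ori_01] at g1
      rw [e, ori_L, ori_11] at g2
      constructor <;> by_contra hc <;> nlinarith
    · exact K x s t g1 g2 g3.ge hst hx' ht (fun hc => hemp t ⟨hc.1, hc.2, ht⟩) htu hsu
  rcases C.dich0 hab (C.ne _ _ hst) hx' g3 with h | h | h
  · exact fin t s (C.symm _ _ hst) hx'.symm h.1 h.2
  · exact fin s t hst hx' h.1 h.2
  · exact hE (C.same h hst)

end Cfg

/-- maximal plane graph with triangular convex hull -/
structure Hul {W : Type} (p : W → ℝ × ℝ) (E : W → W → Prop) (D1 D2 D3 : W) : Prop extends Cfg p E where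
  yinj : ∀ a b, (p a).2 = (p b).2 → a = b
  n12 : D1 ≠ D2
  n23 : D2 ≠ D3
  n31 : D3 ≠ D1
  h12 : ∀ x, x ≠ D1 → x ≠ D2 → 0 < ori (p D1) (p D2) (p x)
  h23 : ∀ x, x ≠ D2 → x ≠ D3 → 0 < ori (p D2) (p D3) (p x)
  h31 : ∀ x, x ≠ D3 → x ≠ D1 → 0 < ori (p D3) (p D1) (p x)

namespace Hul
variable {W : Type} {p : W → ℝ × ℝ} {E : W → W → Prop} {D1 D2 D3 : W}

def Out (D1 D2 D3 a b c : W) : Prop :=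
  (a = D2 ∧ b = D1 ∧ c = D3) ∨ (a = D1 ∧ b = D3 ∧ c = D2) ∨ (a = D3 ∧ b = D2 ∧ c = D1)

def FP (p : W → ℝ × ℝ) (E : W → W → Prop) (u v w : W) : Prop :=
  E u v ∧ E v w ∧ E w u ∧ 0 < ori (p u) (p v) (p w) ∧
    ∀ x, ¬ (0 < ori (p u) (p v) (p x) ∧ 0 < ori (p v) (p w) (p x) ∧ 0 < ori (p w) (p u) (p x))

def F (p : W → ℝ × ℝ) (E : W → W → Prop) (D1 D2 D3 u v w : W) : Prop :=
  FP p E u v w ∨ Out D1 D2 D3 u v w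

theorem edge (C : Hul p E D1 D2 D3) {a b : W} (hab : a ≠ b)
    (h : ∀ x, x ≠ a → x ≠ b → 0 < ori (p a) (p b) (p x)) : E a b := by
  by_contra hE
  obtain ⟨s, t, x, hst, hx, hx'⟩ := C.max a b hab hE
  have key : ∀ s, ¬ ori (p a) (p b) (p s) < 0 := by
    intro s hs
    have := h s (by rintro rfl; rw [ori_01] at hs; linarith)
      (by rintro rfl; rw [ori_11] at hs; linarith)
    linarith
  rcases C.dich0 hab (C.ne _ _ hst) hx' hx.ori0 with h | h | h
  · exact key t h.2
  · exact key s h.2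
  · exact hE (C.same h hst)

theorem Out.info (C : Hul p E D1 D2 D3) {u v w : W} (h : Out D1 D2 D3 u v w) :
    E u v ∧ (∀ x, x ≠ v → x ≠ u → 0 < ori (p v) (p u) (p x)) ∧
    (∀ x, x ≠ u → x ≠ w → 0 < ori (p u) (p w) (p x)) := by
  have e1 := C.symm _ _ (C.edge C.n12 C.h12)
  have e2 := C.symm _ _ (C.edge C.n23 C.h23)
  have e3 := C.symm _ _ (C.edge C.n31 C.h31)
  rcases h with ⟨rfl, rfl, rfl⟩ | ⟨rfl, rfl, rfl⟩ | ⟨rfl, rfl, rfl⟩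
  · exact ⟨e1, C.h12, C.h23⟩
  · exact ⟨e3, C.h31, C.h12⟩
  · exact ⟨e2, C.h23, C.h31⟩

theorem Out.rot {u v w : W} (h : Out D1 D2 D3 u v w) : Out D1 D2 D3 v w u := by
  unfold Out at *; tauto

theorem noleft (C : Hul p E D1 D2 D3) {u v : W} (huv : u ≠ v)
    (h : ∀ w, ori (p u) (p v) (p w) ≤ 0) : ∃ c, Out D1 D2 D3 u v c := by
  have key : ∀ w, ori (p u) (p v) (p w) = 0 → w = D1 ∨ w = D2 ∨ w = D3 := by
    intro w hw
    by_contra hc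
    push Not at hc
    have a1 := C.h12 w hc.1 hc.2.1
    have a2 := C.h23 w hc.2.1 hc.2.2
    have a3 := C.h31 w hc.2.2 hc.1
    have id : ori (p D2) (p D3) (p w) * ori (p u) (p v) (p D1) +
      ori (p D3) (p D1) (p w) * ori (p u) (p v) (p D2) +
      ori (p D1) (p D2) (p w) * ori (p u) (p v) (p D3) =
      (ori (p D2) (p D3) (p w) + ori (p D3) (p D1) (p w) + ori (p D1) (p D2) (p w)) *
        ori (p u) (p v) (p w) := by unfold ori; ring
    rw [hw, mul_zero] at id
    have b1 := mul_nonpos_of_nonneg_of_nonpos a2.le (h D1)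
    have b2 := mul_nonpos_of_nonneg_of_nonpos a3.le (h D2)
    have b3 := mul_nonpos_of_nonneg_of_nonpos a1.le (h D3)
    have z : ∀ x, ori (p u) (p v) (p x) = 0 → x = u ∨ x = v := by
      intro x hx
      by_contra hc
      push Not at hc
      exact C.g1 u v x huv hc.2.symm hc.1.symm hx
    have c1 := z D1 ((mul_eq_zero.1 (by linarith)).resolve_left a2.ne')
    have c2 := z D2 ((mul_eq_zero.1 (by linarith)).resolve_left a3.ne')
    have c3 := z D3 ((mul_eq_zero.1 (by linarith)).resolve_left a1.ne')
    have := C.n12; have := C.n23; have := C.n31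
    grind
  have t1 := C.h12 D3 C.n31 C.n23.symm
  have t2 := C.h23 D1 C.n12 C.n31.symm
  have t3 := C.h31 D2 C.n23 C.n12.symm
  have n1 := h D1
  have n2 := h D2
  have n3 := h D3
  unfold Out
  rcases key u (ori_01 _ _) with rfl | rfl | rfl <;> rcases key v (ori_11 _ _) with rfl | rfl | rfl
  · exact (huv rfl).elim
  · linarith
  · exact ⟨D2, by tauto⟩
  · exact ⟨D3, by tauto⟩
  · exact (huv rfl).elim
  · linarith
  · linarith
  · exact ⟨D1, by tauto⟩
  · exact (huv rfl).elim

theorem FP.rot {u v w : W} (h : FP p E u v w) : FP p E v w u := by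
  obtain ⟨h1, h2, h3, h4, h5⟩ := h
  exact ⟨h2, h3, h1, by rw [ori_rot]; exact h4, fun x hx => h5 x ⟨hx.2.2, hx.1, hx.2.1⟩⟩

theorem FP.wedge (C : Hul p E D1 D2 D3) {u v w t : W} (h : FP p E u v w) (ht : E u t) :
    ¬ (0 < ori (p u) (p v) (p t) ∧ 0 < ori (p w) (p u) (p t)) := by
  rintro ⟨h1, h2⟩
  obtain ⟨e1, e2, e3, h4, h5⟩ := h
  have hT : ori (p v) (p w) (p t) < 0 := by
    refine lt_of_le_of_ne (not_lt.1 fun h => h5 t ⟨h1, h, h2⟩) (C.g1 v w t (C.ne _ _ e2) ?_ ?_)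
    · rintro rfl; rw [ori_01] at h2; linarith
    · rintro rfl; rw [ori_11] at h1; linarith
  have hU : ori (p v) (p w) (p u) = ori (p u) (p v) (p w) := ori_rot _ _ _
  set U := ori (p u) (p v) (p w) with hUdef
  set T := ori (p v) (p w) (p t) with hTdef
  have hd : 0 < U - T := by linarith
  set Y := Lp (p u) (p t) (U / (U - T)) with hY
  have τ0 : 0 < U / (U - T) := by positivity
  have y1 : ori (p v) (p w) Y = 0 := by
    rw [hY, ori_L, hU, ← hTdef]; field_simp; ring
  have y2 : 0 < ori (p u) (p v) Y := by rw [hY, ori_L, ori_01]; nlinarith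
  have y3 : 0 < ori (p w) (p u) Y := by rw [hY, ori_L, ori_11]; nlinarith
  have sum : ori (p v) (p w) Y + ori (p u) (p v) Y + ori (p w) (p u) Y = U := by
    rw [hUdef]; unfold ori; ring
  have e : Y = Lp (p v) (p w) (ori (p u) (p v) Y / U) := by
    have id1 : U * (Y.1 - (p v).1) = ori (p u) (p v) Y * ((p w).1 - (p v).1) +
      ori (p v) (p w) Y * ((p u).1 - (p v).1) := by rw [hUdef]; unfold ori; ring
    have id2 : U * (Y.2 - (p v).2) = ori (p u) (p v) Y * ((p w).2 - (p v).2) +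
      ori (p v) (p w) Y * ((p u).2 - (p v).2) := by rw [hUdef]; unfold ori; ring
    rw [y1] at id1 id2
    have hU0 := h4.ne'
    ext
    · simp only [Lp]; field_simp; linarith
    · simp only [Lp]; field_simp; linarith
  have s1 : Sg (p u) (p t) Y := sgL τ0 (by rw [div_lt_one hd]; linarith)
  have s2 : Sg (p v) (p w) Y := by
    rw [e]; exact sgL (by positivity) (by rw [div_lt_one h4]; linarith)
  rcases C.nc _ _ _ _ Y ht e2 s1 s2 with ⟨h, -⟩ | ⟨h, -⟩
  · exact C.ne _ _ e1 h
  · exact C.ne _ _ e3 h.symm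

theorem F.edge (C : Hul p E D1 D2 D3) {u v w : W} (h : F p E D1 D2 D3 u v w) : E u v :=
  h.elim (fun h => h.1) (fun h => (Out.info C h).1)

theorem F.rot {u v w : W} (h : F p E D1 D2 D3 u v w) : F p E D1 D2 D3 v w u :=
  h.elim (fun h => Or.inl h.rot) (fun h => Or.inr h.rot)

theorem F.uniq (C : Hul p E D1 D2 D3) {u v w w' : W} (h : F p E D1 D2 D3 u v w)
    (h' : F p E D1 D2 D3 u v w') : w = w' := by
  have key : ∀ w w', FP p E u v w → FP p E u v w' → ¬ 0 < ori (p u) (p w) (p w') := by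
    intro w w' h h' hlt
    refine FP.wedge C h' (C.symm _ _ h.2.2.1) ⟨h.2.2.2.1, ?_⟩
    rw [← ori_rot]; exact hlt
  have mix : ∀ w w', FP p E u v w → ¬ Out D1 D2 D3 u v w' := by
    intro w w' h h'
    have := (Out.info C h').2.1 w (C.ne _ _ h.2.1).symm (C.ne _ _ h.2.2.1)
    rw [ori_sw] at this
    linarith [h.2.2.2.1]
  rcases h with h | h <;> rcases h' with h' | h'
  · by_contra hne
    have h1 := key w w' h h'
    have h2 := key w' w h' h
    rw [ori_sw2] at h2
    exact C.g1 u w w' (C.ne _ _ h.2.2.1).symm hne (C.ne _ _ h'.2.2.1).symm (by linarith)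
  · exact (mix _ _ h h').elim
  · exact (mix _ _ h' h).elim
  · have := C.n12; have := C.n23; have := C.n31
    unfold Out at h h'; grind

variable [Finite W]

theorem third (C : Hul p E D1 D2 D3) {u v x : W} (h : E u v) (hx : 0 < ori (p u) (p v) (p x)) :
    ∃ w, FP p E u v w := by
  obtain ⟨w0, hw0, hl⟩ := C.vl (-((p v).2 - (p u).2)) ((p v).1 - (p u).1) (u := u) (q := x)
    (by unfold ori at hx; nlinarith)
  obtain ⟨w, ⟨hw1, hw2⟩, hw⟩ := ang_first p (p u) (p v) {w | E u w ∧ 0 < ori (p u) (p v) (p w)}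
    ⟨w0, hw0, by unfold ori; nlinarith⟩ (fun a ha => ha.2)
  obtain ⟨h1, h2⟩ := C.cl h hw1 hw2 (fun c hc hcc => by
    have := hw c ⟨hc, hcc.1⟩
    have h9 := hcc.2
    rw [ori_sw] at h9
    linarith)
  exact ⟨w, h, h1, C.symm _ _ hw1, hw2, fun x hx => h2 x ⟨hx.1, hx.2.2, hx.2.1⟩⟩

theorem tot (C : Hul p E D1 D2 D3) {u v : W} (h : E u v) : ∃ w, F p E D1 D2 D3 u v w := by
  by_cases hx : ∃ x, 0 < ori (p u) (p v) (p x)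
  · obtain ⟨x, hx⟩ := hx
    obtain ⟨w, hw⟩ := C.third h hx
    exact ⟨w, Or.inl hw⟩
  · push Not at hx
    obtain ⟨w, hw⟩ := C.noleft (C.ne _ _ h) hx
    exact ⟨w, Or.inr hw⟩

theorem link (C : Hul p E D1 D2 D3) (u : W) (A : Set W) (v : W) (hv : v ∈ A) (huv : E u v)
    (hA : ∀ a b, a ∈ A → F p E D1 D2 D3 u a b → b ∈ A) (w : W) (hw : E u w) : w ∈ A := by
  by_contra hwA
  have huw := C.ne _ _ hw
  have hsg : ∀ a ∈ A, E u a → 0 < ori (p u) (p w) (p a) ∨ 0 < ori (p u) (p a) (p w) := by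
    intro a ha hua
    have := C.g1 u w a huw (by rintro rfl; exact hwA ha) (C.ne _ _ hua)
    rw [ori_sw2 _ (p w) (p a)]
    rcases lt_or_gt_of_ne this with h | h
    · right; linarith
    · exact Or.inl h
  have hEb : ∀ a b, F p E D1 D2 D3 u a b → E u b := fun a b h => C.symm _ _ (F.edge C h.rot.rot)
  by_cases hR : ∃ a ∈ A, E u a ∧ 0 < ori (p u) (p a) (p w)
  · obtain ⟨a0, h0⟩ := hR
    obtain ⟨a, ⟨ha, hua, haw⟩, hl⟩ := ang_last p (p u) (Lp (p u) (p w) (-1))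
      {a | a ∈ A ∧ E u a ∧ 0 < ori (p u) (p a) (p w)} ⟨a0, h0⟩ (fun a ha => by
        have e : ori (p u) (Lp (p u) (p w) (-1)) (p a) = ori (p u) (p a) (p w) := by
          unfold ori Lp; ring
        rw [e]; exact ha.2.2)
    obtain ⟨b, hb⟩ := C.tot hua
    have hbA := hA a b ha hb
    have hub := hEb a b hb
    rcases hb with hb | hb
    · rcases hsg b hbA hub with h | h
      · exact FP.wedge C hb hw ⟨haw, by rw [← ori_rot]; exact h⟩
      · have := hl b ⟨hbA, hub, h⟩
        rw [ori_sw2] at this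
        linarith [hb.2.2.2.1]
    · have := (Out.info C hb).2.1 w (by rintro rfl; exact hwA ha) huw.symm
      rw [ori_sw] at this
      linarith
  · push Not at hR
    have hL : ∀ a ∈ A, E u a → 0 < ori (p u) (p w) (p a) := fun a ha hua =>
      (hsg a ha hua).resolve_right (not_lt.2 (hR a ha hua))
    obtain ⟨a, ⟨ha, hua⟩, hl⟩ := ang_last p (p u) (p w)
      {a | a ∈ A ∧ E u a} ⟨v, hv, huv⟩ (fun a ha => hL a ha.1 ha.2)
    obtain ⟨b, hb⟩ := C.tot hua
    have hbA := hA a b ha hb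
    have hub := hEb a b hb
    rcases hb with hb | hb
    · have := hl b ⟨hbA, hub⟩
      rw [ori_sw2] at this
      linarith [hb.2.2.2.1]
    · have h1 := (Out.info C hb).2.2 w huw.symm (by rintro rfl; exact hwA hbA)
      have h2 := hL b hbA hub
      rw [ori_sw2] at h2
      linarith

theorem down (C : Hul p E D1 D2 D3) {a q : W} (h : (p q).2 < (p a).2) :
    ∃ v, E a v ∧ (p v).2 < (p a).2 := by
  obtain ⟨v, h1, h2⟩ := C.vl 0 (-1) (u := a) (q := q) (by linarith)
  exact ⟨v, h1, by linarith⟩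

theorem conn (C : Hul p E D1 D2 D3) (A : Set W) (hne : A.Nonempty)
    (hA : ∀ a b, a ∈ A → E a b → b ∈ A) (w : W) : w ∈ A := by
  by_contra hw
  obtain ⟨a, ha, hm⟩ := Set.exists_min_image A (fun w => (p w).2) (Set.toFinite _) hne
  obtain ⟨b, hb, hm'⟩ := Set.exists_min_image Aᶜ (fun w => (p w).2) (Set.toFinite _) ⟨w, hw⟩
  rcases lt_trichotomy (p a).2 (p b).2 with h | h | h
  · obtain ⟨v, h1, h2⟩ := C.down h
    exact absurd (hm' v fun hv => hb (hA v b hv (C.symm _ _ h1))) (not_le.2 h2)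
  · exact hb (C.yinj _ _ h ▸ ha)
  · obtain ⟨v, h1, h2⟩ := C.down h
    exact absurd (hm v (hA a v ha h1)) (not_le.2 h2)

end Hul

namespace Hul
variable {W : Type} {p : W → ℝ × ℝ} {E : W → W → Prop} {D1 D2 D3 : W}

/-- boundaries -/
def Bd (p : W → ℝ × ℝ) (E : W → W → Prop) (D1 D2 D3 : W) (z : W → W → ZMod 2) : Prop :=
  ∃ f : W → W → ZMod 2, (∀ a b c, F p E D1 D2 D3 a b c → f a b = f b c) ∧
    ∀ a b, E a b → f a b + f b a = z a b

theorem Bd.add {z z' : W → W → ZMod 2} (h : Bd p E D1 D2 D3 z) (h' : Bd p E D1 D2 D3 z') :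
    Bd p E D1 D2 D3 (z + z') := by
  obtain ⟨f, h1, h2⟩ := h
  obtain ⟨g, h3, h4⟩ := h'
  refine ⟨f + g, fun a b c h => ?_, fun a b h => ?_⟩
  · simp only [Pi.add_apply]; rw [h1 a b c h, h3 a b c h]
  · simp only [Pi.add_apply]; rw [← h2 a b h, ← h4 a b h]; ring

theorem Bd.zero : Bd p E D1 D2 D3 0 := ⟨0, by simp, by simp⟩

open Classical in
theorem Bd.tri (C : Hul p E D1 D2 D3) {u a b : W} (h : F p E D1 D2 D3 u a b) :
    Bd p E D1 D2 D3 (ed u a + ed a b + ed b u) := by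
  have n1 := C.ne _ _ (F.edge C h)
  have n2 := C.ne _ _ (F.edge C h.rot)
  have n3 := C.ne _ _ (F.edge C h.rot.rot)
  refine ⟨fun x y => if (x = u ∧ y = a) ∨ (x = a ∧ y = b) ∨ (x = b ∧ y = u) then 1 else 0,
    fun x y w hF => ?_, fun x y _ => ?_⟩
  · have hh : ∀ x y w, F p E D1 D2 D3 x y w → ((x = u ∧ y = a) ∨ (x = a ∧ y = b) ∨ (x = b ∧ y = u)) →
        ((y = u ∧ w = a) ∨ (y = a ∧ w = b) ∨ (y = b ∧ w = u)) := by
      rintro x y w hF (⟨rfl, rfl⟩ | ⟨rfl, rfl⟩ | ⟨rfl, rfl⟩)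
      · have := F.uniq C hF h; tauto
      · have := F.uniq C hF h.rot; tauto
      · have := F.uniq C hF h.rot.rot; tauto
    have e : ((x = u ∧ y = a) ∨ (x = a ∧ y = b) ∨ (x = b ∧ y = u)) ↔
        ((y = u ∧ w = a) ∨ (y = a ∧ w = b) ∨ (y = b ∧ w = u)) :=
      ⟨hh _ _ _ hF, fun k => hh _ _ _ hF.rot.rot (hh _ _ _ hF.rot k)⟩
    simp only [e]
  · simp only [Pi.add_apply, ed]
    by_cases x1 : x = u
    · subst x1; by_cases y1 : y = a
      · subst y1; simp [n1, n2, n3, n1.symm, n2.symm, n3.symm]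
      · simp [n1, n2, n3, n1.symm, n2.symm, n3.symm, y1]
    · by_cases x2 : x = a
      · subst x2; by_cases y1 : y = u
        · subst y1; simp [n1, n2, n3, n1.symm, n2.symm, n3.symm]
        · simp [n1, n2, n3, n1.symm, n2.symm, n3.symm, y1]
      · by_cases x3 : x = b
        · subst x3; by_cases y1 : y = u
          · subst y1; simp [n1, n2, n3, n1.symm, n2.symm, n3.symm]
          · simp [n1, n2, n3, n1.symm, n2.symm, n3.symm, y1]
        · simp [x1, x2, x3]

variable [Fintype W]

def Nice (p : W → ℝ × ℝ) (E : W → W → Prop) (n : ℕ) (z : W → W → ZMod 2) : Prop :=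
  (∀ a b, z a b = z b a) ∧ (∀ a, ∑ b, z a b = 0) ∧
    ∀ a b, z a b ≠ 0 → E a b ∧ {w | (p w).2 < (p a).2}.ncard < n

theorem Nice.add {n : ℕ} {z z' : W → W → ZMod 2} (h : Nice p E n z) (h' : Nice p E n z') :
    Nice p E n (z + z') := by
  refine ⟨fun a b => ?_, fun a => ?_, fun a b hne => ?_⟩
  · simp only [Pi.add_apply, h.1 a b, h'.1 a b]
  · simp only [Pi.add_apply, Finset.sum_add_distrib, h.2.1, h'.2.1, add_zero]
  · by_cases hz : z a b = 0
    · refine h'.2.2 a b fun hz' => hne ?_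
      simp [hz, hz']
    · exact h.2.2 a b hz

theorem Nice.zero {n : ℕ} : Nice p E n (0 : W → W → ZMod 2) :=
  ⟨by simp, by simp, by simp⟩

theorem rk_lt {a b : W} (h : (p a).2 < (p b).2) :
    {w | (p w).2 < (p a).2}.ncard < {w | (p w).2 < (p b).2}.ncard := by
  refine Set.ncard_lt_ncard ⟨fun w hw => lt_trans hw h, fun hs => ?_⟩ (Set.toFinite _)
  have h2 : a ∈ {w | (p w).2 < (p a).2} := hs h
  rw [Set.mem_ofPred_eq] at h2
  exact lt_irrefl _ h2

theorem ed_ne {x y a b : W} (h : ed x y a b ≠ 0) : (a = x ∧ b = y) ∨ (a = y ∧ b = x) := by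
  by_contra hc; apply h; unfold ed; rw [if_neg hc]

open Classical in
theorem Nice.tri (C : Hul p E D1 D2 D3) {n : ℕ} {u a b : W} (h : F p E D1 D2 D3 u a b)
    (hr : ∀ w, w = u ∨ w = a ∨ w = b → {x | (p x).2 < (p w).2}.ncard < n) :
    Nice p E n (ed u a + ed a b + ed b u) := by
  have e1 := F.edge C h
  have e2 := F.edge C h.rot
  have e3 := F.edge C h.rot.rot
  refine ⟨fun x y => ?_, fun x => ?_, fun x y hne => ?_⟩
  · simp only [Pi.add_apply, ed_symm _ _ x y]
  · simp only [Pi.add_apply, Finset.sum_add_distrib, ed_deg (C.ne _ _ e1), ed_deg (C.ne _ _ e2),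
      ed_deg (C.ne _ _ e3)]
    have := fun x : ZMod 2 => z2self x
    linear_combination z2self (if x = u then (1 : ZMod 2) else 0) + z2self (if x = a then (1 : ZMod 2) else 0)
      + z2self (if x = b then (1 : ZMod 2) else 0)
  · have s1 := C.symm _ _ e1
    have s2 := C.symm _ _ e2
    have s3 := C.symm _ _ e3
    have : ed u a x y ≠ 0 ∨ ed a b x y ≠ 0 ∨ ed b u x y ≠ 0 := by
      by_contra hc
      push Not at hc
      apply hne; simp [hc]
    rcases this with h | h | h <;> rcases ed_ne h with ⟨rfl, rfl⟩ | ⟨rfl, rfl⟩ <;>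
      exact ⟨by assumption, hr _ (by tauto)⟩

open Classical in
theorem chain (C : Hul p E D1 D2 D3) {u l : W} (hl : E u l) (hly : (p l).2 < (p u).2)
    (hlast : ∀ c, E u c → (p c).2 < (p u).2 → 0 ≤ ori (p u) (p c) (p l)) (a : W)
    (ha : E u a) (hay : (p a).2 < (p u).2) :
    ∃ z, Nice p E ({w | (p w).2 < (p u).2}.ncard + 1) z ∧ Bd p E D1 D2 D3 z ∧
      ∀ c, z u c = (if c = a then 1 else 0) + (if c = l then 1 else 0) := by
  by_contra hcon
  obtain ⟨a, ⟨ha, hay, hbad⟩, hm⟩ := ang_last p (p u) (Lp (p u) (p u + (-1, 0)) 1)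
    {a | E u a ∧ (p a).2 < (p u).2 ∧ ¬ ∃ z, Nice p E ({w | (p w).2 < (p u).2}.ncard + 1) z ∧
      Bd p E D1 D2 D3 z ∧ ∀ c, z u c = (if c = a then 1 else 0) + (if c = l then 1 else 0)}
    ⟨a, ha, hay, hcon⟩ (fun a ha => by
      have := ha.2.1
      unfold ori Lp; simp; linarith)
  clear hcon
  have hal : a ≠ l := by
    rintro rfl
    exact hbad ⟨0, Nice.zero, Bd.zero, fun c => by rw [z2self]; rfl⟩
  have hpos : 0 < ori (p u) (p a) (p l) :=
    lt_of_le_of_ne (hlast a ha hay) (C.g1 u a l (C.ne _ _ ha) hal (C.ne _ _ hl)).symm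
  obtain ⟨b, hb⟩ := C.third ha hpos
  have hub := C.symm _ _ hb.2.2.1
  have hab := hb.2.2.2.1
  have hby : (p b).2 < (p u).2 := by
    by_cases hbl : b = l
    · rw [hbl]; exact hly
    have h1 := FP.wedge C hb hl
    have h2 : 0 < ori (p u) (p b) (p l) := by
      refine lt_of_le_of_ne ?_ (C.g1 u b l (C.ne _ _ hub) hbl (C.ne _ _ hl)).symm
      by_contra hc
      refine h1 ⟨hpos, ?_⟩
      rw [ori_sw]; linarith
    have id : ori (p u) (p a) (p l) * ((p b).2 - (p u).2) =
      ori (p u) (p a) (p b) * ((p l).2 - (p u).2) + ori (p u) (p b) (p l) * ((p a).2 - (p u).2) := by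
      unfold ori; ring
    nlinarith
  have hgood : ∃ z, Nice p E ({w | (p w).2 < (p u).2}.ncard + 1) z ∧
      Bd p E D1 D2 D3 z ∧ ∀ c, z u c = (if c = b then 1 else 0) + (if c = l then 1 else 0) := by
    by_contra hc
    have := hm b ⟨hub, hby, hc⟩
    rw [ori_sw2] at this
    linarith
  obtain ⟨z, z1, z2, z3⟩ := hgood
  refine hbad ⟨z + (ed u a + ed a b + ed b u), z1.add (Nice.tri C (Or.inl hb) ?_),
    z2.add (Bd.tri C (Or.inl hb)), fun c => ?_⟩
  · rintro w (rfl | rfl | rfl)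
    · exact Nat.lt_succ_self _
    · exact (rk_lt hay).trans (Nat.lt_succ_self _)
    · exact (rk_lt hby).trans (Nat.lt_succ_self _)
  · have n1 := C.ne _ _ ha
    have n3 := C.ne _ _ hub
    simp only [Pi.add_apply, z3, ed]
    have e1 : ((True ∧ c = a) ∨ (u = a ∧ c = u)) ↔ c = a := by tauto
    have e2 : ((u = a ∧ c = b) ∨ (u = b ∧ c = a)) ↔ False := by tauto
    have e3 : ((u = b ∧ c = u) ∨ (True ∧ c = b)) ↔ c = b := by tauto
    rw [if_congr e1 rfl rfl, if_congr e2 rfl rfl, if_congr e3 rfl rfl, if_neg not_false]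
    linear_combination z2self (if c = b then (1 : ZMod 2) else 0)

open Classical in
theorem h1 (C : Hul p E D1 D2 D3) (n : ℕ) : ∀ z, Nice p E n z → Bd p E D1 D2 D3 z := by
  induction n with
  | zero =>
    intro z hz
    have : z = 0 := by
      ext a b
      by_contra hne
      exact absurd (hz.2.2 a b hne).2 (Nat.not_lt_zero _)
    rw [this]; exact Bd.zero
  | succ n ih =>
    intro z hz
    by_cases hu : ∃ u c, z u c ≠ 0 ∧ {w | (p w).2 < (p u).2}.ncard = n
    swap
    · push Not at hu
      refine ih z ⟨hz.1, hz.2.1, fun a b hab => ⟨(hz.2.2 a b hab).1, ?_⟩⟩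
      have := (hz.2.2 a b hab).2
      have := hu a b hab
      omega
    obtain ⟨u, c0, hc0, hun⟩ := hu
    have hlow : ∀ c, z u c ≠ 0 → E u c ∧ (p c).2 < (p u).2 := by
      intro c hc
      have h := hz.2.2 u c hc
      refine ⟨h.1, ?_⟩
      rw [hz.1] at hc
      have h' := (hz.2.2 c u hc).2
      by_contra hlt
      rcases (not_lt.1 hlt).lt_or_eq with h3 | h3
      · have := rk_lt h3; omega
      · exact C.ne _ _ h.1 (C.yinj _ _ h3)
    obtain ⟨l, ⟨hl, hly⟩, hlast⟩ := ang_last p (p u) (Lp (p u) (p u + (-1, 0)) 1)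
      {a | E u a ∧ (p a).2 < (p u).2} ⟨c0, hlow c0 hc0⟩ (fun a ha => by
        have := ha.2
        unfold ori Lp; simp; linarith)
    have hch : ∀ a, ∃ za, z u a ≠ 0 → (Nice p E (n + 1) za ∧ Bd p E D1 D2 D3 za ∧
        ∀ c, za u c = (if c = a then 1 else 0) + (if c = l then 1 else 0)) := by
      intro a
      by_cases h : z u a ≠ 0
      · have := C.chain hl hly (fun c h1 h2 => hlast c ⟨h1, h2⟩) a (hlow a h).1 (hlow a h).2
        rw [hun] at this
        obtain ⟨za, h⟩ := this
        exact ⟨za, fun _ => h⟩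
      · exact ⟨0, fun h' => (h h').elim⟩
    choose za hza using hch
    set S := Finset.univ.filter (fun a => z u a ≠ 0) with hS
    have hSm : ∀ a ∈ S, z u a ≠ 0 := fun a ha => (Finset.mem_filter.1 ha).2
    have hsum : Nice p E (n + 1) (∑ a ∈ S, za a) ∧ Bd p E D1 D2 D3 (∑ a ∈ S, za a) :=
      Finset.sum_induction za (fun x => Nice p E (n + 1) x ∧ Bd p E D1 D2 D3 x)
        (fun x y hx hy => ⟨hx.1.add hy.1, hx.2.add hy.2⟩) ⟨Nice.zero, Bd.zero⟩
        (fun a ha => ⟨(hza a (hSm a ha)).1, (hza a (hSm a ha)).2.1⟩)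
    have hz' := hz.add hsum.1
    have hval : ∀ c, (∑ a ∈ S, za a) u c = z u c := by
      intro c
      have e1 : (∑ a ∈ S, za a) u c = ∑ a ∈ S, ((if c = a then 1 else 0) + (if c = l then 1 else 0)) := by
        rw [Finset.sum_apply, Finset.sum_apply]
        exact Finset.sum_congr rfl fun a ha => (hza a (hSm a ha)).2.2 c
      have hz1 : ∀ a, z u a = if z u a ≠ 0 then 1 else 0 := by
        intro a; rcases z2cases (z u a) with h | h <;> simp [h]
      have e2 : (∑ a ∈ S, (1 : ZMod 2)) = 0 := by
        rw [← hz.2.1 u, hS, Finset.sum_filter]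
        exact Finset.sum_congr rfl fun a _ => (hz1 a).symm
      rw [e1, Finset.sum_add_distrib, Finset.sum_ite_eq]
      have e3 : ∑ a ∈ S, (if c = l then (1 : ZMod 2) else 0) = 0 := by
        split_ifs
        · exact e2
        · simp
      rw [e3, add_zero, hz1 c]
      simp [hS]
    have hfin : Bd p E D1 D2 D3 (z + ∑ a ∈ S, za a) := by
      refine ih _ ⟨hz'.1, hz'.2.1, fun a b hab => ⟨(hz'.2.2 a b hab).1, ?_⟩⟩
      have h1 := (hz'.2.2 a b hab).2
      have h2 : a ≠ u := by
        rintro rfl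
        apply hab
        simp only [Pi.add_apply]
        rw [hval]; exact z2self _
      have h3 : (p a).2 ≠ (p u).2 := fun h => h2 (C.yinj _ _ h)
      rcases lt_or_gt_of_ne h3 with h | h
      · have := rk_lt h; omega
      · have := rk_lt h; omega
    have := hfin.add hsum.2
    rwa [add_assoc, show (∑ a ∈ S, za a) + ∑ a ∈ S, za a = 0 by ext x y; exact z2self _,
      add_zero] at this

/-- the triangulation of a maximal plane graph -/
def tri (C : Hul p E D1 D2 D3) : Tri W where
  F := F p E D1 D2 D3
  cyc h := h.rot
  ne h := C.ne _ _ (F.edge C h)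
  uniq h h' := F.uniq C h h'
  rev h := C.tot (C.symm _ _ (F.edge C h))
  link u A v hv hc hA w hw := C.link u A v hv (F.edge C hc.choose_spec) hA w
    (F.edge C hw.choose_spec)
  conn A hne hA := C.conn A hne fun a b ha hab => by
    obtain ⟨c, hc⟩ := C.tot hab
    exact hA a b c ha hc
  h1 z hs hsup hev := by
    obtain ⟨f, f1, f2⟩ := C.h1 (Fintype.card W + 1) z ⟨hs, hev, fun a b hab => by
      obtain ⟨c, hc⟩ := hsup a b hab
      exact ⟨F.edge C hc, Nat.lt_succ_of_le ((Set.ncard_le_card _).trans_eq Nat.card_eq_fintype_card)⟩⟩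
    exact ⟨f, f1, fun a b ⟨c, hc⟩ => f2 a b (F.edge C hc)⟩

theorem tri_E (C : Hul p E D1 D2 D3) {a b : W} : C.tri.E a b ↔ E a b :=
  ⟨fun ⟨_, h⟩ => F.edge C h, fun h => C.tot h⟩

theorem arc (C : Hul p E D1 D2 D3) {x a b : W} {B : W → Prop} (ha : E x a) (hb : E x b)
    (hab : 0 < ori (p x) (p a) (p b))
    (hB : ∀ c, B c → ¬ (0 < ori (p x) (p a) (p c) ∧ 0 < ori (p x) (p c) (p b))) :
    C.tri.Arc x B b a := by
  by_contra hcon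
  obtain ⟨c, ⟨hc, hca, hcb, hbad⟩, hm⟩ := ang_last p (p x) (Lp (p x) (p b) (-1))
    {c | E x c ∧ (c = a ∨ 0 < ori (p x) (p a) (p c)) ∧ 0 < ori (p x) (p c) (p b) ∧
      ¬ C.tri.Arc x B b c} ⟨a, ha, Or.inl rfl, hab, hcon⟩ (fun c hc => by
        have e : ori (p x) (Lp (p x) (p b) (-1)) (p c) = ori (p x) (p c) (p b) := by
          unfold ori Lp; ring
        rw [e]; exact hc.2.2.1)
  obtain ⟨d, hd⟩ := C.third hc hcb
  have hxd := C.symm _ _ hd.2.2.1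
  by_cases hdb : d = b
  · subst hdb; exact hbad (Tri.Arc.one c (Or.inl hd))
  have h1 : 0 < ori (p x) (p d) (p b) := by
    refine lt_of_le_of_ne ?_ (C.g1 x d b (C.ne _ _ hxd) hdb (C.ne _ _ hb)).symm
    by_contra hcc
    exact FP.wedge C hd hb ⟨hcb, by rw [ori_sw]; linarith⟩
  have h2 : 0 < ori (p x) (p a) (p d) := by
    rcases hca with rfl | hca
    · exact hd.2.2.2.1
    · have := ori_gp (p x) (p a) (p c) (p d) (p b)
      have i1 := mul_pos hca h1
      have i2 := mul_pos hab hd.2.2.2.1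
      by_contra h
      nlinarith
  refine hbad (Tri.Arc.step c d (Or.inl hd) (fun hBd => hB d hBd ⟨h2, h1⟩) ?_)
  by_contra hcc
  have := hm d ⟨hxd, Or.inr h2, h1, hcc⟩
  rw [ori_sw2] at this
  linarith [hd.2.2.2.1]

end Hul

theorem exists_cfg {W : Type} [Finite W] (p : W → ℝ × ℝ) (H : W → W → Prop)
    (inj : ∀ a b, p a = p b → a = b)
    (g1 : ∀ a b c, a ≠ b → b ≠ c → a ≠ c → ori (p a) (p b) (p c) ≠ 0)
    (symm : ∀ a b, H a b → H b a) (ne : ∀ a b, H a b → a ≠ b)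
    (nc : ∀ a b c d x, H a b → H c d → Sg (p a) (p b) x → Sg (p c) (p d) x → SameE a b c d) :
    ∃ E, (∀ a b, H a b → E a b) ∧ Cfg p E := by
  obtain ⟨E, hE, hm⟩ := Finite.exists_le_maximal
    (p := fun E : W → W → Prop => (∀ a b, E a b → E b a) ∧ (∀ a b, E a b → a ≠ b) ∧
      ∀ a b c d x, E a b → E c d → Sg (p a) (p b) x → Sg (p c) (p d) x → SameE a b c d)
    (a := H) ⟨symm, ne, nc⟩
  obtain ⟨e1, e2, e3⟩ := hm.prop
  refine ⟨E, hE, inj, g1, e1, e2, e3, fun a b hab hn => ?_⟩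
  by_contra hc
  push Not at hc
  have sw : ∀ u v, SameE u v a b → ∀ x, Sg (p u) (p v) x → Sg (p a) (p b) x := by
    rintro u v (⟨rfl, rfl⟩ | ⟨rfl, rfl⟩) x h
    exacts [h, h.symm]
  refine hn (hm.le_of_ge (y := fun u v => E u v ∨ SameE u v a b) ⟨?_, ?_, ?_⟩
    (fun u v h => Or.inl h) a b (Or.inr (Or.inl ⟨rfl, rfl⟩)))
  · rintro u v (h | ⟨rfl, rfl⟩ | ⟨rfl, rfl⟩)
    exacts [Or.inl (e1 _ _ h), Or.inr (Or.inr ⟨rfl, rfl⟩), Or.inr (Or.inl ⟨rfl, rfl⟩)]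
  · rintro u v (h | ⟨rfl, rfl⟩ | ⟨rfl, rfl⟩)
    exacts [e2 _ _ h, hab, hab.symm]
  · rintro u v u' v' x (h | h) (h' | h') hx hx'
    · exact e3 _ _ _ _ x h h' hx hx'
    · exact (hc u v x h (sw _ _ h' x hx') hx).elim
    · exact (hc u' v' x h' (sw _ _ h x hx) hx').elim
    · rcases h with ⟨rfl, rfl⟩ | ⟨rfl, rfl⟩ <;> rcases h' with ⟨rfl, rfl⟩ | ⟨rfl, rfl⟩ <;>
        simp [SameE]

open Filter Topology in
theorem ev_quad (c0 c1 c2 : ℝ) (h : c1 ≠ 0 ∨ c2 ≠ 0) :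
    ∀ᶠ e in 𝓝[>] (0 : ℝ), c0 + c1 * e + c2 * e ^ 2 ≠ 0 := by
  have hp : ∀ᶠ e in 𝓝[>] (0 : ℝ), 0 < e := eventually_mem_nhdsWithin
  by_cases h0 : c0 = 0
  · by_cases h1 : c1 = 0
    · filter_upwards [hp] with e he
      rw [h0, h1]
      have := h.resolve_left (by simp [h1])
      simp [this, he.ne']
    · have : ∀ᶠ e in 𝓝 (0 : ℝ), c1 + c2 * e ≠ 0 :=
        ContinuousAt.eventually_ne (by fun_prop) (by simpa using h1)
      filter_upwards [hp, this.filter_mono nhdsWithin_le_nhds] with e he h2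
      rw [show c0 + c1 * e + c2 * e ^ 2 = e * (c1 + c2 * e) by rw [h0]; ring]
      exact mul_ne_zero he.ne' h2
  · have : ∀ᶠ e in 𝓝 (0 : ℝ), c0 + c1 * e + c2 * e ^ 2 ≠ 0 :=
      ContinuousAt.eventually_ne (by fun_prop) (by simpa using h0)
    exact this.filter_mono nhdsWithin_le_nhds

open Filter Topology in
/-- perturbation into general position -/
theorem perturb {W : Type} [Finite W] (pos : W → ℝ × ℝ) (H : W → W → Prop)
    (TT : W → W → W → Prop) (hT : ∀ a b c, TT a b c → 0 < ori (pos a) (pos b) (pos c))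
    (hd : ∀ a b c d, H a b → H c d → a ≠ c → a ≠ d → b ≠ c → b ≠ d → ∀ s t, 0 ≤ s → s ≤ 1 →
      0 ≤ t → t ≤ 1 → Lp (pos a) (pos b) s ≠ Lp (pos c) (pos d) t)
    (ne : ∀ a b, H a b → a ≠ b) :
    ∃ p : W → ℝ × ℝ, (∀ a b, (p a).2 = (p b).2 → a = b) ∧
      (∀ a b c, a ≠ b → b ≠ c → a ≠ c → ori (p a) (p b) (p c) ≠ 0) ∧
      (∀ a b c, TT a b c → 0 < ori (p a) (p b) (p c)) ∧
      (∀ a b c d x, H a b → H c d → Sg (p a) (p b) x → Sg (p c) (p d) x → SameE a b c d) := by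
  obtain ⟨n, ⟨eq⟩⟩ := Finite.exists_equiv_fin W
  obtain ⟨τ, hτ, hτ0⟩ : ∃ τ : W → ℝ, (∀ a b, a ≠ b → τ a - τ b ≠ 0) ∧ ∀ a, 0 ≤ τ a := by
    refine ⟨fun w => ((eq w : ℕ) : ℝ), fun a b h h' => h ?_, fun a => by positivity⟩
    have : ((eq a : ℕ) : ℝ) = (eq b : ℕ) := by linarith
    exact eq.injective (Fin.ext (by exact_mod_cast this))
  let P : ℝ → W → ℝ × ℝ := fun e w => ((pos w).1 + e * τ w, (pos w).2 + e * τ w ^ 2)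
  have P0 : ∀ w, P 0 w = pos w := fun w => by simp [P]
  have E1 : ∀ᶠ e in 𝓝[>] (0 : ℝ), ∀ a b, a ≠ b → (P e a).2 ≠ (P e b).2 := by
    rw [eventually_all]; intro a; rw [eventually_all]; intro b
    by_cases hab : a = b
    · simp [hab]
    have h2 : τ a ^ 2 - τ b ^ 2 ≠ 0 := by
      rw [sq_sub_sq]; refine mul_ne_zero (fun h => hτ a b hab ?_) (hτ a b hab)
      have := hτ0 a; have := hτ0 b; linarith
    filter_upwards [ev_quad ((pos a).2 - (pos b).2) _ 0 (Or.inl h2)] with e he _ h3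
    apply he; simp only [P] at h3; linarith
  have E2 : ∀ᶠ e in 𝓝[>] (0 : ℝ), ∀ a b c, a ≠ b → b ≠ c → a ≠ c →
      ori (P e a) (P e b) (P e c) ≠ 0 := by
    rw [eventually_all]; intro a; rw [eventually_all]; intro b; rw [eventually_all]; intro c
    by_cases h : a ≠ b ∧ b ≠ c ∧ a ≠ c
    · have h2 : (τ a - τ b) * (τ b - τ c) * (τ c - τ a) ≠ 0 :=
        mul_ne_zero (mul_ne_zero (hτ _ _ h.1) (hτ _ _ h.2.1)) (hτ _ _ h.2.2.symm)
      filter_upwards [ev_quad (ori (pos a) (pos b) (pos c))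
        (((pos b).1 - (pos a).1) * (τ c ^ 2 - τ a ^ 2) + (τ b - τ a) * ((pos c).2 - (pos a).2) -
          ((pos b).2 - (pos a).2) * (τ c - τ a) - (τ b ^ 2 - τ a ^ 2) * ((pos c).1 - (pos a).1))
        _ (Or.inr h2)] with e he _ _ _ h3
      apply he; rw [← h3]; simp only [P, ori]; ring
    · exact Eventually.of_forall fun e h1 h2 h3 => absurd ⟨h1, h2, h3⟩ h
  have E3 : ∀ᶠ e in 𝓝[>] (0 : ℝ), ∀ a b c, TT a b c → 0 < ori (P e a) (P e b) (P e c) := by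
    rw [eventually_all]; intro a; rw [eventually_all]; intro b; rw [eventually_all]; intro c
    by_cases h : TT a b c
    · have : ∀ᶠ e in 𝓝 (0 : ℝ), 0 < ori (P e a) (P e b) (P e c) := by
        refine ContinuousAt.eventually_lt continuousAt_const ?_ (by simpa only [P0] using hT _ _ _ h)
        simp only [P, ori]; fun_prop
      filter_upwards [this.filter_mono nhdsWithin_le_nhds] with e he _ using he
    · exact Eventually.of_forall fun e h1 => absurd h1 h
  have E4 : ∀ᶠ e in 𝓝[>] (0 : ℝ), ∀ a b c d, H a b → H c d → a ≠ c → a ≠ d → b ≠ c → b ≠ d →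
      ∀ z ∈ Set.Icc (0 : ℝ) 1 ×ˢ Set.Icc (0 : ℝ) 1,
        Lp (P e a) (P e b) z.1 ≠ Lp (P e c) (P e d) z.2 := by
    rw [eventually_all]; intro a; rw [eventually_all]; intro b; rw [eventually_all]; intro c
    rw [eventually_all]; intro d
    by_cases h : H a b ∧ H c d ∧ a ≠ c ∧ a ≠ d ∧ b ≠ c ∧ b ≠ d
    · have : ∀ᶠ e in 𝓝 (0 : ℝ), ∀ z ∈ Set.Icc (0 : ℝ) 1 ×ˢ Set.Icc (0 : ℝ) 1,
          Lp (P e a) (P e b) z.1 ≠ Lp (P e c) (P e d) z.2 := by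
        refine IsCompact.eventually_forall_of_forall_eventually (isCompact_Icc.prod isCompact_Icc) ?_
        rintro ⟨s, t⟩ ⟨⟨s0, s1⟩, t0, t1⟩
        obtain ⟨h1, h2, h3, h4, h5, h6⟩ := h
        have := hd a b c d h1 h2 h3 h4 h5 h6 s t s0 s1 t0 t1
        have hf : ContinuousAt (fun z : ℝ × ℝ × ℝ => Lp (P z.1 a) (P z.1 b) z.2.1) (0, s, t) := by
          simp only [P, Lp]; fun_prop
        have hg : ContinuousAt (fun z : ℝ × ℝ × ℝ => Lp (P z.1 c) (P z.1 d) z.2.2) (0, s, t) := by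
          simp only [P, Lp]; fun_prop
        have := (hf.sub hg).eventually_ne (y := 0) (by
          simp only [Pi.sub_apply, P0]; exact sub_ne_zero.2 this)
        exact this.mono fun z hz => sub_ne_zero.1 hz
      filter_upwards [this.filter_mono nhdsWithin_le_nhds] with e he _ _ _ _ _ _ using he
    · exact Eventually.of_forall fun e h1 h2 h3 h4 h5 h6 => absurd ⟨h1, h2, h3, h4, h5, h6⟩ h
  obtain ⟨e, h1, h2, h3, h4⟩ := (E1.and (E2.and (E3.and E4))).exists
  refine ⟨P e, fun a b h => by_contra fun hc => h1 a b hc h, h2, h3, ?_⟩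
  have st : ∀ u q t x, u ≠ q → u ≠ t → Sg (P e u) (P e q) x → Sg (P e u) (P e t) x → q = t := by
    intro u q t x hq ht g1 g2
    by_contra hc
    exact star1 (h2 u t q ht (Ne.symm hc) hq) g1 g2
  intro a b c d x ha hc hx hx'
  have na := ne _ _ ha
  have nc := ne _ _ hc
  by_cases k1 : a = c
  · subst k1; exact Or.inl ⟨rfl, st _ _ _ x na nc hx hx'⟩
  by_cases k2 : a = d
  · subst k2; exact Or.inr ⟨rfl, st _ _ _ x na nc.symm hx hx'.symm⟩
  by_cases k3 : b = c
  · subst k3; exact Or.inr ⟨st _ _ _ x na.symm nc hx.symm hx', rfl⟩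
  by_cases k4 : b = d
  · subst k4; exact Or.inl ⟨st _ _ _ x na.symm nc.symm hx.symm hx'.symm, rfl⟩
  obtain ⟨s, s0, s1, rfl⟩ := hx.toL
  obtain ⟨t, t0, t1, ht⟩ := hx'.toL
  exact (h4 a b c d ha hc k1 k2 k3 k4 (s, t) ⟨⟨s0.le, s1.le⟩, t0.le, t1.le⟩ ht).elim

/-- crossing pairs of edges -/
def Cr {V : Type*} (A : V → V → Prop) (ρ : V → ℝ × ℝ) (a b c d : V) : Prop :=
  A a b ∧ A c d ∧ a ≠ c ∧ a ≠ d ∧ b ≠ c ∧ b ≠ d ∧ ∃ x, Sg (ρ a) (ρ b) x ∧ Sg (ρ c) (ρ d) x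

structure IC {V : Type*} (A : V → V → Prop) (ρ : V → ℝ × ℝ) : Prop where
  symm : ∀ a b, A a b → A b a
  ne : ∀ a b, A a b → a ≠ b
  inj : ∀ a b, ρ a = ρ b → a = b
  on : ∀ a b c, A a b → ¬ Sg (ρ a) (ρ b) (ρ c)
  i3 : ∀ a b c d c' d', Cr A ρ a b c d → Cr A ρ a b c' d' → s(c, d) = s(c', d')
  i4 : ∀ a b c d a' b' c' d', Cr A ρ a b c d → Cr A ρ a' b' c' d' → s(a, b) ≠ s(a', b') →
    a ≠ a' ∧ a ≠ b' ∧ b ≠ a' ∧ b ≠ b'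

/-- collinear crossing segments contain an endpoint -/
theorem coll {a b c d x : ℝ × ℝ} (hab : a ≠ b) (hac : a ≠ c) (had : a ≠ d) (hbc : b ≠ c)
    (hbd : b ≠ d) (h1 : Sg a b x) (h2 : Sg c d x) (h0 : ori a b c = 0)
    (k1 : ¬ Sg a b c) (k2 : ¬ Sg a b d) (k3 : ¬ Sg c d a) : False := by
  have par : ∀ z, ori a b z = 0 → ∃ r, z = Lp a b r := by
    intro z hz
    unfold ori at hz
    by_cases hx : b.1 - a.1 = 0
    · have hy : b.2 - a.2 ≠ 0 := fun hy => hab (Prod.ext (by linarith) (by linarith))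
      have : z.1 - a.1 = 0 := by
        rw [hx] at hz
        exact (mul_eq_zero.1 (by linarith : (b.2 - a.2) * (z.1 - a.1) = 0)).resolve_left hy
      exact ⟨(z.2 - a.2) / (b.2 - a.2), Prod.ext (by simp [Lp, hx]; linarith)
        (by simp [Lp]; field_simp; ring)⟩
    · exact ⟨(z.1 - a.1) / (b.1 - a.1), Prod.ext (by simp [Lp]; field_simp; ring)
        (by simp only [Lp]; field_simp; linarith)⟩
  obtain ⟨s, s0, s1, rfl⟩ := h1.toL
  obtain ⟨t, t0, t1, e⟩ := h2.toL
  have hd : ori a b d = 0 := by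
    have := h1.ori0
    rw [e, ori_L, h0] at this
    exact (mul_eq_zero.1 (by linarith : t * ori a b d = 0)).resolve_left t0.ne'
  obtain ⟨γ, rfl⟩ := par c h0
  obtain ⟨δ, rfl⟩ := par d hd
  have e' : s = γ + t * (δ - γ) := by
    have h1 := congrArg Prod.fst e
    have h2 := congrArg Prod.snd e
    simp only [Lp] at h1 h2
    by_contra hc
    refine hab (Prod.ext ?_ ?_)
    · have := (mul_eq_zero.1 (by linarith : (s - (γ + t * (δ - γ))) * (b.1 - a.1) = 0)).resolve_left
        (sub_ne_zero.2 hc)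
      linarith
    · have := (mul_eq_zero.1 (by linarith : (s - (γ + t * (δ - γ))) * (b.2 - a.2) = 0)).resolve_left
        (sub_ne_zero.2 hc)
      linarith
  have out : ∀ r, a ≠ Lp a b r → b ≠ Lp a b r → ¬ Sg a b (Lp a b r) → r < 0 ∨ 1 < r := by
    intro r h1 h2 h3
    by_contra hc
    push Not at hc
    rcases hc.1.lt_or_eq with h | h
    · rcases hc.2.lt_or_eq with h' | h'
      · exact h3 (sgL h h')
      · rw [h', Lp_one] at h2; exact h2 rfl
    · rw [← h, Lp_zero] at h1; exact h1 rfl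
  have fin : ∀ γ δ : ℝ, γ < 0 → 1 < δ → Sg (Lp a b γ) (Lp a b δ) a := by
    intro γ δ h1 h2
    refine ⟨-γ / (δ - γ), div_pos (by linarith) (by linarith), ?_, ?_, ?_⟩
    · rw [div_lt_one (by linarith)]; linarith
    all_goals
      have : δ - γ ≠ 0 := by linarith
      simp only [Lp]; field_simp; ring
  rcases out γ hac hbc k1 with h | h <;> rcases out δ had hbd k2 with h' | h'
  · nlinarith
  · exact k3 (fin _ _ h h')
  · exact k3 (fin _ _ h' h).symm
  · nlinarith

namespace IC
variable {V : Type*} {A : V → V → Prop} {ρ : V → ℝ × ℝ}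

theorem _root_.Cr.sw {a b c d : V} (h : Cr A ρ a b c d) : Cr A ρ c d a b := by
  obtain ⟨h1, h2, h3, h4, h5, h6, x, h7, h8⟩ := h
  exact ⟨h2, h1, h3.symm, h5.symm, h4.symm, h6.symm, x, h8, h7⟩

theorem flip (I : IC A ρ) {a b c d : V} (h : Cr A ρ a b c d) : Cr A ρ b a c d := by
  obtain ⟨h1, h2, h3, h4, h5, h6, x, h7, h8⟩ := h
  exact ⟨I.symm _ _ h1, h2, h5, h6, h3, h4, x, h7.symm, h8⟩

theorem star (I : IC A ρ) {a b c : V} {x : ℝ × ℝ} (h1 : A a b) (h2 : A a c)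
    (hx : Sg (ρ a) (ρ b) x) (hy : Sg (ρ a) (ρ c) x) : b = c := by
  have key : ∀ p q r : ℝ × ℝ, ∀ s t : ℝ, 0 < s → 0 < t → s < t → Lp p q s = Lp p r t →
      Sg p q r := by
    intro p q r s t s0 t0 h e
    have e1 := congrArg Prod.fst e
    have e2 := congrArg Prod.snd e
    simp only [Lp] at e1 e2
    refine ⟨s / t, by positivity, by rw [div_lt_one t0]; exact h, ?_, ?_⟩ <;> field_simp <;> linarith
  obtain ⟨s, s0, s1, rfl⟩ := hx.toL
  obtain ⟨t, t0, t1, e⟩ := hy.toL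
  rcases lt_trichotomy s t with h | h | h
  · exact (I.on _ _ _ h1 (key _ _ _ s t s0 t0 h e)).elim
  · subst h
    have e1 := congrArg Prod.fst e
    have e2 := congrArg Prod.snd e
    simp only [Lp] at e1 e2
    refine I.inj _ _ (Prod.ext ?_ ?_)
    · have := mul_left_cancel₀ s0.ne' (by linarith : s * (ρ b).1 = s * (ρ c).1); exact this
    · have := mul_left_cancel₀ s0.ne' (by linarith : s * (ρ b).2 = s * (ρ c).2); exact this
  · exact (I.on _ _ _ h2 (key _ _ _ t s t0 s0 h e.symm)).elim

theorem meet (I : IC A ρ) {a b c d : V} {x : ℝ × ℝ} (h1 : A a b) (h2 : A c d)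
    (hx : Sg (ρ a) (ρ b) x) (hy : Sg (ρ c) (ρ d) x) : s(a, b) = s(c, d) ∨ Cr A ρ a b c d := by
  rw [Sym2.eq_iff]
  by_cases k1 : a = c
  · subst k1; exact Or.inl (Or.inl ⟨rfl, I.star h1 h2 hx hy⟩)
  by_cases k2 : a = d
  · subst k2; exact Or.inl (Or.inr ⟨rfl, I.star h1 (I.symm _ _ h2) hx hy.symm⟩)
  by_cases k3 : b = c
  · subst k3; exact Or.inl (Or.inr ⟨I.star (I.symm _ _ h1) h2 hx.symm hy, rfl⟩)
  by_cases k4 : b = d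
  · subst k4; exact Or.inl (Or.inl ⟨I.star (I.symm _ _ h1) (I.symm _ _ h2) hx.symm hy.symm, rfl⟩)
  exact Or.inr ⟨h1, h2, k1, k2, k3, k4, x, hx, hy⟩

theorem col (I : IC A ρ) {a b c d : V} (h : Cr A ρ a b c d) : ori (ρ a) (ρ b) (ρ c) ≠ 0 := by
  obtain ⟨h1, h2, h3, h4, h5, h6, x, h7, h8⟩ := h
  exact fun h0 => coll (fun h => I.ne _ _ h1 (I.inj _ _ h)) (fun h => h3 (I.inj _ _ h))
    (fun h => h4 (I.inj _ _ h)) (fun h => h5 (I.inj _ _ h)) (fun h => h6 (I.inj _ _ h)) h7 h8 h0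
    (I.on _ _ _ h1) (I.on _ _ _ h1) (I.on _ _ _ h2)

/-- cyclically ordered crossing quadruples -/
def Pre (A : V → V → Prop) (ρ : V → ℝ × ℝ) (q : Fin 4 → V) : Prop :=
  ∀ m, Cr A ρ (q m) (q (m + 2)) (q (m + 1)) (q (m + 3)) ∧
    0 < ori (ρ (q (m + 2))) (ρ (q m)) (ρ (q (m + 1)))

theorem pre0 (I : IC A ρ) {a b c d : V} (h : Cr A ρ a b c d) (hd : 0 < ori (ρ b) (ρ a) (ρ c)) :
    Pre A ρ ![a, c, b, d] := by
  have hf := I.flip h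
  have hs := h.sw
  have hfs := I.flip hs
  obtain ⟨h1, h2, h3, h4, h5, h6, x, h7, h8⟩ := id h
  have e1 := h7.ori0
  have e2 := h8.ori0
  obtain ⟨t, t0, t1, et⟩ := h8.toL
  obtain ⟨s, s0, s1, es⟩ := h7.toL
  rw [et, ori_L] at e1
  rw [es, ori_L] at e2
  have id1 : ori (ρ a) (ρ b) (ρ d) - ori (ρ a) (ρ b) (ρ c) =
    ori (ρ c) (ρ d) (ρ a) - ori (ρ c) (ρ d) (ρ b) := by unfold ori; ring
  rw [ori_sw] at hd
  have k1 : 0 < ori (ρ a) (ρ b) (ρ d) := by by_contra hc; nlinarith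
  have k2 : 0 < ori (ρ c) (ρ d) (ρ a) := by by_contra hc; nlinarith
  have k3 : ori (ρ c) (ρ d) (ρ b) < 0 := by by_contra hc; nlinarith
  intro m
  fin_cases m
  · exact ⟨h, by change 0 < ori (ρ b) (ρ a) (ρ c); rw [ori_sw]; exact hd⟩
  · exact ⟨(I.flip h).sw, by change 0 < ori (ρ d) (ρ c) (ρ b); rw [ori_sw]; linarith⟩
  · exact ⟨(I.flip hf.sw).sw, k1⟩
  · exact ⟨hfs, k2⟩

theorem pre_rot {q : Fin 4 → V} (h : Pre A ρ q) (k : Fin 4) : Pre A ρ (fun m => q (m + k)) := by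
  intro m
  have := h (m + k)
  simp only [add_right_comm m _ k] at this ⊢
  exact this

theorem exPre (I : IC A ρ) [LinearOrder V] {a b c d : V} (h : Cr A ρ a b c d) :
    ∃ q, Pre A ρ q ∧ (∀ m, q 0 ≤ q m) ∧ ∃ m, q m = a ∧ q (m + 2) = b := by
  obtain ⟨q, hq, m, h1, h2⟩ : ∃ q, Pre A ρ q ∧ ∃ m, q m = a ∧ q (m + 2) = b := by
    rcases lt_or_gt_of_ne (I.col (I.flip h)) with h' | h'
    · exact ⟨_, I.pre0 (I.flip h) (by rw [ori_sw]; linarith), 2, rfl, rfl⟩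
    · exact ⟨_, I.pre0 h h', 0, rfl, rfl⟩
  obtain ⟨k, hk⟩ := Finite.exists_min q
  refine ⟨_, pre_rot hq k, fun m => ?_, m - k, ?_, ?_⟩
  · simpa using hk _
  · simpa using h1
  · rw [← h2]; congr 1; abel

theorem pre_inj0 {q : Fin 4 → V} (I : IC A ρ) (hq : Pre A ρ q) {m m' : Fin 4} (h : q m = q m') :
    m = m' := by
  have h1 := (hq m).1
  obtain ⟨a1, a2, a3, a4, -⟩ := h1
  have a5 := I.ne _ _ a1
  rcases Kites.f4c m m' with rfl | rfl | rfl | rfl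
  exacts [rfl, (a3 h).elim, (a5 h).elim, (a4 h).elim]

theorem pre_neg {q : Fin 4 → V} (hq : Pre A ρ q) (m : Fin 4) :
    ori (ρ (q (m + 2))) (ρ (q m)) (ρ (q (m + 3))) < 0 := by
  have := (hq (m + 2)).2
  rw [show m + 2 + 2 = m by clear this; revert m; decide, show m + 2 + 1 = m + 3 from add_assoc _ _ _,
    ori_sw] at this
  linarith

theorem pre_inj (I : IC A ρ) [LinearOrder V] {q q' : Fin 4 → V} (hq : Pre A ρ q)
    (hq' : Pre A ρ q') (hm : ∀ m, q 0 ≤ q m) (hm' : ∀ m, q' 0 ≤ q' m) {m m' : Fin 4}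
    (h : q m = q' m') : q = q' ∧ m = m' := by
  have c1 := (hq m).1
  have c2 := (hq' m').1
  have h2 : q (m + 2) = q' (m' + 2) := by
    by_cases hs : s(q m, q (m + 2)) = s(q' m', q' (m' + 2))
    · rcases Sym2.eq_iff.1 hs with ⟨-, h⟩ | ⟨h1, h2⟩
      · exact h
      · exact (I.ne _ _ c2.1 (h ▸ h1)).elim
    · exact ((I.i4 _ _ _ _ _ _ _ _ c1 c2 hs).1 h).elim
  rw [← h, ← h2] at c2
  have hall : ∀ k, q (m + k) = q' (m' + k) := by
    rcases Sym2.eq_iff.1 (I.i3 _ _ _ _ _ _ c1 c2) with ⟨h3, h4⟩ | ⟨h3, h4⟩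
    · intro k
      fin_cases k
      exacts [by simpa using h, h3, h2, h4]
    · have n1 := pre_neg hq' m'
      have n2 := (hq m).2
      rw [← h, ← h2, ← h3] at n1
      linarith
  have h0 : q 0 = q' 0 := by
    apply le_antisymm
    · have := hall (-m'); rw [add_neg_cancel] at this; rw [← this]; exact hm _
    · have := hall (-m); rw [add_neg_cancel] at this; rw [this]; exact hm' _
  have h1 := hall (-m)
  rw [add_neg_cancel, h0] at h1
  have h1 := I.pre_inj0 hq' h1
  have hmm : m = m' := by
    have := congrArg (· + m) h1
    simpa using this
  subst hmm
  refine ⟨funext fun k => ?_, rfl⟩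
  have := hall (k - m)
  simpa using this

end IC

namespace IC
variable {n : ℕ} {A : Fin n → Fin n → Prop} {ρ : Fin n → ℝ × ℝ}

abbrev Ix (A : Fin n → Fin n → Prop) (ρ : Fin n → ℝ × ℝ) : Type :=
  {q : Fin 4 → Fin n // Pre A ρ q ∧ ∀ m, q 0 ≤ q m}
abbrev Wt (A : Fin n → Fin n → Prop) (ρ : Fin n → ℝ × ℝ) : Type := Fin n ⊕ Ix A ρ ⊕ Fin 3
noncomputable instance : Fintype (Ix A ρ) := Fintype.ofFinite _

def Kt (I : IC A ρ) : Kites (Wt A ρ) (Ix A ρ) where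
  X i := .inr (.inl i)
  κ i m := .inl (i.1 m)
  D1 := .inr (.inr 0)
  D2 := .inr (.inr 1)
  D3 := .inr (.inr 2)
  Xinj i j h := by simpa using h
  κinj i j m m' h := by
    have := I.pre_inj i.2.1 j.2.1 i.2.2 j.2.2 (Sum.inl.inj h)
    exact ⟨Subtype.ext this.1, this.2⟩
  Xκ i j m := by simp
  XD1 i := by simp
  XD2 i := by simp
  XD3 i := by simp
  κD1 i m := by simp
  κD2 i m := by simp
  κD3 i m := by simp

/-- uncrossed edges -/
def PP (A : Fin n → Fin n → Prop) (ρ : Fin n → ℝ × ℝ) (u v : Wt A ρ) : Prop :=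
  ∃ a b, u = .inl a ∧ v = .inl b ∧ A a b ∧ ∀ c d, ¬ Cr A ρ a b c d

def HH (I : IC A ρ) (u v : Wt A ρ) : Prop :=
  PP A ρ u v ∨ ∃ i m, (u = I.Kt.X i ∧ v = I.Kt.κ i m) ∨ (u = I.Kt.κ i m ∧ v = I.Kt.X i)

theorem xp (i : Ix A ρ) : ∃ x, ∀ m, Sg (ρ (i.1 m)) (ρ (i.1 (m + 2))) x := by
  obtain ⟨-, -, -, -, -, -, x, h1, h2⟩ := (i.2.1 0).1
  refine ⟨x, fun m => ?_⟩
  fin_cases m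
  exacts [h1, h2, h1.symm, h2.symm]

theorem carrier (I : IC A ρ) {pos : Wt A ρ → ℝ × ℝ} (hV : ∀ v, pos (.inl v) = ρ v)
    (hX : ∀ i m, Sg (ρ (i.1 m)) (ρ (i.1 (m + 2))) (pos (I.Kt.X i))) {u v : Wt A ρ}
    (h : I.HH u v) : ∃ a b, A a b ∧ (∀ s, 0 ≤ s → s ≤ 1 →
      Sg (ρ a) (ρ b) (Lp (pos u) (pos v) s) ∨
        ∃ c, (u = .inl c ∨ v = .inl c) ∧ Lp (pos u) (pos v) s = ρ c) ∧
      ((u = .inl a ∧ v = .inl b ∧ ∀ c d, ¬ Cr A ρ a b c d) ∨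
        ∃ i m, a = i.1 m ∧ b = i.1 (m + 2) ∧ (u = I.Kt.X i ∨ v = I.Kt.X i)) := by
  rcases h with ⟨a, b, rfl, rfl, hab, hc⟩ | ⟨i, m, h⟩
  · refine ⟨a, b, hab, fun s s0 s1 => ?_, Or.inl ⟨rfl, rfl, hc⟩⟩
    simp only [hV]
    rcases s0.lt_or_eq with h0 | rfl
    · rcases s1.lt_or_eq with h1 | rfl
      · exact Or.inl (sgL h0 h1)
      · exact Or.inr ⟨b, Or.inr rfl, Lp_one _ _⟩
    · exact Or.inr ⟨a, Or.inl rfl, Lp_zero _ _⟩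
  · have key : ∀ s, 0 ≤ s → s ≤ 1 →
        Sg (ρ (i.1 m)) (ρ (i.1 (m + 2))) (Lp (pos (I.Kt.X i)) (pos (I.Kt.κ i m)) s) ∨
          Lp (pos (I.Kt.X i)) (pos (I.Kt.κ i m)) s = ρ (i.1 m) := by
      intro s s0 s1
      rw [show pos (I.Kt.κ i m) = ρ (i.1 m) from hV _]
      rcases s1.lt_or_eq with h1 | rfl
      · obtain ⟨r, r0, r1, e⟩ := (hX i m).symm.toL
        rw [e, Lp_Lp]
        exact Or.inl (sgL (by nlinarith) (by nlinarith)).symm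
      · exact Or.inr (Lp_one _ _)
    refine ⟨_, _, (i.2.1 m).1.1, fun s s0 s1 => ?_, Or.inr ⟨i, m, rfl, rfl, ?_⟩⟩
    · rcases h with ⟨rfl, rfl⟩ | ⟨rfl, rfl⟩
      · exact (key s s0 s1).imp id fun h => ⟨_, Or.inr rfl, h⟩
      · rw [Lp_symm]
        exact (key (1 - s) (by linarith) (by linarith)).imp id fun h => ⟨_, Or.inl rfl, h⟩
    · exact h.imp And.left And.right

theorem disj (I : IC A ρ) {pos : Wt A ρ → ℝ × ℝ} (hV : ∀ v, pos (.inl v) = ρ v)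
    (hX : ∀ i m, Sg (ρ (i.1 m)) (ρ (i.1 (m + 2))) (pos (I.Kt.X i))) (a b c d : Wt A ρ)
    (h : I.HH a b) (h' : I.HH c d) (h1 : a ≠ c) (h2 : a ≠ d) (h3 : b ≠ c) (h4 : b ≠ d) (s t : ℝ)
    (s0 : 0 ≤ s) (s1 : s ≤ 1) (t0 : 0 ≤ t) (t1 : t ≤ 1) :
    Lp (pos a) (pos b) s ≠ Lp (pos c) (pos d) t := by
  intro e
  obtain ⟨u, v, k1, k2, k3⟩ := I.carrier hV hX h
  obtain ⟨u', v', k1', k2', k3'⟩ := I.carrier hV hX h'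
  have g := k2 s s0 s1
  have g' := k2' t t0 t1
  rw [← e] at g'
  have noX : ∀ i, (a = I.Kt.X i ∨ b = I.Kt.X i) → (c = I.Kt.X i ∨ d = I.Kt.X i) → False := by
    rintro i (rfl | rfl) (rfl | rfl) <;> contradiction
  rcases g with g | ⟨x, hx, ex⟩
  · rcases g' with g' | ⟨y, hy, ey⟩
    · have hm := I.meet k1 k1' g g'
      rcases k3 with ⟨rfl, rfl, hc⟩ | ⟨i, m, rfl, rfl, hi⟩
      · rcases hm with hm | hm
        · rcases k3' with ⟨rfl, rfl, hc'⟩ | ⟨j, m', rfl, rfl, hj⟩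
          · rcases Sym2.eq_iff.1 hm with ⟨rfl, rfl⟩ | ⟨rfl, rfl⟩ <;> contradiction
          · have hq := (j.2.1 m').1
            rcases Sym2.eq_iff.1 hm with ⟨rfl, rfl⟩ | ⟨rfl, rfl⟩
            · exact hc _ _ hq
            · exact hc _ _ (I.flip hq)
        · exact hc _ _ hm
      · have hq := (i.2.1 m).1
        rcases k3' with ⟨rfl, rfl, hc'⟩ | ⟨j, m', rfl, rfl, hj⟩
        · rcases hm with hm | hm
          · rcases Sym2.eq_iff.1 hm with ⟨rfl, rfl⟩ | ⟨rfl, rfl⟩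
            · exact hc' _ _ hq
            · exact hc' _ _ (I.flip hq)
          · exact hc' _ _ hm.sw
        · have hij : ∃ k k', i.1 k = j.1 k' := by
            rcases hm with hm | hm
            · rcases Sym2.eq_iff.1 hm with h | h
              exacts [⟨_, _, h.1⟩, ⟨_, _, h.1⟩]
            · rcases Sym2.eq_iff.1 (I.i3 _ _ _ _ _ _ hq hm) with h | h
              exacts [⟨_, _, h.1⟩, ⟨_, _, h.1⟩]
          obtain ⟨k, k', hk⟩ := hij
          have := (I.Kt.κinj i j k k' (congrArg Sum.inl hk)).1
          subst this
          exact noX i hi hj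
    · rw [ey] at g; exact I.on _ _ _ k1 g
  · rcases g' with g' | ⟨y, hy, ey⟩
    · rw [ex] at g'; exact I.on _ _ _ k1' g'
    · have := I.inj _ _ (ex.symm.trans ey)
      subst this
      rcases hx with rfl | rfl <;> rcases hy with rfl | rfl <;> contradiction

theorem to_nrm (I : IC A ρ) : ∃ T : Tri (Wt A ρ), I.Kt.Nrm T ∧ ∀ u v, PP A ρ u v → T.E u v := by
  choose x hx using xp (A := A) (ρ := ρ)
  obtain ⟨M, M1, hM⟩ : ∃ M : ℝ, 1 ≤ M ∧ ∀ w : Fin n ⊕ Ix A ρ,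
      |(Sum.elim ρ x w).1| ≤ M ∧ |(Sum.elim ρ x w).2| ≤ M := by
    obtain ⟨B, hB⟩ := (Set.finite_range fun w => ‖Sum.elim ρ x w‖).bddAbove
    refine ⟨max 1 B, le_max_left _ _, fun w => ?_⟩
    have := (hB ⟨w, rfl⟩).trans (le_max_right 1 B)
    exact ⟨(norm_fst_le _).trans this, (norm_snd_le _).trans this⟩
  let pos : Wt A ρ → ℝ × ℝ := Sum.elim ρ (Sum.elim x
    ![(-4 * M, -2 * M), (4 * M, -2 * M), (0, 4 * M)])
  have bd : ∀ w : Wt A ρ, (w = I.Kt.D1 ∨ w = I.Kt.D2 ∨ w = I.Kt.D3) ∨ ((-M ≤ (pos w).1 ∧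
      (pos w).1 ≤ M) ∧ -M ≤ (pos w).2 ∧ (pos w).2 ≤ M) := by
    rintro (v | i | k)
    · have := hM (.inl v); exact Or.inr ⟨abs_le.1 this.1, abs_le.1 this.2⟩
    · have := hM (.inr i); exact Or.inr ⟨abs_le.1 this.1, abs_le.1 this.2⟩
    · left; fin_cases k <;> simp [Kt]
  have p1 : pos I.Kt.D1 = (-4 * M, -2 * M) := rfl
  have p2 : pos I.Kt.D2 = (4 * M, -2 * M) := rfl
  have p3 : pos I.Kt.D3 = (0, 4 * M) := rfl
  obtain ⟨p, yinj, g1, hT, nc⟩ := perturb pos I.HH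
    (fun u v w => (u = I.Kt.D1 ∧ v = I.Kt.D2 ∧ w ≠ u ∧ w ≠ v) ∨
      (u = I.Kt.D2 ∧ v = I.Kt.D3 ∧ w ≠ u ∧ w ≠ v) ∨ (u = I.Kt.D3 ∧ v = I.Kt.D1 ∧ w ≠ u ∧ w ≠ v) ∨
      ∃ i m, u = I.Kt.X i ∧ v = I.Kt.κ i m ∧ w = I.Kt.κ i (m + 1))
    (by
      rintro u v w (⟨rfl, rfl, h1, h2⟩ | ⟨rfl, rfl, h1, h2⟩ | ⟨rfl, rfl, h1, h2⟩ |
        ⟨i, m, rfl, rfl, rfl⟩)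
      · rcases bd w with (rfl | rfl | rfl) | ⟨⟨h3, h4⟩, h5, h6⟩
        · exact (h1 rfl).elim
        · exact (h2 rfl).elim
        · rw [p1, p2, p3]; simp only [ori]; nlinarith
        · rw [p1, p2]; simp only [ori]; nlinarith
      · rcases bd w with (rfl | rfl | rfl) | ⟨⟨h3, h4⟩, h5, h6⟩
        · rw [p1, p2, p3]; simp only [ori]; nlinarith
        · exact (h1 rfl).elim
        · exact (h2 rfl).elim
        · rw [p2, p3]; simp only [ori]
          have : 0 < M * (16 * M - 4 * (pos w).2 - 6 * (pos w).1) := by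
            apply mul_pos <;> linarith
          linarith
      · rcases bd w with (rfl | rfl | rfl) | ⟨⟨h3, h4⟩, h5, h6⟩
        · exact (h2 rfl).elim
        · rw [p1, p2, p3]; simp only [ori]; nlinarith
        · exact (h1 rfl).elim
        · rw [p1, p3]; simp only [ori]
          have : 0 < M * (16 * M - 4 * (pos w).2 + 6 * (pos w).1) := by
            apply mul_pos <;> linarith
          linarith
      · obtain ⟨r, r0, r1, e⟩ := (hx i m).symm.toL
        have := (i.2.1 m).2
        change 0 < ori (x i) (ρ (i.1 m)) (ρ (i.1 (m + 1)))
        rw [e, ← ori_rot, ori_L, ori_01, ori_rot]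
        nlinarith)
    (I.disj (fun _ => rfl) (fun i m => hx i m))
    (by
      rintro u v (⟨a, b, rfl, rfl, h, -⟩ | ⟨i, m, ⟨rfl, rfl⟩ | ⟨rfl, rfl⟩⟩)
      · simpa using I.ne _ _ h
      · exact I.Kt.Xκ _ _ _
      · exact (I.Kt.Xκ _ _ _).symm)
  obtain ⟨E, hE, C⟩ := exists_cfg p I.HH (fun a b h => yinj a b (by rw [h])) g1
    (by
      rintro u v (⟨a, b, rfl, rfl, h, hc⟩ | ⟨i, m, h⟩)
      · exact Or.inl ⟨b, a, rfl, rfl, I.symm _ _ h, fun c d h => hc c d (I.flip h)⟩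
      · exact Or.inr ⟨i, m, h.symm.imp And.symm And.symm⟩)
    (by
      rintro u v (⟨a, b, rfl, rfl, h, -⟩ | ⟨i, m, ⟨rfl, rfl⟩ | ⟨rfl, rfl⟩⟩)
      · simpa using I.ne _ _ h
      · exact I.Kt.Xκ _ _ _
      · exact (I.Kt.Xκ _ _ _).symm) nc
  have C : Hul p E I.Kt.D1 I.Kt.D2 I.Kt.D3 :=
    { C with
      yinj := yinj
      n12 := by simp [Kt]
      n23 := by simp [Kt]
      n31 := by simp [Kt]
      h12 := fun x h h' => hT _ _ _ (Or.inl ⟨rfl, rfl, h, h'⟩)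
      h23 := fun x h h' => hT _ _ _ (Or.inr (Or.inl ⟨rfl, rfl, h, h'⟩))
      h31 := fun x h h' => hT _ _ _ (Or.inr (Or.inr (Or.inl ⟨rfl, rfl, h, h'⟩))) }
  have hw : ∀ i m, 0 < ori (p (I.Kt.X i)) (p (I.Kt.κ i m)) (p (I.Kt.κ i (m + 1))) :=
    fun i m => hT _ _ _ (Or.inr (Or.inr (Or.inr ⟨i, m, rfl, rfl, rfl⟩)))
  have inv : I.Kt.Inv (PP A ρ) C.tri ∅ :=
    { arc := fun i m => by
        refine C.arc (hE _ _ (Or.inr ⟨i, _, Or.inl ⟨rfl, rfl⟩⟩))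
          (hE _ _ (Or.inr ⟨i, _, Or.inl ⟨rfl, rfl⟩⟩)) (hw i m) ?_
        rintro c ⟨m', rfl⟩ ⟨h1, h2⟩
        rcases (by decide : ∀ m m' : Fin 4, m' = m ∨ m' = m + 1 ∨ m' = m + 1 + 1 ∨ m = m' + 1) m m'
          with rfl | rfl | rfl | rfl
        · rw [ori_11] at h1; exact lt_irrefl _ h1
        · rw [ori_11] at h2; exact lt_irrefl _ h2
        · have := hw i (m + 1); rw [ori_sw2] at h2; linarith
        · have := hw i m'; rw [ori_sw2] at h1; linarith
      need := fun u v h => C.tri_E.2 (hE _ _ (Or.inl h))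
      done := by simp
      outer := Or.inr (Or.inl ⟨rfl, rfl, rfl⟩) }
  obtain ⟨T, t1, t2, t3, t4⟩ := Kites.normalize (by
    rintro u v i ⟨a, b, rfl, rfl, -⟩; simp [Kt]) (by
    rintro i m ⟨a, b, h1, h2, -, h⟩
    have := (i.2.1 m).1
    rw [Sum.inl.inj h1, Sum.inl.inj h2] at this
    exact h _ _ this) inv
  exact ⟨T, ⟨t1, t2, t4⟩, t3⟩

theorem grid (I : IC A ρ) (hn : 3 ≤ n) : ∃ a b : Fin n → ℕ,
    (∀ v, a v ≤ 2 * n - 2 ∧ b v ≤ 2 * n - 3) ∧ IC A (fun v => ((a v : ℝ), (b v : ℝ))) := by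
  obtain ⟨T, N, hP⟩ := I.to_nrm
  obtain ⟨px, ps, hQ, hb⟩ := N.final
  have hS : ∀ v : Fin n, (Sum.inl v : Wt A ρ) ∈ I.Kt.SD {w | w ≠ I.Kt.D3} :=
    fun v => ⟨by simp [Kt], fun i => by simp [Kt]⟩
  have hcard : (I.Kt.SD {w | w ≠ I.Kt.D3}).ncard ≤ n + 2 := by
    have hsub : I.Kt.SD {w | w ≠ I.Kt.D3} ⊆
        Set.range (Sum.elim Sum.inl ![I.Kt.D1, I.Kt.D2] : Fin n ⊕ Fin 2 → Wt A ρ) := by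
      rintro (v | i | k) ⟨h1, h2⟩
      · exact ⟨.inl v, rfl⟩
      · exact (h2 i rfl).elim
      · fin_cases k
        · exact ⟨.inr 0, rfl⟩
        · exact ⟨.inr 1, rfl⟩
        · exact (h1 rfl).elim
    refine (Set.ncard_le_ncard hsub (Set.toFinite _)).trans ?_
    rw [← Set.image_univ]
    refine (Set.ncard_image_le (Set.toFinite _)).trans ?_
    simp [Set.ncard_univ]
  have hD : px I.Kt.D2 ≤ 2 * (n : ℤ) - 1 := by
    refine hb.trans ?_
    simp only [Kites.NN]
    omega
  have hbox : ∀ v : Fin n, 1 ≤ px (.inl v) ∧ px (.inl v) + 1 ≤ ps (.inl v) ∧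
      ps (.inl v) ≤ px I.Kt.D2 := fun v => by
    rcases hQ.box _ (hS v) with h | h | h
    · simp [Kt] at h
    · simp [Kt] at h
    · exact h
  have hAS : ∀ a b, A a b → I.Kt.AS T {w | w ≠ I.Kt.D3} (.inl a) (.inl b) := by
    intro a b hab
    refine ⟨(hS a).1, (hS b).1, ?_⟩
    by_cases hc : ∃ c d, Cr A ρ a b c d
    · obtain ⟨c, d, hc⟩ := hc
      obtain ⟨q, q1, q2, m, rfl, rfl⟩ := I.exPre hc
      exact Or.inr (Or.inl ⟨⟨q, q1, q2⟩, m, by simp [Kt], rfl, rfl⟩)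
    · push Not at hc
      exact Or.inl ⟨hP _ _ ⟨a, b, rfl, rfl, hab, hc⟩, (hS a).2, (hS b).2⟩
  refine ⟨fun v => (px (.inl v) - 1).toNat, fun v => (ps (.inl v) - px (.inl v) - 1).toNat,
    fun v => ?_, ?_⟩
  · have := hbox v; dsimp only; omega
  generalize hσ : (fun v => (((px (.inl v) - 1).toNat : ℝ),
    ((ps (.inl v) - px (.inl v) - 1).toNat : ℝ))) = σ
  have e1 : ∀ v, (σ v).1 = (px (.inl v) : ℝ) - 1 := fun v => by
    have h := hbox v
    have : (((px (.inl v) - 1).toNat : ℤ) : ℝ) = ((px (.inl v) - 1 : ℤ) : ℝ) := by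
      rw [Int.toNat_of_nonneg (by omega)]
    rw [← hσ]; push_cast at this ⊢; linarith
  have e2 : ∀ v, (σ v).2 = (ps (.inl v) : ℝ) - px (.inl v) - 1 := fun v => by
    have h := hbox v
    have : (((ps (.inl v) - px (.inl v) - 1).toNat : ℤ) : ℝ) =
        ((ps (.inl v) - px (.inl v) - 1 : ℤ) : ℝ) := by
      rw [Int.toNat_of_nonneg (by omega)]
    rw [← hσ]; push_cast at this ⊢; linarith
  have sg : ∀ u v y, Sg (σ u) (σ v) y → Sg (Rho px ps (.inl u)) (Rho px ps (.inl v))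
      (y.1 + 1, y.1 + y.2 + 2) := by
    rintro u v y ⟨t, t0, t1, h1, h2⟩
    rw [e1, e1] at h1
    rw [e2, e2] at h2
    refine ⟨t, t0, t1, ?_, ?_⟩ <;> simp only [Rho] <;> linarith
  have rs : ∀ v, Rho px ps (.inl v) = ((σ v).1 + 1, (σ v).1 + (σ v).2 + 2) := fun v => by
    rw [e1, e2]; simp only [Rho]; ext <;> simp only <;> ring
  have cr : ∀ a b c d, Cr A σ a b c d → Cr A ρ a b c d := by
    rintro a b c d ⟨h1, h2, h3, h4, h5, h6, x, h7, h8⟩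
    rcases hQ.good.ee _ _ _ _ (hAS _ _ h1) (hAS _ _ h2) _ (sg _ _ _ h7) (sg _ _ _ h8) with
      h | ⟨i, m, h, h'⟩
    · rcases h with ⟨h, -⟩ | ⟨h, -⟩
      exacts [(h3 (Sum.inl.inj h)).elim, (h4 (Sum.inl.inj h)).elim]
    · have hq := (i.2.1 m).1
      have hq' : Cr A ρ a b (i.1 (m + 1)) (i.1 (m + 3)) := by
        rcases h with ⟨h, h'⟩ | ⟨h, h'⟩ <;> rw [Sum.inl.inj h, Sum.inl.inj h']
        exacts [hq, I.flip hq]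
      rcases h' with ⟨h, h'⟩ | ⟨h, h'⟩ <;> rw [Sum.inl.inj h, Sum.inl.inj h']
      exacts [hq', (I.flip hq'.sw).sw]
  exact
    { symm := I.symm
      ne := I.ne
      inj := fun a b h => Sum.inl.inj (hQ.good.inj _ (hS a) _ (hS b) (by rw [rs, rs, h]))
      on := fun a b c h h' => hQ.good.ev _ _ (hAS _ _ h) _ (hS c) (by
        rw [rs c]; exact sg _ _ _ h')
      i3 := fun a b c d c' d' h h' => I.i3 _ _ _ _ _ _ (cr _ _ _ _ h) (cr _ _ _ _ h')
      i4 := fun a b c d a' b' c' d' h h' => I.i4 _ _ _ _ _ _ _ _ (cr _ _ _ _ h) (cr _ _ _ _ h') }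

end IC

theorem sg_iff {p q x : ℝ × ℝ} : x ∈ openSegment ℝ p q ↔ Sg p q x := by
  rw [openSegment_eq_image']
  constructor
  · rintro ⟨t, ⟨h0, h1⟩, rfl⟩
    exact ⟨t, h0, h1, by simp, by simp⟩
  · rintro ⟨t, h0, h1, h2, h3⟩
    exact ⟨t, ⟨h0, h1⟩, Prod.ext (by simp [h2]) (by simp [h3])⟩

theorem seg_mk {V : Type*} (ρ : V → ℝ × ℝ) (a b : V) (x : ℝ × ℝ) :
    x ∈ edgeSeg ρ s(a, b) ↔ Sg (ρ a) (ρ b) x := sg_iff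

theorem dis_mk {V : Type*} (a b c d : V) : (∀ v : V, v ∈ s(a, b) → v ∉ s(c, d)) ↔
    (a ≠ c ∧ a ≠ d ∧ b ≠ c ∧ b ≠ d) := by
  simp only [Sym2.mem_iff]
  constructor
  · intro h
    have h1 := h a (Or.inl rfl)
    have h2 := h b (Or.inr rfl)
    push Not at h1 h2
    exact ⟨h1.1, h1.2, h2.1, h2.2⟩
  · rintro ⟨h1, h2, h3, h4⟩ v (rfl | rfl) (h | h) <;> contradiction

theorem cr_mk {V : Type*} {G : SimpleGraph V} {ρ : V → ℝ × ℝ} {a b c d : V} (h : G.Adj a b)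
    (h' : G.Adj c d) : Crosses ρ s(a, b) s(c, d) ↔ Cr G.Adj ρ a b c d := by
  simp only [Crosses, Cr, dis_mk, Set.Nonempty, Set.mem_inter_iff, seg_mk, h, h', true_and,
    and_assoc]

theorem ic_iff {V : Type*} {G : SimpleGraph V} {ρ : V → ℝ × ℝ} :
    IsICPlanarDrawing G ρ ↔ IC G.Adj ρ := by
  constructor
  · rintro ⟨⟨h1, h2, -⟩, h4, h5⟩
    refine ⟨fun a b h => h.symm, fun a b h => h.ne, fun a b h => h1 h, ?_, ?_, ?_⟩
    · intro a b c h hs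
      have key : ∀ a b, G.Adj a b → ¬ Sg (ρ a) (ρ b) (ρ a) := by
        rintro a b h ⟨r, r0, r1, e1, e2⟩
        apply h.ne; apply h1
        ext <;> nlinarith
      by_cases k1 : c = a
      · subst k1; exact key _ _ h hs
      by_cases k2 : c = b
      · subst k2; exact key _ _ h.symm hs.symm
      exact h2 s(a, b) h c (by simp [k1, k2]) ((seg_mk _ _ _ _).2 hs)
    · intro a b c d c' d' h h'
      exact h4 s(a, b) h.1 s(c, d) h.2.1 s(c', d') h'.2.1 ((cr_mk h.1 h.2.1).2 h)
        ((cr_mk h'.1 h'.2.1).2 h')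
    · intro a b c d a' b' c' d' h h' hne
      exact (dis_mk _ _ _ _).1 (h5 s(a, b) h.1 s(a', b') h'.1
        ⟨s(c, d), h.2.1, (cr_mk h.1 h.2.1).2 h⟩ ⟨s(c', d'), h'.2.1, (cr_mk h'.1 h'.2.1).2 h'⟩ hne)
  · intro I
    refine ⟨⟨fun a b h => I.inj a b h, ?_, ?_⟩, ?_, ?_⟩
    · rintro ⟨a, b⟩ h v _ hs
      exact I.on _ _ _ h ((seg_mk _ _ _ _).1 hs)
    · intro e
      induction e using Sym2.inductionOn with | hf a b => ?_
      intro h f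
      induction f using Sym2.inductionOn with | hf c d => ?_
      rintro h' hd x ⟨hx, hx'⟩ y ⟨hy, hy'⟩
      rw [seg_mk] at hx hx' hy hy'
      obtain ⟨d1, d2, d3, d4⟩ := (dis_mk _ _ _ _).1 hd
      have hc := I.col (⟨h, h', d1, d2, d3, d4, x, hx, hx'⟩ : Cr G.Adj ρ a b c d)
      by_contra hxy
      have o1 := hx.ori0
      have o2 := hy.ori0
      obtain ⟨s, -, -, rfl⟩ := hx'.toL
      obtain ⟨t, -, -, rfl⟩ := hy'.toL
      rw [ori_L] at o1 o2
      have hst : s - t ≠ 0 := fun hst => hxy (by rw [sub_eq_zero.1 hst])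
      have : (s - t) * ori (ρ a) (ρ b) (ρ c) = 0 := by linear_combination s * o2 - t * o1
      exact (mul_ne_zero hst hc) this
    · rintro ⟨a, b⟩ h ⟨c, d⟩ h' ⟨c', d'⟩ h2 k1 k2
      exact I.i3 _ _ _ _ _ _ ((cr_mk h h').1 k1) ((cr_mk h h2).1 k2)
    · rintro ⟨a, b⟩ h ⟨c, d⟩ h' ⟨⟨a', b'⟩, k1, k2⟩ ⟨⟨c', d'⟩, k3, k4⟩ hne
      exact (dis_mk _ _ _ _).2 (I.i4 _ _ _ _ _ _ _ _ ((cr_mk h k1).1 k2) ((cr_mk h' k3).1 k4) hne)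

theorem IC.comap {V V' : Type*} {A : V → V → Prop} {ρ : V → ℝ × ℝ} (I : IC A ρ) (f : V' → V)
    (hf : Function.Injective f) : IC (fun a b => A (f a) (f b)) (fun a => ρ (f a)) := by
  have cr : ∀ a b c d, Cr (fun a b => A (f a) (f b)) (fun a => ρ (f a)) a b c d →
      Cr A ρ (f a) (f b) (f c) (f d) := by
    rintro a b c d ⟨h1, h2, h3, h4, h5, h6, x, h7, h8⟩
    exact ⟨h1, h2, hf.ne h3, hf.ne h4, hf.ne h5, hf.ne h6, x, h7, h8⟩
  have hs : ∀ a b c d, s(f a, f b) = s(f c, f d) ↔ s(a, b) = s(c, d) := by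
    intro a b c d
    simp only [Sym2.eq_iff, hf.eq_iff]
  refine ⟨fun a b h => I.symm _ _ h, fun a b h e => I.ne _ _ h (by rw [e]),
    fun a b h => hf (I.inj _ _ h), fun a b c h => I.on _ _ _ h, ?_, ?_⟩
  · intro a b c d c' d' h h'
    exact (hs _ _ _ _).1 (I.i3 _ _ _ _ _ _ (cr _ _ _ _ h) (cr _ _ _ _ h'))
  · intro a b c d a' b' c' d' h h' hne
    obtain ⟨k1, k2, k3, k4⟩ := I.i4 _ _ _ _ _ _ _ _ (cr _ _ _ _ h) (cr _ _ _ _ h')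
      (fun h => hne ((hs _ _ _ _).1 h))
    exact ⟨fun h => k1 (by rw [h]), fun h => k2 (by rw [h]), fun h => k3 (by rw [h]),
      fun h => k4 (by rw [h])⟩

/-- Every finite simple graph with `n ≥ 3` vertices that admits an
IC-planar straight-line drawing admits an IC-planar straight-line grid drawing with
all vertices in the grid `{0, 1, …, 2n-2} × {0, 1, …, 2n-3}`. -/
theorem icplanar_quadratic_area_grid_drawing {V : Type*} [Fintype V] (G : SimpleGraph V)
    (hn : 3 ≤ Fintype.card V)
    (h : ∃ ρ : V → ℝ × ℝ, IsICPlanarDrawing G ρ) :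
    ∃ ρ : V → ℝ × ℝ, IsICPlanarDrawing G ρ ∧
      ∀ v : V, ∃ a b : ℕ, a ≤ 2 * Fintype.card V - 2 ∧ b ≤ 2 * Fintype.card V - 3 ∧
        ρ v = ((a : ℝ), (b : ℝ)) := by
  obtain ⟨ρ, hρ⟩ := h
  have e := Fintype.equivFin V
  obtain ⟨a, b, hab, J⟩ := ((ic_iff.1 hρ).comap e.symm e.symm.injective).grid hn
  have J := J.comap e e.injective
  simp only [Equiv.symm_apply_apply] at J
  exact ⟨_, ic_iff.2 J, fun v => ⟨a (e v), b (e v), (hab _).1, (hab _).2, rfl⟩⟩
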